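/- Let G be a nonplanar graph. Then the following are equivalent: (i) G is almost-planar; (ii) the graph G* obtained from G by deleting all isolated vertices is obtained from some 3-connected almost-planar graph H by subdividing (repeatedly, zero or more times) only edges belonging to D(H); (iii) G has no minor isomorphic to any of K5+, K33+, K5h, K33h, K5⊕e, K33⊕e. -/

import Mathlib

open SimpleGraph

/-- `H` is a minor of `G` (branch-set / model definition). -/
def IsMinor {W V : Type*} (H : SimpleGraph W) (G : SimpleGraph V) : Prop :=
  ∃ B : W → Set V,
    (∀ w, (B w).Nonempty) ∧
    (∀ w, (G.induce (B w)).Connected) ∧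
    (Pairwise fun w₁ w₂ => Disjoint (B w₁) (B w₂)) ∧
    (∀ ⦃w₁ w₂ : W⦄, H.Adj w₁ w₂ → ∃ v₁ ∈ B w₁, ∃ v₂ ∈ B w₂, G.Adj v₁ v₂)

def K5 : SimpleGraph (Fin 5) := ⊤

def K33 : SimpleGraph (Fin 3 ⊕ Fin 3) := completeBipartiteGraph (Fin 3) (Fin 3)

/-- A graph is planar iff it has neither a `K₅` nor a `K₃,₃` minor (Wagner's theorem). -/
def Planar {V : Type*} (G : SimpleGraph V) : Prop := ¬ IsMinor K5 G ∧ ¬ IsMinor K33 G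

/-- `G / uw`: contract the edge `uw`, merging `w` into `u` (the vertex `w` becomes isolated). -/
def contractEdge {V : Type*} (G : SimpleGraph V) (u w : V) : SimpleGraph V :=
  SimpleGraph.fromRel fun a b =>
    a ≠ w ∧ b ≠ w ∧ (G.Adj a b ∨ (a = u ∧ G.Adj w b) ∨ (b = u ∧ G.Adj a w))

/-- A nonplanar graph is almost-planar if for every edge, deletion or contraction is planar. -/
def AlmostPlanar {V : Type*} (G : SimpleGraph V) : Prop :=
  ¬ Planar G ∧ ∀ ⦃u v : V⦄, G.Adj u v →
    (Planar (G.deleteEdges {s(u, v)}) ∨ Planar (contractEdge G u v))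

/-- `G` is `k`-connected: more than `k` vertices and deleting fewer than `k` vertices
leaves a connected graph. -/
def KConnected {V : Type*} (G : SimpleGraph V) (k : ℕ) : Prop :=
  k < Nat.card V ∧ ∀ s : Set V, s.ncard < k → (G.induce (sᶜ)).Connected

/-- `{G[A], G[B]}` is a `k`-separation of `G`. -/
def IsSep {V : Type*} (G : SimpleGraph V) (k : ℕ) (A B : Set V) : Prop :=
  A ∪ B = Set.univ ∧ A ≠ Set.univ ∧ B ≠ Set.univ ∧ (A ∩ B).ncard = k ∧
  ∀ ⦃x y : V⦄, G.Adj x y → (x ∈ A ∧ y ∈ A) ∨ (x ∈ B ∧ y ∈ B)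

/-- The star `K_{1,3}`, with centre `0`. -/
def K13 : SimpleGraph (Fin 4) := SimpleGraph.fromRel fun a _ => a = 0

def InternallyFourConnected {V : Type*} (G : SimpleGraph V) : Prop :=
  KConnected G 3 ∧ 5 ≤ Nat.card V ∧
  ∀ A B : Set V, IsSep G 3 A B →
    Xor' (Nonempty (G.induce A ≃g K13)) (Nonempty (G.induce B ≃g K13))

/-- The wheel `W_n`: a cycle of length `n` plus a hub (`none`) joined to all of it. -/
def wheelGraph (n : ℕ) : SimpleGraph (Option (Fin n)) :=
  SimpleGraph.fromRel fun a b =>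
    match a, b with
    | some i, some j => j.val = (i.val + 1) % n
    | none, some _ => True
    | _, _ => False

def IsWheel {V : Type*} (G : SimpleGraph V) : Prop :=
  ∃ n, 3 ≤ n ∧ Nonempty (G ≃g wheelGraph n)

/-- The double wheel `DW_n`: a cycle of length `n` plus two adjacent hubs joined to all of it. -/
def doubleWheel (n : ℕ) : SimpleGraph (Fin n ⊕ Fin 2) :=
  SimpleGraph.fromRel fun a b =>
    match a, b with
    | .inl i, .inl j => j.val = (i.val + 1) % n
    | .inl _, .inr _ => True
    | .inr _, .inr _ => True
    | _, _ => False

/-- The Möbius ladder `M_n`: a cycle of length `2n` plus all "opposite" chords. -/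
def mobiusLadder (n : ℕ) : SimpleGraph (Fin (2 * n)) :=
  SimpleGraph.fromRel fun i j =>
    j.val = (i.val + 1) % (2 * n) ∨ j.val = (i.val + n) % (2 * n)

/-- `C²_m`: a cycle of length `m` plus all chords between vertices at distance two. -/
def squareCycle (m : ℕ) : SimpleGraph (Fin m) :=
  SimpleGraph.fromRel fun i j =>
    j.val = (i.val + 1) % m ∨ j.val = (i.val + 2) % m

/-- The alternating double wheel `AW_{2n}`: a cycle of length `2n` plus two adjacent hubs,
each joined to alternating cycle vertices. -/
def altDoubleWheel (n : ℕ) : SimpleGraph (Fin (2 * n) ⊕ Fin 2) :=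
  SimpleGraph.fromRel fun a b =>
    match a, b with
    | .inl i, .inl j => j.val = (i.val + 1) % (2 * n)
    | .inl i, .inr k => i.val % 2 = k.val
    | .inr _, .inr _ => True
    | _, _ => False

/-- The class `𝒲`: three wheels glued along a common triangle `V₀`, with no other edges. -/
def InClassW {V : Type*} (G : SimpleGraph V) : Prop :=
  ∃ P : V → Fin 4,
    (P ⁻¹' {0}).ncard = 3 ∧
    (∀ x y : V, P x = 0 → P y = 0 → x ≠ y → G.Adj x y) ∧
    (∀ i : Fin 4, i ≠ 0 → IsWheel (G.induce {v | P v = 0 ∨ P v = i})) ∧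
    (∀ ⦃x y : V⦄, G.Adj x y → ∃ i : Fin 4, i ≠ 0 ∧ (P x = 0 ∨ P x = i) ∧ (P y = 0 ∨ P y = i))

/-- `EX₁`: `K₃,₃` plus a vertex joined to all of one colour class. -/
def EX1 : SimpleGraph (Option (Fin 3 ⊕ Fin 3)) :=
  SimpleGraph.fromRel fun a b =>
    match a, b with
    | some (.inl _), some (.inr _) => True
    | none, some (.inl _) => True
    | _, _ => False

/-- `EX₂`: `K₅` plus a vertex joined to three of its vertices. -/
def EX2 : SimpleGraph (Option (Fin 5)) :=
  SimpleGraph.fromRel fun a b =>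
    match a, b with
    | some i, some j => i ≠ j
    | none, some j => j.val < 3
    | _, _ => False

/-- `EX₈`: `K₃,₃` plus a vertex joined to two vertices of one class and one of the other. -/
def EX8 : SimpleGraph (Option (Fin 3 ⊕ Fin 3)) :=
  SimpleGraph.fromRel fun a b =>
    match a, b with
    | some (.inl _), some (.inr _) => True
    | none, some x => x = Sum.inl 0 ∨ x = Sum.inl 1 ∨ x = Sum.inr 0
    | _, _ => False

/-- `K₅ʰ`: subdivide the edges `01` and `02` of `K₅` and join the two subdivision vertices. -/
def K5h : SimpleGraph (Fin 5 ⊕ Fin 2) :=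
  SimpleGraph.fromRel fun a b =>
    match a, b with
    | .inl i, .inl j =>
        i ≠ j ∧ ¬(i = 0 ∧ j = 1) ∧ ¬(i = 1 ∧ j = 0) ∧ ¬(i = 0 ∧ j = 2) ∧ ¬(i = 2 ∧ j = 0)
    | .inl i, .inr k => (k = 0 ∧ (i = 0 ∨ i = 1)) ∨ (k = 1 ∧ (i = 0 ∨ i = 2))
    | .inr _, .inr _ => True
    | _, _ => False

/-- `K₃,₃ʰ`: subdivide two edges of `K₃,₃` at a common endpoint and join
the two subdivision vertices. -/
def K33h : SimpleGraph ((Fin 3 ⊕ Fin 3) ⊕ Fin 2) :=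
  SimpleGraph.fromRel fun a b =>
    match a, b with
    | .inl (.inl i), .inl (.inr j) => ¬(i = 0 ∧ (j = 0 ∨ j = 1))
    | .inl (.inr j), .inl (.inl i) => ¬(i = 0 ∧ (j = 0 ∨ j = 1))
    | .inl x, .inr k =>
        (k = 0 ∧ (x = Sum.inl 0 ∨ x = Sum.inr 0)) ∨ (k = 1 ∧ (x = Sum.inl 0 ∨ x = Sum.inr 1))
    | .inr _, .inr _ => True
    | _, _ => False

/-- `K₅⁺`: `K₅` plus a pendant vertex. -/
def K5plus : SimpleGraph (Option (Fin 5)) :=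
  SimpleGraph.fromRel fun a b =>
    match a, b with
    | some i, some j => i ≠ j
    | none, some j => j = 0
    | _, _ => False

/-- `K₃,₃⁺`: `K₃,₃` plus a pendant vertex. -/
def K33plus : SimpleGraph (Option (Fin 3 ⊕ Fin 3)) :=
  SimpleGraph.fromRel fun a b =>
    match a, b with
    | some (.inl _), some (.inr _) => True
    | none, some x => x = Sum.inl 0
    | _, _ => False

/-- `K₅ ⊕ e`: disjoint union of `K₅` and one edge. -/
def K5oplus : SimpleGraph (Fin 5 ⊕ Fin 2) :=
  SimpleGraph.fromRel fun a b =>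
    match a, b with
    | .inl i, .inl j => i ≠ j
    | .inr _, .inr _ => True
    | _, _ => False

/-- `K₃,₃ ⊕ e`: disjoint union of `K₃,₃` and one edge. -/
def K33oplus : SimpleGraph ((Fin 3 ⊕ Fin 3) ⊕ Fin 2) :=
  SimpleGraph.fromRel fun a b =>
    match a, b with
    | .inl (.inl _), .inl (.inr _) => True
    | .inr _, .inr _ => True
    | _, _ => False

/-- The triad addition of `H` at `x y z`: add a new vertex joined to `x`, `y`, `z`. -/
def triadAddition {U : Type*} (H : SimpleGraph U) (x y z : U) : SimpleGraph (Option U) :=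
  SimpleGraph.fromRel fun a b =>
    match a, b with
    | some u, some v => H.Adj u v
    | none, some u => u = x ∨ u = y ∨ u = z
    | _, _ => False

def IsTriadAdditionOf {V U : Type*} (G : SimpleGraph V) (H : SimpleGraph U) : Prop :=
  ∃ x y z : U, x ≠ y ∧ y ≠ z ∧ x ≠ z ∧ Nonempty (G ≃g triadAddition H x y z)

/-- `G` is obtained from `H` by subdividing (possibly repeatedly) edges of `H`,
all of which lie in `S`. -/
def IsSubdivisionWithin {V W : Type*} (G : SimpleGraph V) (H : SimpleGraph W)
    (S : Set (Sym2 W)) : Prop :=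
  ∃ (f : W ↪ V) (p : ∀ ⦃u v : W⦄, H.Adj u v → G.Walk (f u) (f v)),
    (∀ ⦃u v : W⦄ (h : H.Adj u v), (p h).IsPath) ∧
    (∀ ⦃u v : W⦄ (h : H.Adj u v), p h.symm = (p h).reverse) ∧
    (∀ ⦃u v : W⦄ (h : H.Adj u v), s(u, v) ∉ S → (p h).length = 1) ∧
    (∀ ⦃u v : W⦄ (h : H.Adj u v) (w : W), f w ∈ (p h).support → w = u ∨ w = v) ∧
    (∀ ⦃u v u' v' : W⦄ (h : H.Adj u v) (h' : H.Adj u' v'), s(u, v) ≠ s(u', v') →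
      ∀ x : V, x ∈ (p h).support → x ∈ (p h').support → x ∈ Set.range f) ∧
    (∀ x : V, x ∈ Set.range f ∨ ∃ (u v : W) (h : H.Adj u v), x ∈ (p h).support) ∧
    (∀ e ∈ G.edgeSet, ∃ (u v : W) (h : H.Adj u v), e ∈ (p h).edges)

/-- `G` is a subdivision of `H`. -/
def IsSubdivision {V W : Type*} (G : SimpleGraph V) (H : SimpleGraph W) : Prop :=
  IsSubdivisionWithin G H Set.univ

/-- `D(H)`: the set of edges of `H` whose deletion leaves a planar graph. -/
def Dset {U : Type*} (H : SimpleGraph U) : Set (Sym2 U) :=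
  {e | e ∈ H.edgeSet ∧ Planar (H.deleteEdges {e})}

/-- `G[A]` together with all edges between vertices of `T` (`T ⊆ A` intended). -/
def deltaGraph {V : Type*} (G : SimpleGraph V) (A T : Set V) : SimpleGraph A :=
  SimpleGraph.fromRel fun a b => G.Adj a.1 b.1 ∨ (a.1 ∈ T ∧ b.1 ∈ T)

/-- `G[A]^Y` for the separation `{G[A], G[B]}`: add a new vertex joined to `A ∩ B`. -/
def sepY {V : Type*} (G : SimpleGraph V) (A B : Set V) : SimpleGraph (Option A) :=
  SimpleGraph.fromRel fun x y =>
    match x, y with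
    | some a, some b => G.Adj a.1 b.1
    | none, some a => a.1 ∈ A ∩ B
    | _, _ => False

/-- `G₂` is obtained from `G` by adding isolated vertices. -/
def AddIsolated {V₂ V : Type*} (G₂ : SimpleGraph V₂) (G : SimpleGraph V) : Prop :=
  ∃ f : V ↪ V₂, (∀ a b : V, G₂.Adj (f a) (f b) ↔ G.Adj a b) ∧
    ∀ x : V₂, x ∉ Set.range f → ∀ y : V₂, ¬ G₂.Adj x y

/-- The set of non-isolated vertices of `G` (so `G* = G.induce (core G)`). -/
def core {V : Type*} (G : SimpleGraph V) : Set V := {v | ∃ w, G.Adj v w}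

/-- `G` is obtained from `G'` by 3-summing wheels onto distinct triangles of `G'`. -/
def SumWheelsOnto {V U : Type*} (G : SimpleGraph V) (G' : SimpleGraph U) : Prop :=
  ∃ (g : U ↪ V) (k : ℕ) (Wp : Fin k → Set V) (T : Fin k → Set U),
    (∀ i, (T i).ncard = 3) ∧
    (∀ i, ∀ x ∈ T i, ∀ y ∈ T i, x ≠ y → G'.Adj x y) ∧
    Function.Injective T ∧
    (∀ i, Disjoint (Wp i) (Set.range ⇑g)) ∧
    (Pairwise fun i j => Disjoint (Wp i) (Wp j)) ∧
    (Set.range ⇑g ∪ ⋃ i, Wp i) = Set.univ ∧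
    (∀ i, IsWheel (deltaGraph G (Wp i ∪ ⇑g '' T i) (⇑g '' T i))) ∧
    (∀ a b : U, G.Adj (g a) (g b) → G'.Adj a b) ∧
    (∀ a b : U, G'.Adj a b → (G.Adj (g a) (g b) ∨ ∃ i, a ∈ T i ∧ b ∈ T i)) ∧
    (∀ ⦃x y : V⦄, G.Adj x y → (x ∈ Set.range ⇑g ∧ y ∈ Set.range ⇑g) ∨
      ∃ i, x ∈ Wp i ∪ ⇑g '' T i ∧ y ∈ Wp i ∪ ⇑g '' T i) ∧
    (∀ i, ∀ x ∈ Wp i, ∀ ⦃y : V⦄, G.Adj x y → y ∈ Wp i ∪ ⇑g '' T i)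

/-- `H` has an edge whose deletion and contraction are both nonplanar. -/
def HasBadEdge {V : Type*} (H : SimpleGraph V) : Prop :=
  ∃ u v : V, H.Adj u v ∧ ¬ Planar (H.deleteEdges {s(u, v)}) ∧ ¬ Planar (contractEdge H u v)


open SimpleGraph

/-! ## Connected sets, touching sets -/

section ConnSets

variable {V : Type*} {G : SimpleGraph V}

/-- the vertex set `S` induces a connected subgraph -/
def Conn (G : SimpleGraph V) (S : Set V) : Prop := (G.induce S).Connected

/-- some edge joins `S` to `T` -/
def Tch (G : SimpleGraph V) (S T : Set V) : Prop := ∃ s ∈ S, ∃ t ∈ T, G.Adj s t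

theorem Tch.symm {S T : Set V} (h : Tch G S T) : Tch G T S := by
  obtain ⟨s, hs, t, ht, h⟩ := h; exact ⟨t, ht, s, hs, h.symm⟩

theorem Tch.mono {S T S' T' : Set V} (h : Tch G S T) (h1 : S ⊆ S') (h2 : T ⊆ T') : Tch G S' T' := by
  obtain ⟨s, hs, t, ht, h⟩ := h; exact ⟨s, h1 hs, t, h2 ht, h⟩

theorem tch_of_adj {S T : Set V} {s t : V} (hs : s ∈ S) (ht : t ∈ T) (h : G.Adj s t) : Tch G S T :=
  ⟨s, hs, t, ht, h⟩

theorem conn_iff {S : Set V} : Conn G S ↔ S.Nonempty ∧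
    ∀ A : Set V, (∃ a ∈ S, a ∈ A) → (∃ b ∈ S, b ∉ A) → ∃ a ∈ S, a ∈ A ∧ ∃ b ∈ S, b ∉ A ∧ G.Adj a b := by
  constructor
  · intro h
    refine ⟨Set.nonempty_coe_sort.mp h.nonempty, ?_⟩
    rintro A ⟨a, ha, haA⟩ ⟨b, hb, hbA⟩
    obtain ⟨p⟩ := h.preconnected ⟨a, ha⟩ ⟨b, hb⟩
    obtain ⟨d, hd, h1, h2⟩ := p.exists_boundary_dart (Subtype.val ⁻¹' A) haA hbA
    exact ⟨d.fst, d.fst.2, h1, d.snd, d.snd.2, h2, d.adj⟩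
  · rintro ⟨⟨a, ha⟩, h⟩
    have hne : Nonempty S := ⟨⟨a, ha⟩⟩
    refine (connected_iff_exists_forall_reachable _).2 ⟨⟨a, ha⟩, ?_⟩
    by_contra hc
    push Not at hc
    obtain ⟨⟨b, hb⟩, hbr⟩ := hc
    obtain ⟨x, hx, ⟨hx1, hx2⟩, y, hy, hyA, hxy⟩ :=
      h {x | ∃ hx : x ∈ S, (G.induce S).Reachable ⟨a, ha⟩ ⟨x, hx⟩}
      ⟨a, ha, ha, Reachable.refl _⟩ ⟨b, hb, fun ⟨_, h⟩ => hbr h⟩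
    exact hyA ⟨hy, hx2.trans (Adj.reachable (by simpa using hxy))⟩

theorem Conn.nonempty {S : Set V} (h : Conn G S) : S.Nonempty := (conn_iff.1 h).1

theorem Conn.cut {S : Set V} (h : Conn G S) (A : Set V) {a b : V} (ha : a ∈ S) (haA : a ∈ A)
    (hb : b ∈ S) (hbA : b ∉ A) : ∃ a ∈ S, a ∈ A ∧ ∃ b ∈ S, b ∉ A ∧ G.Adj a b :=
  (conn_iff.1 h).2 A ⟨a, ha, haA⟩ ⟨b, hb, hbA⟩

/-- it suffices to connect everything to a root -/
theorem conn_of_root {S : Set V} (r : V) (hr : r ∈ S)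
    (h : ∀ A : Set V, r ∈ A → (∃ b ∈ S, b ∉ A) → ∃ a ∈ S, a ∈ A ∧ ∃ b ∈ S, b ∉ A ∧ G.Adj a b) :
    Conn G S := by
  refine conn_iff.2 ⟨⟨r, hr⟩, ?_⟩
  rintro A ⟨a, ha, haA⟩ hb
  by_cases hrA : r ∈ A
  · exact h A hrA hb
  · obtain ⟨x, hx, hxA, y, hy, hyA, hxy⟩ := h Aᶜ hrA ⟨a, ha, fun h => h haA⟩
    exact ⟨y, hy, by simpa using hyA, x, hx, hxA, hxy.symm⟩

theorem conn_singleton (x : V) : Conn G {x} := by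
  refine conn_of_root x rfl ?_
  rintro A hA ⟨b, hb, hbA⟩
  rw [Set.mem_singleton_iff] at hb
  exact absurd (hb ▸ hA) hbA

theorem Conn.mono {S : Set V} {G' : SimpleGraph V} (h : Conn G S)
    (hle : ∀ a ∈ S, ∀ b ∈ S, G.Adj a b → G'.Adj a b) : Conn G' S := by
  rw [conn_iff] at *
  refine ⟨h.1, fun A ha hb => ?_⟩
  obtain ⟨a, ha, haA, b, hb, hbA, hab⟩ := h.2 A ha hb
  exact ⟨a, ha, haA, b, hb, hbA, hle a ha b hb hab⟩

theorem Conn.union_inter {S T : Set V} (hS : Conn G S) (hT : Conn G T) {r : V} (hrS : r ∈ S)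
    (hrT : r ∈ T) : Conn G (S ∪ T) := by
  refine conn_of_root r (Or.inl hrS) ?_
  rintro A hA ⟨b, hb | hb, hbA⟩
  · obtain ⟨a, ha, haA, b, hb, hbA, hab⟩ := hS.cut A hrS hA hb hbA
    exact ⟨a, Or.inl ha, haA, b, Or.inl hb, hbA, hab⟩
  · obtain ⟨a, ha, haA, b, hb, hbA, hab⟩ := hT.cut A hrT hA hb hbA
    exact ⟨a, Or.inr ha, haA, b, Or.inr hb, hbA, hab⟩

theorem Conn.union {S T : Set V} (hS : Conn G S) (hT : Conn G T) (h : Tch G S T) :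
    Conn G (S ∪ T) := by
  obtain ⟨s, hs, t, ht, hst⟩ := h
  refine conn_of_root s (Or.inl hs) ?_
  rintro A hA ⟨b, hb, hbA⟩
  by_cases htA : t ∈ A
  · rcases hb with hb | hb
    · obtain ⟨a, ha, haA, b, hb, hbA, hab⟩ := hS.cut A hs hA hb hbA
      exact ⟨a, Or.inl ha, haA, b, Or.inl hb, hbA, hab⟩
    · obtain ⟨a, ha, haA, b, hb, hbA, hab⟩ := hT.cut A ht htA hb hbA
      exact ⟨a, Or.inr ha, haA, b, Or.inr hb, hbA, hab⟩
  · exact ⟨s, Or.inl hs, hA, t, Or.inr ht, htA, hst⟩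

theorem Conn.insert {S : Set V} (hS : Conn G S) {x s : V} (hs : s ∈ S) (h : G.Adj x s) :
    Conn G (insert x S) := by
  rw [Set.insert_eq]
  exact (conn_singleton x).union hS ⟨x, rfl, s, hs, h⟩

theorem conn_pair {x y : V} (h : G.Adj x y) : Conn G {x, y} :=
  (conn_singleton y).insert rfl h

/-- leaf lemma -/
theorem Conn.exists_leaf [Finite V] {S R : Set V} (hS : Conn G S) (hR : Conn G R) (hRS : R ⊆ S)
    (hne : R ≠ S) : ∃ x ∈ S, x ∉ R ∧ Conn G (S \ {x}) ∧ ∃ t ∈ S, t ≠ x ∧ G.Adj x t := by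
  induction hn : (S \ R).ncard using Nat.strong_induction_on generalizing R with
  | _ n ih =>
    obtain ⟨r, hr⟩ := hR.nonempty
    have : ∃ b ∈ S, b ∉ R := by
      by_contra hc; push Not at hc; exact hne (hRS.antisymm hc)
    obtain ⟨b, hb, hbR⟩ := this
    obtain ⟨a, ha, haR, x, hx, hxR, hax⟩ := hS.cut R (hRS hr) hr hb hbR
    have hR' : Conn G (Insert.insert x R) := hR.insert haR hax.symm
    by_cases heq : Insert.insert x R = S
    · refine ⟨x, hx, hxR, ?_, a, ha, hax.ne, hax.symm⟩
      rw [← heq, Set.insert_sdiff_self_of_notMem hxR]; exact hR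
    · obtain ⟨y, hy, hyR, h1, h2⟩ := ih _ (by
        rw [← hn]
        apply Set.ncard_lt_ncard _ (Set.toFinite _)
        refine ⟨fun z hz => ⟨hz.1, fun h => hz.2 (Or.inr h)⟩, fun h => (h ⟨hx, hxR⟩).2 (Or.inl rfl)⟩)
        hR' (Set.insert_subset hx hRS) heq rfl
      exact ⟨y, hy, fun h => hyR (Or.inr h), h1, h2⟩

/-- partition lemma -/
theorem Conn.exists_partition [Finite V] {D R1 R2 : Set V} (hD : Conn G D) (h1 : Conn G R1)
    (h2 : Conn G R2) (hs1 : R1 ⊆ D) (hs2 : R2 ⊆ D) (hd : Disjoint R1 R2) :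
    ∃ D1 D2, Conn G D1 ∧ Conn G D2 ∧ R1 ⊆ D1 ∧ R2 ⊆ D2 ∧ D1 ∪ D2 = D ∧ Disjoint D1 D2 := by
  induction hn : (D \ (R1 ∪ R2)).ncard using Nat.strong_induction_on generalizing R1 R2 with
  | _ n ih =>
    by_cases heq : R1 ∪ R2 = D
    · exact ⟨R1, R2, h1, h2, subset_rfl, subset_rfl, heq, hd⟩
    obtain ⟨r, hr⟩ := h1.nonempty
    have : ∃ b ∈ D, b ∉ R1 ∪ R2 := by
      by_contra hc; push Not at hc; exact heq ((Set.union_subset hs1 hs2).antisymm hc)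
    obtain ⟨b, hb, hbR⟩ := this
    obtain ⟨a, ha, haR, x, hx, hxR, hax⟩ := hD.cut (R1 ∪ R2) (hs1 hr) (Or.inl hr) hb hbR
    have hlt : ∀ T : Set V, R1 ∪ R2 ⊆ T → x ∈ T → (D \ T).ncard < n := by
      intro T hT hxT
      rw [← hn]
      apply Set.ncard_lt_ncard _ (Set.toFinite _)
      exact ⟨fun z hz => ⟨hz.1, fun h => hz.2 (hT h)⟩, fun h => (h ⟨hx, hxR⟩).2 hxT⟩
    rcases haR with haR | haR
    · obtain ⟨D1, D2, a1, a2, a3, a4, a5⟩ := ih _ (hlt (Insert.insert x R1 ∪ R2)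
        (Set.union_subset_union_left _ (Set.subset_insert _ _)) (Or.inl (Or.inl rfl)))
        (h1.insert haR hax.symm) h2 (Set.insert_subset hx hs1) hs2
        (by rw [Set.disjoint_insert_left]; exact ⟨fun h => hxR (Or.inr h), hd⟩) rfl
      exact ⟨D1, D2, a1, a2, (Set.subset_insert _ _).trans a3, a4, a5⟩
    · obtain ⟨D1, D2, a1, a2, a3, a4, a5⟩ := ih _ (hlt (R1 ∪ Insert.insert x R2)
        (Set.union_subset_union_right _ (Set.subset_insert _ _)) (Or.inr (Or.inl rfl)))
        h1 (h2.insert haR hax.symm) hs1 (Set.insert_subset hx hs2)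
        (by rw [Set.disjoint_insert_right]; exact ⟨fun h => hxR (Or.inl h), hd⟩) rfl
      exact ⟨D1, D2, a1, a2, a3, (Set.subset_insert _ _).trans a4, a5⟩

theorem Conn.tch_of_partition {D D1 D2 : Set V} (hD : Conn G D) (h1 : D1.Nonempty) (h2 : D2.Nonempty)
    (hu : D1 ∪ D2 = D) (hd : Disjoint D1 D2) : Tch G D1 D2 := by
  obtain ⟨a, ha⟩ := h1
  obtain ⟨b, hb⟩ := h2
  obtain ⟨x, hx, hx1, y, hy, hy1, hxy⟩ := hD.cut D1 (hu ▸ Or.inl ha) ha (hu ▸ Or.inr hb)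
    (fun h => hd.le_bot ⟨h, hb⟩)
  refine ⟨x, hx1, y, ?_, hxy⟩
  rw [← hu] at hy
  exact hy.resolve_left hy1

end ConnSets

/-! ## Models -/

section Models

variable {V W X : Type*} {G G' : SimpleGraph V} {H : SimpleGraph W} {K : SimpleGraph X}

/-- `B` is a model of `H` in `G` -/
structure Model (H : SimpleGraph W) (G : SimpleGraph V) (B : W → Set V) : Prop where
  conn : ∀ w, Conn G (B w)
  disj : ∀ ⦃w w'⦄, w ≠ w' → Disjoint (B w) (B w')
  adj : ∀ ⦃w w'⦄, H.Adj w w' → Tch G (B w) (B w')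

theorem isMinor_iff : IsMinor H G ↔ ∃ B, Model H G B := by
  constructor
  · rintro ⟨B, _, h2, h3, h4⟩
    exact ⟨B, h2, h3, h4⟩
  · rintro ⟨B, h2, h3, h4⟩
    exact ⟨B, fun w => (h2 w).nonempty, h2, h3, h4⟩

theorem Model.isMinor {B : W → Set V} (h : Model H G B) : IsMinor H G := isMinor_iff.2 ⟨B, h⟩

theorem Model.eq_of_mem {B : W → Set V} (h : Model H G B) {x : V} {w w' : W} (h1 : x ∈ B w)
    (h2 : x ∈ B w') : w = w' := by
  by_contra hne
  exact (h.disj hne).le_bot ⟨h1, h2⟩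

theorem conn_biUnion {B : W → Set V} (h : Model H G B) {S : Set W} (hS : Conn H S) :
    Conn G (⋃ w ∈ S, B w) := by
  obtain ⟨w, hw⟩ := hS.nonempty
  obtain ⟨r, hr⟩ := (h.conn w).nonempty
  refine conn_of_root r (Set.mem_biUnion hw hr) ?_
  rintro A hrA ⟨b, hb, hbA⟩
  simp only [Set.mem_iUnion] at hb
  obtain ⟨wb, hwb, hb⟩ := hb
  have key : ∀ w ∈ S, ∀ a ∈ B w, ∀ b ∈ B w, a ∈ A → b ∉ A →
      ∃ a ∈ ⋃ w ∈ S, B w, a ∈ A ∧ ∃ b ∈ ⋃ w ∈ S, B w, b ∉ A ∧ G.Adj a b := by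
    intro w hw a ha b hb haA hbA
    obtain ⟨a, ha, haA, b, hb, hbA, hab⟩ := (h.conn w).cut A ha haA hb hbA
    exact ⟨a, Set.mem_biUnion hw ha, haA, b, Set.mem_biUnion hw hb, hbA, hab⟩
  by_cases hc : ∀ b ∈ B w, b ∈ A
  · by_cases hc2 : ∀ b ∈ B wb, b ∉ A
    · obtain ⟨a, ha, haA, c, hc, hcA, hac⟩ := hS.cut {w | ∀ b ∈ B w, b ∈ A} hw hc hwb
        (fun h => hc2 b hb (h b hb))
      obtain ⟨s, hs, t, ht, hst⟩ := h.adj hac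
      have hsA := haA s hs
      by_cases htA : t ∈ A
      · simp only [Set.mem_ofPred_eq, not_forall] at hcA
        obtain ⟨b', hb', hb'A⟩ := hcA
        exact key c hc t ht b' hb' htA hb'A
      · exact ⟨s, Set.mem_biUnion ha hs, hsA, t, Set.mem_biUnion hc ht, htA, hst⟩
    · push Not at hc2
      obtain ⟨b', hb', hb'A⟩ := hc2
      exact key wb hwb b' hb' b hb hb'A hbA
  · push Not at hc
    obtain ⟨b', hb', hb'A⟩ := hc
    exact key w hw r hr b' hb' hrA hb'A

theorem Model.trans {B : W → Set V} {C : X → Set W} (hB : Model H G B) (hC : Model K H C) :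
    Model K G (fun x => ⋃ w ∈ C x, B w) where
  conn x := conn_biUnion hB (hC.conn x)
  disj := by
    intro x y hxy
    rw [Set.disjoint_left]
    intro a ha hb
    simp only [Set.mem_iUnion] at ha hb
    obtain ⟨w, hw, ha⟩ := ha
    obtain ⟨w', hw', hb⟩ := hb
    have := hB.eq_of_mem ha hb
    subst this
    exact hxy (hC.eq_of_mem hw hw')
  adj := by
    intro x y hxy
    obtain ⟨w, hw, w', hw', h⟩ := hC.adj hxy
    exact (hB.adj h).mono (fun a ha => Set.mem_biUnion hw ha) (fun a ha => Set.mem_biUnion hw' ha)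

theorem IsMinor.trans' (h1 : IsMinor K H) (h2 : IsMinor H G) : IsMinor K G := by
  obtain ⟨C, hC⟩ := isMinor_iff.1 h1
  obtain ⟨B, hB⟩ := isMinor_iff.1 h2
  exact (hB.trans hC).isMinor

theorem Model.mono {B : W → Set V} (h : Model H G B) (hle : G ≤ G') : Model H G' B where
  conn w := (h.conn w).mono (fun _ _ _ _ h => hle h)
  disj := h.disj
  adj := fun _ _ hw => by
    obtain ⟨s, hs, t, ht, hst⟩ := h.adj hw
    exact ⟨s, hs, t, ht, hle hst⟩

theorem not_planar_iff : ¬ Planar G ↔ IsMinor K5 G ∨ IsMinor K33 G := by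
  unfold Planar; tauto

theorem not_planar_trans (h1 : ¬ Planar H) (h2 : IsMinor H G) : ¬ Planar G := by
  rw [not_planar_iff] at *
  exact h1.imp (fun h => h.trans' h2) (fun h => h.trans' h2)

theorem isMinor_of_le (h : G ≤ G') : IsMinor G G' := by
  refine Model.isMinor (B := fun v => {v}) ⟨fun w => conn_singleton w, ?_, ?_⟩
  · intro w w' hne; simpa using hne
  · intro w w' hw; exact ⟨w, rfl, w', rfl, h hw⟩

theorem not_planar_mono (h : G ≤ G') (h1 : ¬ Planar G) : ¬ Planar G' :=
  not_planar_trans h1 (isMinor_of_le h)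

/-! ### contraction -/

theorem contract_adj {u w a b : V} : (contractEdge G u w).Adj a b ↔
    a ≠ b ∧ a ≠ w ∧ b ≠ w ∧ (G.Adj a b ∨ (a = u ∧ G.Adj w b) ∨ (b = u ∧ G.Adj w a)) := by
  simp only [contractEdge, SimpleGraph.fromRel_adj, G.adj_comm b a, G.adj_comm b w, G.adj_comm a w]
  tauto

theorem Conn.contract {S : Set V} {u w : V} (h : Conn G S) (hu : u ∈ S) (huw : u ≠ w) :
    Conn (contractEdge G u w) (S \ {w}) := by
  refine conn_of_root u ⟨hu, huw⟩ ?_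
  rintro A hA ⟨b, ⟨hb, hbw⟩, hbA⟩
  obtain ⟨a, ha, haA, b, hb, hbA2, hab⟩ := h.cut (Insert.insert w A) hu (Or.inr hA) hb
    (fun h => h.elim hbw hbA)
  have hbw : b ≠ w := fun h => hbA2 (Or.inl h)
  have hbA : b ∉ A := fun h => hbA2 (Or.inr h)
  clear hbA2
  by_cases haw : a = w
  · subst haw
    exact ⟨u, ⟨hu, huw⟩, hA, b, ⟨hb, hbw⟩, hbA, contract_adj.2 ⟨fun h => hbA (h ▸ hA), huw, hbw,
      Or.inr (Or.inl ⟨rfl, hab⟩)⟩⟩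
  · exact ⟨a, ⟨ha, haw⟩, haA.resolve_left haw, b, ⟨hb, hbw⟩, hbA,
      contract_adj.2 ⟨hab.ne, haw, hbw, Or.inl hab⟩⟩

/-- A connected set of the contraction avoiding `u` is connected. -/
theorem Conn.of_contract {S : Set V} {u w : V} (h : Conn (contractEdge G u w) S) (hu : u ∉ S) :
    Conn G S := by
  refine h.mono ?_
  intro a ha b hb hab
  rcases (contract_adj.1 hab).2.2.2 with h | ⟨rfl, _⟩ | ⟨rfl, _⟩
  · exact h
  · exact absurd ha hu
  · exact absurd hb hu

theorem Conn.of_contract_insert {S : Set V} {u w : V} (huw : G.Adj u w)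
    (h : Conn (contractEdge G u w) S) (hu : u ∈ S) :
    Conn G (Insert.insert w S) := by
  refine conn_of_root u (Or.inr hu) ?_
  rintro A hA ⟨b, hb, hbA⟩
  by_cases hw : w ∈ A
  · have hbw : b ≠ w := fun h => hbA (h ▸ hw)
    obtain ⟨a, ha, haA, b, hb, hbA, hab⟩ := h.cut A hu hA (hb.resolve_left hbw) hbA
    rcases (contract_adj.1 hab).2.2.2 with h' | ⟨rfl, h'⟩ | ⟨rfl, _⟩
    · exact ⟨a, Or.inr ha, haA, b, Or.inr hb, hbA, h'⟩
    · exact ⟨w, Or.inl rfl, hw, b, Or.inr hb, hbA, h'⟩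
    · exact absurd hA hbA
  · exact ⟨u, Or.inr hu, hA, w, Or.inl rfl, hw, huw⟩

/-- lifting a model from a contraction. Requires that no branch set is `{w}`. -/
theorem Model.of_contract {B : W → Set V} {u w : V} (huw : G.Adj u w)
    (h : Model H (contractEdge G u w) B) (hw : ∀ i, w ∉ B i) :
    Model H G (fun i => {x | x ∈ B i ∨ (x = w ∧ u ∈ B i)}) where
  conn i := by
    by_cases hu : u ∈ B i
    · convert (h.conn i).of_contract_insert huw hu using 1
      ext x; simp [hu, or_comm]
    · convert (h.conn i).of_contract hu using 1
      ext x; simp [hu]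
  disj := by
    intro i j hij
    rw [Set.disjoint_left]
    rintro x (hx | ⟨rfl, hx⟩) (hy | ⟨hy', hy⟩)
    · exact hij (h.eq_of_mem hx hy)
    · exact hw _ (hy' ▸ hx)
    · exact hw _ hy
    · exact hij (h.eq_of_mem hx hy)
  adj := by
    intro i j hij
    obtain ⟨s, hs, t, ht, hst⟩ := h.adj hij
    rcases (contract_adj.1 hst).2.2.2 with h' | ⟨rfl, h'⟩ | ⟨rfl, h'⟩
    · exact ⟨s, Or.inl hs, t, Or.inl ht, h'⟩
    · exact ⟨w, Or.inr ⟨rfl, hs⟩, t, Or.inl ht, h'⟩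
    · exact ⟨s, Or.inl hs, w, Or.inr ⟨rfl, ht⟩, h'.symm⟩

/-- An isolated vertex does not lie in a branch set of a vertex with a neighbour. -/
theorem Model.not_mem_of_isolated {B : W → Set V} (h : Model H G B) {x : V} (hx : ∀ y, ¬ G.Adj x y)
    {i j : W} (hij : H.Adj i j) : x ∉ B i := by
  intro hxi
  obtain ⟨s, hs, t, ht, hst⟩ := h.adj hij
  by_cases hsx : s = x
  · exact hx t (hsx ▸ hst)
  · obtain ⟨a, ha, haA, b, hb, hbA, hab⟩ := (h.conn i).cut {x} hxi rfl hs hsx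
    rw [Set.mem_singleton_iff] at haA
    exact hx b (haA ▸ hab)

/-- Suppression: a vertex with at most two neighbours can be contracted into one of them. -/
theorem Model.suppress {B : W → Set V} (h : Model H G B) {x y z : V} (hxy : x ≠ y)
    (hN : ∀ t, G.Adj x t → t = y ∨ t = z)
    (hyx : G.Adj x y)
    (hdeg : ∀ i : W, ∃ j k l, H.Adj i j ∧ H.Adj i k ∧ H.Adj i l ∧ j ≠ k ∧ j ≠ l ∧ k ≠ l) :
    Model H (contractEdge G y x) (fun i => B i \ {x}) := by
  -- x is never a whole branch set
  have hns : ∀ i, x ∈ B i → ∃ t ∈ B i, G.Adj x t := by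
    intro i hi
    by_contra hc
    push Not at hc
    have hone : ∀ t ∈ B i, t = x := by
      by_contra hne
      push Not at hne
      obtain ⟨t, ht, hne⟩ := hne
      obtain ⟨a, ha, haA, b, hb, hbA, hab⟩ := (h.conn i).cut {x} hi rfl ht hne
      rw [Set.mem_singleton_iff] at haA
      exact hc b hb (haA ▸ hab)
    obtain ⟨j, k, l, hj, hk, hl, h1, h2, h3⟩ := hdeg i
    have key : ∀ j, H.Adj i j → y ∈ B j ∨ z ∈ B j := by
      intro j hj
      obtain ⟨s, hs, t, ht, hst⟩ := h.adj hj
      rw [hone s hs] at hst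
      rcases hN t hst with rfl | rfl
      · exact Or.inl ht
      · exact Or.inr ht
    rcases key j hj with a | a <;> rcases key k hk with b | b <;> rcases key l hl with c | c
    all_goals first
      | exact h1 (h.eq_of_mem a b)
      | exact h2 (h.eq_of_mem a c)
      | exact h3 (h.eq_of_mem b c)
  refine ⟨?_, fun i j hij => (h.disj hij).mono Set.sdiff_subset Set.sdiff_subset, ?_⟩
  · intro i
    by_cases hy : y ∈ B i
    · exact (h.conn i).contract hy hxy.symm
    · by_cases hx : x ∈ B i
      · -- y not in B i, so x has the unique neighbour z in B i
        obtain ⟨t, ht, hxt⟩ := hns i hx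
        have htz : t = z := (hN t hxt).resolve_left (fun h => hy (h ▸ ht))
        subst htz
        refine conn_of_root t ⟨ht, hxt.ne.symm⟩ ?_
        rintro A hA ⟨b, ⟨hb, hbx⟩, hbA⟩
        obtain ⟨a, ha, haA, b, hb, hbA, hab⟩ := (h.conn i).cut (Insert.insert x A) ht (Or.inr hA) hb
          (fun h => h.elim hbx hbA)
        have hbw : b ≠ x := fun h => hbA (Or.inl h)
        replace hbA : b ∉ A := fun h => hbA (Or.inr h)
        have hax : a ≠ x := by
          rintro rfl
          rcases hN b hab with rfl | rfl
          · exact hy hb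
          · exact hbA hA
        exact ⟨a, ⟨ha, hax⟩, haA.resolve_left hax, b, ⟨hb, hbw⟩, hbA,
          contract_adj.2 ⟨hab.ne, hax, hbw, Or.inl hab⟩⟩
      · rw [Set.sdiff_singleton_eq_self hx]
        refine (h.conn i).mono ?_
        intro a ha b hb hab
        exact contract_adj.2 ⟨hab.ne, fun h => hx (h ▸ ha), fun h => hx (h ▸ hb), Or.inl hab⟩
  · -- adjacency
    have main : ∀ i j, H.Adj i j → x ∈ B i → ∀ t ∈ B j, G.Adj x t →
        Tch (contractEdge G y x) (B i \ {x}) (B j \ {x}) := by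
      intro i j hij hxi t ht hxt
      obtain ⟨r, hr, hxr⟩ := hns i hxi
      have hrt : r ≠ t := fun e => hij.ne (h.eq_of_mem hr (e ▸ ht))
      refine ⟨r, ⟨hr, hxr.ne.symm⟩, t, ⟨ht, hxt.ne.symm⟩, contract_adj.2
        ⟨hrt, hxr.ne.symm, hxt.ne.symm, ?_⟩⟩
      rcases hN r hxr with e | e
      · exact Or.inr (Or.inl ⟨e, hxt⟩)
      · rcases hN t hxt with e' | e'
        · exact Or.inr (Or.inr ⟨e', hxr⟩)
        · exact absurd (e.trans e'.symm) hrt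
    intro i j hij
    obtain ⟨s, hs, t, ht, hst⟩ := h.adj hij
    by_cases hsx : s = x
    · subst hsx; exact main i j hij hs t ht hst
    by_cases htx : t = x
    · subst htx; exact (main j i hij.symm ht s hs hst.symm).symm
    exact ⟨s, ⟨hs, hsx⟩, t, ⟨ht, htx⟩, contract_adj.2 ⟨hst.ne, hsx, htx, Or.inl hst⟩⟩

end Models

theorem K5_deg (i : Fin 5) : ∃ j k l, K5.Adj i j ∧ K5.Adj i k ∧ K5.Adj i l ∧ j ≠ k ∧ j ≠ l ∧ k ≠ l := by
  refine ⟨i+1, i+2, i+3, ?_⟩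
  revert i; simp only [K5, top_adj]; decide

theorem K33_deg (i : Fin 3 ⊕ Fin 3) :
    ∃ j k l, K33.Adj i j ∧ K33.Adj i k ∧ K33.Adj i l ∧ j ≠ k ∧ j ≠ l ∧ k ≠ l := by
  rcases i with i | i
  · exact ⟨.inr 0, .inr 1, .inr 2, by simp [K33], by simp [K33], by simp [K33], by decide⟩
  · exact ⟨.inl 0, .inl 1, .inl 2, by simp [K33], by simp [K33], by simp [K33], by decide⟩

open SimpleGraph
set_option linter.unnecessarySimpa false
set_option linter.unusedVariables false

section SixFree

variable {V W X : Type*} {G : SimpleGraph V}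

theorem model_delete {K : SimpleGraph W} {B : W → Set V} (hB : Model K G B) {a b : W} (hab : a ≠ b)
    {x y : V} (hx : x ∈ B a) (hy : y ∈ B b) :
    Model (K.deleteEdges {s(a, b)}) (G.deleteEdges {s(x, y)}) B where
  conn w := by
    refine (hB.conn w).mono ?_
    intro c hc d hd hcd
    rw [deleteEdges_adj]
    refine ⟨hcd, ?_⟩
    rw [Set.mem_singleton_iff, Sym2.eq_iff]
    rintro (⟨rfl, rfl⟩ | ⟨rfl, rfl⟩)
    · exact hab ((hB.eq_of_mem hx hc).trans (hB.eq_of_mem hd hy))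
    · exact hab ((hB.eq_of_mem hx hd).trans (hB.eq_of_mem hc hy))
  disj := hB.disj
  adj := by
    intro w w' hw
    rw [deleteEdges_adj] at hw
    obtain ⟨s, hs, t, ht, hst⟩ := hB.adj hw.1
    refine ⟨s, hs, t, ht, ?_⟩
    rw [deleteEdges_adj]
    refine ⟨hst, ?_⟩
    rw [Set.mem_singleton_iff, Sym2.eq_iff]
    have h2 := hw.2
    rw [Set.mem_singleton_iff, Sym2.eq_iff] at h2
    rintro (⟨rfl, rfl⟩ | ⟨rfl, rfl⟩)
    · exact h2 (Or.inl ⟨hB.eq_of_mem hs hx, hB.eq_of_mem ht hy⟩)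
    · exact h2 (Or.inr ⟨hB.eq_of_mem hs hy, hB.eq_of_mem ht hx⟩)

open Classical in
theorem model_contract {K : SimpleGraph W} {B : W → Set V} (hB : Model K G B) {a b : W} (hab : a ≠ b)
    {x y : V} (hx : x ∈ B a) (hy : y ∈ B b) (hxy : G.Adj x y) :
    IsMinor (contractEdge K a b) (contractEdge G x y) := by
  have hsub : ∀ w, w ≠ b → y ∉ B w := fun w hw h => hw (hB.eq_of_mem h hy)
  have hconn : ∀ w, w ≠ b → w ≠ a → Conn (contractEdge G x y) (B w) := by
    intro w hw hwa
    refine (hB.conn w).mono ?_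
    intro c hc d hd hcd
    exact contract_adj.2 ⟨hcd.ne, fun h => hsub w hw (h ▸ hc), fun h => hsub w hw (h ▸ hd), Or.inl hcd⟩
  refine Model.isMinor (B := fun w => if w = b then {y} else if w = a then (B a ∪ B b) \ {y} else B w)
    ⟨?_, ?_, ?_⟩
  · intro w
    by_cases hw : w = b
    · simp only [hw, if_true]; exact conn_singleton y
    by_cases hwa : w = a
    · simp only [hwa, hab, if_true, if_false]
      exact ((hB.conn a).union (hB.conn b) ⟨x, hx, y, hy, hxy⟩).contract (Or.inl hx) hxy.ne
    · simp only [hw, hwa, if_false]; exact hconn w hw hwa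
  · -- disjointness via an invariant: element of set w lies in B w, or w=a and in B b minus y
    have key : ∀ w z, z ∈ (if w = b then {y} else if w = a then (B a ∪ B b) \ {y} else B w) →
        (z = y → w = b) ∧ (z ≠ y → (z ∈ B b → w = a) ∧ (z ∉ B b → z ∈ B w)) := by
      intro w z hz
      by_cases hw : w = b
      · simp only [hw, if_true, Set.mem_singleton_iff] at hz
        exact ⟨fun _ => hw, fun h => absurd hz h⟩
      by_cases hwa : w = a
      · simp only [hwa, hab, if_true, if_false] at hz
        exact ⟨fun h => absurd h hz.2, fun h => ⟨fun _ => hwa, fun h' => hwa ▸ hz.1.resolve_right h'⟩⟩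
      · simp only [hw, hwa, if_false] at hz
        exact ⟨fun h => absurd (h ▸ hz) (hsub w hw), fun h => ⟨fun h' => absurd (hB.eq_of_mem hz h') hw,
          fun _ => hz⟩⟩
    intro w w' hne
    rw [Set.disjoint_left]
    intro z hz hz'
    have h1 := key w z hz
    have h2 := key w' z hz'
    by_cases hzy : z = y
    · exact hne ((h1.1 hzy).trans (h2.1 hzy).symm)
    by_cases hzb : z ∈ B b
    · exact hne (((h1.2 hzy).1 hzb).trans ((h2.2 hzy).1 hzb).symm)
    · exact hne (hB.eq_of_mem ((h1.2 hzy).2 hzb) ((h2.2 hzy).2 hzb))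
  · have main : ∀ w w', w ≠ b → w' ≠ b → w ≠ w' → K.Adj w w' → Tch (contractEdge G x y)
        (if w = b then {y} else if w = a then (B a ∪ B b) \ {y} else B w)
        (if w' = b then {y} else if w' = a then (B a ∪ B b) \ {y} else B w') := by
      intro w w' h1 h2 _ h3
      obtain ⟨s, hs, t, ht, hst⟩ := hB.adj h3
      have hsy : s ≠ y := fun h => hsub w h1 (h ▸ hs)
      have hty : t ≠ y := fun h => hsub w' h2 (h ▸ ht)
      refine ⟨s, ?_, t, ?_, contract_adj.2 ⟨hst.ne, hsy, hty, Or.inl hst⟩⟩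
      · by_cases hwa : w = a
        · subst hwa; simp [h1, hs, hsy]
        · simp [h1, hwa, hs]
      · by_cases hwa : w' = a
        · subst hwa; simp [h2, ht, hty]
        · simp [h2, hwa, ht]
    have main2 : ∀ w', w' ≠ b → w' ≠ a → K.Adj b w' → Tch (contractEdge G x y)
        (if a = b then {y} else if a = a then (B a ∪ B b) \ {y} else B a)
        (if w' = b then {y} else if w' = a then (B a ∪ B b) \ {y} else B w') := by
      intro w' h2 h4 h3
      obtain ⟨s, hs, t, ht, hst⟩ := hB.adj h3
      have hty : t ≠ y := fun h => hsub w' h2 (h ▸ ht)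
      have htx : t ≠ x := fun h => h4 (hB.eq_of_mem (h ▸ ht) hx)
      by_cases hsy : s = y
      · subst hsy
        exact ⟨x, by simp [hab, hx, hxy.ne], t, by simp [h2, h4, ht],
          contract_adj.2 ⟨htx.symm, hxy.ne, hty, Or.inr (Or.inl ⟨rfl, hst⟩)⟩⟩
      · exact ⟨s, by simp [hab, hs, hsy], t, by simp [h2, h4, ht],
          contract_adj.2 ⟨hst.ne, hsy, hty, Or.inl hst⟩⟩
    intro w w' hw
    obtain ⟨h1, h2, h3, h4⟩ := contract_adj.1 hw
    rcases h4 with h4 | ⟨rfl, h4⟩ | ⟨rfl, h4⟩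
    · exact main w w' h2 h3 h1 h4
    · exact main2 w' h3 h1.symm h4
    · exact (main2 w h2 h1 h4).symm

theorem not_almostPlanar_of_badEdge {K : SimpleGraph W} (hK : IsMinor K G) {a b : W} (hab : K.Adj a b)
    (h1 : ¬ Planar (K.deleteEdges {s(a, b)})) (h2 : ¬ Planar (contractEdge K a b)) :
    ¬ AlmostPlanar G := by
  rintro ⟨-, h⟩
  obtain ⟨B, hB⟩ := isMinor_iff.1 hK
  obtain ⟨x, hx, y, hy, hxy⟩ := hB.adj hab
  rcases h hxy with h | h
  · exact not_planar_trans h1 (model_delete hB hab.ne hx hy).isMinor h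
  · exact not_planar_trans h2 (model_contract hB hab.ne hx hy hxy) h

/-! ### explicit models -/

/-- pairwise disjointness of a list of sets -/
theorem fin_disj {n : ℕ} {f : Fin n → Set V} (h : ∀ i j, i < j → Disjoint (f i) (f j)) :
    ∀ ⦃i j⦄, i ≠ j → Disjoint (f i) (f j) := by
  intro i j hij
  rcases lt_or_gt_of_ne hij with h' | h'
  · exact h i j h'
  · exact (h j i h').symm

theorem isMinor_K5_of {f : Fin 5 → Set V} (hc : ∀ i, Conn G (f i))
    (hd : ∀ i j, i < j → Disjoint (f i) (f j)) (ha : ∀ i j, i < j → Tch G (f i) (f j)) :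
    Model K5 G f := by
  refine ⟨hc, fin_disj hd, ?_⟩
  intro i j hij
  rcases lt_or_gt_of_ne hij.ne with h' | h'
  · exact ha i j h'
  · exact (ha j i h').symm

theorem sum_disj {α β : Type*} {f : α → Set V} {g : β → Set V} (h1 : ∀ ⦃i j⦄, i ≠ j → Disjoint (f i) (f j))
    (h2 : ∀ ⦃i j⦄, i ≠ j → Disjoint (g i) (g j)) (h3 : ∀ i j, Disjoint (f i) (g j)) :
    ∀ ⦃i j⦄, i ≠ j → Disjoint (Sum.elim f g i) (Sum.elim f g j) := by
  rintro (i | i) (j | j) hij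
  · exact h1 (fun h => hij (by rw [h]))
  · exact h3 i j
  · exact (h3 j i).symm
  · exact h2 (fun h => hij (by rw [h]))

theorem isMinor_K33_of {f g : Fin 3 → Set V} (hc : ∀ i, Conn G (f i)) (hc' : ∀ i, Conn G (g i))
    (hd : ∀ i j, i < j → Disjoint (f i) (f j)) (hd' : ∀ i j, i < j → Disjoint (g i) (g j))
    (hd2 : ∀ i j, Disjoint (f i) (g j)) (ha : ∀ i j, Tch G (f i) (g j)) :
    Model K33 G (Sum.elim f g) := by
  refine ⟨?_, sum_disj (fin_disj hd) (fin_disj hd') hd2, ?_⟩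
  · rintro (i | i)
    · exact hc i
    · exact hc' i
  · rintro (i | i) (j | j) hij
    · simp [K33] at hij
    · exact ha i j
    · exact (ha j i).symm
    · simp [K33] at hij

end SixFree

/-! ### the six graphs have bad edges -/

section Bad

theorem np5 {V : Type*} {G : SimpleGraph V} {f : Fin 5 → Set V} (h : Model K5 G f) : ¬ Planar G :=
  fun hp => hp.1 h.isMinor

theorem np33 {V : Type*} {G : SimpleGraph V} {f : Fin 3 ⊕ Fin 3 → Set V} (h : Model K33 G f) : ¬ Planar G :=
  fun hp => hp.2 h.isMinor

/-- a generic way to get models by singletons -/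
theorem model_emb {V W : Type*} {G : SimpleGraph V} {K : SimpleGraph W} (f : W → V)
    (hf : Function.Injective f)
    (h : ∀ i j, K.Adj i j → G.Adj (f i) (f j)) : Model K G (fun w => {f w}) where
  conn w := conn_singleton _
  disj := fun i j hij => by simpa using fun h => hij (hf h)
  adj := fun i j hij => ⟨f i, rfl, f j, rfl, h i j hij⟩

theorem bad_K5plus : K5plus.Adj (some 0) none ∧ ¬ Planar (K5plus.deleteEdges {s(some 0, none)}) ∧
    ¬ Planar (contractEdge K5plus (some 0) none) := by
  refine ⟨by simp [K5plus], np5 (model_emb some (Option.some_injective _) ?_),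
    np5 (model_emb some (Option.some_injective _) ?_)⟩
  · intro i j hij
    have : i ≠ j := hij.ne
    simp [K5plus, this]
  · intro i j hij
    have : i ≠ j := hij.ne
    simp [contract_adj, K5plus, this]

theorem bad_K33plus : K33plus.Adj (some (.inl 0)) none ∧
    ¬ Planar (K33plus.deleteEdges {s(some (.inl 0), none)}) ∧
    ¬ Planar (contractEdge K33plus (some (.inl 0)) none) := by
  refine ⟨by simp [K33plus], np33 (model_emb some (Option.some_injective _) ?_),
    np33 (model_emb some (Option.some_injective _) ?_)⟩
  · rintro (i | i) (j | j) hij <;> simp [K33] at hij <;> simp [K33plus]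
  · rintro (i | i) (j | j) hij <;> simp [K33] at hij <;> simp [contract_adj, K33plus]

theorem bad_K5oplus : K5oplus.Adj (.inr 0) (.inr 1) ∧ ¬ Planar (K5oplus.deleteEdges {s(.inr 0, .inr 1)}) ∧
    ¬ Planar (contractEdge K5oplus (.inr 0) (.inr 1)) := by
  refine ⟨by simp [K5oplus], np5 (model_emb .inl Sum.inl_injective ?_),
    np5 (model_emb .inl Sum.inl_injective ?_)⟩
  · intro i j hij
    have : i ≠ j := hij.ne
    simp [K5oplus, this]
  · intro i j hij
    have : i ≠ j := hij.ne
    simp [contract_adj, K5oplus, this]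

theorem bad_K33oplus : K33oplus.Adj (.inr 0) (.inr 1) ∧
    ¬ Planar (K33oplus.deleteEdges {s(.inr 0, .inr 1)}) ∧
    ¬ Planar (contractEdge K33oplus (.inr 0) (.inr 1)) := by
  refine ⟨by simp [K33oplus], np33 (model_emb .inl Sum.inl_injective ?_),
    np33 (model_emb .inl Sum.inl_injective ?_)⟩
  · rintro (i | i) (j | j) hij <;> simp [K33] at hij <;> simp [K33oplus]
  · rintro (i | i) (j | j) hij <;> simp [K33] at hij <;> simp [contract_adj, K33oplus]

/-- models where the set of one vertex is enlarged -/
theorem model_emb_set {V W : Type*} {G : SimpleGraph V} {K : SimpleGraph W} (g : V → Option W)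
    (f : W → V) (hf : ∀ w, g (f w) = some w)
    (hc : ∀ v w, g v = some w → v = f w ∨ G.Adj v (f w))
    (h : ∀ i j, K.Adj i j → ∃ a b, g a = some i ∧ g b = some j ∧ G.Adj a b) :
    Model K G (fun w => {v | g v = some w}) where
  conn w := by
    refine conn_of_root (f w) (hf w) ?_
    rintro A hA ⟨b, hb, hbA⟩
    rcases hc b w hb with h | h
    · exact absurd (h ▸ hA) hbA
    · exact ⟨f w, hf w, hA, b, hb, hbA, h.symm⟩
  disj := fun i j hij => by
    rw [Set.disjoint_left]
    intro x hx hy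
    exact hij (Option.some_injective _ (hx.symm.trans hy))
  adj := fun i j hij => by
    obtain ⟨a, b, h1, h2, h3⟩ := h i j hij
    exact ⟨a, h1, b, h2, h3⟩

instance : DecidableRel K5.Adj := fun _ _ => inferInstanceAs (Decidable (_ ≠ _))
instance : DecidableRel K33.Adj := fun a b =>
  inferInstanceAs (Decidable (a.isLeft ∧ b.isRight ∨ a.isRight ∧ b.isLeft))
instance dK5h : DecidableRel K5h.Adj := fun a b => by
  unfold K5h; rw [fromRel_adj]
  rcases a with a | a <;> rcases b with b | b <;> infer_instance
instance dK33h : DecidableRel K33h.Adj := fun a b => by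
  unfold K33h; rw [fromRel_adj]
  rcases a with (a | a) | a <;> rcases b with (b | b) | b <;> infer_instance
instance {V : Type*} [DecidableEq V] (G : SimpleGraph V) [DecidableRel G.Adj] (a b : V) :
    DecidableRel (contractEdge G a b).Adj := fun _ _ => decidable_of_iff _ contract_adj.symm

theorem bad_K5h : K5h.Adj (.inr 0) (.inr 1) ∧ ¬ Planar (K5h.deleteEdges {s(.inr 0, .inr 1)}) ∧
    ¬ Planar (contractEdge K5h (.inr 0) (.inr 1)) := by
  refine ⟨by decide, np5 (model_emb_set (Sum.elim some (fun _ => some 0)) .inl ?_ ?_ ?_),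
    np5 (model_emb_set (Sum.elim some (fun k => if k = 0 then some 0 else none)) .inl ?_ ?_ ?_)⟩
  · decide
  · simp only [deleteEdges_adj, Set.mem_singleton_iff]; decide
  · simp only [deleteEdges_adj, Set.mem_singleton_iff]; decide
  · decide
  · decide
  · decide

set_option synthInstance.maxHeartbeats 400000 in
set_option synthInstance.maxSize 2000 in
theorem bad_K33h : K33h.Adj (.inr 0) (.inr 1) ∧ ¬ Planar (K33h.deleteEdges {s(.inr 0, .inr 1)}) ∧
    ¬ Planar (contractEdge K33h (.inr 0) (.inr 1)) := by
  refine ⟨by decide, np33 (model_emb_set (Sum.elim some (fun _ => some (.inl 0))) .inl ?_ ?_ ?_),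
    np33 (model_emb_set (Sum.elim some (fun k => if k = 0 then some (.inl 0) else none)) .inl ?_ ?_ ?_)⟩
  · decide
  · simp only [deleteEdges_adj, Set.mem_singleton_iff]; decide
  · simp only [deleteEdges_adj, Set.mem_singleton_iff]; decide
  · decide
  · decide
  · decide

end Bad

/-- the statement (iii) -/
def SixFree {V : Type*} (G : SimpleGraph V) : Prop :=
  ¬ IsMinor K5plus G ∧ ¬ IsMinor K33plus G ∧ ¬ IsMinor K5h G ∧ ¬ IsMinor K33h G ∧
       ¬ IsMinor K5oplus G ∧ ¬ IsMinor K33oplus G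

theorem sixFree_of_almostPlanar {V : Type*} {G : SimpleGraph V} (h : AlmostPlanar G) : SixFree G :=
  ⟨fun h' => not_almostPlanar_of_badEdge h' bad_K5plus.1 bad_K5plus.2.1 bad_K5plus.2.2 h,
   fun h' => not_almostPlanar_of_badEdge h' bad_K33plus.1 bad_K33plus.2.1 bad_K33plus.2.2 h,
   fun h' => not_almostPlanar_of_badEdge h' bad_K5h.1 bad_K5h.2.1 bad_K5h.2.2 h,
   fun h' => not_almostPlanar_of_badEdge h' bad_K33h.1 bad_K33h.2.1 bad_K33h.2.2 h,
   fun h' => not_almostPlanar_of_badEdge h' bad_K5oplus.1 bad_K5oplus.2.1 bad_K5oplus.2.2 h,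
   fun h' => not_almostPlanar_of_badEdge h' bad_K33oplus.1 bad_K33oplus.2.1 bad_K33oplus.2.2 h⟩

section SixFree2

variable {V W W' : Type*} {G : SimpleGraph V}

theorem Model.reindex {K : SimpleGraph W} {K' : SimpleGraph W'} {B : W → Set V} (h : Model K G B)
    (σ : W' → W) (hσ : Function.Injective σ) (hσ' : ∀ i j, K'.Adj i j → K.Adj (σ i) (σ j)) :
    Model K' G (fun i => B (σ i)) :=
  ⟨fun _ => h.conn _, fun _ _ hij => h.disj (fun e => hij (hσ e)), fun i j hij => h.adj (hσ' i j hij)⟩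

theorem SixFree.crit5 (hG : SixFree G) {B : Fin 5 → Set V} (h : Model K5 G B) {x : V} (hx : x ∈ core G)
    (hxB : ∀ i, x ∉ B i) : False := by
  obtain ⟨y, hxy⟩ := hx
  by_cases hy : ∃ i, y ∈ B i
  · obtain ⟨i, hi⟩ := hy
    let B' : Fin 5 → Set V := fun j => B (Equiv.swap 0 i j)
    have hB' : Model K5 G B' := h.reindex _ (Equiv.injective _)
      (fun a b hab => by simpa [K5] using hab)
    have hx' : ∀ j, x ∉ B' j := fun j => hxB _
    have hy' : y ∈ B' 0 := by simpa [B'] using hi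
    apply hG.1
    refine Model.isMinor (B := fun o => o.elim {x} B') ⟨?_, ?_, ?_⟩
    · rintro (_ | j)
      · exact conn_singleton x
      · exact hB'.conn j
    · rintro (_ | j) (_ | k) hjk
      · exact absurd rfl hjk
      · simpa using hx' k
      · simpa using hx' j
      · exact hB'.disj (fun h => hjk (by rw [h]))
    · rintro (_ | j) (_ | k) hjk
      · simp [K5plus] at hjk
      · simp [K5plus] at hjk
        subst hjk
        exact ⟨x, rfl, y, hy', hxy⟩
      · simp [K5plus] at hjk
        subst hjk
        exact ⟨y, hy', x, rfl, hxy.symm⟩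
      · have : j ≠ k := fun h => hjk.ne (by rw [h])
        exact hB'.adj this
  · push Not at hy
    apply hG.2.2.2.2.1
    refine Model.isMinor (B := Sum.elim B ![{x}, {y}]) ⟨?_, ?_, ?_⟩
    · rintro (i | i)
      · exact h.conn i
      · fin_cases i <;> exact conn_singleton _
    · refine sum_disj h.disj (fin_disj ?_) ?_
      · intro i j; fin_cases i <;> fin_cases j <;> simp [hxy.ne]
      · intro i j; fin_cases j <;> simp [hxB, hy]
    · have h01 : Tch G {x} {y} := ⟨x, rfl, y, rfl, hxy⟩
      rintro (i | i) (j | j) hij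
      · have : i ≠ j := fun h => hij.ne (by rw [h])
        exact h.adj this
      · simp [K5oplus] at hij
      · simp [K5oplus] at hij
      · revert hij; fin_cases i <;> fin_cases j <;> simp [h01, h01.symm]

theorem SixFree.crit33 (hG : SixFree G) {B : Fin 3 ⊕ Fin 3 → Set V} (h : Model K33 G B) {x : V}
    (hx : x ∈ core G) (hxB : ∀ i, x ∉ B i) : False := by
  obtain ⟨y, hxy⟩ := hx
  by_cases hy : ∃ i, y ∈ B i
  · have : ∃ B' : Fin 3 ⊕ Fin 3 → Set V, Model K33 G B' ∧ (∀ j, x ∉ B' j) ∧ y ∈ B' (.inl 0) := by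
      obtain ⟨i | i, hi⟩ := hy
      · refine ⟨fun j => B (Sum.map (Equiv.swap 0 i) id j), h.reindex _ ?_ ?_, fun j => hxB _, ?_⟩
        · exact Sum.map_injective.2 ⟨Equiv.injective _, Function.injective_id⟩
        · rintro (a | a) (b | b) hab <;> simpa [K33] using hab
        · simpa using hi
      · refine ⟨fun j => B (Sum.swap (Sum.map (Equiv.swap 0 i) id j)), h.reindex _ ?_ ?_, fun j => hxB _, ?_⟩
        · exact Sum.swap_leftInverse.injective.comp
            (Sum.map_injective.2 ⟨Equiv.injective _, Function.injective_id⟩)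
        · rintro (a | a) (b | b) hab <;> simpa [K33] using hab
        · simpa using hi
    obtain ⟨B', hB', hx', hy'⟩ := this
    apply hG.2.1
    refine Model.isMinor (B := fun o => o.elim {x} B') ⟨?_, ?_, ?_⟩
    · rintro (_ | j)
      · exact conn_singleton x
      · exact hB'.conn j
    · rintro (_ | j) (_ | k) hjk
      · exact absurd rfl hjk
      · simpa using hx' k
      · simpa using hx' j
      · exact hB'.disj (fun h => hjk (by rw [h]))
    · rintro (_ | j) (_ | k) hjk
      · simp [K33plus] at hjk
      · simp [K33plus] at hjk
        subst hjk
        exact ⟨x, rfl, y, hy', hxy⟩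
      · simp [K33plus] at hjk
        subst hjk
        exact ⟨y, hy', x, rfl, hxy.symm⟩
      · refine hB'.adj ?_
        rcases j with j | j <;> rcases k with k | k <;> simp [K33plus] at hjk <;> simp [K33]
  · push Not at hy
    apply hG.2.2.2.2.2
    refine Model.isMinor (B := Sum.elim B ![{x}, {y}]) ⟨?_, ?_, ?_⟩
    · rintro (i | i)
      · exact h.conn i
      · fin_cases i <;> exact conn_singleton _
    · refine sum_disj h.disj (fin_disj ?_) ?_
      · intro i j; fin_cases i <;> fin_cases j <;> simp [hxy.ne]
      · intro i j; fin_cases j <;> simp [hxB, hy]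
    · have h01 : Tch G {x} {y} := ⟨x, rfl, y, rfl, hxy⟩
      rintro (i | i) (j | j) hij
      · refine h.adj ?_
        rcases i with i | i <;> rcases j with j | j <;> simp [K33oplus] at hij <;> simp [K33]
      · rcases i with i | i <;> simp [K33oplus] at hij
      · rcases j with j | j <;> simp [K33oplus] at hij
      · revert hij; fin_cases i <;> fin_cases j <;> simp [h01, h01.symm]

/-- no `K33h`: eight explicit sets; `f 0 - s0 - g 0`, `f 0 - s1 - g 1`, `s0 - s1`. -/
theorem SixFree.no33h (hG : SixFree G) {f g : Fin 3 → Set V} {s0 s1 : Set V}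
    (hc : ∀ i, Conn G (f i)) (hc' : ∀ i, Conn G (g i)) (hs0 : Conn G s0) (hs1 : Conn G s1)
    (hd : ∀ i j, i < j → Disjoint (f i) (f j)) (hd' : ∀ i j, i < j → Disjoint (g i) (g j))
    (hd2 : ∀ i j, Disjoint (f i) (g j))
    (h0f : ∀ i, Disjoint s0 (f i)) (h0g : ∀ i, Disjoint s0 (g i))
    (h1f : ∀ i, Disjoint s1 (f i)) (h1g : ∀ i, Disjoint s1 (g i)) (h01 : Disjoint s0 s1)
    (ha : ∀ i j, ¬ (i = 0 ∧ j ≠ 2) → Tch G (f i) (g j))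
    (t1 : Tch G s0 (f 0)) (t2 : Tch G s0 (g 0)) (t3 : Tch G s1 (f 0)) (t4 : Tch G s1 (g 1))
    (t5 : Tch G s0 s1) : False := by
  apply hG.2.2.2.1
  refine Model.isMinor (B := Sum.elim (Sum.elim f g) ![s0, s1]) ⟨?_, ?_, ?_⟩
  · rintro ((i | i) | i)
    · exact hc i
    · exact hc' i
    · fin_cases i
      · exact hs0
      · exact hs1
  · refine sum_disj (sum_disj (fin_disj hd) (fin_disj hd') hd2) (fin_disj ?_) ?_
    · intro i j; fin_cases i <;> fin_cases j <;> simp [h01]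
    · rintro (i | i) j <;> fin_cases j
      · exact (h0f i).symm
      · exact (h1f i).symm
      · exact (h0g i).symm
      · exact (h1g i).symm
  · have main : ∀ i j, K33h.Adj (.inl (.inl i)) (.inl (.inr j)) → Tch G (f i) (g j) := by
      intro i j hij
      apply ha
      revert i j; decide
    have mid : ∀ x k, K33h.Adj (.inl x) (.inr k) →
        Tch G (Sum.elim (Sum.elim f g) ![s0, s1] (.inl x)) (Sum.elim (Sum.elim f g) ![s0, s1] (.inr k)) := by
      intro x k hxk
      have h : (x = .inl 0 ∧ k = 0) ∨ (x = .inr 0 ∧ k = 0) ∨ (x = .inl 0 ∧ k = 1) ∨ (x = .inr 1 ∧ k = 1) := by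
        revert x k; decide
      rcases h with ⟨rfl, rfl⟩ | ⟨rfl, rfl⟩ | ⟨rfl, rfl⟩ | ⟨rfl, rfl⟩
      · exact t1.symm
      · exact t2.symm
      · exact t3.symm
      · exact t4.symm
    rintro (x | k) (y | l) hxy
    · rcases x with i | i <;> rcases y with j | j
      · simp [K33h] at hxy
      · exact main _ _ hxy
      · exact (main _ _ hxy.symm).symm
      · simp [K33h] at hxy
    · exact mid _ _ hxy
    · exact (mid _ _ hxy.symm).symm
    · revert hxy; fin_cases k <;> fin_cases l <;> simp [t5, t5.symm]

/-- no `K5h` -/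
theorem SixFree.no5h (hG : SixFree G) {f : Fin 5 → Set V} {s0 s1 : Set V}
    (hc : ∀ i, Conn G (f i)) (hs0 : Conn G s0) (hs1 : Conn G s1)
    (hd : ∀ i j, i < j → Disjoint (f i) (f j))
    (h0f : ∀ i, Disjoint s0 (f i)) (h1f : ∀ i, Disjoint s1 (f i)) (h01 : Disjoint s0 s1)
    (ha : ∀ i j, i < j → ¬ (i = 0 ∧ (j = 1 ∨ j = 2)) → Tch G (f i) (f j))
    (t1 : Tch G s0 (f 0)) (t2 : Tch G s0 (f 1)) (t3 : Tch G s1 (f 0)) (t4 : Tch G s1 (f 2))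
    (t5 : Tch G s0 s1) : False := by
  apply hG.2.2.1
  refine Model.isMinor (B := Sum.elim f ![s0, s1]) ⟨?_, ?_, ?_⟩
  · rintro (i | i)
    · exact hc i
    · fin_cases i
      · exact hs0
      · exact hs1
  · refine sum_disj (fin_disj hd) (fin_disj ?_) ?_
    · intro i j; fin_cases i <;> fin_cases j <;> simp [h01]
    · rintro i j; fin_cases j
      · exact (h0f i).symm
      · exact (h1f i).symm
  · have main : ∀ i j, i < j → K5h.Adj (.inl i) (.inl j) → Tch G (f i) (f j) := by
      intro i j h hij
      apply ha _ _ h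
      revert i j; decide
    have mid : ∀ x k, K5h.Adj (.inl x) (.inr k) →
        Tch G (Sum.elim f ![s0, s1] (.inl x)) (Sum.elim f ![s0, s1] (.inr k)) := by
      intro x k hxk
      have h : (x = 0 ∧ k = 0) ∨ (x = 1 ∧ k = 0) ∨ (x = 0 ∧ k = 1) ∨ (x = 2 ∧ k = 1) := by
        revert x k; decide
      rcases h with ⟨rfl, rfl⟩ | ⟨rfl, rfl⟩ | ⟨rfl, rfl⟩ | ⟨rfl, rfl⟩
      · exact t1.symm
      · exact t2.symm
      · exact t3.symm
      · exact t4.symm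
    rintro (x | k) (y | l) hxy
    · have : x ≠ y := fun h => hxy.ne (by rw [h])
      rcases lt_or_gt_of_ne this with h' | h'
      · exact main _ _ h' hxy
      · exact (main _ _ h' hxy.symm).symm
    · exact mid _ _ hxy
    · exact (mid _ _ hxy.symm).symm
    · revert hxy; fin_cases k <;> fin_cases l <;> simp [t5, t5.symm]

end SixFree2

open SimpleGraph
set_option linter.unusedVariables false

section Cert

variable {V : Type*} {G : SimpleGraph V}

theorem Conn.exists_walk {S : Set V} (h : Conn G S) {x y : V} (hx : x ∈ S) (hy : y ∈ S) :
    ∃ p : G.Walk x y, ∀ z ∈ p.support, z ∈ S := by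
  obtain ⟨p⟩ := h.preconnected ⟨x, hx⟩ ⟨y, hy⟩
  refine ⟨p.map (Embedding.induce S).toHom, ?_⟩
  intro z hz
  erw [Walk.support_map, List.mem_map] at hz
  obtain ⟨a, _, rfl⟩ := hz
  exact a.2

/-- sum of `Y` along a walk -/
def walkSum (Y : V → V → V → ZMod 2) (c : V) : ∀ {x y : V}, G.Walk x y → ZMod 2
  | _, _, .nil => 0
  | x, _, .cons (v := b) _ p => Y x b c + walkSum Y c p

/-- local condition -/
def CertLocal (G : SimpleGraph V) (L : V → V → ZMod 2) (Y : V → V → V → ZMod 2) : Prop :=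
  ∀ a b c d, G.Adj a b → G.Adj c d → a ≠ c → a ≠ d → b ≠ c → b ≠ d →
    L a c + L b c + L a d + L b d + Y a b c + Y a b d + Y c d a + Y c d b = 0

theorem two_zero : (2 : ZMod 2) = 0 := by decide

theorem cert_one {L : V → V → ZMod 2} {Y : V → V → V → ZMod 2} (h : CertLocal G L Y) {a b : V}
    (hab : G.Adj a b) {y y' : V} (q : G.Walk y y') (ha : a ∉ q.support) (hb : b ∉ q.support) :
    L a y + L b y + L a y' + L b y' + Y a b y + Y a b y' + walkSum Y a q + walkSum Y b q = 0 := by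
  induction q with
  | nil => 
    rename_i u
    simp only [walkSum]
    linear_combination (L a u + L b u + Y a b u) * two_zero
  | cons hcd q ih =>
    rename_i c d e
    simp only [Walk.support_cons, List.mem_cons, not_or] at ha hb
    have h1 := ih ha.2 hb.2
    have h2 := h a b c d hab hcd ha.1 (fun e => ha.2 (e ▸ q.start_mem_support)) hb.1
      (fun e => hb.2 (e ▸ q.start_mem_support))
    simp only [walkSum]
    linear_combination h1 + h2 - (L a d + L b d + Y a b d) * two_zero

theorem cert_two {L : V → V → ZMod 2} {Y : V → V → V → ZMod 2} (h : CertLocal G L Y) {x x' y y' : V}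
    (p : G.Walk x x') (q : G.Walk y y') (hpq : ∀ z ∈ p.support, z ∉ q.support) :
    L x y + L x' y + L x y' + L x' y' + walkSum Y y p + walkSum Y y' p
      + walkSum Y x q + walkSum Y x' q = 0 := by
  induction p with
  | nil =>
    rename_i u
    simp only [walkSum]
    linear_combination (L u y + L u y' + walkSum Y u q) * two_zero
  | cons hab p ih =>
    rename_i a b e
    simp only [Walk.support_cons, List.mem_cons, forall_eq_or_imp] at hpq
    have h1 := ih hpq.2
    have h2 := cert_one h hab q hpq.1 (hpq.2 _ p.start_mem_support)
    simp only [walkSum]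
    linear_combination h1 + h2 - (L b y + L b y' + walkSum Y b q) * two_zero

theorem cert_model {W : Type*} {K : SimpleGraph W} {B : W → Set V} (hB : Model K G B)
    {L : V → V → ZMod 2} {Y : V → V → V → ZMod 2} (h : CertLocal G L Y) 
    (hL : ∀ a b, a ≠ b → L a b + L b a = 1) :
    ∃ (l : W → W → ZMod 2) (F : W → W → W → ZMod 2), (∀ i j, i ≠ j → l i j + l j i = 1) ∧
      ∀ i j k m, K.Adj i j → K.Adj k m → i ≠ k → i ≠ m → j ≠ k → j ≠ m →
        l i k + l j k + l i m + l j m + F i j k + F i j m + F k m i + F k m j = 0 := by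
  classical
  have hr : ∀ i, ∃ r, r ∈ B i := fun i => (hB.conn i).nonempty
  choose r hr using hr
  have hw : ∀ i j, ∃ p : G.Walk (r i) (r j) ⊕ Unit, K.Adj i j →
      ∃ p' : G.Walk (r i) (r j), p = .inl p' ∧ ∀ z ∈ p'.support, z ∈ B i ∪ B j := by
    intro i j
    by_cases hij : K.Adj i j
    · obtain ⟨p, hp⟩ := ((hB.conn i).union (hB.conn j) (hB.adj hij)).exists_walk (Or.inl (hr i)) (Or.inr (hr j))
      exact ⟨.inl p, fun _ => ⟨p, rfl, hp⟩⟩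
    · exact ⟨.inr (), fun h => absurd h hij⟩
  choose p hp using hw
  refine ⟨fun i j => L (r i) (r j), fun i j k => Sum.elim (fun q => walkSum Y (r k) q) (fun _ => 0) (p i j),
    ?_, ?_⟩
  · intro i j hij
    exact hL _ _ (fun e => hij (hB.eq_of_mem (hr i) (e ▸ hr j)))
  · intro i j k m hij hkm h1 h2 h3 h4
    obtain ⟨p1, e1, hp1⟩ := hp i j hij
    obtain ⟨p2, e2, hp2⟩ := hp k m hkm
    simp only [e1, e2, Sum.elim_inl]
    apply cert_two h
    intro z hz hz'
    rcases hp1 z hz with a | a <;> rcases hp2 z hz' with b | b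
    · exact h1 (hB.eq_of_mem a b)
    · exact h2 (hB.eq_of_mem a b)
    · exact h3 (hB.eq_of_mem a b)
    · exact h4 (hB.eq_of_mem a b)

theorem planar_of_cert {L : V → V → ZMod 2} {Y : V → V → V → ZMod 2} (h : CertLocal G L Y)
    (hL : ∀ a b, a ≠ b → L a b + L b a = 1) : Planar G := by
  constructor
  · intro hm
    obtain ⟨B, hB⟩ := isMinor_iff.1 hm
    obtain ⟨l, F, hl, hF⟩ := cert_model hB h hL
    have e0123 := hF (0) (1) (2) (3) (by decide) (by decide) (by decide) (by decide) (by decide) (by decide)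
    have e0124 := hF (0) (1) (2) (4) (by decide) (by decide) (by decide) (by decide) (by decide) (by decide)
    have e0134 := hF (0) (1) (3) (4) (by decide) (by decide) (by decide) (by decide) (by decide) (by decide)
    have e0213 := hF (0) (2) (1) (3) (by decide) (by decide) (by decide) (by decide) (by decide) (by decide)
    have e0214 := hF (0) (2) (1) (4) (by decide) (by decide) (by decide) (by decide) (by decide) (by decide)
    have e0234 := hF (0) (2) (3) (4) (by decide) (by decide) (by decide) (by decide) (by decide) (by decide)
    have e0312 := hF (0) (3) (1) (2) (by decide) (by decide) (by decide) (by decide) (by decide) (by decide)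
    have e0314 := hF (0) (3) (1) (4) (by decide) (by decide) (by decide) (by decide) (by decide) (by decide)
    have e0324 := hF (0) (3) (2) (4) (by decide) (by decide) (by decide) (by decide) (by decide) (by decide)
    have e0412 := hF (0) (4) (1) (2) (by decide) (by decide) (by decide) (by decide) (by decide) (by decide)
    have e0413 := hF (0) (4) (1) (3) (by decide) (by decide) (by decide) (by decide) (by decide) (by decide)
    have e0423 := hF (0) (4) (2) (3) (by decide) (by decide) (by decide) (by decide) (by decide) (by decide)
    have e1234 := hF (1) (2) (3) (4) (by decide) (by decide) (by decide) (by decide) (by decide) (by decide)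
    have e1324 := hF (1) (3) (2) (4) (by decide) (by decide) (by decide) (by decide) (by decide) (by decide)
    have e1423 := hF (1) (4) (2) (3) (by decide) (by decide) (by decide) (by decide) (by decide) (by decide)
    have s21 := hl (2) (1) (by decide)
    have s31 := hl (3) (1) (by decide)
    have s32 := hl (3) (2) (by decide)
    have s41 := hl (4) (1) (by decide)
    have s42 := hl (4) (2) (by decide)
    have s43 := hl (4) (3) (by decide)
    have : (1 : ZMod 2) = 0 := by
      linear_combination e0123 + e0124 + e0134 + e0213 + e0214 + e0234 + e0312 + e0314 + e0324 + e0412 + e0413 + e0423 + e1234 + e1324 + e1423 - (2 * s21 + 2 * s31 + 3 * s32 + 2 * s41 + 3 * s42 + 3 * s43) - (3 * l (0) (2) + 3 * l (0) (3) + 1 * l (1) (2) + 1 * l (1) (3) + 1 * F (0) (1) (2) + 1 * F (0) (1) (3) + 1 * F (2) (3) (0) + 1 * F (2) (3) (1) + 3 * l (0) (4) + 1 * l (1) (4) + 1 * F (0) (1) (4) + 1 * F (2) (4) (0) + 1 * F (2) (4) (1) + 1 * F (3) (4) (0) + 1 * F (3) (4) (1) + 3 * l (0) (1) + 1 * F (0)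 (2) (1) + 1 * F (0) (2) (3) + 1 * F (1) (3) (0) + 1 * F (1) (3) (2) + 1 * F (0) (2) (4) + 1 * F (1) (4) (0) + 1 * F (1) (4) (2) + 1 * F (3) (4) (2) + 1 * F (0) (3) (1) + 1 * F (0) (3) (2) + 1 * F (1) (2) (0) + 1 * F (1) (2) (3) + 1 * F (0) (3) (4) + 1 * F (1) (4) (3) + 1 * F (2) (4) (3) + 1 * F (0) (4) (1) + 1 * F (0) (4) (2) + 1 * F (1) (2) (4) + 1 * F (0) (4) (3) + 1 * F (1) (3) (4) + 1 * F (2) (3) (4) + 7) * two_zero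
    exact absurd this (by decide)
  · intro hm
    obtain ⟨B, hB⟩ := isMinor_iff.1 hm
    obtain ⟨l, F, hl, hF⟩ := cert_model hB h hL
    have e0314 := hF (.inl 0) (.inr 0) (.inl 1) (.inr 1) (by decide) (by decide) (by decide) (by decide) (by decide) (by decide)
    have e0315 := hF (.inl 0) (.inr 0) (.inl 1) (.inr 2) (by decide) (by decide) (by decide) (by decide) (by decide) (by decide)
    have e0324 := hF (.inl 0) (.inr 0) (.inl 2) (.inr 1) (by decide) (by decide) (by decide) (by decide) (by decide) (by decide)
    have e0325 := hF (.inl 0) (.inr 0) (.inl 2) (.inr 2) (by decide) (by decide) (by decide) (by decide) (by decide) (by decide)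
    have e0413 := hF (.inl 0) (.inr 1) (.inl 1) (.inr 0) (by decide) (by decide) (by decide) (by decide) (by decide) (by decide)
    have e0415 := hF (.inl 0) (.inr 1) (.inl 1) (.inr 2) (by decide) (by decide) (by decide) (by decide) (by decide) (by decide)
    have e0423 := hF (.inl 0) (.inr 1) (.inl 2) (.inr 0) (by decide) (by decide) (by decide) (by decide) (by decide) (by decide)
    have e0425 := hF (.inl 0) (.inr 1) (.inl 2) (.inr 2) (by decide) (by decide) (by decide) (by decide) (by decide) (by decide)
    have e0513 := hF (.inl 0) (.inr 2) (.inl 1) (.inr 0) (by decide) (by decide) (by decide) (by decide) (by decide) (by decide)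
    have e0514 := hF (.inl 0) (.inr 2) (.inl 1) (.inr 1) (by decide) (by decide) (by decide) (by decide) (by decide) (by decide)
    have e0523 := hF (.inl 0) (.inr 2) (.inl 2) (.inr 0) (by decide) (by decide) (by decide) (by decide) (by decide) (by decide)
    have e0524 := hF (.inl 0) (.inr 2) (.inl 2) (.inr 1) (by decide) (by decide) (by decide) (by decide) (by decide) (by decide)
    have e1324 := hF (.inl 1) (.inr 0) (.inl 2) (.inr 1) (by decide) (by decide) (by decide) (by decide) (by decide) (by decide)
    have e1325 := hF (.inl 1) (.inr 0) (.inl 2) (.inr 2) (by decide) (by decide) (by decide) (by decide) (by decide) (by decide)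
    have e1423 := hF (.inl 1) (.inr 1) (.inl 2) (.inr 0) (by decide) (by decide) (by decide) (by decide) (by decide) (by decide)
    have e1425 := hF (.inl 1) (.inr 1) (.inl 2) (.inr 2) (by decide) (by decide) (by decide) (by decide) (by decide) (by decide)
    have e1523 := hF (.inl 1) (.inr 2) (.inl 2) (.inr 0) (by decide) (by decide) (by decide) (by decide) (by decide) (by decide)
    have e1524 := hF (.inl 1) (.inr 2) (.inl 2) (.inr 1) (by decide) (by decide) (by decide) (by decide) (by decide) (by decide)
    have s31 := hl (.inr 0) (.inl 1) (by decide)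
    have s32 := hl (.inr 0) (.inl 2) (by decide)
    have s41 := hl (.inr 1) (.inl 1) (by decide)
    have s43 := hl (.inr 1) (.inr 0) (by decide)
    have s42 := hl (.inr 1) (.inl 2) (by decide)
    have s51 := hl (.inr 2) (.inl 1) (by decide)
    have s53 := hl (.inr 2) (.inr 0) (by decide)
    have s54 := hl (.inr 2) (.inr 1) (by decide)
    have s52 := hl (.inr 2) (.inl 2) (by decide)
    have : (1 : ZMod 2) = 0 := by
      linear_combination e0314 + e0315 + e0324 + e0325 + e0413 + e0415 + e0423 + e0425 + e0513 + e0514 + e0523 + e0524 + e1324 + e1325 + e1423 + e1425 + e1523 + e1524 - (2 * s31 + 4 * s32 + 2 * s41 + 3 * s43 + 4 * s42 + 2 * s51 + 3 * s53 + 3 * s54 + 4 * s52) - (3 * l (.inl 0) (.inl 1) + 2 * l (.inl 0) (.inr 1) + 1 * F (.inl 0) (.inr 0) (.inl 1) + 1 * F (.inl 0) (.inr 0) (.inr 1) + 1 * F (.inl 1) (.inr 1) (.inl 0) + 1 * F (.inl 1) (.inr 1) (.inr 0) + 2 * l (.inl 0) (.inr 2) + 1 * F (.inl 0) (.inr 0)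 (.inr 2) + 1 * F (.inl 1) (.inr 2) (.inl 0) + 1 * F (.inl 1) (.inr 2) (.inr 0) + 3 * l (.inl 0) (.inl 2) + -2 * l (.inl 2) (.inr 0) + 1 * F (.inl 0) (.inr 0) (.inl 2) + 1 * F (.inl 2) (.inr 1) (.inl 0) + 1 * F (.inl 2) (.inr 1) (.inr 0) + 1 * F (.inl 2) (.inr 2) (.inl 0) + 1 * F (.inl 2) (.inr 2) (.inr 0) + 2 * l (.inl 0) (.inr 0) + 1 * F (.inl 0) (.inr 1) (.inl 1) + 1 * F (.inl 0) (.inr 1) (.inr 0) + 1 * F (.inl 1) (.inr 0) (.inl 0) + 1 * F (.inl 1) (.inr 0) (.inr 1) + 1 * F (.inl 0) (.inr 1) (.inr 2) + 1 * F (.inl 1) (.inr 2) (.inr 1) + -2 * l (.inl 2) (.inr 1) + 1 * F (.inl 0) (.inr 1) (.inl 2) + 1 * F (.inl 2) (.inr 0) (.inl 0) + 1 * F (.inl 2) (.inr 0) (.inr 1) + 1 * F (.inl 2) (.inr 2) (.inr 1) + 1 * F (.inl 0) (.inr 2) (.inl 1) + 1 * F (.inl 0) (.inr 2) (.inr 0)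 + 1 * F (.inl 1) (.inr 0) (.inr 2) + 1 * F (.inl 0) (.inr 2) (.inr 1) + 1 * F (.inl 1) (.inr 1) (.inr 2) + -2 * l (.inl 2) (.inr 2) + 1 * F (.inl 0) (.inr 2) (.inl 2) + 1 * F (.inl 2) (.inr 0) (.inr 2) + 1 * F (.inl 2) (.inr 1) (.inr 2) + 3 * l (.inl 1) (.inl 2) + 1 * F (.inl 1) (.inr 0) (.inl 2) + 1 * F (.inl 2) (.inr 1) (.inl 1) + 1 * F (.inl 2) (.inr 2) (.inl 1) + 1 * F (.inl 1) (.inr 1) (.inl 2) + 1 * F (.inl 2) (.inr 0) (.inl 1) + 1 * F (.inl 1) (.inr 2) (.inl 2) + 13) * two_zero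
    exact absurd this (by decide)

end Cert

open SimpleGraph
set_option linter.unusedVariables false

section Labels

variable {V W : Type*}

/-- labelled partial subdivision structure -/
structure Lab (X : SimpleGraph V) (Y : SimpleGraph W) (f : W → V) (lab : V → Sym2 W) : Prop where
  inj : Function.Injective f
  ll : ∀ s t, s ∉ Set.range f → t ∉ Set.range f → X.Adj s t → lab s = lab t
  lf : ∀ t c, t ∉ Set.range f → X.Adj t (f c) → c ∈ lab t
  ff : ∀ a b, X.Adj (f a) (f b) → Y.Adj a b
  ok : ∀ t, t ∉ Set.range f → t ∈ core X → (lab t).IsDiag ∨ lab t ∈ Y.edgeSet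
  deg : ∀ t, t ∉ Set.range f → ∃ y z, ∀ s, X.Adj t s → s = y ∨ s = z

theorem Lab.contract {X : SimpleGraph V} {Y : SimpleGraph W} {f : W → V} {lab : V → Sym2 W}
    (h : Lab X Y f lab) {t y : V} (ht : t ∉ Set.range f) (hty : X.Adj t y) :
    Lab (contractEdge X y t) Y f lab := by
  refine ⟨h.inj, ?_, ?_, ?_, ?_, ?_⟩
  · intro s s' hs hs' hadj
    rcases (contract_adj.1 hadj).2.2.2 with h1 | ⟨rfl, h1⟩ | ⟨rfl, h1⟩
    · exact h.ll _ _ hs hs' h1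
    · exact (h.ll _ _ ht hs hty).symm.trans (h.ll _ _ ht hs' h1)
    · exact (h.ll _ _ ht hs h1).symm.trans (h.ll _ _ ht hs' hty)
  · intro s c hs hadj
    rcases (contract_adj.1 hadj).2.2.2 with h1 | ⟨rfl, h1⟩ | ⟨rfl, h1⟩
    · exact h.lf _ _ hs h1
    · rw [← h.ll _ _ ht hs hty]; exact h.lf _ _ ht h1
    · rw [← h.ll _ _ ht hs h1]; exact h.lf _ _ ht hty
  · intro a b hadj
    have key : ∀ a b, a ≠ b → X.Adj t (f a) → X.Adj t (f b) → Y.Adj a b := by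
      intro a b hab ha hb
      have h1 := h.lf _ _ ht ha
      have h2 := h.lf _ _ ht hb
      have h3 := (Sym2.mem_and_mem_iff hab).1 ⟨h1, h2⟩
      rcases h.ok t ht ⟨_, hty⟩ with h4 | h4
      · rw [h3] at h4; exact absurd h4 hab
      · rw [h3] at h4; exact h4
    have hab : a ≠ b := fun e => hadj.ne (by rw [e])
    rcases (contract_adj.1 hadj).2.2.2 with h1 | ⟨e, h1⟩ | ⟨e, h1⟩
    · exact h.ff _ _ h1
    · exact key a b hab (e ▸ hty) h1
    · exact key a b hab h1 (e ▸ hty)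
  · rintro s hs ⟨s', hadj⟩
    apply h.ok s hs
    rcases (contract_adj.1 hadj).2.2.2 with h1 | ⟨rfl, h1⟩ | ⟨rfl, h1⟩
    · exact ⟨_, h1⟩
    · exact ⟨_, hty.symm⟩
    · exact ⟨_, h1.symm⟩
  · classical
    intro s hs
    obtain ⟨a, b, hab⟩ := h.deg s hs
    by_cases hsy : s = y
    · subst hsy
      obtain ⟨c, d, hcd⟩ := h.deg t ht
      have e1 := hab t hty.symm
      have e2 := hcd s hty
      refine ⟨if a = t then b else a, if c = s then d else c, ?_⟩
      intro r hr
      obtain ⟨n1, n2, n3, h1⟩ := contract_adj.1 hr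
      rcases h1 with h1 | ⟨_, h1⟩ | ⟨rfl, h1⟩
      · have := hab r h1
        left
        split_ifs with e
        · subst e; exact this.resolve_left n3
        · rcases e1 with e1 | e1
          · exact absurd e1.symm e
          · subst e1; exact this.resolve_right n3
      · have := hcd r h1
        right
        split_ifs with e
        · subst e; exact this.resolve_left n1.symm
        · rcases e2 with e2 | e2
          · exact absurd e2.symm e
          · subst e2; exact this.resolve_right n1.symm
      · exact absurd rfl n1
    · refine ⟨if a = t then y else a, if b = t then y else b, ?_⟩
      intro r hr
      obtain ⟨n1, n2, n3, h1⟩ := contract_adj.1 hr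
      rcases h1 with h1 | ⟨e, h1⟩ | ⟨rfl, h1⟩
      · rcases hab r h1 with e | e
        · left; rw [if_neg (fun e' => n3 (e.trans e'))]; exact e
        · right; rw [if_neg (fun e' => n3 (e.trans e'))]; exact e
      · exact absurd e hsy
      · rcases hab t h1.symm with e | e
        · left; rw [if_pos e.symm]
        · right; rw [if_pos e.symm]

theorem Lab.base {Z : Type*} {K : SimpleGraph Z} (hK : ∀ i : Z, ∃ j, K.Adj i j)
    {X : SimpleGraph V} {Y : SimpleGraph W} {f : W → V} {lab : V → Sym2 W}
    (h : Lab X Y f lab) (hr : core X ⊆ Set.range f) {B : Z → Set V} (hB : Model K X B) :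
    IsMinor K Y := by
  have hsub : ∀ i, B i ⊆ Set.range f := by
    intro i x hx
    by_contra hxr
    obtain ⟨j, hj⟩ := hK i
    exact hB.not_mem_of_isolated (fun y hy => hxr (hr ⟨y, hy⟩)) hj hx
  refine Model.isMinor (B := fun i => f ⁻¹' B i) ⟨?_, ?_, ?_⟩
  · intro i
    obtain ⟨r, hr⟩ := (hB.conn i).nonempty
    obtain ⟨c, rfl⟩ := hsub i hr
    refine conn_of_root c hr ?_
    rintro A hA ⟨b, hb, hbA⟩
    obtain ⟨x, hx, hxA, y, hy, hyA, hxy⟩ := (hB.conn i).cut (f '' A) hr ⟨c, hA, rfl⟩ hb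
      (by rintro ⟨b', hb', e⟩; exact hbA (h.inj e ▸ hb'))
    obtain ⟨x, rfl⟩ := hsub i hx
    obtain ⟨y, rfl⟩ := hsub i hy
    rw [h.inj.mem_set_image] at hxA hyA
    exact ⟨x, hx, hxA, y, hy, hyA, h.ff _ _ hxy⟩
  · intro i j hij
    exact (hB.disj hij).preimage f
  · intro i j hij
    obtain ⟨s, hs, t, ht, hst⟩ := hB.adj hij
    obtain ⟨s, rfl⟩ := hsub i hs
    obtain ⟨t, rfl⟩ := hsub j ht
    exact ⟨s, hs, t, ht, h.ff _ _ hst⟩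

theorem core_contract {X : SimpleGraph V} {t y : V} (hty : X.Adj t y) :
    core (contractEdge X y t) ⊆ core X := by
  rintro s ⟨s', hadj⟩
  rcases (contract_adj.1 hadj).2.2.2 with h1 | ⟨rfl, h1⟩ | ⟨rfl, h1⟩
  · exact ⟨_, h1⟩
  · exact ⟨_, hty.symm⟩
  · exact ⟨_, h1.symm⟩

theorem not_mem_core_contract {X : SimpleGraph V} {t y : V} : t ∉ core (contractEdge X y t) := by
  rintro ⟨s', hadj⟩
  exact (contract_adj.1 hadj).2.1 rfl

theorem Lab.minor [Finite V] {Z : Type*} {K : SimpleGraph Z}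
    (hK : ∀ i : Z, ∃ j k l, K.Adj i j ∧ K.Adj i k ∧ K.Adj i l ∧ j ≠ k ∧ j ≠ l ∧ k ≠ l)
    {Y : SimpleGraph W} {f : W → V} {lab : V → Sym2 W} {X : SimpleGraph V}
    (h : Lab X Y f lab) {B : Z → Set V} (hB : Model K X B) : IsMinor K Y := by
  induction hn : (core X).ncard using Nat.strong_induction_on generalizing X B with
  | _ n ih =>
    by_cases hc : core X ⊆ Set.range f
    · exact h.base (fun i => by obtain ⟨j, _, _, hj, _⟩ := hK i; exact ⟨j, hj⟩) hc hB
    · rw [Set.not_subset] at hc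
      obtain ⟨t, htc, ht⟩ := hc
      have htc' := htc
      obtain ⟨y, hty⟩ := htc
      have hN : ∃ z, ∀ s, X.Adj t s → s = y ∨ s = z := by
        obtain ⟨a, b, hab⟩ := h.deg t ht
        rcases hab y hty with e | e
        · exact ⟨b, fun s hs => e ▸ hab s hs⟩
        · exact ⟨a, fun s hs => e ▸ (hab s hs).symm⟩
      obtain ⟨z, hN⟩ := hN
      refine ih _ ?_ (h.contract ht hty) (hB.suppress hty.ne hN hty hK) rfl
      rw [← hn]
      apply Set.ncard_lt_ncard _ (Set.toFinite _)
      exact ⟨core_contract hty, fun hs => not_mem_core_contract (hs htc')⟩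

theorem Lab.planar [Finite V] {Y : SimpleGraph W} {f : W → V} {lab : V → Sym2 W} {X : SimpleGraph V}
    (h : Lab X Y f lab) (hY : Planar Y) : Planar X := by
  refine ⟨fun hm => hY.1 ?_, fun hm => hY.2 ?_⟩
  · obtain ⟨B, hB⟩ := isMinor_iff.1 hm
    exact h.minor K5_deg hB
  · obtain ⟨B, hB⟩ := isMinor_iff.1 hm
    exact h.minor K33_deg hB

/-! ### V-level subdivisions -/

structure SubV {G : SimpleGraph V} {H : SimpleGraph W} (S : Set (Sym2 W)) (f : W → V)
    (p : ∀ ⦃u v : W⦄, H.Adj u v → G.Walk (f u) (f v)) : Prop where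
  inj : Function.Injective f
  path : ∀ ⦃u v : W⦄ (h : H.Adj u v), (p h).IsPath
  symm : ∀ ⦃u v : W⦄ (h : H.Adj u v), p h.symm = (p h).reverse
  len : ∀ ⦃u v : W⦄ (h : H.Adj u v), s(u, v) ∉ S → (p h).length = 1
  fr : ∀ ⦃u v : W⦄ (h : H.Adj u v) (w : W), f w ∈ (p h).support → w = u ∨ w = v
  dis : ∀ ⦃u v u' v' : W⦄ (h : H.Adj u v) (h' : H.Adj u' v'), s(u, v) ≠ s(u', v') →
      ∀ x : V, x ∈ (p h).support → x ∈ (p h').support → x ∈ Set.range f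
  edge : ∀ e ∈ G.edgeSet, ∃ (u v : W) (h : H.Adj u v), e ∈ (p h).edges

theorem IsSubdivisionWithin.subV {G : SimpleGraph V} {H : SimpleGraph W} {S : Set (Sym2 W)}
    (h : IsSubdivisionWithin (G.induce (core G)) H S) :
    ∃ (f : W → V) (p : ∀ ⦃u v : W⦄, H.Adj u v → G.Walk (f u) (f v)), SubV S f p := by
  obtain ⟨f, p, h1, h2, h3, h4, h5, h6, h7⟩ := h
  have hs : ∀ {a b : core G} (q : (G.induce (core G)).Walk a b) (x : V),
      x ∈ (q.map (Embedding.induce (core G)).toHom).support ↔ ∃ hx : x ∈ core G, (⟨x, hx⟩ : core G) ∈ q.support := by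
    intro a b q x
    rw [Walk.support_map, List.mem_map]
    constructor
    · rintro ⟨y, hy, rfl⟩; exact ⟨y.2, hy⟩
    · rintro ⟨hx, hy⟩; exact ⟨_, hy, rfl⟩
  refine ⟨fun u => (Embedding.induce (core G)).toHom (f u),
    fun u v h => (p h).map (Embedding.induce (core G)).toHom, ?_⟩
  refine ⟨fun a b e => f.injective (Subtype.ext e), ?_, ?_, ?_, ?_, ?_, ?_⟩
  · intro u v h
    exact Walk.IsPath.map (fun a b e => Subtype.ext e) (h1 h)
  · intro u v h
    exact (congrArg _ (h2 h)).trans (Walk.reverse_map _ _).symm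
  · intro u v h hS
    exact (Walk.length_map _ _).trans (h3 h hS)
  · intro u v h w hw
    obtain ⟨hx, hw⟩ := (hs _ _).1 hw
    exact h4 h w hw
  · intro u v u' v' h h' hne x hx hx'
    obtain ⟨hc, hx⟩ := (hs _ _).1 hx
    obtain ⟨hc', hx'⟩ := (hs _ _).1 hx'
    obtain ⟨w, hw⟩ := h5 h h' hne _ hx hx'
    exact ⟨w, congrArg Subtype.val hw⟩
  · intro e
    induction e with
    | _ a b =>
      intro hab
      have ha : a ∈ core G := ⟨b, hab⟩
      have hb : b ∈ core G := ⟨a, hab.symm⟩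
      obtain ⟨u, v, h, he⟩ := h7 s(⟨a, ha⟩, ⟨b, hb⟩) hab
      refine ⟨u, v, h, ?_⟩
      show s(a, b) ∈ ((p h).map (Embedding.induce (core G)).toHom).edges
      have he' := List.mem_map_of_mem (f := Sym2.map (Embedding.induce (G := G) (core G)).toHom) he
      have hq := Walk.edges_map (Embedding.induce (G := G) (core G)).toHom (p h)
      exact hq.symm ▸ he'

theorem path_edges_deg {G : SimpleGraph V} {a b : V} (p : G.Walk a b) (hp : p.IsPath) :
    (∃ c, ∀ s, s(a, s) ∈ p.edges → s = c) ∧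
    ∀ t, ∃ y z, ∀ s, s(t, s) ∈ p.edges → s = y ∨ s = z := by
  induction p with
  | nil => exact ⟨⟨‹_›, by simp⟩, fun t => ⟨t, t, by simp⟩⟩
  | cons h p ih =>
    rename_i a b c
    rw [Walk.cons_isPath_iff] at hp
    obtain ⟨⟨c1, hc1⟩, h2⟩ := ih hp.1
    have h1 : ∀ s, s(a, s) ∈ (Walk.cons h p).edges → s = b := by
      intro s hs
      rw [Walk.edges_cons, List.mem_cons] at hs
      rcases hs with hs | hs
      · rw [Sym2.eq_iff] at hs
        rcases hs with ⟨_, e⟩ | ⟨e, _⟩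
        · exact e
        · exact absurd e h.ne
      · exact absurd (p.fst_mem_support_of_mem_edges hs) hp.2
    refine ⟨⟨b, h1⟩, ?_⟩
    intro t
    by_cases hta : t = a
    · subst hta; exact ⟨b, b, fun s hs => Or.inl (h1 s hs)⟩
    by_cases htb : t = b
    · subst htb
      refine ⟨a, c1, fun s hs => ?_⟩
      rw [Walk.edges_cons, List.mem_cons] at hs
      rcases hs with hs | hs
      · rw [Sym2.eq_iff] at hs
        rcases hs with ⟨e, _⟩ | ⟨_, e⟩
        · exact absurd e hta
        · exact Or.inl e
      · exact Or.inr (hc1 s hs)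
    · obtain ⟨y, z, hyz⟩ := h2 t
      refine ⟨y, z, fun s hs => ?_⟩
      rw [Walk.edges_cons, List.mem_cons] at hs
      rcases hs with hs | hs
      · rw [Sym2.eq_iff] at hs
        rcases hs with ⟨e, _⟩ | ⟨e, _⟩
        · exact absurd e hta
        · exact absurd e htb
      · exact hyz s hs

theorem path_split {G : SimpleGraph V} {a b : V} (p : G.Walk a b) (hp : p.IsPath) {e : Sym2 V}
    (he : e ∈ p.edges) : ∃ A B : Set V, Disjoint A B ∧ a ∈ A ∧ b ∈ B ∧ (∀ x ∈ B, x ∈ p.support) ∧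
      ∀ s t, s(s, t) ∈ p.edges → s(s, t) = e ∨ (s ∈ A ∧ t ∈ A) ∨ (s ∈ B ∧ t ∈ B) := by
  induction p with
  | nil => simp at he
  | cons h p ih =>
    rename_i a c b
    rw [Walk.cons_isPath_iff] at hp
    by_cases heq : e = s(a, c)
    · refine ⟨{a}, {x | x ∈ p.support}, ?_, rfl, p.end_mem_support, ?_, ?_⟩
      · rw [Set.disjoint_singleton_left]; exact hp.2
      · intro x hx; rw [Walk.support_cons]; exact List.mem_cons_of_mem _ hx
      · intro s t hst
        rw [Walk.edges_cons, List.mem_cons] at hst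
        rcases hst with hst | hst
        · exact Or.inl (hst.trans heq.symm)
        · exact Or.inr (Or.inr ⟨p.fst_mem_support_of_mem_edges hst, p.snd_mem_support_of_mem_edges hst⟩)
    · rw [Walk.edges_cons, List.mem_cons] at he
      obtain ⟨A, B, hd, hc, hb, hB, hst⟩ := ih hp.1 (he.resolve_left heq)
      refine ⟨Insert.insert a A, B, ?_, Or.inl rfl, hb, ?_, ?_⟩
      · rw [Set.disjoint_insert_left]; exact ⟨fun h => hp.2 (hB _ h), hd⟩
      · intro x hx; rw [Walk.support_cons]; exact List.mem_cons_of_mem _ (hB x hx)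
      · intro s t hs
        rw [Walk.edges_cons, List.mem_cons] at hs
        rcases hs with hs | hs
        · rw [Sym2.eq_iff] at hs
          rcases hs with ⟨rfl, rfl⟩ | ⟨rfl, rfl⟩
          · exact Or.inr (Or.inl ⟨Or.inl rfl, Or.inr hc⟩)
          · exact Or.inr (Or.inl ⟨Or.inr hc, Or.inl rfl⟩)
        · rcases hst s t hs with h | h | h
          · exact Or.inl h
          · exact Or.inr (Or.inl ⟨Or.inr h.1, Or.inr h.2⟩)
          · exact Or.inr (Or.inr h)

theorem SubV.exists_lab {G : SimpleGraph V} {H : SimpleGraph W} {S : Set (Sym2 W)} {f : W → V}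
    {p : ∀ ⦃u v : W⦄, H.Adj u v → G.Walk (f u) (f v)} (h : SubV S f p) [Nonempty W] :
    ∃ lab : V → Sym2 W, (∀ t, t ∉ Set.range f → ∀ u v (hu : H.Adj u v), t ∈ (p hu).support → lab t = s(u, v)) := by
  classical
  obtain ⟨w0⟩ := ‹Nonempty W›
  refine ⟨fun t => if ht : ∃ u v, ∃ hu : H.Adj u v, t ∈ (p hu).support then
    s(ht.choose, ht.choose_spec.choose) else s(w0, w0), ?_⟩
  intro t ht u v hu htu
  have hex : ∃ u v, ∃ hu : H.Adj u v, t ∈ (p hu).support := ⟨u, v, hu, htu⟩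
  simp only [dif_pos hex]
  obtain ⟨hu', htu'⟩ := hex.choose_spec.choose_spec
  by_contra hne
  exact ht (h.dis hu' hu hne t htu' htu)

theorem SubV.edges_eq {G : SimpleGraph V} {H : SimpleGraph W} {S : Set (Sym2 W)} {f : W → V}
    {p : ∀ ⦃u v : W⦄, H.Adj u v → G.Walk (f u) (f v)} (h : SubV S f p) {u v u' v' : W}
    (hu : H.Adj u v) (hu' : H.Adj u' v') (e : s(u, v) = s(u', v')) (x : Sym2 V) (hx : x ∈ (p hu).edges) :
    x ∈ (p hu').edges := by
  rw [Sym2.eq_iff] at e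
  rcases e with ⟨rfl, rfl⟩ | ⟨rfl, rfl⟩
  · exact hx
  · rw [h.symm hu, Walk.edges_reverse, List.mem_reverse]; exact hx

theorem SubV.deg {G : SimpleGraph V} {H : SimpleGraph W} {S : Set (Sym2 W)} {f : W → V}
    {p : ∀ ⦃u v : W⦄, H.Adj u v → G.Walk (f u) (f v)} (h : SubV S f p) {t : V} (ht : t ∉ Set.range f) :
    ∃ y z, ∀ s, G.Adj t s → s = y ∨ s = z := by
  by_cases hc : ∃ s, G.Adj t s
  · obtain ⟨s, hs⟩ := hc
    obtain ⟨u, v, hu, he⟩ := h.edge s(t, s) hs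
    obtain ⟨y, z, hyz⟩ := (path_edges_deg (p hu) (h.path hu)).2 t
    refine ⟨y, z, fun s' hs' => hyz s' ?_⟩
    obtain ⟨u', v', hu', he'⟩ := h.edge s(t, s') hs'
    by_cases e : s(u', v') = s(u, v)
    · exact h.edges_eq hu' hu e _ he'
    · exact absurd (h.dis hu' hu e t ((p hu').fst_mem_support_of_mem_edges he')
        ((p hu).fst_mem_support_of_mem_edges he)) ht
  · push Not at hc
    exact ⟨t, t, fun s hs => absurd hs (hc s)⟩

/-- (E1) -/
theorem SubV.planar_delete [Finite V] {G : SimpleGraph V} {H : SimpleGraph W} {S : Set (Sym2 W)} {f : W → V}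
    {p : ∀ ⦃u v : W⦄, H.Adj u v → G.Walk (f u) (f v)} (h : SubV S f p) {u v : W} (hu : H.Adj u v)
    {x y : V} (hxy : s(x, y) ∈ (p hu).edges) (hpl : Planar (H.deleteEdges {s(u, v)})) :
    Planar (G.deleteEdges {s(x, y)}) := by
  classical
  have : Nonempty W := ⟨u⟩
  obtain ⟨lab, hlab⟩ := h.exists_lab
  obtain ⟨A, B, hAB, huA, hvB, -, hst⟩ := path_split (p hu) (h.path hu) hxy
  have hnot : ∀ z, z ∈ A → z ∉ B := fun z h1 h2 => hAB.le_bot ⟨h1, h2⟩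
  -- every edge of X
  have hE : ∀ s t, (G.deleteEdges {s(x, y)}).Adj s t → ∃ u' v', ∃ hu' : H.Adj u' v',
      s ∈ (p hu').support ∧ t ∈ (p hu').support ∧
      (s(u', v') = s(u, v) → (s ∈ A ∧ t ∈ A) ∨ (s ∈ B ∧ t ∈ B)) := by
    intro s t hadj
    rw [deleteEdges_adj] at hadj
    obtain ⟨u', v', hu', he⟩ := h.edge s(s, t) hadj.1
    refine ⟨u', v', hu', (p hu').fst_mem_support_of_mem_edges he, (p hu').snd_mem_support_of_mem_edges he, ?_⟩
    intro e
    rcases hst s t (h.edges_eq hu' hu e _ he) with h1 | h1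
    · exact absurd h1 hadj.2
    · exact h1
  have hfA : ∀ c, f c ∈ A → c = u ∨ c = v → c = u := by
    rintro c hc (rfl | rfl)
    · rfl
    · exact absurd hvB (hnot _ hc)
  have hfB : ∀ c, f c ∈ B → c = u ∨ c = v → c = v := by
    rintro c hc (rfl | rfl)
    · exact absurd hc (hnot _ huA)
    · rfl
  have hmem : ∀ c u' v', s(u', v') = s(u, v) → c = u' ∨ c = v' → c = u ∨ c = v := by
    intro c u' v' e hc
    rw [← Sym2.mem_iff] at hc ⊢
    rw [← e]; exact hc
  refine Lab.planar (Y := H.deleteEdges {s(u, v)}) (f := f) 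
    (lab := fun t => if lab t = s(u, v) then (if t ∈ A then s(u, u) else s(v, v)) else lab t)
    ⟨h.inj, ?_, ?_, ?_, ?_, ?_⟩ hpl
  · intro s t hs ht hadj
    obtain ⟨u', v', hu', h1, h2, h3⟩ := hE s t hadj
    have e1 := hlab s hs _ _ hu' h1
    have e2 := hlab t ht _ _ hu' h2
    simp only [e1, e2]
    split_ifs with c1 c2 c3 c3
    · rfl
    · rcases h3 c1 with h3 | h3
      · exact absurd h3.2 c3
      · exact absurd h3.1 (hnot _ c2)
    · rcases h3 c1 with h3 | h3
      · exact absurd h3.1 c2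
      · exact absurd h3.2 (hnot _ c3)
    · rfl
    · rfl
  · intro t c ht hadj
    obtain ⟨u', v', hu', h1, h2, h3⟩ := hE t (f c) hadj
    have e1 := hlab t ht _ _ hu' h1
    simp only [e1]
    have hc := h.fr hu' c h2
    split_ifs with c1 c2
    · rcases h3 c1 with h3 | h3
      · rw [hfA c h3.2 (hmem _ _ _ c1 hc)]; simp
      · exact absurd h3.1 (hnot _ c2)
    · rcases h3 c1 with h3 | h3
      · exact absurd h3.1 c2
      · rw [hfB c h3.2 (hmem _ _ _ c1 hc)]; simp
    · rw [Sym2.mem_iff]; exact hc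
  · intro a b hadj
    have hab : a ≠ b := fun e => hadj.ne (by rw [e])
    obtain ⟨u', v', hu', h1, h2, h3⟩ := hE (f a) (f b) hadj
    have ha := h.fr hu' a h1
    have hb := h.fr hu' b h2
    have e : s(u', v') = s(a, b) := by
      rw [← Sym2.mem_iff] at ha hb
      exact (Sym2.mem_and_mem_iff hab).1 ⟨ha, hb⟩
    rw [deleteEdges_adj]
    refine ⟨?_, ?_⟩
    · rw [← mem_edgeSet, ← e]; exact hu'
    · rw [Set.mem_singleton_iff]
      intro e'
      have e2 := e.trans e'
      rcases h3 e2 with h3 | h3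
      · exact hab ((hfA a h3.1 (hmem _ _ _ e2 ha)).trans (hfA b h3.2 (hmem _ _ _ e2 hb)).symm)
      · exact hab ((hfB a h3.1 (hmem _ _ _ e2 ha)).trans (hfB b h3.2 (hmem _ _ _ e2 hb)).symm)
  · rintro t ht ⟨s, hadj⟩
    obtain ⟨u', v', hu', h1, h2, h3⟩ := hE t s hadj
    have e1 := hlab t ht _ _ hu' h1
    simp only [e1]
    split_ifs with c1 c2
    · left; simp
    · left; simp
    · right
      rw [mem_edgeSet, deleteEdges_adj]; exact ⟨hu', c1⟩
  · intro t ht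
    obtain ⟨y, z, hyz⟩ := h.deg ht
    exact ⟨y, z, fun s hs => hyz s (by rw [deleteEdges_adj] at hs; exact hs.1)⟩

/-- (E2) -/
theorem SubV.planar_contract [Finite V] {G : SimpleGraph V} {H : SimpleGraph W} {S : Set (Sym2 W)} {f : W → V}
    {p : ∀ ⦃u v : W⦄, H.Adj u v → G.Walk (f u) (f v)} (h : SubV S f p) {u v : W} (hu : H.Adj u v)
    (hpl : Planar (contractEdge H u v)) :
    Planar (contractEdge G (f u) (f v)) := by
  classical
  have : Nonempty W := ⟨u⟩
  obtain ⟨lab, hlab⟩ := h.exists_lab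
  have hE : ∀ s t, G.Adj s t → ∃ u' v', ∃ hu' : H.Adj u' v',
      s ∈ (p hu').support ∧ t ∈ (p hu').support := by
    intro s t hadj
    obtain ⟨u', v', hu', he⟩ := h.edge s(s, t) hadj
    exact ⟨u', v', hu', (p hu').fst_mem_support_of_mem_edges he, (p hu').snd_mem_support_of_mem_edges he⟩
  have hmem : ∀ t c, t ∉ Set.range f → G.Adj t (f c) → c ∈ lab t := by
    intro t c ht hadj
    obtain ⟨u', v', hu', h1, h2⟩ := hE t (f c) hadj
    rw [hlab t ht _ _ hu' h1, Sym2.mem_iff]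
    exact h.fr hu' c h2
  have hff : ∀ a b, G.Adj (f a) (f b) → H.Adj a b := by
    intro a b hadj
    have hab : a ≠ b := fun e => hadj.ne (by rw [e])
    obtain ⟨u', v', hu', h1, h2⟩ := hE (f a) (f b) hadj
    have ha := h.fr hu' a h1
    have hb := h.fr hu' b h2
    rw [← Sym2.mem_iff] at ha hb
    have e := (Sym2.mem_and_mem_iff hab).1 ⟨ha, hb⟩
    rw [← mem_edgeSet, ← e]; exact hu'
  let φ : W → W := fun w => if w = v then u else w
  have hne : ∀ t, t ∉ Set.range f → ∀ c, t ≠ f c := fun t ht c e => ht ⟨c, e.symm⟩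
  refine Lab.planar (Y := contractEdge H u v) (f := f) (lab := fun t => (lab t).map φ)
    ⟨h.inj, ?_, ?_, ?_, ?_, ?_⟩ hpl
  · intro s t hs ht hadj
    rcases (contract_adj.1 hadj).2.2.2 with h1 | ⟨e, h1⟩ | ⟨e, h1⟩
    · obtain ⟨u', v', hu', h2, h3⟩ := hE s t h1
      simp only [hlab s hs _ _ hu' h2, hlab t ht _ _ hu' h3]
    · exact absurd e (hne s hs u)
    · exact absurd e (hne t ht u)
  · intro t c ht hadj
    obtain ⟨n1, n2, n3, h1⟩ := contract_adj.1 hadj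
    rw [Sym2.mem_map]
    rcases h1 with h1 | ⟨e, h1⟩ | ⟨e, h1⟩
    · refine ⟨c, hmem t c ht h1, ?_⟩
      simp only [φ]; rw [if_neg]; intro e; exact n3 (by rw [e])
    · exact absurd e (hne t ht u)
    · refine ⟨v, hmem t v ht h1.symm, ?_⟩
      simp only [φ, if_true]; exact (h.inj e).symm
  · intro a b hadj
    have hab : a ≠ b := fun e => hadj.ne (by rw [e])
    obtain ⟨n1, n2, n3, h1⟩ := contract_adj.1 hadj
    refine contract_adj.2 ⟨hab, fun e => n2 (by rw [e]), fun e => n3 (by rw [e]), ?_⟩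
    rcases h1 with h1 | ⟨e, h1⟩ | ⟨e, h1⟩
    · exact Or.inl (hff _ _ h1)
    · exact Or.inr (Or.inl ⟨h.inj e, hff _ _ h1⟩)
    · exact Or.inr (Or.inr ⟨h.inj e, hff _ _ h1⟩)
  · rintro t ht ⟨s, hadj⟩
    have : ∃ s', G.Adj t s' := by
      rcases (contract_adj.1 hadj).2.2.2 with h1 | ⟨e, h1⟩ | ⟨e, h1⟩
      · exact ⟨_, h1⟩
      · exact absurd e (hne t ht u)
      · exact ⟨_, h1.symm⟩
    obtain ⟨s', hs'⟩ := this
    obtain ⟨u', v', hu', h1, h2⟩ := hE t s' hs'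
    simp only [hlab t ht _ _ hu' h1, Sym2.map_mk]
    by_cases e : φ u' = φ v'
    · left; exact e
    · right
      rw [mem_edgeSet]
      refine contract_adj.2 ⟨e, ?_, ?_, ?_⟩
      · simp only [φ]; split_ifs with c
        · exact hu.ne
        · exact c
      · simp only [φ]; split_ifs with c
        · exact hu.ne
        · exact c
      · simp only [φ] at e ⊢
        by_cases c1 : u' = v
        · by_cases c2 : v' = v
          · simp [c1, c2] at e
          · rw [if_pos c1, if_neg c2]; right; left; exact ⟨rfl, c1 ▸ hu'⟩
        · by_cases c2 : v' = v
          · rw [if_neg c1, if_pos c2]; right; right; exact ⟨rfl, c2 ▸ hu'.symm⟩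
          · rw [if_neg c1, if_neg c2]; left; exact hu'
  · intro t ht
    obtain ⟨a, b, hab⟩ := h.deg ht
    refine ⟨if a = f v then f u else a, if b = f v then f u else b, ?_⟩
    intro r hr
    obtain ⟨n1, n2, n3, h1⟩ := contract_adj.1 hr
    rcases h1 with h1 | ⟨e, h1⟩ | ⟨e, h1⟩
    · rcases hab r h1 with e | e
      · left; rw [if_neg (fun e' => n3 (e.trans e'))]; exact e
      · right; rw [if_neg (fun e' => n3 (e.trans e'))]; exact e
    · exact absurd e (hne t ht u)
    · rcases hab (f v) h1.symm with e' | e'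
      · left; rw [if_pos e'.symm]; exact e
      · right; rw [if_pos e'.symm]; exact e

theorem walk_len_one {G : SimpleGraph V} {a b : V} (q : G.Walk a b) (hlen : q.length = 1)
    {e : Sym2 V} (he : e ∈ q.edges) : e = s(a, b) := by
  cases q with
  | nil => simp at hlen
  | cons h' q' =>
    cases q' with
    | nil => simpa using he
    | cons h'' q'' => simp at hlen

theorem almostPlanar_of_sub [Finite V] {G : SimpleGraph V} (hnp : ¬ Planar G) {H : SimpleGraph W}
    (hH : AlmostPlanar H) (hs : IsSubdivisionWithin (G.induce (core G)) H (Dset H)) : AlmostPlanar G := by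
  refine ⟨hnp, ?_⟩
  intro x y hxy
  obtain ⟨f, p, h⟩ := hs.subV
  obtain ⟨u, v, hu, he⟩ := h.edge s(x, y) hxy
  by_cases hD : s(u, v) ∈ Dset H
  · exact Or.inl (h.planar_delete hu he hD.2)
  · right
    have hlen := h.len hu hD
    have he' : s(x, y) = s(f u, f v) := by
      exact walk_len_one _ hlen he
    have hnd : ¬ Planar (H.deleteEdges {s(u, v)}) := fun hp => hD ⟨hu, hp⟩
    rw [Sym2.eq_iff] at he'
    rcases he' with ⟨rfl, rfl⟩ | ⟨rfl, rfl⟩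
    · exact h.planar_contract hu ((hH.2 hu).resolve_left hnd)
    · exact h.planar_contract hu.symm ((hH.2 hu.symm).resolve_left (by rwa [Sym2.eq_swap]))

end Labels

open SimpleGraph
set_option linter.unusedVariables false

section Legs

variable {V W : Type*} {G : SimpleGraph V}

/-- A connection from `p` to `b` through the (possibly empty) set `L`. -/
def Leg (G : SimpleGraph V) (p : V) (L : Set V) (b : V) : Prop :=
  (L = ∅ ∧ G.Adj p b) ∨ (Conn G L ∧ (∃ x ∈ L, G.Adj p x) ∧ ∃ y ∈ L, G.Adj y b)

theorem Leg.symm {p b : V} {L : Set V} (h : Leg G p L b) : Leg G b L p := by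
  rcases h with ⟨h, h'⟩ | ⟨h, ⟨x, hx, hpx⟩, ⟨y, hy, hyb⟩⟩
  · exact Or.inl ⟨h, h'.symm⟩
  · exact Or.inr ⟨h, ⟨y, hy, hyb.symm⟩, ⟨x, hx, hpx.symm⟩⟩

/-- shortening of legs -/
theorem Leg.shorten [Finite V] : ∀ (n : ℕ) {p b : V} {L : Set V}, L.ncard = n → Leg G p L b → L.Nonempty →
    (∀ z ∈ L, ∀ t, G.Adj z t → t ∈ L ∨ t = p ∨ t = b) →
    (∀ z ∈ L, ∀ y w, ∃ t, G.Adj z t ∧ t ≠ y ∧ t ≠ w) → ∃ L', L' ⊂ L ∧ Leg G p L' b := by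
  intro n
  induction n with
  | zero =>
    intro p b L hn _ hne
    exact absurd ((Set.ncard_eq_zero).1 hn) hne.ne_empty
  | succ n ih =>
    intro p b L hn hleg hne hN hdeg
    rcases hleg with ⟨h, h'⟩ | ⟨hL, ⟨x, hx, hpx⟩, ⟨y, hy, hyb⟩⟩
    · exact absurd h hne.ne_empty
    by_cases h1 : ∃ x ∈ L, G.Adj p x ∧ G.Adj x b
    · obtain ⟨x, hx, h1, h2⟩ := h1
      refine ⟨{x}, ?_, Or.inr ⟨conn_singleton x, ⟨x, rfl, h1⟩, ⟨x, rfl, h2⟩⟩⟩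
      refine Set.ssubset_iff_subset_ne.2 ⟨by simpa using hx, ?_⟩
      rintro rfl
      obtain ⟨t, ht, htp, htb⟩ := hdeg x rfl p b
      rcases hN x rfl t ht with h | h | h
      · exact ht.ne h.symm
      · exact htp h
      · exact htb h
    · push Not at h1
      have hxy : x ≠ y := by rintro rfl; exact h1 x hx hpx hyb
      obtain ⟨z, hz, hzy, hLz, t, ht, htz, hzt⟩ := hL.exists_leaf (conn_singleton y) (by simpa using hy)
        (by rintro h; rw [← h] at hx; exact hxy hx)
      have hzL : L \ {z} ⊂ L := Set.ssubset_iff_subset_ne.2 ⟨Set.sdiff_subset, fun h => by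
        rw [← h] at hz; exact hz.2 rfl⟩
      have hyz : y ∈ L \ {z} := ⟨hy, fun h => hzy h.symm⟩
      by_cases h2 : ∃ x' ∈ L \ {z}, G.Adj p x'
      · obtain ⟨x', hx', hpx'⟩ := h2
        exact ⟨L \ {z}, hzL, Or.inr ⟨hLz, ⟨x', hx', hpx'⟩, ⟨y, hyz, hyb⟩⟩⟩
      · push Not at h2
        have hxz : x = z := by
          by_contra hc
          exact h2 x ⟨hx, hc⟩ hpx
        subst hxz
        have hcard : (L \ {x}).ncard = n := by
          rw [Set.ncard_sdiff_singleton_of_mem hx, hn]; rfl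
        obtain ⟨L', hL', hleg'⟩ := ih (p := x) (b := b) hcard
          (Or.inr ⟨hLz, ⟨t, ⟨ht, htz⟩, hzt⟩, ⟨y, hyz, hyb⟩⟩) ⟨y, hyz⟩ (by
            intro w hw s hs
            rcases hN w hw.1 s hs with h | h | h
            · by_cases hsx : s = x
              · exact Or.inr (Or.inl hsx)
              · exact Or.inl ⟨h, hsx⟩
            · subst h; exact absurd hs.symm (h2 w hw)
            · exact Or.inr (Or.inr h)) (fun w hw => hdeg w hw.1)
        have hxL' : x ∉ L' := fun h => (hL'.1 h).2 rfl
        refine ⟨insert x L', ?_, ?_⟩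
        · refine ⟨Set.insert_subset hx (hL'.1.trans Set.sdiff_subset), ?_⟩
          intro h
          apply hL'.2
          rintro w ⟨hw, hwx⟩
          exact (h hw).resolve_left hwx
        · rcases hleg' with ⟨rfl, h⟩ | ⟨h3, ⟨a, ha, hxa⟩, ⟨c, hc, hcb⟩⟩
          · exact absurd h (h1 x hx hpx)
          · exact Or.inr ⟨h3.insert ha hxa, ⟨x, Or.inl rfl, hpx⟩, ⟨c, Or.inr hc, hcb⟩⟩

/-- every model of `K` covers the core -/
def Crit (K : SimpleGraph W) (G : SimpleGraph V) : Prop :=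
  ∀ B, Model K G B → ∀ x ∈ core G, ∃ i, x ∈ B i

theorem SixFree.c5 (hG : SixFree G) : Crit K5 G := by
  intro B hB x hx
  by_contra hc; push Not at hc
  exact hG.crit5 hB hx hc

theorem SixFree.c33 (hG : SixFree G) : Crit K33 G := by
  intro B hB x hx
  by_contra hc; push Not at hc
  exact hG.crit33 hB hx hc

theorem SixFree.planar_of_isolated (hG : SixFree G) {G' : SimpleGraph V} (hle : G' ≤ G) {x : V}
    (hx : x ∈ core G) (hx' : ∀ y, ¬ G'.Adj x y) : Planar G' := by
  by_contra hc
  rcases not_planar_iff.1 hc with h | h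
  · obtain ⟨B, hB⟩ := isMinor_iff.1 h
    refine hG.crit5 (hB.mono hle) hx fun i => ?_
    obtain ⟨j, _, _, hj, _⟩ := K5_deg i
    exact hB.not_mem_of_isolated hx' hj
  · obtain ⟨B, hB⟩ := isMinor_iff.1 h
    refine hG.crit33 (hB.mono hle) hx fun i => ?_
    obtain ⟨j, _, _, hj, _⟩ := K33_deg i
    exact hB.not_mem_of_isolated hx' hj

theorem not_planar_suppress {x y z : V} (h : ¬ Planar G) (hN : ∀ t, G.Adj x t → t = y ∨ t = z)
    (hyx : G.Adj x y) : ¬ Planar (contractEdge G y x) := by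
  rcases not_planar_iff.1 h with h | h
  · obtain ⟨B, hB⟩ := isMinor_iff.1 h
    exact not_planar_iff.2 (Or.inl (hB.suppress hyx.ne hN hyx K5_deg).isMinor)
  · obtain ⟨B, hB⟩ := isMinor_iff.1 h
    exact not_planar_iff.2 (Or.inr (hB.suppress hyx.ne hN hyx K33_deg).isMinor)

theorem SixFree.planar_of_deg1 (hG : SixFree G) {G' : SimpleGraph V} (hle : G' ≤ G) {x y : V}
    (hx : x ∈ core G) (hx' : ∀ s, G'.Adj x s → s = y) : Planar G' := by
  by_cases hxy : G'.Adj x y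
  · by_contra hc
    have h1 := not_planar_suppress hc (z := y) (fun t ht => Or.inl (hx' t ht)) hxy
    refine h1 (hG.planar_of_isolated ?_ hx ?_)
    · intro a b hab
      obtain ⟨hne, ha, hb, h | ⟨rfl, h⟩ | ⟨rfl, h⟩⟩ := contract_adj.1 hab
      · exact hle h
      · exact absurd (hx' _ h).symm hne
      · exact absurd (hx' _ h) hne
    · intro s hs
      exact (contract_adj.1 hs).2.1 rfl
  · refine hG.planar_of_isolated hle hx ?_
    intro s hs
    exact hxy (hx' s hs ▸ hs)

theorem isMinor_contract {K : SimpleGraph W} {u w : V} (huw : G.Adj u w) (hK : ∀ i : W, ∃ j, K.Adj i j)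
    (h : IsMinor K (contractEdge G u w)) : IsMinor K G := by
  obtain ⟨B, hB⟩ := isMinor_iff.1 h
  refine (hB.of_contract huw fun i => ?_).isMinor
  obtain ⟨j, hj⟩ := hK i
  exact hB.not_mem_of_isolated (fun y hy => (contract_adj.1 hy).2.1 rfl) hj

theorem not_planar_contract {u w : V} (huw : G.Adj u w) (h : ¬ Planar (contractEdge G u w)) : ¬ Planar G := by
  rcases not_planar_iff.1 h with h | h
  · exact not_planar_iff.2 (Or.inl (isMinor_contract huw (fun i => by obtain ⟨j, _, _, hj, _⟩ := K5_deg i; exact ⟨j, hj⟩) h))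
  · exact not_planar_iff.2 (Or.inr (isMinor_contract huw (fun i => by obtain ⟨j, _, _, hj, _⟩ := K33_deg i; exact ⟨j, hj⟩) h))

theorem SixFree.minor {W : Type*} {H : SimpleGraph W} (hG : SixFree G) (h : IsMinor H G) : SixFree H :=
  ⟨fun h' => hG.1 (h'.trans' h), fun h' => hG.2.1 (h'.trans' h), fun h' => hG.2.2.1 (h'.trans' h),
   fun h' => hG.2.2.2.1 (h'.trans' h), fun h' => hG.2.2.2.2.1 (h'.trans' h), fun h' => hG.2.2.2.2.2 (h'.trans' h)⟩

theorem SixFree.contract {u w : V} (hG : SixFree G) (huw : G.Adj u w) : SixFree (contractEdge G u w) := by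
  have key : ∀ {W : Type} (K : SimpleGraph W), (∀ i : W, ∃ j, K.Adj i j) →
      ¬ IsMinor K G → ¬ IsMinor K (contractEdge G u w) := fun K hK h h' => h (isMinor_contract huw hK h')
  refine ⟨key _ ?_ hG.1, key _ ?_ hG.2.1, key _ ?_ hG.2.2.1, key _ ?_ hG.2.2.2.1, key _ ?_ hG.2.2.2.2.1, key _ ?_ hG.2.2.2.2.2⟩
  · rintro (_ | i)
    · exact ⟨some 0, by simp [K5plus]⟩
    · exact ⟨some (i + 1), by revert i; simp [K5plus]⟩
  · rintro (_ | i | i)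
    · exact ⟨some (.inl 0), by simp [K33plus]⟩
    · exact ⟨some (.inr 0), by simp [K33plus]⟩
    · exact ⟨some (.inl 0), by simp [K33plus]⟩
  · rintro (i | i)
    · exact ⟨if i = 3 then .inl 4 else .inl 3, by fin_cases i <;> simp [K5h]⟩
    · exact ⟨.inl 0, by fin_cases i <;> simp [K5h]⟩
  · rintro ((i | i) | i)
    · exact ⟨.inl (.inr 2), by simp [K33h]⟩
    · exact ⟨.inl (.inl 1), by simp [K33h]⟩
    · exact ⟨.inl (.inl 0), by fin_cases i <;> simp [K33h]⟩
  · rintro (i | i)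
    · exact ⟨.inl (i + 1), by simp [K5oplus]⟩
    · exact ⟨.inr (i + 1), by simp [K5oplus]⟩
  · rintro ((i | i) | i)
    · exact ⟨.inl (.inr 2), by simp [K33oplus]⟩
    · exact ⟨.inl (.inl 1), by simp [K33oplus]⟩
    · exact ⟨.inr (i + 1), by simp [K33oplus]⟩

end Legs

open SimpleGraph
set_option linter.unusedVariables false

section Sep

variable {V Z : Type*} {G : SimpleGraph V}

theorem sep_false [Finite V] {K : SimpleGraph Z} (hcrit : Crit K G) {B : Z → Set V} (hB : Model K G B)
    {p q : V} {C : Set V} (hC : Conn G C) (hCc : C ⊆ core G) (hpC : p ∉ C) (hqC : q ∉ C)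
    (hcl : ∀ a ∈ C, ∀ b, G.Adj a b → b ∈ C ∨ b = p ∨ b = q)
    (hdeg : ∀ z ∈ C, ∀ y w, ∃ t, G.Adj z t ∧ t ≠ y ∧ t ≠ w)
    (hBs : ∀ i, p ∉ B i → q ∉ B i → ∀ x ∈ B i, x ∉ C) : False := by
  classical
  obtain ⟨L, hLC, hL1, hL2⟩ : ∃ L : Set V, L ⊂ C ∧ (L.Nonempty → Leg G p L q) ∧
      ((∃ a ∈ C, G.Adj a p) → (∃ a ∈ C, G.Adj a q) → Leg G p L q) := by
    by_cases h : (∃ a ∈ C, G.Adj a p) ∧ (∃ a ∈ C, G.Adj a q)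
    · obtain ⟨⟨a, ha, hap⟩, h2⟩ := h
      obtain ⟨L, h3, h4⟩ := Leg.shorten _ rfl (Or.inr ⟨hC, ⟨a, ha, hap.symm⟩, h2⟩) hC.nonempty hcl hdeg
      exact ⟨L, h3, fun _ => h4, fun _ _ => h4⟩
    · refine ⟨∅, Set.empty_ssubset.2 hC.nonempty, fun h => absurd h Set.not_nonempty_empty, fun h1 h2 => absurd ⟨h1, h2⟩ h⟩
  obtain ⟨c, hcC, hcL⟩ := Set.exists_of_ssubset hLC
  have hnL : ∀ x ∈ L, x ∈ C := fun x hx => hLC.1 hx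
  have key : Model K G (fun i => {x | (x ∈ B i ∧ x ∉ C) ∨ (x ∈ L ∧ p ∈ B i)}) := by
    refine ⟨?_, ?_, ?_⟩
    · intro i
      by_cases hp : p ∈ B i
      · refine conn_of_root p (Or.inl ⟨hp, hpC⟩) ?_
        rintro A hpA ⟨b, hb, hbA⟩
        have legc : ∀ b ∈ L, b ∉ A → ∃ a ∈ {x | (x ∈ B i ∧ x ∉ C) ∨ (x ∈ L ∧ p ∈ B i)}, a ∈ A ∧
            ∃ b ∈ {x | (x ∈ B i ∧ x ∉ C) ∨ (x ∈ L ∧ p ∈ B i)}, b ∉ A ∧ G.Adj a b := by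
          intro b hbL hbA
          rcases hL1 ⟨b, hbL⟩ with ⟨h, _⟩ | ⟨h1, ⟨x, hx, hpx⟩, _⟩
          · rw [h] at hbL; exact absurd hbL (Set.notMem_empty _)
          · by_cases hxA : x ∈ A
            · obtain ⟨a, ha, haA, b, hb, hbA, hab⟩ := h1.cut A hx hxA hbL hbA
              exact ⟨a, Or.inr ⟨ha, hp⟩, haA, b, Or.inr ⟨hb, hp⟩, hbA, hab⟩
            · exact ⟨p, Or.inl ⟨hp, hpC⟩, hpA, x, Or.inr ⟨hx, hp⟩, hxA, hpx⟩
        rcases hb with ⟨hbB, hbC⟩ | ⟨hbL, _⟩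
        · obtain ⟨a, ha, haA, b', hb', hb'A, hab⟩ := (hB.conn i).cut ((A \ C) ∪ C) hp (Or.inl ⟨hpA, hpC⟩) hbB
            (by rintro (h | h); exacts [hbA h.1, hbC h])
          have hb'C : b' ∉ C := fun h => hb'A (Or.inr h)
          have hb'A' : b' ∉ A := fun h => hb'A (Or.inl ⟨h, hb'C⟩)
          rcases haA with ⟨haA, haC⟩ | haC
          · exact ⟨a, Or.inl ⟨ha, haC⟩, haA, b', Or.inl ⟨hb', hb'C⟩, hb'A', hab⟩
          · rcases hcl a haC b' hab with h | h | h
            · exact absurd h hb'C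
            · subst h; exact absurd hpA hb'A'
            · subst h
              by_cases hpc : ∃ a ∈ C, G.Adj a p
              · rcases hL2 hpc ⟨a, haC, hab⟩ with ⟨h, h'⟩ | ⟨h1, _, ⟨y, hy, hyb⟩⟩
                · exact ⟨p, Or.inl ⟨hp, hpC⟩, hpA, b', Or.inl ⟨hb', hb'C⟩, hb'A', h'⟩
                · by_cases hyA : y ∈ A
                  · exact ⟨y, Or.inr ⟨hy, hp⟩, hyA, b', Or.inl ⟨hb', hb'C⟩, hb'A', hyb⟩
                  · exact legc y hy hyA
              · push Not at hpc
                obtain ⟨a', ha', ⟨ha'A, ha'C⟩, b'', hb'', hb''A, hab'⟩ := (hB.conn i).cut (A \ C) hp ⟨hpA, hpC⟩ hb' (fun h => hb'A' h.1)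
                by_cases h3 : b'' ∈ C
                · rcases hcl b'' h3 a' hab'.symm with h | h | h
                  · exact absurd h ha'C
                  · subst h; exact absurd hab'.symm (hpc b'' h3)
                  · subst h; exact absurd ha'A hb'A'
                · exact ⟨a', Or.inl ⟨ha', ha'C⟩, ha'A, b'', Or.inl ⟨hb'', h3⟩, fun h => hb''A ⟨h, h3⟩, hab'⟩
        · exact legc b hbL hbA
      · by_cases hq : q ∈ B i
        · refine conn_of_root q (Or.inl ⟨hq, hqC⟩) ?_
          rintro A hqA ⟨b, ⟨hbB, hbC⟩ | ⟨_, hb⟩, hbA⟩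
          · obtain ⟨a, ha, haA, b', hb', hb'A, hab⟩ := (hB.conn i).cut ((A \ C) ∪ C) hq (Or.inl ⟨hqA, hqC⟩) hbB
              (by rintro (h | h); exacts [hbA h.1, hbC h])
            have hb'C : b' ∉ C := fun h => hb'A (Or.inr h)
            have hb'A' : b' ∉ A := fun h => hb'A (Or.inl ⟨h, hb'C⟩)
            rcases haA with ⟨haA, haC⟩ | haC
            · exact ⟨a, Or.inl ⟨ha, haC⟩, haA, b', Or.inl ⟨hb', hb'C⟩, hb'A', hab⟩
            · rcases hcl a haC b' hab with h | h | h
              · exact absurd h hb'C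
              · subst h; exact absurd hb' hp
              · subst h; exact absurd hqA hb'A'
          · exact absurd hb hp
        · convert hB.conn i using 1
          ext x
          constructor
          · rintro (⟨h, _⟩ | ⟨_, h⟩)
            exacts [h, absurd h hp]
          · exact fun h => Or.inl ⟨h, hBs i hp hq x h⟩
    · intro i j hij
      rw [Set.disjoint_left]
      rintro x (⟨h1, h2⟩ | ⟨h1, h2⟩) (⟨h3, h4⟩ | ⟨h3, h4⟩)
      · exact hij (hB.eq_of_mem h1 h3)
      · exact h2 (hnL x h3)
      · exact h4 (hnL x h1)
      · exact hij (hB.eq_of_mem h2 h4)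
    · have att : ∀ i a, a ∈ B i → a ∈ C → p ∈ B i → q ∉ B i → ∃ a ∈ C, G.Adj a p := by
        intro i a ha haC hp hq
        obtain ⟨a', ha', ha'C, b, hb, hbC, hab⟩ := (hB.conn i).cut C ha haC hp hpC
        rcases hcl a' ha'C b hab with h | h | h
        · exact absurd h hbC
        · exact ⟨a', ha'C, h ▸ hab⟩
        · exact absurd (h ▸ hb) hq
      have att' : ∀ i a, a ∈ B i → a ∈ C → q ∈ B i → p ∉ B i → ∃ a ∈ C, G.Adj a q := by
        intro i a ha haC hp hq
        obtain ⟨a', ha', ha'C, b, hb, hbC, hab⟩ := (hB.conn i).cut C ha haC hp hqC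
        rcases hcl a' ha'C b hab with h | h | h
        · exact absurd h hbC
        · exact absurd (h ▸ hb) hq
        · exact ⟨a', ha'C, h ▸ hab⟩
      have fin : ∀ i j, p ∈ B i → q ∈ B j → (∃ a ∈ C, G.Adj a p) → (∃ a ∈ C, G.Adj a q) →
          Tch G {x | (x ∈ B i ∧ x ∉ C) ∨ (x ∈ L ∧ p ∈ B i)} {x | (x ∈ B j ∧ x ∉ C) ∨ (x ∈ L ∧ p ∈ B j)} := by
        intro i j hp hq h1 h2
        rcases hL2 h1 h2 with ⟨_, h⟩ | ⟨_, _, y, hy, hyq⟩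
        · exact ⟨p, Or.inl ⟨hp, hpC⟩, q, Or.inl ⟨hq, hqC⟩, h⟩
        · exact ⟨y, Or.inr ⟨hy, hp⟩, q, Or.inl ⟨hq, hqC⟩, hyq⟩
      have half : ∀ i j a b, i ≠ j → a ∈ B i → b ∈ B j → a ∈ C → G.Adj a b → 
          Tch G {x | (x ∈ B i ∧ x ∉ C) ∨ (x ∈ L ∧ p ∈ B i)} {x | (x ∈ B j ∧ x ∉ C) ∨ (x ∈ L ∧ p ∈ B j)} := by
        intro i j a b hij ha hb haC hab
        have hi : p ∈ B i ∨ q ∈ B i := by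
          by_contra h; push Not at h; exact hBs i h.1 h.2 a ha haC
        have hj : p ∈ B j ∨ q ∈ B j := by
          rcases hcl a haC b hab with h | h | h
          · by_contra h'; push Not at h'; exact hBs j h'.1 h'.2 b hb h
          · exact Or.inl (h ▸ hb)
          · exact Or.inr (h ▸ hb)
        have hnp : ¬ (p ∈ B i ∧ p ∈ B j) := fun h => hij (hB.eq_of_mem h.1 h.2)
        have hnq : ¬ (q ∈ B i ∧ q ∈ B j) := fun h => hij (hB.eq_of_mem h.1 h.2)
        rcases hi with hi | hi
        · have hqj : q ∈ B j := hj.resolve_left fun h => hnp ⟨hi, h⟩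
          have hqi : q ∉ B i := fun h => hnq ⟨h, hqj⟩
          have hpj : p ∉ B j := fun h => hnp ⟨hi, h⟩
          refine fin i j hi hqj (att i a ha haC hi hqi) ?_
          rcases hcl a haC b hab with h | h | h
          · exact att' j b hb h hqj hpj
          · exact absurd (h ▸ hb) hpj
          · exact ⟨a, haC, h ▸ hab⟩
        · have hpj : p ∈ B j := hj.resolve_right fun h => hnq ⟨hi, h⟩
          have hpi : p ∉ B i := fun h => hnp ⟨h, hpj⟩
          have hqj : q ∉ B j := fun h => hnq ⟨hi, h⟩
          refine (fin j i hpj hi ?_ (att' i a ha haC hi hpi)).symm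
          rcases hcl a haC b hab with h | h | h
          · exact att j b hb h hpj hqj
          · exact ⟨a, haC, h ▸ hab⟩
          · exact absurd (h ▸ hb) hqj
      intro i j hij
      obtain ⟨a, ha, b, hb, hab⟩ := hB.adj hij
      by_cases haC : a ∈ C
      · exact half i j a b hij.ne ha hb haC hab
      · by_cases hbC : b ∈ C
        · exact (half j i b a hij.ne' hb ha hbC hab.symm).symm
        · exact ⟨a, Or.inl ⟨ha, haC⟩, b, Or.inl ⟨hb, hbC⟩, hab⟩
  obtain ⟨i, ⟨_, h⟩ | ⟨h, _⟩⟩ := hcrit _ key c (hCc hcC)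
  · exact h hcC
  · exact hcL h

/-- 3-connectivity for a generic `K` -/
theorem three_conn_aux [Finite V] {K : SimpleGraph Z} (hcrit : Crit K G) {B : Z → Set V} (hB : Model K G B)
    (hK : ∀ i j : Z, ∀ S : Set Z, S ⊆ {i, j} → ∀ T : Set Z, (∃ a, a ∉ S ∧ a ∈ T) → (∃ a, a ∉ S ∧ a ∉ T) →
      ∃ a b, a ∉ S ∧ b ∉ S ∧ a ∈ T ∧ b ∉ T ∧ K.Adj a b)
    (hcore : ∀ x, x ∈ core G)
    (hdeg : ∀ z, ∀ y w, ∃ t, G.Adj z t ∧ t ≠ y ∧ t ≠ w) (p q : V) (s : Set V) (hs : s ⊆ {p, q})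
    (hne : (sᶜ).Nonempty) : Conn G sᶜ := by
  classical
  by_contra hc
  rw [conn_iff] at hc
  push Not at hc
  obtain ⟨A, ⟨a, ha, haA⟩, ⟨b, hb, hbA⟩, hno⟩ := hc hne
  -- closed sets
  have main : ∀ D : Set V, D ⊆ sᶜ → D.Nonempty → (∃ x, x ∉ s ∧ x ∉ D) →
      (∀ x ∈ D, ∀ y, G.Adj x y → y ∈ D ∨ y ∈ s) → (∀ i, (∀ x ∈ s, x ∉ B i) → ∀ x ∈ B i, x ∉ D) → False := by
    intro D hDs hDn ⟨w, hws, hwD⟩ hDc hDB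
    obtain ⟨C, ⟨hCD, hCn, hCc⟩, hmin⟩ := (Set.toFinite {C : Set V | C ⊆ D ∧ C.Nonempty ∧
      (∀ x ∈ C, ∀ y, G.Adj x y → y ∈ C ∨ y ∈ s)}).exists_minimal ⟨D, subset_rfl, hDn, hDc⟩
    have hCs : ∀ x ∈ C, x ∉ s := fun x hx => hDs (hCD hx)
    have hCconn : Conn G C := by
      by_contra hcc
      rw [conn_iff] at hcc
      push Not at hcc
      obtain ⟨A, ⟨a, ha, haA⟩, ⟨b, hb, hbA⟩, hno⟩ := hcc hCn
      have := hmin (y := C ∩ A) ⟨Set.inter_subset_left.trans hCD, ⟨a, ha, haA⟩, ?_⟩ Set.inter_subset_left hb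
      · exact hbA this.2
      · rintro x ⟨hx, hxA⟩ y hxy
        rcases hCc x hx y hxy with h | h
        · by_cases hyA : y ∈ A
          · exact Or.inl ⟨h, hyA⟩
          · exact absurd hxy (hno x hx hxA y h hyA)
        · exact Or.inr h
    have hwC : w ∉ C := fun h => hwD (hCD h)
    refine sep_false hcrit hB (p := if p ∈ s then p else w) (q := if q ∈ s then q else w) hCconn (fun x _ => hcore x) ?_ ?_ ?_
      (fun z _ => hdeg z) ?_
    · split_ifs with h
      · exact fun h' => hCs _ h' h
      · exact hwC
    · split_ifs with h
      · exact fun h' => hCs _ h' h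
      · exact hwC
    · intro x hx y hxy
      rcases hCc x hx y hxy with h | h
      · exact Or.inl h
      · right
        rcases hs h with h' | h'
        · left; rw [← h', if_pos h]
        · right; rw [← (Set.mem_singleton_iff.1 h'), if_pos h]
    · intro i hp hq x hx hxC
      refine hDB i ?_ x hx (hCD hxC)
      intro y hy hyB
      rcases hs hy with h' | h'
      · subst h'; rw [if_pos hy] at hp; exact hp hyB
      · rw [Set.mem_singleton_iff] at h'; subst h'; rw [if_pos hy] at hq; exact hq hyB
  -- branch sets meeting s
  let S : Set Z := {i | ∃ x ∈ s, x ∈ B i}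
  obtain ⟨i0⟩ : Nonempty Z := by
    obtain ⟨i, _⟩ := hcrit B hB p (hcore p); exact ⟨i⟩
  obtain ⟨i1, hi1⟩ : ∃ i1, ∀ i, p ∈ B i → i = i1 := by
    by_cases h : ∃ i, p ∈ B i
    · obtain ⟨i, hi⟩ := h; exact ⟨i, fun j hj => hB.eq_of_mem hj hi⟩
    · exact ⟨i0, fun i hi => absurd ⟨i, hi⟩ h⟩
  obtain ⟨i2, hi2⟩ : ∃ i1, ∀ i, q ∈ B i → i = i1 := by
    by_cases h : ∃ i, q ∈ B i
    · obtain ⟨i, hi⟩ := h; exact ⟨i, fun j hj => hB.eq_of_mem hj hi⟩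
    · exact ⟨i0, fun i hi => absurd ⟨i, hi⟩ h⟩
  have hS : S ⊆ {i1, i2} := by
    rintro i ⟨x, hx, hxi⟩
    rcases hs hx with h | h
    · subst h; exact Or.inl (hi1 i hxi)
    · rw [Set.mem_singleton_iff] at h; subst h; exact Or.inr (hi2 i hxi)
  have side : ∀ i, i ∉ S → (∃ x ∈ B i, x ∈ A) → ∀ x ∈ B i, x ∈ A := by
    rintro i hi ⟨x, hx, hxA⟩ y hy
    by_contra hyA
    obtain ⟨c, hc, hcA, d, hd, hdA, hcd⟩ := (hB.conn i).cut A hx hxA hy hyA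
    exact hno c (fun h => hi ⟨c, h, hc⟩) hcA d (fun h => hi ⟨d, h, hd⟩) hdA hcd
  have hnS : ∀ i, (∀ x ∈ s, x ∉ B i) → i ∉ S := fun i h ⟨x, hx, hxi⟩ => h x hx hxi
  have hdich : (∀ i, i ∉ S → ∀ x ∈ B i, x ∈ A) ∨ (∀ i, i ∉ S → ∀ x ∈ B i, x ∉ A) := by
    by_contra hcon
    push Not at hcon
    obtain ⟨⟨i, hi, x, hx, hxA⟩, ⟨j, hj, y, hy, hyA⟩⟩ := hcon
    obtain ⟨a', b', ha', hb', haT, hbT, hab⟩ := hK i1 i2 S hS {i | ∃ x ∈ B i, x ∈ A} ⟨j, hj, y, hy, hyA⟩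
      ⟨i, hi, fun h => hxA (side i hi h x hx)⟩
    obtain ⟨c, hc, d, hd, hcd⟩ := hB.adj hab
    exact hno c (fun h => ha' ⟨c, h, hc⟩) (side a' ha' haT c hc) d (fun h => hb' ⟨d, h, hd⟩)
      (fun h => hbT ⟨d, hd, h⟩) hcd
  rcases hdich with h | h
  · refine main (sᶜ \ A) Set.sdiff_subset ⟨b, hb, hbA⟩ ⟨a, ha, fun h => h.2 haA⟩ ?_ ?_
    · rintro x ⟨hx, hxA⟩ y hxy
      by_cases hy : y ∈ s
      · exact Or.inr hy
      · refine Or.inl ⟨hy, fun hyA => hno y hy hyA x hx hxA hxy.symm⟩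
    · intro i hi x hx hxD
      exact hxD.2 (h i (hnS i hi) x hx)
  · refine main (sᶜ ∩ A) Set.inter_subset_left ⟨a, ha, haA⟩ ⟨b, hb, fun h => hbA h.2⟩ ?_ ?_
    · rintro x ⟨hx, hxA⟩ y hxy
      by_cases hy : y ∈ s
      · exact Or.inr hy
      · refine Or.inl ⟨hy, ?_⟩
        by_contra hyA
        exact hno x hx hxA y hy hyA hxy
    · intro i hi x hx hxD
      exact h i (hnS i hi) x hx hxD.2

theorem K5_two (i j : Fin 5) (S : Set (Fin 5)) (hS : S ⊆ {i, j}) (T : Set (Fin 5)) (h1 : ∃ a, a ∉ S ∧ a ∈ T)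
    (h2 : ∃ a, a ∉ S ∧ a ∉ T) : ∃ a b, a ∉ S ∧ b ∉ S ∧ a ∈ T ∧ b ∉ T ∧ K5.Adj a b := by
  obtain ⟨b, h3, h4⟩ := h2
  obtain ⟨a, h1, h2⟩ := h1
  exact ⟨a, b, h1, h3, h2, h4, fun h => h4 (h ▸ h2)⟩

theorem K33_two (i j : Fin 3 ⊕ Fin 3) (S : Set (Fin 3 ⊕ Fin 3)) (hS : S ⊆ {i, j}) (T : Set (Fin 3 ⊕ Fin 3))
    (h1 : ∃ a, a ∉ S ∧ a ∈ T) (h2 : ∃ a, a ∉ S ∧ a ∉ T) :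
    ∃ a b, a ∉ S ∧ b ∉ S ∧ a ∈ T ∧ b ∉ T ∧ K33.Adj a b := by
  obtain ⟨b, h3, h4⟩ := h2
  obtain ⟨a, h1, h2⟩ := h1
  by_contra hc
  push Not at hc
  have e1 : ∀ x, x ∉ S → x ∈ T → ∀ y, y ∉ S → K33.Adj x y → y ∈ T := by
    intro x h1 h2 y h3 h4
    by_contra h5
    exact hc x y h1 h3 h2 h5 h4
  have ex : ∀ k l : Fin 3 ⊕ Fin 3, ∃ m n : Fin 3, .inl m ≠ k ∧ .inl m ≠ l ∧ .inr n ≠ k ∧ .inr n ≠ l := by decide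
  obtain ⟨m, n, hm1, hm2, hn1, hn2⟩ := ex i j
  have hm : (.inl m : Fin 3 ⊕ Fin 3) ∉ S := fun h => by rcases hS h with h | h; exacts [hm1 h, hm2 h]
  have hn : (.inr n : Fin 3 ⊕ Fin 3) ∉ S := fun h => by rcases hS h with h | h; exacts [hn1 h, hn2 h]
  have A1 : ∀ x y : Fin 3, K33.Adj (.inl x) (.inr y) := by intro x y; simp [K33]
  have A2 : ∀ x y : Fin 3, K33.Adj (.inr x) (.inl y) := by intro x y; simp [K33]
  have hmT : (.inl m : Fin 3 ⊕ Fin 3) ∈ T := by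
    rcases a with a | a
    · exact e1 _ hn (e1 _ h1 h2 _ hn (A1 _ _)) _ hm (A2 _ _)
    · exact e1 _ h1 h2 _ hm (A2 _ _)
  have hnT := e1 _ hm hmT _ hn (A1 _ _)
  rcases b with b | b
  · exact h4 (e1 _ hn hnT _ h3 (A2 _ _))
  · exact h4 (e1 _ hm hmT _ h3 (A1 _ _))

theorem SixFree.three_conn [Finite V] (hG : SixFree G) (hnp : ¬ Planar G) (hcore : ∀ x, x ∈ core G)
    (hdeg : ∀ z, ∀ y w, ∃ t, G.Adj z t ∧ t ≠ y ∧ t ≠ w) : KConnected G 3 := by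
  have hcard : 3 < Nat.card V := by
    have key : ∀ {Z : Type} [Fintype Z] (K : SimpleGraph Z) (B : Z → Set V), Model K G B → 3 < Nat.card Z → 3 < Nat.card V := by
      intro Z _ K B hB h
      choose g hg using fun i => (hB.conn i).nonempty
      have hinj : Function.Injective g := fun i j hij => hB.eq_of_mem (hg i) (hij ▸ hg j)
      exact h.trans_le (Nat.card_le_card_of_injective g hinj)
    rcases not_planar_iff.1 hnp with h | h
    · obtain ⟨B, hB⟩ := isMinor_iff.1 h
      exact key K5 B hB (by simp)
    · obtain ⟨B, hB⟩ := isMinor_iff.1 h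
      exact key K33 B hB (by simp)
  refine ⟨hcard, ?_⟩
  intro s hs
  have hne : (sᶜ).Nonempty := by
    by_contra h
    rw [Set.not_nonempty_iff_eq_empty, Set.compl_empty_iff] at h
    rw [h, Set.ncard_univ] at hs
    omega
  obtain ⟨v0⟩ : Nonempty V := ⟨hne.some⟩
  obtain ⟨p, q, hpq⟩ : ∃ p q, s ⊆ {p, q} := by
    have h3 : s.ncard = 0 ∨ s.ncard = 1 ∨ s.ncard = 2 := by omega
    rcases h3 with h | h | h
    · rw [Set.ncard_eq_zero] at h; exact ⟨v0, v0, by simp [h]⟩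
    · obtain ⟨a, rfl⟩ := Set.ncard_eq_one.1 h; exact ⟨a, a, by simp⟩
    · obtain ⟨a, b, _, rfl⟩ := Set.ncard_eq_two.1 h; exact ⟨a, b, subset_rfl⟩
  rcases not_planar_iff.1 hnp with h | h
  · obtain ⟨B, hB⟩ := isMinor_iff.1 h
    exact three_conn_aux hG.c5 hB K5_two hcore hdeg p q s hpq hne
  · obtain ⟨B, hB⟩ := isMinor_iff.1 h
    exact three_conn_aux hG.c33 hB K33_two hcore hdeg p q s hpq hne

end Sep

open SimpleGraph
set_option linter.unusedVariables false

section LiftWalk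

variable {V : Type*} {G G' : SimpleGraph V}

open Classical in
/-- replace a step `yz` by `y x z` -/
noncomputable def stepW {x : V} (hG : ∀ a b, G'.Adj a b → ¬ G.Adj a b → G.Adj a x ∧ G.Adj x b) {a b : V}
    (h : G'.Adj a b) : G.Walk a b :=
  if h' : G.Adj a b then Walk.cons h' Walk.nil else Walk.cons (hG a b h h').1 (Walk.cons (hG a b h h').2 Walk.nil)

noncomputable def liftW {x : V} (hG : ∀ a b, G'.Adj a b → ¬ G.Adj a b → G.Adj a x ∧ G.Adj x b) :
    ∀ {a b : V}, G'.Walk a b → G.Walk a b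
  | _, _, Walk.nil => Walk.nil
  | _, _, Walk.cons h q => (stepW hG h).append (liftW hG q)

variable {x : V} (hG : ∀ a b, G'.Adj a b → ¬ G.Adj a b → G.Adj a x ∧ G.Adj x b)

theorem stepW_symm {a b : V} (h : G'.Adj a b) : stepW hG h.symm = (stepW hG h).reverse := by
  unfold stepW
  by_cases h' : G.Adj a b
  · rw [dif_pos h', dif_pos h'.symm]; simp
  · rw [dif_neg h', dif_neg (fun h => h' h.symm)]; simp

theorem liftW_append {a b c : V} (p : G'.Walk a b) (q : G'.Walk b c) :
    liftW hG (p.append q) = (liftW hG p).append (liftW hG q) := by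
  induction p with
  | nil => simp [liftW]
  | cons h p ih => simp [liftW, ih, Walk.append_assoc]

theorem liftW_reverse {a b : V} (p : G'.Walk a b) : liftW hG p.reverse = (liftW hG p).reverse := by
  induction p with
  | nil => simp [liftW]
  | cons h p ih =>
    rw [Walk.reverse_cons, liftW_append, ih]
    have e : liftW hG (Walk.cons h p) = (stepW hG h).append (liftW hG p) := rfl
    rw [e, Walk.reverse_append, ← stepW_symm]
    simp [liftW]

theorem liftW_support {a b : V} (p : G'.Walk a b) (v : V) :
    v ∈ (liftW hG p).support ↔ v ∈ p.support ∨ (v = x ∧ ∃ s t, s(s, t) ∈ p.edges ∧ ¬ G.Adj s t) := by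
  induction p with
  | nil => simp [liftW]
  | cons h p ih =>
    rename_i a b c
    rw [liftW, Walk.mem_support_append_iff, ih]
    unfold stepW
    by_cases h' : G.Adj a b
    · rw [dif_pos h']
      have : (∃ s t, s(s, t) ∈ (Walk.cons h p).edges ∧ ¬ G.Adj s t) ↔ ∃ s t, s(s, t) ∈ p.edges ∧ ¬ G.Adj s t := by
        constructor
        · rintro ⟨s, t, h1, h2⟩
          rw [Walk.edges_cons, List.mem_cons] at h1
          rcases h1 with h1 | h1
          · rw [Sym2.eq_iff] at h1
            rcases h1 with ⟨rfl, rfl⟩ | ⟨rfl, rfl⟩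
            · exact absurd h' h2
            · exact absurd h'.symm h2
          · exact ⟨s, t, h1, h2⟩
        · rintro ⟨s, t, h1, h2⟩
          exact ⟨s, t, by rw [Walk.edges_cons]; exact List.mem_cons_of_mem _ h1, h2⟩
      rw [this]
      have hb : b ∈ p.support := p.start_mem_support
      simp only [Walk.support_cons, Walk.support_nil, List.mem_cons, List.not_mem_nil, or_false]
      constructor
      · rintro ((rfl | rfl) | h)
        · exact Or.inl (Or.inl rfl)
        · exact Or.inl (Or.inr hb)
        · tauto
      · tauto
    · rw [dif_neg h']
      have hb : b ∈ p.support := p.start_mem_support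
      have this : ∃ s t, s(s, t) ∈ (Walk.cons h p).edges ∧ ¬ G.Adj s t := ⟨a, b, by simp, h'⟩
      simp only [this, and_true]
      simp only [Walk.support_cons, Walk.support_nil, List.mem_cons, List.not_mem_nil, or_false]
      constructor
      · rintro ((rfl | rfl | rfl) | h)
        · exact Or.inl (Or.inl rfl)
        · exact Or.inr rfl
        · exact Or.inl (Or.inr hb)
        · tauto
      · tauto

theorem liftW_edges {a b : V} (p : G'.Walk a b) {e : Sym2 V} (he : e ∈ (liftW hG p).edges) :
    (e ∈ p.edges ∧ e ∈ G.edgeSet) ∨ ∃ s t, s(s, t) ∈ p.edges ∧ ¬ G.Adj s t ∧ (e = s(s, x) ∨ e = s(x, t)) := by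
  induction p with
  | nil => simp [liftW] at he
  | cons h p ih =>
    rename_i a b c
    rw [liftW, Walk.edges_append, List.mem_append] at he
    rcases he with he | he
    · unfold stepW at he
      by_cases h' : G.Adj a b
      · rw [dif_pos h'] at he
        simp at he
        subst he
        left; simpa using h'
      · rw [dif_neg h'] at he
        simp at he
        right
        exact ⟨a, b, by simp, h', he⟩
    · rcases ih he with h1 | ⟨s, t, h1, h2⟩
      · left; exact ⟨by simp [h1.1], h1.2⟩
      · right; exact ⟨s, t, by simp [h1], h2⟩

theorem liftW_edges1 {a b : V} (p : G'.Walk a b) {e : Sym2 V} (he : e ∈ p.edges) (he' : e ∈ G.edgeSet) :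
    e ∈ (liftW hG p).edges := by
  induction p with
  | nil => simp at he
  | cons h p ih =>
    rename_i a b c
    rw [liftW, Walk.edges_append, List.mem_append]
    rw [Walk.edges_cons, List.mem_cons] at he
    rcases he with rfl | he
    · left
      unfold stepW
      rw [dif_pos (show G.Adj a b from he')]
      simp
    · exact Or.inr (ih he)

theorem liftW_edges2 {a b : V} (p : G'.Walk a b) {s t : V} (he : s(s, t) ∈ p.edges) (he' : ¬ G.Adj s t) :
    s(s, x) ∈ (liftW hG p).edges ∧ s(x, t) ∈ (liftW hG p).edges := by
  induction p with
  | nil => simp at he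
  | cons h p ih =>
    rename_i a b c
    rw [liftW, Walk.edges_append]
    rw [Walk.edges_cons, List.mem_cons] at he
    rcases he with he | he
    · have : ∀ e, e = s(s, x) ∨ e = s(x, t) → e ∈ (stepW hG h).edges := by
        intro e h1
        have h' : ¬ G.Adj a b := by
          intro h'
          rw [Sym2.eq_iff] at he
          rcases he with ⟨rfl, rfl⟩ | ⟨rfl, rfl⟩
          · exact he' h'
          · exact he' h'.symm
        unfold stepW
        rw [dif_neg h']
        rw [Sym2.eq_iff] at he
        rcases he with ⟨rfl, rfl⟩ | ⟨rfl, rfl⟩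
        · simpa using h1
        · rcases h1 with h1 | h1
          · rw [h1, Sym2.eq_swap]; simp
          · rw [h1, Sym2.eq_swap]; simp
      exact ⟨List.mem_append_left _ (this _ (Or.inl rfl)), List.mem_append_left _ (this _ (Or.inr rfl))⟩
    · exact ⟨List.mem_append_right _ (ih he).1, List.mem_append_right _ (ih he).2⟩

theorem liftW_isPath {y z : V} (hyz : ∀ a b, G'.Adj a b → ¬ G.Adj a b → s(a, b) = s(y, z)) {a b : V} (p : G'.Walk a b)
    (hx : x ∉ p.support) (hp : p.IsPath) : (liftW hG p).IsPath := by
  induction p with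
  | nil => simp [liftW]
  | cons h p ih =>
    rename_i a b c
    have hp0 := hp
    rw [Walk.cons_isPath_iff] at hp
    rw [Walk.support_cons, List.mem_cons, not_or] at hx
    have ih' := ih hx.2 hp.1
    rw [liftW]
    unfold stepW
    have ha : a ∉ (liftW hG p).support := by
      rw [liftW_support]
      rintro (h | ⟨h, _⟩)
      · exact hp.2 h
      · exact hx.1 h.symm
    by_cases h' : G.Adj a b
    · rw [dif_pos h', Walk.cons_append, Walk.nil_append, Walk.cons_isPath_iff]
      exact ⟨ih', ha⟩
    · rw [dif_neg h', Walk.cons_append, Walk.cons_append, Walk.nil_append, Walk.cons_isPath_iff, Walk.cons_isPath_iff]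
      refine ⟨⟨ih', ?_⟩, ?_⟩
      · rw [liftW_support]
        rintro (h | ⟨_, s, t, h1, h2⟩)
        · exact hx.2 h
        · have e1 := hyz s t (Walk.adj_of_mem_edges _ h1) h2
          have e2 := hyz a b h h'
          have := hp0.isTrail
          rw [Walk.isTrail_cons] at this
          rw [e2, ← e1] at this
          exact this.2 h1
      · rw [Walk.support_cons, List.mem_cons, not_or]
        exact ⟨fun h => hx.1 h.symm, ha⟩

theorem mem_support_core {a b : V} (p : G.Walk a b) {v : V} (hv : v ∈ p.support) : v = a ∨ v ∈ core G := by
  induction p with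
  | nil => left; simpa using hv
  | cons h p ih =>
    rw [Walk.support_cons, List.mem_cons] at hv
    rcases hv with hv | hv
    · exact Or.inl hv
    · rcases ih hv with rfl | h'
      · exact Or.inr ⟨_, h.symm⟩
      · exact Or.inr h'

end LiftWalk

section Main

/-- the conclusion carried along the induction -/
def Carried {V : Type} (G : SimpleGraph V) : Prop :=
  ∃ (U : Type) (H : SimpleGraph U), KConnected H 3 ∧ AlmostPlanar H ∧
    ∃ (f : U → V) (p : ∀ ⦃u v : U⦄, H.Adj u v → G.Walk (f u) (f v)),
      SubV Set.univ f p ∧ (∀ u, f u ∈ core G) ∧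
      ∀ ⦃u v : U⦄ (h : H.Adj u v), ¬ Planar (H.deleteEdges {s(u, v)}) → ∀ e ∈ (p h).edges,
        ¬ Planar (G.deleteEdges {e})

theorem del_adj {V : Type*} {G : SimpleGraph V} {e : Sym2 V} {a b : V} :
    (G.deleteEdges {e}).Adj a b ↔ G.Adj a b ∧ s(a, b) ≠ e := by
  simp [deleteEdges_adj]

theorem Carried.step {V : Type} [Finite V] {G : SimpleGraph V} {x y z : V} (hxy : G.Adj x y) (hxz : G.Adj x z)
    (hyz : y ≠ z) (hnyz : ¬ G.Adj y z) (hN : ∀ t, G.Adj x t → t = y ∨ t = z)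
    (h : Carried (contractEdge G y x)) : Carried G := by
  obtain ⟨U, H, h3, hap, f, p, hs, hc, hinv⟩ := h
  have hle : ∀ a b, (contractEdge G y x).Adj a b → ¬ G.Adj a b → s(a, b) = s(y, z) := by
    intro a b hab hnab
    obtain ⟨hne, ha, hb, h | ⟨rfl, h⟩ | ⟨rfl, h⟩⟩ := contract_adj.1 hab
    · exact absurd h hnab
    · rcases hN _ h with rfl | rfl
      · exact absurd rfl hne
      · rfl
    · rcases hN _ h with rfl | rfl
      · exact absurd rfl hne
      · exact Sym2.eq_swap
  have hG : ∀ a b, (contractEdge G y x).Adj a b → ¬ G.Adj a b → G.Adj a x ∧ G.Adj x b := by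
    intro a b hab hnab
    have := hle a b hab hnab
    rw [Sym2.eq_iff] at this
    rcases this with ⟨rfl, rfl⟩ | ⟨rfl, rfl⟩
    · exact ⟨hxy.symm, hxz⟩
    · exact ⟨hxz.symm, hxy⟩
  have hYZ : (contractEdge G y x).Adj y z := contract_adj.2 ⟨hyz, hxy.ne', hxz.ne', Or.inr (Or.inl ⟨rfl, hxz⟩)⟩
  have hxc : x ∉ core (contractEdge G y x) := not_mem_core_contract
  have hxf : ∀ u, f u ≠ x := fun u h => hxc (h ▸ hc u)
  have hxs : ∀ {u v} (h : H.Adj u v), x ∉ (p h).support := by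
    intro u v h hx
    rcases mem_support_core _ hx with h' | h'
    · exact hxf u h'.symm
    · exact hxc h'
  have hyzs : ∀ {u v} (h : H.Adj u v) s t, s(s, t) ∈ (p h).edges → ¬ G.Adj s t → s(y, z) ∈ (p h).edges := by
    intro u v h s t h1 h2
    rw [← hle s t (Walk.adj_of_mem_edges _ h1) h2]; exact h1
  refine ⟨U, H, h3, hap, f, fun u v h => liftW hG (p h), ⟨hs.inj, ?_, ?_, ?_, ?_, ?_, ?_⟩, ?_, ?_⟩
  · intro u v h
    exact liftW_isPath hG hle _ (hxs h) (hs.path h)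
  · intro u v h
    rw [hs.symm h, liftW_reverse]
  · intro u v h hS
    exact absurd (Set.mem_univ _) hS
  · intro u v h w hw
    rw [liftW_support] at hw
    rcases hw with hw | ⟨hw, _⟩
    · exact hs.fr h w hw
    · exact absurd hw (hxf w)
  · intro u v u' v' h h' hne w hw hw'
    rw [liftW_support] at hw hw'
    rcases hw with hw | ⟨hw, s, t, h1, h2⟩
    · rcases hw' with hw' | ⟨rfl, _⟩
      · exact hs.dis h h' hne w hw hw'
      · exact absurd hw (hxs h)
    · subst hw
      rcases hw' with hw' | ⟨_, s', t', h1', h2'⟩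
      · exact absurd hw' (hxs h')
      · exfalso
        have e1 := hyzs h s t h1 h2
        have e2 := hyzs h' s' t' h1' h2'
        have y1 := Walk.fst_mem_support_of_mem_edges _ e1
        have z1 := Walk.snd_mem_support_of_mem_edges _ e1
        have y2 := Walk.fst_mem_support_of_mem_edges _ e2
        have z2 := Walk.snd_mem_support_of_mem_edges _ e2
        obtain ⟨a, rfl⟩ := hs.dis h h' hne y y1 y2
        obtain ⟨b, rfl⟩ := hs.dis h h' hne z z1 z2
        have hab : a ≠ b := fun h => hyz (by rw [h])
        apply hne
        have m1 : a ∈ s(u, v) := Sym2.mem_iff.2 (hs.fr h a y1)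
        have m2 : b ∈ s(u, v) := Sym2.mem_iff.2 (hs.fr h b z1)
        have m3 : a ∈ s(u', v') := Sym2.mem_iff.2 (hs.fr h' a y2)
        have m4 : b ∈ s(u', v') := Sym2.mem_iff.2 (hs.fr h' b z2)
        rw [(Sym2.mem_and_mem_iff hab).1 ⟨m1, m2⟩, (Sym2.mem_and_mem_iff hab).1 ⟨m3, m4⟩]
  · intro e
    induction e with
    | _ a b =>
      intro hab
      obtain ⟨u, v, h, he⟩ := hs.edge s(y, z) hYZ
      have h2 := liftW_edges2 hG (p h) he hnyz
      by_cases hax : a = x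
      · subst hax
        rcases hN b hab with rfl | rfl
        · exact ⟨u, v, h, Sym2.eq_swap ▸ h2.1⟩
        · exact ⟨u, v, h, h2.2⟩
      · by_cases hbx : b = x
        · subst hbx
          rcases hN a (SimpleGraph.Adj.symm hab) with rfl | rfl
          · exact ⟨u, v, h, h2.1⟩
          · exact ⟨u, v, h, Sym2.eq_swap ▸ h2.2⟩
        · have hab' : (contractEdge G y x).Adj a b := contract_adj.2 ⟨G.ne_of_adj hab, hax, hbx, Or.inl hab⟩
          obtain ⟨u, v, h, he⟩ := hs.edge s(a, b) hab'
          exact ⟨u, v, h, liftW_edges1 hG (p h) he hab⟩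
  · intro u; exact core_contract hxy (hc u)
  · intro u v h hnp e he
    rcases liftW_edges hG (p h) he with ⟨h1, h2⟩ | ⟨s, t, h1, h2, h3⟩
    · have h4 := hinv h hnp e h1
      have hex : ∀ t, e ≠ s(x, t) := by
        rintro t rfl
        exact hxs h (Walk.fst_mem_support_of_mem_edges _ h1)
      refine not_planar_contract (u := y) (w := x) ?_ (not_planar_mono ?_ h4)
      · exact del_adj.2 ⟨hxy.symm, fun h => hex y (by rw [← h, Sym2.eq_swap])⟩
      · intro a b hab
        obtain ⟨hab, hne⟩ := del_adj.1 hab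
        obtain ⟨hne', ha, hb, h | ⟨rfl, h⟩ | ⟨rfl, h⟩⟩ := contract_adj.1 hab
        · exact contract_adj.2 ⟨hne', ha, hb, Or.inl (del_adj.2 ⟨h, hne⟩)⟩
        · exact contract_adj.2 ⟨hne', ha, hb, Or.inr (Or.inl ⟨rfl, del_adj.2 ⟨h, fun h => hex _ h.symm⟩⟩)⟩
        · exact contract_adj.2 ⟨hne', ha, hb, Or.inr (Or.inr ⟨rfl, del_adj.2 ⟨h, fun h => hex _ h.symm⟩⟩)⟩
    · have h4 := hinv h hnp _ (hyzs h s t h1 h2)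
      refine not_planar_mono ?_ h4
      intro a b hab
      obtain ⟨hab, hne⟩ := del_adj.1 hab
      refine del_adj.2 ⟨?_, ?_⟩
      · by_contra hn
        exact hne (hle a b hab hn)
      · have ha := (contract_adj.1 hab).2.1
        have hb := (contract_adj.1 hab).2.2.1
        rintro rfl
        rcases h3 with h3 | h3 <;> rw [Sym2.eq_iff] at h3
        · rcases h3 with ⟨_, h3⟩ | ⟨h3, _⟩
          exacts [hb h3, ha h3]
        · rcases h3 with ⟨h3, _⟩ | ⟨_, h3⟩
          exacts [ha h3, hb h3]

theorem conn_induce {V : Type*} {G : SimpleGraph V} {S T : Set V} (hST : S ⊆ T) (h : Conn G S) :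
    Conn (G.induce T) (Subtype.val ⁻¹' S) := by
  rw [conn_iff] at h ⊢
  refine ⟨?_, ?_⟩
  · obtain ⟨s, hs⟩ := h.1; exact ⟨⟨s, hST hs⟩, hs⟩
  · rintro A ⟨a, ha, haA⟩ ⟨b, hb, hbA⟩
    obtain ⟨c, hc, ⟨c', hcA, rfl⟩, d, hd, hdA, hcd⟩ := h.2 (Subtype.val '' A) ⟨a, ha, a, haA, rfl⟩
      ⟨b, hb, fun ⟨b', hb', e⟩ => hbA (Subtype.ext e ▸ hb')⟩
    exact ⟨c', hc, hcA, ⟨d, hST hd⟩, hd, fun h => hdA ⟨_, h, rfl⟩, hcd⟩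

theorem model_induce {V Z : Type*} {G : SimpleGraph V} {K : SimpleGraph Z} {B : Z → Set V} (hB : Model K G B) {T : Set V}
    (hT : ∀ i, B i ⊆ T) : Model K (G.induce T) (fun i => Subtype.val ⁻¹' (B i)) := by
  refine ⟨fun i => conn_induce (hT i) (hB.conn i), fun i j hij => Set.disjoint_left.2 fun x h1 h2 => hij (hB.eq_of_mem h1 h2), ?_⟩
  intro i j hij
  obtain ⟨a, ha, b, hb, hab⟩ := hB.adj hij
  exact ⟨⟨a, hT i ha⟩, ha, ⟨b, hT j hb⟩, hb, hab⟩

theorem not_planar_core {V : Type*} {G : SimpleGraph V} (h : ¬ Planar G) : ¬ Planar (G.induce (core G)) := by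
  have key : ∀ {Z : Type} (K : SimpleGraph Z), (∀ i, ∃ j, K.Adj i j) → IsMinor K G → IsMinor K (G.induce (core G)) := by
    intro Z K hK h
    obtain ⟨B, hB⟩ := isMinor_iff.1 h
    refine (model_induce hB ?_).isMinor
    intro i x hx
    by_contra hc
    obtain ⟨j, hj⟩ := hK i
    exact hB.not_mem_of_isolated (fun y hy => hc ⟨y, hy⟩) hj hx
  rcases not_planar_iff.1 h with h | h
  · exact not_planar_iff.2 (Or.inl (key _ (fun i => by obtain ⟨j, _, _, hj, _⟩ := K5_deg i; exact ⟨j, hj⟩) h))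
  · exact not_planar_iff.2 (Or.inr (key _ (fun i => by obtain ⟨j, _, _, hj, _⟩ := K33_deg i; exact ⟨j, hj⟩) h))

theorem isMinor_emb {V W : Type*} {G : SimpleGraph V} {H : SimpleGraph W} (f : W → V) (hf : Function.Injective f)
    (h : ∀ a b, H.Adj a b → G.Adj (f a) (f b)) : IsMinor H G := by
  refine Model.isMinor (B := fun w => {f w}) ⟨fun i => conn_singleton _, ?_, ?_⟩
  · intro i j hij
    simpa using fun h => hij (hf h)
  · intro i j hij
    exact ⟨_, rfl, _, rfl, h i j hij⟩

theorem carried_of_sixFree (hF : ∀ (V : Type) [Finite V] (G : SimpleGraph V), SixFree G → ¬ Planar G → AlmostPlanar G) :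
    ∀ (n : ℕ) (V : Type) [Finite V] (G : SimpleGraph V), (core G).ncard = n → SixFree G → ¬ Planar G → Carried G := by
  intro n
  induction n using Nat.strong_induction_on with
  | _ n ih =>
    intro V _ G hn hG hnp
    by_cases hdeg : ∀ x ∈ core G, ∀ y z, ∃ t, G.Adj x t ∧ t ≠ y ∧ t ≠ z
    · have h1 : IsMinor (G.induce (core G)) G := isMinor_emb Subtype.val Subtype.val_injective (fun a b h => h)
      have hnp' := not_planar_core hnp
      have hG' := hG.minor h1
      refine ⟨core G, G.induce (core G), hG'.three_conn hnp' ?_ ?_, hF _ _ hG' hnp', Subtype.val,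
        fun u v h => Walk.cons (show G.Adj u v from h) Walk.nil, ⟨Subtype.val_injective, ?_, ?_, ?_, ?_, ?_, ?_⟩, ?_, ?_⟩
      · rintro ⟨x, y, hxy⟩; exact ⟨⟨y, x, hxy.symm⟩, hxy⟩
      · rintro ⟨x, hx⟩ y z
        obtain ⟨t, ht, h1, h2⟩ := hdeg x hx y z
        exact ⟨⟨t, x, ht.symm⟩, ht, fun h => h1 (congrArg Subtype.val h), fun h => h2 (congrArg Subtype.val h)⟩
      · intro u v h
        have : (u : V) ≠ v := fun e => h.ne (Subtype.ext e)
        simp [this]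
      · intro u v h; simp
      · intro u v h _; simp
      · intro u v h w hw
        simp at hw
        simpa [Subtype.ext_iff] using hw
      · intro u v u' v' h h' hne x hx hx'
        simp at hx
        rcases hx with rfl | rfl
        exacts [⟨u, rfl⟩, ⟨v, rfl⟩]
      · intro e
        induction e with
        | _ a b =>
          intro hab
          exact ⟨⟨a, b, hab⟩, ⟨b, a, SimpleGraph.Adj.symm hab⟩, hab, by simp⟩
      · intro u; exact u.2
      · intro u v h hnp e he
        simp at he
        subst he
        refine not_planar_trans hnp (isMinor_emb Subtype.val Subtype.val_injective ?_)
        intro a b hab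
        obtain ⟨h1, h2⟩ := del_adj.1 hab
        refine del_adj.2 ⟨h1, fun h => h2 ?_⟩
        simpa [Sym2.eq_iff, Subtype.ext_iff] using h
    · push Not at hdeg
      obtain ⟨x, hx, y0, z0, hN0⟩ := hdeg
      have hN0' : ∀ t, G.Adj x t → t = y0 ∨ t = z0 := by
        intro t ht
        by_cases h : t = y0
        · exact Or.inl h
        · exact Or.inr (hN0 t ht h)
      have hy0 : G.Adj x y0 := by
        by_contra h
        exact hnp (hG.planar_of_deg1 le_rfl hx (y := z0) fun s hs => (hN0' s hs).resolve_left fun e => h (e ▸ hs))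
      have hz0 : G.Adj x z0 := by
        by_contra h
        exact hnp (hG.planar_of_deg1 le_rfl hx (y := y0) fun s hs => (hN0' s hs).resolve_right fun e => h (e ▸ hs))
      have hyz : y0 ≠ z0 := by
        rintro rfl
        exact hnp (hG.planar_of_deg1 le_rfl hx (y := y0) fun s hs => (hN0' s hs).elim id id)
      have hnp' := not_planar_suppress hnp hN0' hy0
      have hnyz : ¬ G.Adj y0 z0 := by
        intro h
        refine hnp' (hG.planar_of_isolated (x := x) ?_ hx fun s hs => (contract_adj.1 hs).2.1 rfl)
        intro a b hab
        obtain ⟨hne', ha, hb, h' | ⟨e, h'⟩ | ⟨e, h'⟩⟩ := contract_adj.1 hab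
        · exact h'
        · rcases hN0' _ h' with e' | e'
          · exact absurd (e.trans e'.symm) hne'
          · rw [e, e']; exact h
        · rcases hN0' _ h' with e' | e'
          · exact absurd (e'.trans e.symm) hne'
          · rw [e, e']; exact h.symm
      refine Carried.step hy0 hz0 hyz hnyz hN0' (ih _ ?_ V _ rfl (hG.contract hy0.symm) hnp')
      rw [← hn]
      exact Set.ncard_lt_ncard ⟨core_contract hy0, fun h => not_mem_core_contract (h hx)⟩ (Set.toFinite _)

theorem Carried.sub {V : Type} [Finite V] {G : SimpleGraph V} (hG : SixFree G) (h : Carried G) :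
    ∃ (U : Type) (H : SimpleGraph U), KConnected H 3 ∧ AlmostPlanar H ∧
        IsSubdivisionWithin (G.induce (core G)) H (Dset H) := by
  obtain ⟨U, H, h3, hap, f, p, hs, hc, hinv⟩ := h
  refine ⟨U, H, h3, hap, ?_⟩
  have hcore : ∀ {u v} (h : H.Adj u v), ∀ x ∈ (p h).support, x ∈ core G := by
    intro u v h x hx
    rcases mem_support_core _ hx with rfl | h
    · exact hc u
    · exact h
  let φ := (Embedding.induce (G := G) (core G)).toHom
  have hφ : Function.Injective φ := Subtype.val_injective
  have hmap : ∀ {u v} (h : H.Adj u v), ((p h).induce (core G) (hcore h)).map φ = p h := by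
    intro u v h; exact Walk.map_induce _ _
  have hsupp : ∀ {u v} (h : H.Adj u v), (p h).support = ((p h).induce (core G) (hcore h)).support.map φ := by
    intro u v h
    exact (congrArg Walk.support (hmap h)).symm.trans (Walk.support_map φ _)
  have hedg : ∀ {u v} (h : H.Adj u v), (p h).edges = ((p h).induce (core G) (hcore h)).edges.map (Sym2.map φ) := by
    intro u v h
    exact (congrArg Walk.edges (hmap h)).symm.trans (Walk.edges_map φ _)
  have hsup : ∀ {u v} (h : H.Adj u v) (x : core G), x ∈ ((p h).induce (core G) (hcore h)).support → x.1 ∈ (p h).support := by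
    intro u v h x hx
    rw [hsupp h]
    exact List.mem_map_of_mem (f := φ) hx
  refine ⟨⟨fun u => ⟨f u, hc u⟩, fun a b e => hs.inj (congrArg Subtype.val e)⟩,
    fun u v h => (p h).induce (core G) (hcore h), ?_, ?_, ?_, ?_, ?_, ?_, ?_⟩
  · intro u v h
    have := hs.path h
    rw [← hmap h] at this
    exact Walk.IsPath.of_map this
  · intro u v h
    apply Walk.map_injective_of_injective hφ
    exact ((hmap h.symm).trans (hs.symm h)).trans
      ((congrArg Walk.reverse (hmap h)).symm.trans (Walk.reverse_map φ _))
  · intro u v h hS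
    have hlen : ((p h).induce (core G) (hcore h)).length = (p h).length := by
      conv_rhs => rw [← hmap h]
      exact (Walk.length_map _ _).symm
    rw [hlen]
    have hnp : ¬ Planar (H.deleteEdges {s(u, v)}) := fun hp => hS ⟨h, hp⟩
    have h1 := hinv h hnp
    have h2 := hs.path h
    have h3 := hs.fr h
    have hne : f u ≠ f v := fun e => h.ne (hs.inj e)
    by_contra hl
    obtain ⟨a, hua, haf, hav, he⟩ : ∃ a, G.Adj (f u) a ∧ a ≠ f u ∧ a ≠ f v ∧ a ∈ (p h).support ∧ s(f u, a) ∈ (p h).edges := by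
      revert hl h2
      generalize p h = q
      generalize f v = c at q hne
      intro h2 hl
      cases q with
      | nil => exact absurd rfl hne
      | cons h' q' =>
        rename_i a
        refine ⟨a, h', h'.ne', ?_, by simp, by simp⟩
        rintro rfl
        rw [Walk.cons_isPath_iff, Walk.isPath_iff_eq_nil] at h2
        rw [h2.1] at hl
        simp at hl
    have har : a ∉ Set.range f := by
      rintro ⟨w, rfl⟩
      rcases h3 w he.1 with rfl | rfl
      · exact haf rfl
      · exact hav rfl
    classical
    obtain ⟨y, z, hyz⟩ := hs.deg har
    refine h1 _ he.2 (hG.planar_of_deg1 (deleteEdges_le _) (x := a) ⟨_, hua.symm⟩ (y := if y = f u then z else y) ?_)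
    intro s hs'
    obtain ⟨h4, h5⟩ := del_adj.1 hs'
    have h6 : s ≠ f u := by rintro rfl; exact h5 Sym2.eq_swap
    rcases hyz s h4 with rfl | rfl
    · rw [if_neg h6]
    · split_ifs with h7
      · rfl
      · rcases hyz _ hua.symm with h8 | h8
        · exact absurd h8.symm h7
        · exact absurd h8.symm h6
  · intro u v h w hw
    exact hs.fr h w (hsup h _ hw)
  · intro u v u' v' h h' hne x hx hx'
    obtain ⟨w, hw⟩ := hs.dis h h' hne x.1 (hsup h _ hx) (hsup h' _ hx')
    exact ⟨w, Subtype.ext hw⟩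
  · rintro ⟨x, y, hxy⟩
    obtain ⟨u, v, h, he⟩ := hs.edge s(x, y) hxy
    right
    refine ⟨u, v, h, ?_⟩
    have hx := Walk.fst_mem_support_of_mem_edges _ he
    rw [hsupp h, List.mem_map] at hx
    obtain ⟨x', hx', e⟩ := hx
    have : x' = ⟨x, y, hxy⟩ := Subtype.ext e
    rw [← this]; exact hx'
  · intro e
    induction e with
    | _ a b =>
      intro hab
      obtain ⟨u, v, h, he⟩ := hs.edge s(a.1, b.1) hab
      refine ⟨u, v, h, ?_⟩
      rw [hedg h, List.mem_map] at he
      obtain ⟨e', he', hee⟩ := he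
      have : e' = s(a, b) := Sym2.map.injective hφ hee
      rw [← this]; exact he'

end Main

open SimpleGraph
set_option linter.unusedVariables false

section Explicit

variable {V : Type*} {G : SimpleGraph V}

theorem mk33 {A0 A1 A2 B0 B1 B2 : Set V}
    (hc : Conn G A0 ∧ Conn G A1 ∧ Conn G A2 ∧ Conn G B0 ∧ Conn G B1 ∧ Conn G B2)
    (hd : [A0, A1, A2, B0, B1, B2].Pairwise Disjoint)
    (ht : Tch G A0 B0 ∧ Tch G A0 B1 ∧ Tch G A0 B2 ∧ Tch G A1 B0 ∧ Tch G A1 B1 ∧ Tch G A1 B2 ∧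
      Tch G A2 B0 ∧ Tch G A2 B1 ∧ Tch G A2 B2) :
    Model K33 G (Sum.elim ![A0, A1, A2] ![B0, B1, B2]) := by
  obtain ⟨a0, a1, a2, b0, b1, b2⟩ := hc
  obtain ⟨t1, t2, t3, t4, t5, t6, t7, t8, t9⟩ := ht
  simp only [List.pairwise_cons, List.mem_cons, List.not_mem_nil, or_false, forall_eq_or_imp, forall_eq] at hd
  refine isMinor_K33_of ?_ ?_ ?_ ?_ ?_ ?_
  · intro i; fin_cases i <;> assumption
  · intro i; fin_cases i <;> assumption
  · intro i j h; fin_cases i <;> fin_cases j <;> first | (exact absurd h (by decide)) | simp [hd]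
  · intro i j h; fin_cases i <;> fin_cases j <;> first | (exact absurd h (by decide)) | simp [hd]
  · intro i j; fin_cases i <;> fin_cases j <;> simp [hd]
  · intro i j; fin_cases i <;> fin_cases j <;> assumption

theorem mk5 {A0 A1 A2 A3 A4 : Set V}
    (hc : Conn G A0 ∧ Conn G A1 ∧ Conn G A2 ∧ Conn G A3 ∧ Conn G A4)
    (hd : [A0, A1, A2, A3, A4].Pairwise Disjoint)
    (ht : Tch G A0 A1 ∧ Tch G A0 A2 ∧ Tch G A0 A3 ∧ Tch G A0 A4 ∧ Tch G A1 A2 ∧ Tch G A1 A3 ∧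
      Tch G A1 A4 ∧ Tch G A2 A3 ∧ Tch G A2 A4 ∧ Tch G A3 A4) :
    Model K5 G ![A0, A1, A2, A3, A4] := by
  obtain ⟨a0, a1, a2, b0, b1⟩ := hc
  obtain ⟨t1, t2, t3, t4, t5, t6, t7, t8, t9, t10⟩ := ht
  simp only [List.pairwise_cons, List.mem_cons, List.not_mem_nil, or_false, forall_eq_or_imp, forall_eq] at hd
  refine isMinor_K5_of ?_ ?_ ?_
  · intro i; fin_cases i <;> assumption
  · intro i j h; fin_cases i <;> fin_cases j <;> first | (exact absurd h (by decide)) | simp [hd]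
  · intro i j h; fin_cases i <;> fin_cases j <;> first | (exact absurd h (by decide)) | assumption

theorem SixFree.k33 (hG : SixFree G) {A0 A1 A2 B0 B1 B2 : Set V} {x : V} (hx : x ∈ core G)
    (hc : Conn G A0 ∧ Conn G A1 ∧ Conn G A2 ∧ Conn G B0 ∧ Conn G B1 ∧ Conn G B2)
    (hd : [A0, A1, A2, B0, B1, B2].Pairwise Disjoint)
    (ht : Tch G A0 B0 ∧ Tch G A0 B1 ∧ Tch G A0 B2 ∧ Tch G A1 B0 ∧ Tch G A1 B1 ∧ Tch G A1 B2 ∧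
      Tch G A2 B0 ∧ Tch G A2 B1 ∧ Tch G A2 B2)
    (hn : x ∉ A0 ∧ x ∉ A1 ∧ x ∉ A2 ∧ x ∉ B0 ∧ x ∉ B1 ∧ x ∉ B2) : False := by
  obtain ⟨n1, n2, n3, n4, n5, n6⟩ := hn
  refine hG.crit33 (mk33 hc hd ht) hx ?_
  rintro (i | i) <;> fin_cases i <;> assumption

theorem SixFree.k5 (hG : SixFree G) {A0 A1 A2 A3 A4 : Set V} {x : V} (hx : x ∈ core G)
    (hc : Conn G A0 ∧ Conn G A1 ∧ Conn G A2 ∧ Conn G A3 ∧ Conn G A4)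
    (hd : [A0, A1, A2, A3, A4].Pairwise Disjoint)
    (ht : Tch G A0 A1 ∧ Tch G A0 A2 ∧ Tch G A0 A3 ∧ Tch G A0 A4 ∧ Tch G A1 A2 ∧ Tch G A1 A3 ∧
      Tch G A1 A4 ∧ Tch G A2 A3 ∧ Tch G A2 A4 ∧ Tch G A3 A4)
    (hn : x ∉ A0 ∧ x ∉ A1 ∧ x ∉ A2 ∧ x ∉ A3 ∧ x ∉ A4) : False := by
  obtain ⟨n1, n2, n3, n4, n5⟩ := hn
  refine hG.crit5 (mk5 hc hd ht) hx ?_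
  intro i; fin_cases i <;> assumption

/-- `A0 - s0 - B0`, `A0 - s1 - B1`, `s0 ~ s1`. -/
theorem SixFree.k33h (hG : SixFree G) {A0 A1 A2 B0 B1 B2 s0 s1 : Set V}
    (hc : Conn G A0 ∧ Conn G A1 ∧ Conn G A2 ∧ Conn G B0 ∧ Conn G B1 ∧ Conn G B2 ∧ Conn G s0 ∧ Conn G s1)
    (hd : [A0, A1, A2, B0, B1, B2, s0, s1].Pairwise Disjoint)
    (ht : Tch G A0 B2 ∧ Tch G A1 B0 ∧ Tch G A1 B1 ∧ Tch G A1 B2 ∧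
      Tch G A2 B0 ∧ Tch G A2 B1 ∧ Tch G A2 B2)
    (hs : Tch G s0 A0 ∧ Tch G s0 B0 ∧ Tch G s1 A0 ∧ Tch G s1 B1 ∧ Tch G s0 s1) : False := by
  obtain ⟨a0, a1, a2, b0, b1, b2, c0, c1⟩ := hc
  obtain ⟨t3, t4, t5, t6, t7, t8, t9⟩ := ht
  obtain ⟨r1, r2, r3, r4, r5⟩ := hs
  simp only [List.pairwise_cons, List.mem_cons, List.not_mem_nil, or_false, forall_eq_or_imp, forall_eq] at hd
  have hd2 : Disjoint s0 A0 ∧ Disjoint s0 A1 ∧ Disjoint s0 A2 ∧ Disjoint s0 B0 ∧ Disjoint s0 B1 ∧ Disjoint s0 B2 ∧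
    Disjoint s1 A0 ∧ Disjoint s1 A1 ∧ Disjoint s1 A2 ∧ Disjoint s1 B0 ∧ Disjoint s1 B1 ∧ Disjoint s1 B2 := by
    simp [disjoint_comm (a := s0), disjoint_comm (a := s1), hd]
  refine hG.no33h (f := ![A0, A1, A2]) (g := ![B0, B1, B2]) (s0 := s0) (s1 := s1) ?_ ?_ c0 c1 ?_ ?_ ?_ ?_ ?_ ?_ ?_ ?_ ?_ r1 r2 r3 r4 r5
  · intro i; fin_cases i <;> assumption
  · intro i; fin_cases i <;> assumption
  · intro i j h; fin_cases i <;> fin_cases j <;> first | (exact absurd h (by decide)) | simp [hd]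
  · intro i j h; fin_cases i <;> fin_cases j <;> first | (exact absurd h (by decide)) | simp [hd]
  · intro i j; fin_cases i <;> fin_cases j <;> simp [hd]
  · intro i; fin_cases i <;> simp [hd2]
  · intro i; fin_cases i <;> simp [hd2]
  · intro i; fin_cases i <;> simp [hd2]
  · intro i; fin_cases i <;> simp [hd2]
  · simp [hd]
  · intro i j h; fin_cases i <;> fin_cases j <;> first | (exact absurd (by decide) h) | assumption

/-- `A0 - s0 - A1`, `A0 - s1 - A2`, `s0 ~ s1`. -/
theorem SixFree.k5h (hG : SixFree G) {A0 A1 A2 A3 A4 s0 s1 : Set V}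
    (hc : Conn G A0 ∧ Conn G A1 ∧ Conn G A2 ∧ Conn G A3 ∧ Conn G A4 ∧ Conn G s0 ∧ Conn G s1)
    (hd : [A0, A1, A2, A3, A4, s0, s1].Pairwise Disjoint)
    (ht : Tch G A0 A3 ∧ Tch G A0 A4 ∧ Tch G A1 A2 ∧ Tch G A1 A3 ∧
      Tch G A1 A4 ∧ Tch G A2 A3 ∧ Tch G A2 A4 ∧ Tch G A3 A4)
    (hs : Tch G s0 A0 ∧ Tch G s0 A1 ∧ Tch G s1 A0 ∧ Tch G s1 A2 ∧ Tch G s0 s1) : False := by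
  obtain ⟨a0, a1, a2, b0, b1, c0, c1⟩ := hc
  obtain ⟨t3, t4, t5, t6, t7, t8, t9, t10⟩ := ht
  obtain ⟨r1, r2, r3, r4, r5⟩ := hs
  simp only [List.pairwise_cons, List.mem_cons, List.not_mem_nil, or_false, forall_eq_or_imp, forall_eq] at hd
  have hd2 : Disjoint s0 A0 ∧ Disjoint s0 A1 ∧ Disjoint s0 A2 ∧ Disjoint s0 A3 ∧ Disjoint s0 A4 ∧
    Disjoint s1 A0 ∧ Disjoint s1 A1 ∧ Disjoint s1 A2 ∧ Disjoint s1 A3 ∧ Disjoint s1 A4 := by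
    simp [disjoint_comm (a := s0), disjoint_comm (a := s1), hd]
  refine hG.no5h (f := ![A0, A1, A2, A3, A4]) (s0 := s0) (s1 := s1) ?_ c0 c1 ?_ ?_ ?_ ?_ ?_ r1 r2 r3 r4 r5
  · intro i; fin_cases i <;> assumption
  · intro i j h; fin_cases i <;> fin_cases j <;> first | (exact absurd h (by decide)) | simp [hd]
  · intro i; fin_cases i <;> simp [hd2]
  · intro i; fin_cases i <;> simp [hd2]
  · simp [hd]
  · intro i j h h'; fin_cases i <;> fin_cases j <;> first | (exact absurd h (by decide)) | (exact absurd (by decide) h') | assumption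

end Explicit

open SimpleGraph
set_option linter.unusedVariables false

section FOne

variable {V : Type*} {G : SimpleGraph V}

def Contr33 (G : SimpleGraph V) (u v : V) : Prop :=
  ∃ f g : Fin 3 → Set V, Model K33 G (Sum.elim f g) ∧ u ∈ f 0 ∧ v ∈ f 0

theorem Tch.ul {S S' T : Set V} (h : Tch G S T) : Tch G (S ∪ S') T := h.mono Set.subset_union_left le_rfl
theorem Tch.ur {S S' T : Set V} (h : Tch G S T) : Tch G (S' ∪ S) T := h.mono Set.subset_union_right le_rfl

theorem caseI_aux (hG : SixFree G) {X1 X2 T U0 U1 U2 : Set V} {x : V}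
    (hc : Conn G X1 ∧ Conn G X2 ∧ Conn G T ∧ Conn G U0 ∧ Conn G U1 ∧ Conn G U2)
    (hd : [X1, X2, T, U0, U1, U2, {x}].Pairwise Disjoint)
    (hU : Tch G U0 U1 ∧ Tch G U0 U2 ∧ Tch G U1 U2 ∧ Tch G T U0 ∧ Tch G T U1 ∧ Tch G T U2)
    (hx : Tch G {x} X1 ∧ Tch G {x} X2 ∧ Tch G {x} T) (h12 : Tch G X1 X2)
    (h1 : Tch G X1 U1) (h2 : Tch G X1 U2) (h0 : Tch G X2 U0) : False := by
  simp only [List.pairwise_cons, List.mem_cons, List.not_mem_nil, or_false, forall_eq_or_imp, forall_eq] at hd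
  refine hG.k5h (A0 := X1) (A1 := T) (A2 := U0) (A3 := U1) (A4 := U2) (s0 := {x}) (s1 := X2)
    ⟨hc.1, hc.2.2.1, hc.2.2.2.1, hc.2.2.2.2.1, hc.2.2.2.2.2, conn_singleton _, hc.2.1⟩ ?_
    ⟨h1, h2, hU.2.2.2.1, hU.2.2.2.2.1, hU.2.2.2.2.2, hU.1, hU.2.1, hU.2.2.1⟩
    ⟨hx.1, hx.2.2, h12.symm, h0, hx.2.1⟩
  simp only [List.pairwise_cons, List.mem_cons, List.not_mem_nil, or_false, forall_eq_or_imp, forall_eq]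
  simp [hd, disjoint_comm (b := X2), -Set.disjoint_singleton_left, -Set.disjoint_singleton_right]

set_option maxHeartbeats 2000000 in
theorem caseI [Finite V] (hG : SixFree G) {X T U0 U1 U2 : Set V} {x y1 y2 : V}
    (hc : Conn G X ∧ Conn G T ∧ Conn G U0 ∧ Conn G U1 ∧ Conn G U2)
    (hd : [X, T, U0, U1, U2, {x}].Pairwise Disjoint)
    (hU : Tch G U0 U1 ∧ Tch G U0 U2 ∧ Tch G U1 U2 ∧ Tch G T U0 ∧ Tch G T U1 ∧ Tch G T U2)
    (hX : Tch G X U0 ∧ Tch G X U1 ∧ Tch G X U2)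
    (h1 : y1 ∈ X) (h2 : y2 ∈ X) (hne : y1 ≠ y2) (hx1 : G.Adj x y1) (hx2 : G.Adj x y2)
    (hxT : Tch G {x} T) : False := by
  obtain ⟨X1, X2, c1, c2, s1, s2, hu, hdj⟩ := hc.1.exists_partition (conn_singleton y1) (conn_singleton y2)
    (by simpa using h1) (by simpa using h2) (by simpa using hne)
  simp only [Set.singleton_subset_iff] at s1 s2
  have h12 := hc.1.tch_of_partition ⟨_, s1⟩ ⟨_, s2⟩ hu hdj
  have e1 : X1 ⊆ X := hu ▸ Set.subset_union_left
  have e2 : X2 ⊆ X := hu ▸ Set.subset_union_right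
  simp only [List.pairwise_cons, List.mem_cons, List.not_mem_nil, or_false, forall_eq_or_imp, forall_eq] at hd
  obtain ⟨⟨d1, d2, d3, d4, d5⟩, ⟨d6, d7, d8, d9⟩, ⟨d10, d11, d12⟩, ⟨d13, d14⟩, d15, -⟩ := hd
  have t1 : Tch G {x} X1 := tch_of_adj rfl s1 hx1
  have t2 : Tch G {x} X2 := tch_of_adj rfl s2 hx2
  obtain ⟨hU1, hU2, hU3, hU4, hU5, hU6⟩ := hU
  have hor : ∀ U : Set V, Tch G X U → Tch G X1 U ∨ Tch G X2 U := by
    rintro U ⟨a, ha, b, hb, hab⟩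
    rw [← hu] at ha
    exact ha.imp (fun h => ⟨a, h, b, hb, hab⟩) (fun h => ⟨a, h, b, hb, hab⟩)
  have hnall : ∀ X1 X2 : Set V, Conn G X1 → X1 ⊆ X → X2 ⊆ X → Disjoint X1 X2 → Tch G {x} X1 → ∀ y ∈ X2, G.Adj x y →
      Tch G X1 U0 → Tch G X1 U1 → Tch G X1 U2 → False := by
    intro X1 X2 c1 e1 e2 hdj t1 y hy hxy a0 a1 a2
    refine hG.k5 (A0 := X1 ∪ {x}) (A1 := T) (A2 := U0) (A3 := U1) (A4 := U2) (x := y) ⟨x, hxy.symm⟩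
      ⟨c1.union (conn_singleton _) t1.symm, hc.2⟩ ?_ ⟨hxT.ur, a0.ul, a1.ul, a2.ul, hU4, hU5, hU6, hU1, hU2, hU3⟩ ?_
    · simp only [List.pairwise_cons, List.mem_cons, List.not_mem_nil, or_false, forall_eq_or_imp, forall_eq,
        Set.disjoint_union_left]
      simp [d6, d7, d8, d10, d11, d13, d1.mono_left e1, d2.mono_left e1, d3.mono_left e1, d4.mono_left e1,
        d9.symm, d12.symm, d14.symm, d15.symm, -Set.disjoint_singleton_left, -Set.disjoint_singleton_right]
    · have := e2 hy
      refine ⟨?_, fun h => Set.disjoint_left.1 d1 this h, fun h => Set.disjoint_left.1 d2 this h,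
        fun h => Set.disjoint_left.1 d3 this h, fun h => Set.disjoint_left.1 d4 this h⟩
      rintro (h | h)
      · exact Set.disjoint_left.1 hdj h hy
      · exact hxy.ne (h.symm)
  have n1 := hnall X1 X2 c1 e1 e2 hdj t1 y2 s2 hx2
  have n2 := hnall X2 X1 c2 e2 e1 hdj.symm t2 y1 s1 hx1
  have key : ∀ X1 X2 : Set V, Conn G X1 → Conn G X2 → X1 ⊆ X → X2 ⊆ X → Disjoint X1 X2 → Tch G {x} X1 → Tch G {x} X2 →
      Tch G X1 X2 → 
      (Tch G X1 U1 → Tch G X1 U2 → Tch G X2 U0 → False) ∧ (Tch G X1 U0 → Tch G X1 U2 → Tch G X2 U1 → False) ∧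
      (Tch G X1 U0 → Tch G X1 U1 → Tch G X2 U2 → False) := by
    intro X1 X2 c1 c2 e1 e2 hdj t1 t2 h12
    refine ⟨fun b1 b2 b3 => ?_, fun b1 b2 b3 => ?_, fun b1 b2 b3 => ?_⟩
    · refine caseI_aux hG (U0 := U0) (U1 := U1) (U2 := U2) ⟨c1, c2, hc.2⟩ ?_ ⟨hU1, hU2, hU3, hU4, hU5, hU6⟩
        ⟨t1, t2, hxT⟩ h12 b1 b2 b3
      simp only [List.pairwise_cons, List.mem_cons, List.not_mem_nil, or_false, forall_eq_or_imp, forall_eq]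
      simp [d6, d7, d8, d9, d10, d11, d12, d13, d14, d15, d1.mono_left e1, d2.mono_left e1, d3.mono_left e1, d4.mono_left e1, d5.mono_left e1, d1.mono_left e2, d2.mono_left e2, d3.mono_left e2, d4.mono_left e2, d5.mono_left e2, hdj, -Set.disjoint_singleton_left, -Set.disjoint_singleton_right]
    · refine caseI_aux hG (U0 := U1) (U1 := U0) (U2 := U2) ⟨c1, c2, hc.2.1, hc.2.2.2.1, hc.2.2.1, hc.2.2.2.2⟩ ?_ ⟨hU1.symm, hU3, hU2, hU5, hU4, hU6⟩
        ⟨t1, t2, hxT⟩ h12 b1 b2 b3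
      simp only [List.pairwise_cons, List.mem_cons, List.not_mem_nil, or_false, forall_eq_or_imp, forall_eq]
      simp [d6, d7, d8, d9, d10.symm, d11, d12, d13, d14, d15, d1.mono_left e1, d2.mono_left e1, d3.mono_left e1, d4.mono_left e1, d5.mono_left e1, d1.mono_left e2, d2.mono_left e2, d3.mono_left e2, d4.mono_left e2, d5.mono_left e2, hdj, -Set.disjoint_singleton_left, -Set.disjoint_singleton_right]
    · refine caseI_aux hG (U0 := U2) (U1 := U0) (U2 := U1) ⟨c1, c2, hc.2.1, hc.2.2.2.2, hc.2.2.1, hc.2.2.2.1⟩ ?_ ⟨hU2.symm, hU3.symm, hU1, hU6, hU4, hU5⟩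
        ⟨t1, t2, hxT⟩ h12 b1 b2 b3
      simp only [List.pairwise_cons, List.mem_cons, List.not_mem_nil, or_false, forall_eq_or_imp, forall_eq]
      simp [d6, d7, d8, d9, d10, d11.symm, d12, d13.symm, d14, d15, d1.mono_left e1, d2.mono_left e1, d3.mono_left e1, d4.mono_left e1, d5.mono_left e1, d1.mono_left e2, d2.mono_left e2, d3.mono_left e2, d4.mono_left e2, d5.mono_left e2, hdj, -Set.disjoint_singleton_left, -Set.disjoint_singleton_right]
  obtain ⟨k1, k2, k3⟩ := key X1 X2 c1 c2 e1 e2 hdj t1 t2 h12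
  obtain ⟨k4, k5, k6⟩ := key X2 X1 c2 c1 e2 e1 hdj.symm t2 t1 h12.symm
  have r0 := hor _ hX.1
  have r1 := hor _ hX.2.1
  have r2 := hor _ hX.2.2
  rcases r0 with r0 | r0 <;> rcases r1 with r1 | r1 <;> rcases r2 with r2 | r2
  · exact n1 r0 r1 r2
  · exact k3 r0 r1 r2
  · exact k2 r0 r2 r1
  · exact k4 r1 r2 r0
  · exact k1 r1 r2 r0
  · exact k5 r0 r2 r1
  · exact k6 r0 r1 r2
  · exact n2 r0 r1 r2

theorem fin5_rest : ∀ i t t' : Fin 5, t ≠ i → t' ≠ i → t ≠ t' → ∃ r r', r ≠ i ∧ r ≠ t ∧ r ≠ t' ∧ r' ≠ i ∧ r' ≠ t ∧ r' ≠ t' ∧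
    r ≠ r' ∧ ∀ j, j = i ∨ j = t ∨ j = t' ∨ j = r ∨ j = r' := by decide

theorem K5_adj {i j : Fin 5} (h : i ≠ j) : K5.Adj i j := by simpa [K5] using h

theorem split22 {B : Fin 5 → Set V} (hB : Model K5 G B) {i a b c d : Fin 5} {X Z : Set V} (hX : Conn G X) (hZ : Conn G Z)
    (hXZ : Tch G X Z) (hu : X ∪ Z = B i) (hdj : Disjoint X Z)
    (hia : i ≠ a) (hib : i ≠ b) (hic : i ≠ c) (hid : i ≠ d) (hab : a ≠ b) (hac : a ≠ c) (had : a ≠ d) (hbc : b ≠ c) (hbd : b ≠ d) (hcd : c ≠ d)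
    (za : Tch G Z (B a)) (zb : Tch G Z (B b)) (xc : Tch G X (B c)) (xd : Tch G X (B d)) :
    Model K33 G (Sum.elim ![X, B a, B b] ![Z, B c, B d]) := by
  have e1 : X ⊆ B i := hu ▸ Set.subset_union_left
  have e2 : Z ⊆ B i := hu ▸ Set.subset_union_right
  refine mk33 ⟨hX, hB.conn _, hB.conn _, hZ, hB.conn _, hB.conn _⟩ ?_
    ⟨hXZ, xc, xd, za.symm, hB.adj (K5_adj hac), hB.adj (K5_adj had), zb.symm, hB.adj (K5_adj hbc), hB.adj (K5_adj hbd)⟩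
  simp only [List.pairwise_cons, List.mem_cons, List.not_mem_nil, or_false, forall_eq_or_imp, forall_eq]
  simp [hB.disj hab, hB.disj hac, hB.disj had, hB.disj hbc, hB.disj hbd, hB.disj hcd, hdj,
    (hB.disj hia).mono_left e1, (hB.disj hib).mono_left e1, (hB.disj hic).mono_left e1, (hB.disj hid).mono_left e1,
    ((hB.disj hia).mono_left e2).symm, ((hB.disj hib).mono_left e2).symm, (hB.disj hic).mono_left e2, (hB.disj hid).mono_left e2]

theorem contr33_of_model {B : Fin 3 ⊕ Fin 3 → Set V} (hB : Model K33 G B) {u v : V} {i} (hu : u ∈ B i) (hv : v ∈ B i) :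
    Contr33 G u v := by
  have key : ∀ i : Fin 3 ⊕ Fin 3, ∃ σ : Fin 3 ⊕ Fin 3 → Fin 3 ⊕ Fin 3, Function.Injective σ ∧
      (∀ a b, K33.Adj a b → K33.Adj (σ a) (σ b)) ∧ σ (.inl 0) = i := by
    rintro (i | i)
    · refine ⟨Sum.map (Equiv.swap 0 i) id, ?_, ?_, by simp⟩
      · exact Sum.map_injective.2 ⟨Equiv.injective _, Function.injective_id⟩
      · rintro (a | a) (b | b) <;> simp [K33]
    · refine ⟨fun x => (Sum.map (Equiv.swap 0 i) id x).swap, ?_, ?_, by simp⟩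
      · exact (Equiv.sumComm _ _).injective.comp (Sum.map_injective.2 ⟨Equiv.injective _, Function.injective_id⟩)
      · rintro (a | a) (b | b) <;> simp [K33]
  obtain ⟨σ, h1, h2, h3⟩ := key i
  refine ⟨fun a => B (σ (.inl a)), fun a => B (σ (.inr a)), ?_, by simpa [h3] using hu, by simpa [h3] using hv⟩
  have := hB.reindex (K' := K33) σ h1 h2
  have e : (Sum.elim (fun a => B (σ (.inl a))) fun a => B (σ (.inr a))) = fun i => B (σ i) := by
    ext x; cases x <;> rfl
  rw [e]; exact this

/-- splitting a branch set of a `K5` model into two connected pieces -/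
theorem split5 (hG : SixFree G) {B : Fin 5 → Set V} (hB : Model K5 G B) {i : Fin 5} {X Z : Set V} (hX : Conn G X) (hZ : Conn G Z)
    (hu : X ∪ Z = B i) (hdj : Disjoint X Z) (hBi : Conn G (B i)) {u v : V}
    (huv : (u ∈ X ∧ v ∈ X) ∨ ∃ j, j ≠ i ∧ u ∈ B j ∧ v ∈ B j) (hcore : ∀ x ∈ B i, x ∈ core G) :
    Contr33 G u v ∨ (∃ t, t ≠ i ∧ Tch G Z (B t) ∧ (∀ j, j ≠ i → Tch G Z (B j) → j = t) ∧ ∀ j, j ≠ i → j ≠ t → Tch G X (B j)) ∨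
      (∃ t, t ≠ i ∧ Tch G X (B t) ∧ (∀ j, j ≠ i → Tch G X (B j) → j = t) ∧ ∀ j, j ≠ i → j ≠ t → Tch G Z (B j)) := by
  have hXZ := hBi.tch_of_partition hX.nonempty hZ.nonempty hu hdj
  have e1 : X ⊆ B i := hu ▸ Set.subset_union_left
  have e2 : Z ⊆ B i := hu ▸ Set.subset_union_right
  have hor : ∀ j, j ≠ i → Tch G X (B j) ∨ Tch G Z (B j) := by
    intro j hj
    obtain ⟨a, ha, b, hb, hab⟩ := hB.adj (K5_adj hj.symm)
    rw [← hu] at ha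
    exact ha.imp (fun h => ⟨a, h, b, hb, hab⟩) (fun h => ⟨a, h, b, hb, hab⟩)
  have hnall : ∀ X Z : Set V, Conn G X → Z.Nonempty → X ⊆ B i → Z ⊆ B i → Disjoint X Z → ∃ t, t ≠ i ∧ ¬ Tch G X (B t) := by
    intro X Z hX hZ e1 e2 hd
    by_contra hcon
    push Not at hcon
    obtain ⟨z, hz⟩ := hZ
    refine hG.crit5 (B := fun j => if j = i then X else B j) ⟨?_, ?_, ?_⟩ (hcore z (e2 hz)) ?_
    · intro j; split_ifs; exacts [hX, hB.conn j]
    · intro j j' hjj; split_ifs with h1 h2 h2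
      · exact absurd (h1.trans h2.symm) hjj
      · exact (hB.disj (Ne.symm h2)).mono_left e1
      · exact (hB.disj h1).mono_right e1
      · exact hB.disj hjj
    · intro j j' hjj; split_ifs with h1 h2 h2
      · exact absurd (h1.trans h2.symm) hjj.ne
      · exact hcon _ h2
      · exact (hcon _ h1).symm
      · exact hB.adj hjj
    · intro j; split_ifs with h1
      · exact fun h => Set.disjoint_left.1 hd h hz
      · exact fun h => h1 (hB.eq_of_mem h (e2 hz))
  obtain ⟨t', ht'i, ht'⟩ := hnall X Z hX hZ.nonempty e1 e2 hdj
  obtain ⟨t, hti, ht⟩ := hnall Z X hZ hX.nonempty e2 e1 hdj.symm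
  have hXt := (hor t hti).resolve_right ht
  have hZt := (hor t' ht'i).resolve_left ht'
  have htt : t ≠ t' := by rintro rfl; exact ht hZt
  obtain ⟨r, r', hr1, hr2, hr3, hr4, hr5, hr6, hrr, hall⟩ := fin5_rest i t t' hti ht'i htt
  have hcontr : ∀ r r', r ≠ i → r ≠ t → r ≠ t' → r' ≠ i → r' ≠ t → r' ≠ t' → r ≠ r' → (∀ j, j = i ∨ j = t ∨ j = t' ∨ j = r ∨ j = r') →
      Tch G X (B r) → Tch G Z (B r') → Contr33 G u v := by
    intro r r' hr1 hr2 hr3 hr4 hr5 hr6 hrr hall h1 h2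
    have hM := split22 hB hX hZ hXZ hu hdj ht'i.symm hr4.symm hti.symm hr1.symm hr6.symm htt.symm hr3.symm hr5 hrr.symm hr2.symm hZt h2 hXt h1
    rcases huv with ⟨h3, h4⟩ | ⟨j, hj, h3, h4⟩
    · exact contr33_of_model hM (i := .inl 0) h3 h4
    · rcases hall j with rfl | rfl | rfl | rfl | rfl
      · exact absurd rfl hj
      · exact contr33_of_model hM (i := .inr 1) h3 h4
      · exact contr33_of_model hM (i := .inl 1) h3 h4
      · exact contr33_of_model hM (i := .inr 2) h3 h4
      · exact contr33_of_model hM (i := .inl 2) h3 h4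
  have hc1 := hcontr r r' hr1 hr2 hr3 hr4 hr5 hr6 hrr hall
  have hc2 := hcontr r' r hr4 hr5 hr6 hr1 hr2 hr3 hrr.symm (fun j => by rcases hall j with h | h | h | h | h <;> simp [h])
  have o1 := hor r hr1
  have o2 := hor r' hr4
  by_cases z1 : Tch G Z (B r)
  · by_cases x2 : Tch G X (B r')
    · exact Or.inl (hc2 x2 z1)
    · have z2 := o2.resolve_left x2
      by_cases x1 : Tch G X (B r)
      · exact Or.inl (hc1 x1 z2)
      · right; right
        refine ⟨t, hti, hXt, fun j hj h => ?_, fun j hj hjt => ?_⟩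
        · rcases hall j with rfl | rfl | rfl | rfl | rfl <;> first | rfl | contradiction
        · rcases hall j with rfl | rfl | rfl | rfl | rfl <;> first | assumption | contradiction
  · have x1 := o1.resolve_right z1
    by_cases z2 : Tch G Z (B r')
    · exact Or.inl (hc1 x1 z2)
    · have x2 := o2.resolve_right z2
      right; left
      refine ⟨t', ht'i, hZt, fun j hj h => ?_, fun j hj hjt => ?_⟩
      · rcases hall j with rfl | rfl | rfl | rfl | rfl <;> first | rfl | contradiction
      · rcases hall j with rfl | rfl | rfl | rfl | rfl <;> first | assumption | contradiction

end FOne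

open SimpleGraph
set_option linter.unusedVariables false

section FOneB

variable {V : Type*} {G : SimpleGraph V}

def H6 : SimpleGraph (Fin 6) where
  Adj a b := a ≠ b ∧ (a, b) ∉ [((0 : Fin 6), (1 : Fin 6)), (1, 0), (0, 2), (2, 0), (1, 3), (3, 1)]
  symm := ⟨by decide⟩
  loopless := ⟨by decide⟩

instance : DecidableRel H6.Adj := fun a b => by unfold H6; infer_instance

def L6 (a b : Fin 6) : ZMod 2 := if a < b then 1 else 0

def Y6 (a b c : Fin 6) : ZMod 2 :=
  if (min a b, max a b, c) ∈ [((0 : Fin 6), (3 : Fin 6), (1 : Fin 6)), (0, 3, 2), (0, 4, 5), (2, 5, 1), (3, 5, 4), (3, 5, 0)]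
    then 1 else 0

theorem H6_planar : Planar H6 := by
  refine planar_of_cert (L := L6) (Y := Y6) ?_ (by decide)
  have h : ∀ a b c d : Fin 6, (H6.Adj a b ∧ H6.Adj c d ∧ a ≠ c ∧ a ≠ d ∧ b ≠ c ∧ b ≠ d) →
    (L6 a c + L6 b c + L6 a d + L6 b d + Y6 a b c + Y6 a b d + Y6 c d a + Y6 c d b : ZMod 2) = 0 := by
    decide +kernel
  intro a b c d h1 h2 h3 h4 h5 h6
  exact h a b c d ⟨h1, h2, h3, h4, h5, h6⟩

theorem k5_nall (hG : SixFree G) {B : Fin 5 → Set V} (hB : Model K5 G B) {i : Fin 5} {X : Set V} {z : V}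
    (hX : Conn G X) (hz : z ∈ B i) (e1 : X ⊆ B i) (hzX : z ∉ X) (hcon : ∀ t, t ≠ i → Tch G X (B t)) : False := by
  have hcore : z ∈ core G := by
    by_contra h
    have h' : ∀ y, ¬ G.Adj z y := fun y hy => h ⟨y, hy⟩
    obtain ⟨j, hj⟩ := exists_ne i
    exact hB.not_mem_of_isolated h' (K5_adj hj.symm) hz
  refine hG.crit5 (B := fun j => if j = i then X else B j) ⟨?_, ?_, ?_⟩ hcore ?_
  · intro j; split_ifs; exacts [hX, hB.conn j]
  · intro j j' hjj; split_ifs with h1 h2 h2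
    · exact absurd (h1.trans h2.symm) hjj
    · exact (hB.disj (Ne.symm h2)).mono_left e1
    · exact (hB.disj h1).mono_right e1
    · exact hB.disj hjj
  · intro j j' hjj; split_ifs with h1 h2 h2
    · exact absurd (h1.trans h2.symm) hjj.ne
    · exact hcon _ h2
    · exact (hcon _ h1).symm
    · exact hB.adj hjj
  · intro j; split_ifs with h1
    · exact hzX
    · exact fun h => h1 (hB.eq_of_mem h hz)

theorem k5_core {B : Fin 5 → Set V} (hB : Model K5 G B) {i : Fin 5} {z : V} (hz : z ∈ B i) : z ∈ core G := by
  by_contra h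
  have h' : ∀ y, ¬ G.Adj z y := fun y hy => h ⟨y, hy⟩
  obtain ⟨j, hj⟩ := exists_ne i
  exact hB.not_mem_of_isolated h' (K5_adj hj.symm) hz

theorem fin5_rest1 : ∀ i t : Fin 5, t ≠ i → ∃ a b c : Fin 5, a ≠ i ∧ b ≠ i ∧ c ≠ i ∧ a ≠ t ∧ b ≠ t ∧ c ≠ t ∧ a ≠ b ∧ a ≠ c ∧ b ≠ c := by
  decide

theorem f1_leaf [Finite V] (hG : SixFree G) (hdeg : ∀ x ∈ core G, ∀ y w, ∃ t, G.Adj x t ∧ t ≠ y ∧ t ≠ w)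
    {B : Fin 5 → Set V} (hB : Model K5 G B) {i t : Fin 5} {x : V} (hx : x ∈ B i) (hX : Conn G (B i \ {x}))
    (hti : t ≠ i) (ht : Tch G {x} (B t)) (hone : ∀ j, j ≠ i → Tch G {x} (B j) → j = t)
    (hrest : ∀ j, j ≠ i → j ≠ t → Tch G (B i \ {x}) (B j)) : False := by
  have hu : (B i \ {x}) ∪ {x} = B i := by
    ext y; by_cases h : y = x <;> simp [h, hx]
  have htch := (hB.conn i).tch_of_partition hX.nonempty (Set.singleton_nonempty x) hu Set.disjoint_sdiff_left
  obtain ⟨na, hna, x', hx', hxa⟩ := htch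
  obtain ⟨x'', hx'', nb, hnb, hxb⟩ := ht
  simp only [Set.mem_singleton_iff] at hx' hx''
  rw [hx'] at hxa
  rw [hx''] at hxb
  obtain ⟨nc, hxc, hca, hcb⟩ := hdeg x (k5_core hB hx) na nb
  obtain ⟨j, hj⟩ := hG.c5 B hB nc ⟨x, hxc.symm⟩
  obtain ⟨a, b, c, ha, hb, hc, hat, hbt, hct, hab, hac, hbc⟩ := fin5_rest1 i t hti
  have hsub : B i \ {x} ⊆ B i := Set.sdiff_subset
  have dxj : ∀ j, j ≠ i → Disjoint (B j) {x} := fun j hj => by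
    rw [Set.disjoint_singleton_right]; exact fun h => hj (hB.eq_of_mem h hx)
  have dX : ∀ j, j ≠ i → Disjoint (B i \ {x}) (B j) := fun j hj => (hB.disj hj.symm).mono_left hsub
  have hU : Tch G (B a) (B b) ∧ Tch G (B a) (B c) ∧ Tch G (B b) (B c) := ⟨hB.adj (K5_adj hab), hB.adj (K5_adj hac), hB.adj (K5_adj hbc)⟩
  have hT : Tch G (B t) (B a) ∧ Tch G (B t) (B b) ∧ Tch G (B t) (B c) :=
    ⟨hB.adj (K5_adj hat.symm), hB.adj (K5_adj hbt.symm), hB.adj (K5_adj hct.symm)⟩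
  have hXX : Tch G (B i \ {x}) (B a) ∧ Tch G (B i \ {x}) (B b) ∧ Tch G (B i \ {x}) (B c) :=
    ⟨hrest a ha hat, hrest b hb hbt, hrest c hc hct⟩
  by_cases hji : j = i
  · subst hji
    refine caseI hG (X := B j \ {x}) (T := B t) (U0 := B a) (U1 := B b) (U2 := B c) (x := x) (y1 := na) (y2 := nc)
      ⟨hX, hB.conn _, hB.conn _, hB.conn _, hB.conn _⟩ ?_ ⟨hU.1, hU.2.1, hU.2.2, hT⟩ hXX hna ⟨hj, fun h => hxc.ne h.symm⟩
      hca.symm hxa.symm hxc ⟨x, rfl, nb, hnb, hxb⟩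
    simp only [List.pairwise_cons, List.mem_cons, List.not_mem_nil, or_false, forall_eq_or_imp, forall_eq]
    refine ⟨⟨dX t hti, dX a ha, dX b hb, dX c hc, Set.disjoint_sdiff_left⟩, ⟨hB.disj hat.symm, hB.disj hbt.symm, hB.disj hct.symm, dxj _ hti⟩,
      ⟨hB.disj hab, hB.disj hac, dxj _ ha⟩, ⟨hB.disj hbc, dxj _ hb⟩, dxj _ hc, by simp⟩
  · have hjt := hone j hji ⟨x, rfl, nc, hj, hxc⟩
    subst hjt
    refine caseI hG (X := B j) (T := B i \ {x}) (U0 := B a) (U1 := B b) (U2 := B c) (x := x) (y1 := nb) (y2 := nc)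
      ⟨hB.conn _, hX, hB.conn _, hB.conn _, hB.conn _⟩ ?_ ⟨hU.1, hU.2.1, hU.2.2, hXX⟩ hT hnb hj
      hcb.symm hxb hxc ⟨x, rfl, na, hna, hxa.symm⟩
    simp only [List.pairwise_cons, List.mem_cons, List.not_mem_nil, or_false, forall_eq_or_imp, forall_eq]
    refine ⟨⟨(dX j hti).symm, hB.disj hat.symm, hB.disj hbt.symm, hB.disj hct.symm, dxj _ hti⟩, ⟨dX a ha, dX b hb, dX c hc, Set.disjoint_sdiff_left⟩,
      ⟨hB.disj hab, hB.disj hac, dxj _ ha⟩, ⟨hB.disj hbc, dxj _ hb⟩, dxj _ hc, by simp⟩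

theorem f1_other [Finite V] (hG : SixFree G) (hdeg : ∀ x ∈ core G, ∀ y w, ∃ t, G.Adj x t ∧ t ≠ y ∧ t ≠ w)
    {B : Fin 5 → Set V} (hB : Model K5 G B) {u v : V} {i j : Fin 5} (hu : u ∈ B i) (hv : v ∈ B i) (hC : ¬ Contr33 G u v)
    (hj : j ≠ i) : ∃ b, B j = {b} := by
  obtain ⟨b, hb⟩ := (hB.conn j).nonempty
  refine ⟨b, ?_⟩
  by_contra hne
  have key : ∀ y ∈ B j, ∃ x ∈ B j, x ≠ y ∧ ∃ t, t ≠ j ∧ ∀ k, k ≠ j → k ≠ t → ¬ Tch G (B j \ {x}) (B k) ∧ Tch G {x} (B k) := by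
    intro y hy
    obtain ⟨x, hx, hxy, hX, -⟩ := (hB.conn j).exists_leaf (conn_singleton y) (by simpa using hy) (by
      rintro h
      rw [← h] at hb
      exact hne (h ▸ (by rw [Set.mem_singleton_iff.1 hb])))
    refine ⟨x, hx, by simpa using hxy, ?_⟩
    have huu : (B j \ {x}) ∪ {x} = B j := by
      ext y; by_cases h : y = x <;> simp [h, hx]
    rcases split5 hG hB (u := u) (v := v) hX (conn_singleton x) huu Set.disjoint_sdiff_left (hB.conn j) (Or.inr ⟨i, hj.symm, hu, hv⟩)
      (fun z hz => k5_core hB hz) with h | ⟨t, ht, h1, h2, h3⟩ | ⟨t, ht, h1, h2, h3⟩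
    · exact absurd h hC
    · exact absurd (f1_leaf hG hdeg hB hx hX ht h1 h2 h3) id
    · exact ⟨t, ht, fun k hk hkt => ⟨fun h => hkt (h2 k hk h), h3 k hk hkt⟩⟩
  obtain ⟨x, hx, -, t, ht, h1⟩ := key b hb
  obtain ⟨y, hy, hyx, t', ht', h2⟩ := key x hx
  have : ∀ j t t' : Fin 5, ∃ k, k ≠ j ∧ k ≠ t ∧ k ≠ t' := by decide
  obtain ⟨k, hk, hkt, hkt'⟩ := this j t t'
  exact (h2 k hk hkt').1 ((h1 k hk hkt).2.mono (by simp [hx, hyx.symm]) le_rfl)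

theorem f1_self [Finite V] (hG : SixFree G) (hdeg : ∀ x ∈ core G, ∀ y w, ∃ t, G.Adj x t ∧ t ≠ y ∧ t ≠ w)
    {B : Fin 5 → Set V} (hB : Model K5 G B) {u v : V} (huv : G.Adj u v) {i : Fin 5} (hu : u ∈ B i) (hv : v ∈ B i) (hC : ¬ Contr33 G u v) :
    B i = {u, v} := by
  by_contra hne
  obtain ⟨x, hx, hxy, hX, -⟩ := (hB.conn i).exists_leaf (conn_pair huv) (by simp [Set.insert_subset_iff, hu, hv]) (Ne.symm hne)
  have huu : (B i \ {x}) ∪ {x} = B i := by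
    ext y; by_cases h : y = x <;> simp [h, hx]
  have hux : u ≠ x := by rintro rfl; simp at hxy
  have hvx : v ≠ x := by rintro rfl; simp at hxy
  rcases split5 hG hB (u := u) (v := v) hX (conn_singleton x) huu Set.disjoint_sdiff_left (hB.conn i) (Or.inl ⟨⟨hu, hux⟩, ⟨hv, hvx⟩⟩)
      (fun z hz => k5_core hB hz) with h | ⟨t, ht, h1, h2, h3⟩ | ⟨t, ht, h1, h2, h3⟩
  · exact hC h
  · exact f1_leaf hG hdeg hB hx hX ht h1 h2 h3
  · obtain ⟨b, hb⟩ := f1_other hG hdeg hB hu hv hC ht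
    have htch := (hB.conn i).tch_of_partition hX.nonempty (Set.singleton_nonempty x) huu Set.disjoint_sdiff_left
    obtain ⟨na, hna, x', hx', hxa⟩ := htch
    obtain ⟨nb, hnb, b', hb', hbb⟩ := h1
    rw [hb, Set.mem_singleton_iff] at hb'
    rw [Set.mem_singleton_iff] at hx'
    rw [hx'] at hxa
    rw [hb'] at hbb
    have hleg : Leg G x (B i \ {x}) b := Or.inr ⟨hX, ⟨na, hna, hxa.symm⟩, nb, hnb, hbb⟩
    obtain ⟨L', hL, hleg'⟩ := Leg.shorten _ rfl hleg hX.nonempty (by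
      intro z hz s hs
      obtain ⟨j, hj⟩ := hG.c5 B hB s ⟨z, hs.symm⟩
      by_cases hji : j = i
      · subst hji
        by_cases hsx : s = x
        · exact Or.inr (Or.inl hsx)
        · exact Or.inl ⟨hj, hsx⟩
      · have := h2 j hji ⟨z, hz, s, hj, hs⟩
        subst this
        rw [hb] at hj
        exact Or.inr (Or.inr hj)) (fun z hz => hdeg z (k5_core hB hz.1))
    obtain ⟨z, hz, hzL⟩ := Set.exists_of_ssubset hL
    have hx1 : x ∈ L' ∪ {x} := Or.inr rfl
    refine k5_nall hG hB (i := i) (X := L' ∪ {x}) (z := z) ?_ hz.1 ?_ ?_ ?_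
    · rcases hleg' with ⟨h, -⟩ | ⟨hc, ⟨y, hy, hxy⟩, -⟩
      · subst h; simpa using conn_singleton x
      · exact hc.union (conn_singleton x) ⟨y, hy, x, rfl, hxy.symm⟩
    · rintro y (hy | hy)
      · exact (hL.1 hy).1
      · rw [Set.mem_singleton_iff.1 hy]; exact hx
    · rintro (h | h)
      · exact hzL h
      · exact hz.2 h
    · intro k hk
      by_cases hkt : k = t
      · subst hkt
        rcases hleg' with ⟨h, h'⟩ | ⟨hc, -, y, hy, hyb⟩
        · exact ⟨x, hx1, b, by simp [hb], h'⟩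
        · exact ⟨y, Or.inl hy, b, by simp [hb], hyb⟩
      · exact (h3 k hk hkt).ur

/-- F1: a contraction model of `K5` yields one of `K33`. -/
theorem f1 [Finite V] (hG : SixFree G) (hdeg : ∀ x ∈ core G, ∀ y w, ∃ t, G.Adj x t ∧ t ≠ y ∧ t ≠ w)
    {B : Fin 5 → Set V} (hB : Model K5 G B) {u v : V} (huv : G.Adj u v) {i : Fin 5} (hu : u ∈ B i) (hv : v ∈ B i)
    (hnp : ¬ Planar (G.deleteEdges {s(u, v)})) : Contr33 G u v := by
  by_contra hC
  have hi := f1_self hG hdeg hB huv hu hv hC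
  have hj : ∀ j, ∃ b, j ≠ i → B j = {b} := fun j => by
    by_cases hji : j = i
    · exact ⟨u, fun h => absurd hji h⟩
    · obtain ⟨b, hb⟩ := f1_other hG hdeg hB hu hv hC hji
      exact ⟨b, fun _ => hb⟩
  choose b hb using hj
  have h1 : ∃ t, t ≠ i ∧ ¬ G.Adj u (b t) := by
    by_contra hcon
    push Not at hcon
    exact k5_nall hG hB (i := i) (X := {u}) (z := v) (conn_singleton u) hv (by simpa using hu) (by simpa using huv.ne.symm)
      (fun t ht => ⟨u, rfl, b t, by simp [hb t ht], hcon t ht⟩)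
  have h2 : ∃ t, t ≠ i ∧ ¬ G.Adj v (b t) := by
    by_contra hcon
    push Not at hcon
    exact k5_nall hG hB (i := i) (X := {v}) (z := u) (conn_singleton v) hu (by simpa using hv) (by simpa using huv.ne)
      (fun t ht => ⟨v, rfl, b t, by simp [hb t ht], hcon t ht⟩)
  obtain ⟨t, hti, ht⟩ := h1
  obtain ⟨t', hti', ht'⟩ := h2
  have htt : t ≠ t' := by
    rintro rfl
    obtain ⟨x, hx, y, hy, hxy⟩ := hB.adj (K5_adj hti.symm)
    rw [hb t hti, Set.mem_singleton_iff] at hy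
    rw [hi] at hx
    subst hy
    rcases hx with rfl | rfl
    · exact ht hxy
    · exact ht' hxy
  obtain ⟨r, r', hr1, hr2, hr3, hr4, hr5, hr6, hrr, hall⟩ := fin5_rest i t t' hti hti' htt
  let g : Fin 6 → V := ![u, v, b t, b t', b r, b r']
  have hsurj : ∀ x ∈ core G, ∃ k, g k = x := by
    intro x hx
    obtain ⟨j, hj⟩ := hG.c5 B hB x hx
    rcases hall j with h | h | h | h | h
    · subst h; rw [hi] at hj
      rcases hj with h | h
      · exact ⟨0, h.symm⟩
      · exact ⟨1, (Set.mem_singleton_iff.1 h).symm⟩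
    · subst h; rw [hb _ hti] at hj; exact ⟨2, (Set.mem_singleton_iff.1 hj).symm⟩
    · subst h; rw [hb _ hti'] at hj; exact ⟨3, (Set.mem_singleton_iff.1 hj).symm⟩
    · subst h; rw [hb _ hr1] at hj; exact ⟨4, (Set.mem_singleton_iff.1 hj).symm⟩
    · subst h; rw [hb _ hr4] at hj; exact ⟨5, (Set.mem_singleton_iff.1 hj).symm⟩
  have hadj : ∀ k l, (G.deleteEdges {s(u, v)}).Adj (g k) (g l) → H6.Adj k l := by
    intro k l h
    have hne : k ≠ l := by rintro rfl; exact h.ne rfl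
    rw [deleteEdges_adj, Set.mem_singleton_iff] at h
    refine ⟨hne, ?_⟩
    intro hmem
    simp only [List.mem_cons, Prod.mk.injEq, List.not_mem_nil, or_false] at hmem
    rcases hmem with ⟨rfl, rfl⟩ | ⟨rfl, rfl⟩ | ⟨rfl, rfl⟩ | ⟨rfl, rfl⟩ | ⟨rfl, rfl⟩ | ⟨rfl, rfl⟩
    · exact h.2 rfl
    · exact h.2 Sym2.eq_swap
    · exact ht h.1
    · exact ht h.1.symm
    · exact ht' h.1
    · exact ht' h.1.symm
  have hcs : ∀ x : core (G.deleteEdges {s(u, v)}), ∃ k, g k = x := fun x => by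
    obtain ⟨y, hy⟩ := x.2
    exact hsurj _ ⟨y, (deleteEdges_adj.1 hy).1⟩
  choose f hf using hcs
  refine not_planar_trans (not_planar_core hnp) (isMinor_emb (H := (G.deleteEdges {s(u, v)}).induce (core (G.deleteEdges {s(u, v)}))) (G := H6) f ?_ ?_)
    H6_planar
  · intro x y hxy
    apply Subtype.ext
    rw [← hf x, ← hf y, hxy]
  · intro x y hxy
    apply hadj
    rw [hf, hf]
    exact hxy

end FOneB

open SimpleGraph
set_option linter.unusedVariables false

section Paths

variable {V : Type*} {G : SimpleGraph V}

structure PathOn (G : SimpleGraph V) (r : ℤ → V) (k : ℤ) : Prop where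
  nn : 0 ≤ k
  adj : ∀ i, 0 ≤ i → i < k → G.Adj (r i) (r (i + 1))
  inj : ∀ i j, 0 ≤ i → i ≤ k → 0 ≤ j → j ≤ k → r i = r j → i = j

def cat (p : ℤ → V) (a : ℤ) (p' : ℤ → V) : ℤ → V := fun i => if i ≤ a then p i else p' (i - a - 1)

theorem cat_le {p p' : ℤ → V} {a i : ℤ} (h : i ≤ a) : cat p a p' i = p i := by simp [cat, h]
theorem cat_gt {p p' : ℤ → V} {a i : ℤ} (h : a < i) : cat p a p' i = p' (i - a - 1) := by simp [cat, not_le.2 h]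
theorem cat_add {p p' : ℤ → V} {a i : ℤ} (h : 0 ≤ i) : cat p a p' (a + i + 1) = p' i := by
  rw [cat_gt (by omega)]; congr 1; omega

theorem PathOn.concat {p p' : ℤ → V} {a b : ℤ} (hp : PathOn G p a) (hp' : PathOn G p' b) (h : G.Adj (p a) (p' 0))
    (hd : ∀ i j, 0 ≤ i → i ≤ a → 0 ≤ j → j ≤ b → p i ≠ p' j) : PathOn G (cat p a p') (a + b + 1) := by
  have h1 := hp.nn
  have h2 := hp'.nn
  refine ⟨by omega, ?_, ?_⟩
  · intro i hi hib
    rcases lt_trichotomy i a with hia | hia | hia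
    · rw [cat_le hia.le, cat_le (by omega)]
      exact hp.adj i hi hia
    · subst hia
      rw [cat_le le_rfl, cat_gt (by omega)]
      simpa using h
    · rw [cat_gt hia, cat_gt (by omega)]
      have := hp'.adj (i - a - 1) (by omega) (by omega)
      rwa [show i - a - 1 + 1 = i + 1 - a - 1 by omega] at this
  · intro i j hi hib hj hjb hij
    rcases le_or_gt i a with hia | hia <;> rcases le_or_gt j a with hja | hja
    · rw [cat_le hia, cat_le hja] at hij
      exact hp.inj i j hi hia hj hja hij
    · rw [cat_le hia, cat_gt hja] at hij
      exact absurd hij (hd _ _ hi hia (by omega) (by omega))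
    · rw [cat_gt hia, cat_le hja] at hij
      exact absurd hij.symm (hd _ _ hj hja (by omega) (by omega))
    · rw [cat_gt hia, cat_gt hja] at hij
      have := hp'.inj _ _ (by omega) (by omega) (by omega) (by omega) hij
      omega

theorem cat_mem {p p' : ℤ → V} {a b : ℤ} {S T : Set V} (h : ∀ i, 0 ≤ i → i ≤ a → p i ∈ S)
    (h' : ∀ i, 0 ≤ i → i ≤ b → p' i ∈ T) : ∀ i, 0 ≤ i → i ≤ a + b + 1 → cat p a p' i ∈ S ∪ T := by
  intro i hi hib
  rcases le_or_gt i a with hia | hia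
  · rw [cat_le hia]; exact Or.inl (h i hi hia)
  · rw [cat_gt hia]; exact Or.inr (h' _ (by omega) (by omega))

theorem PathOn.rev {p : ℤ → V} {k : ℤ} (hp : PathOn G p k) : PathOn G (fun i => p (k - i)) k := by
  refine ⟨hp.nn, ?_, ?_⟩
  · intro i hi hik
    have := (hp.adj (k - i - 1) (by omega) (by omega)).symm
    rwa [show k - i - 1 + 1 = k - i by omega, show k - i - 1 = k - (i + 1) by omega] at this
  · intro i j hi hik hj hjk h
    have := hp.inj _ _ (by omega) (by omega) (by omega) (by omega) h
    omega

theorem pathOn_single (x : V) : PathOn G (fun _ => x) 0 :=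
  ⟨le_rfl, fun i h1 h2 => by omega, fun i j h1 h2 h3 h4 _ => by omega⟩

theorem Conn.exists_path {S : Set V} (h : Conn G S) {x y : V} (hx : x ∈ S) (hy : y ∈ S) :
    ∃ (k : ℤ) (r : ℤ → V), PathOn G r k ∧ r 0 = x ∧ r k = y ∧ ∀ i, 0 ≤ i → i ≤ k → r i ∈ S := by
  classical
  obtain ⟨p, hp⟩ := h.exists_walk hx hy
  refine ⟨p.bypass.length, fun i => p.bypass.getVert i.toNat, ⟨by omega, ?_, ?_⟩, by simp, by simp, ?_⟩
  · intro i h0 h1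
    have := p.bypass.adj_getVert_succ (i := i.toNat) (by omega)
    rwa [show (i + 1).toNat = i.toNat + 1 by omega]
  · intro i j h0 h1 h2 h3 h4
    have := p.bypass_isPath.getVert_injOn (show i.toNat ≤ _ by omega) (show j.toNat ≤ _ by omega) h4
    omega
  · intro i h0 h1
    exact hp _ (p.support_bypass_subset_support (p.bypass.getVert_mem_support _))

/-- the image of an integer interval -/
def im (r : ℤ → V) (a b : ℤ) : Set V := r '' Set.Ico a b

theorem mem_im {r : ℤ → V} {a b : ℤ} {x : V} : x ∈ im r a b ↔ ∃ i, a ≤ i ∧ i < b ∧ r i = x := by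
  simp [im, and_assoc]

theorem im_mem {r : ℤ → V} {a b i : ℤ} (h : a ≤ i) (h' : i < b) : r i ∈ im r a b := mem_im.2 ⟨i, h, h', rfl⟩

theorem conn_im_nat {r : ℤ → V} {a : ℤ} (n : ℕ) (h : ∀ i, a ≤ i → i < a + n → G.Adj (r i) (r (i + 1))) :
    Conn G (im r a (a + n + 1)) := by
  induction n with
  | zero =>
    have : im r a (a + (0 : ℕ) + 1) = {r a} := by
      ext x; rw [mem_im]; constructor
      · rintro ⟨i, h1, h2, rfl⟩
        rw [show i = a by push_cast at h2; omega]; rfl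
      · rintro rfl; exact ⟨a, le_rfl, by push_cast; omega, rfl⟩
    rw [this]; exact conn_singleton _
  | succ n ih =>
    have h1 := ih (fun i h1 h2 => h i h1 (by push_cast; omega))
    have : im r a (a + (n + 1 : ℕ) + 1) = insert (r (a + n + 1)) (im r a (a + n + 1)) := by
      ext x; rw [Set.mem_insert_iff, mem_im, mem_im]; constructor
      · rintro ⟨i, h1, h2, rfl⟩
        by_cases hi : i = a + n + 1
        · left; rw [hi]
        · right; exact ⟨i, h1, by push_cast at h2; omega, rfl⟩
      · rintro (rfl | ⟨i, h1, h2, rfl⟩)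
        · exact ⟨_, by omega, by push_cast; omega, rfl⟩
        · exact ⟨_, h1, by push_cast; omega, rfl⟩
    rw [this]
    exact h1.insert (im_mem (i := a + n) (by omega) (by omega)) (h _ (by omega) (by push_cast; omega)).symm

theorem conn_im {r : ℤ → V} {a b : ℤ} (hab : a < b) (h : ∀ i, a ≤ i → i + 1 < b → G.Adj (r i) (r (i + 1))) :
    Conn G (im r a b) := by
  have := conn_im_nat (G := G) (r := r) (a := a) (b - a - 1).toNat (fun i h1 h2 => h i h1 (by omega))
  rwa [show a + ((b - a - 1).toNat : ℤ) + 1 = b by omega] at this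

/-- reach a target set `R` from `y` within `S` -/
theorem Conn.hit {S R : Set V} (h : Conn G S) {t y s : V} (hy : y ∈ S) (hty : G.Adj t y) (hs : s ∈ S) (hsR : s ∈ R) :
    ∃ b ∈ R, b ∈ S ∧ ∃ L, L ⊆ S \ R ∧ Leg G t L b := by
  by_cases hyR : y ∈ R
  · exact ⟨y, hyR, hy, ∅, Set.empty_subset _, Or.inl ⟨rfl, hty⟩⟩
  · obtain ⟨a, ha, ⟨L, hL, hLS, hyL, haL⟩, b, hb, hbA, hab⟩ := h.cut {z | ∃ L, Conn G L ∧ L ⊆ S \ R ∧ y ∈ L ∧ z ∈ L} hy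
      ⟨{y}, conn_singleton _, by simpa using ⟨hy, hyR⟩, rfl, rfl⟩ hs (by
        rintro ⟨L, -, hL, -, hsL⟩; exact (hL hsL).2 hsR)
    refine ⟨b, ?_, hb, L, hLS, Or.inr ⟨hL, ⟨y, hyL, hty⟩, a, haL, hab⟩⟩
    by_contra hbR
    refine hbA ⟨Insert.insert b L, hL.insert haL hab.symm, ?_, Or.inr hyL, Or.inl rfl⟩
    rintro z (rfl | hz)
    · exact ⟨hb, hbR⟩
    · exact hLS hz

theorem Conn.tri {S : Set V} (h : Conn G S) {s s' t : V} (hs : s ∈ S) (hs' : s' ∈ S) (ht : Tch G {t} S) :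
    ∃ (k : ℤ) (r : ℤ → V) (i : ℤ) (L : Set V), PathOn G r k ∧ r 0 = s ∧ r k = s' ∧ 0 ≤ i ∧ i ≤ k ∧ Leg G t L (r i) ∧
      im r 0 (k + 1) ⊆ S ∧ L ⊆ S ∧ Disjoint L (im r 0 (k + 1)) := by
  obtain ⟨k, r, hr, h0, hk, hm⟩ := h.exists_path hs hs'
  obtain ⟨t', ht', y, hy, hty⟩ := ht
  rw [Set.mem_singleton_iff.1 ht'] at hty
  have hnn := hr.nn
  obtain ⟨b, hbR, hbS, L, hL, hleg⟩ := h.hit (R := im r 0 (k + 1)) hy hty hs (h0 ▸ im_mem le_rfl (by omega))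
  obtain ⟨i, hi, hik, rfl⟩ := mem_im.1 hbR
  refine ⟨k, r, i, L, hr, h0, hk, hi, by omega, hleg, ?_, fun x hx => (hL hx).1, ?_⟩
  · intro x hx
    obtain ⟨j, hj, hjk, rfl⟩ := mem_im.1 hx
    exact hm j hj (by omega)
  · rw [Set.disjoint_left]; exact fun x hx => (hL hx).2

theorem Conn.center {Y T1 T2 : Set V} (h : Conn G Y) {u : V} (hu : u ∈ Y) (c1 : Conn G T1) (c2 : Conn G T2)
    (d1 : Disjoint Y T1) (d2 : Disjoint Y T2) (d12 : Disjoint T1 T2) (t1 : Tch G Y T1) (t2 : Tch G Y T2) :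
    ∃ (k : ℤ) (r : ℤ → V) (T1' T2' : Set V), PathOn G r k ∧ r 0 = u ∧ (∀ i, 0 ≤ i → i ≤ k → r i ∈ Y ∧ r i ∉ T1' ∧ r i ∉ T2') ∧
      T1 ⊆ T1' ∧ T1' ⊆ T1 ∪ Y ∧ T2 ⊆ T2' ∧ T2' ⊆ T2 ∪ Y ∧ Conn G T1' ∧ Conn G T2' ∧ Disjoint T1' T2' ∧
      Tch G {r k} T1' ∧ Tch G {r k} T2' := by
  obtain ⟨y1, hy1, z1, hz1, a1⟩ := t1
  obtain ⟨y2, hy2, z2, hz2, a2⟩ := t2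
  obtain ⟨K, w, hw, hw0, hwK, hwm⟩ := h.exists_path hy1 hy2
  have hnn := hw.nn
  -- the part of `w` reached from `u`
  have key : ∃ j, 0 ≤ j ∧ j ≤ K ∧ ∃ (k : ℤ) (r : ℤ → V), PathOn G r k ∧ r 0 = u ∧ r k = w j ∧
      ∀ i, 0 ≤ i → i ≤ k → r i ∈ Y ∧ ∀ l, 0 ≤ l → l ≤ K → r i = w l → l = j := by
    by_cases huR : u ∈ im w 0 (K + 1)
    · obtain ⟨j, hj, hjK, hju⟩ := mem_im.1 huR
      refine ⟨j, hj, by omega, 0, fun _ => u, pathOn_single u, rfl, hju.symm, fun i _ _ => ⟨hu, fun l hl hlK hul => ?_⟩⟩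
      exact hw.inj l j hl hlK hj (by omega) (hul.symm.trans hju.symm)
    · obtain ⟨a, ha, ⟨L, hL, hLS, huL, haL⟩, b, hb, hbA, hab⟩ := h.cut {z | ∃ L, Conn G L ∧ L ⊆ Y \ im w 0 (K + 1) ∧ u ∈ L ∧ z ∈ L} hu
        ⟨{u}, conn_singleton _, by simpa using ⟨hu, huR⟩, rfl, rfl⟩ hy1 (by
          rintro ⟨L, -, hL, -, hsL⟩; exact (hL hsL).2 (hw0 ▸ im_mem le_rfl (by omega)))
      have hbR : b ∈ im w 0 (K + 1) := by
        by_contra hbR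
        refine hbA ⟨Insert.insert b L, hL.insert haL hab.symm, ?_, Or.inr huL, Or.inl rfl⟩
        rintro z (rfl | hz)
        · exact ⟨hb, hbR⟩
        · exact hLS hz
      obtain ⟨j, hj, hjK, rfl⟩ := mem_im.1 hbR
      obtain ⟨k, r, hr, hr0, hrk, hrm⟩ := (hL.insert haL hab.symm).exists_path (Or.inr huL) (Or.inl rfl)
      refine ⟨j, hj, by omega, k, r, hr, hr0, hrk, fun i hi hik => ?_⟩
      rcases hrm i hi hik with h' | h'
      · rw [h']
        exact ⟨hb, fun l hl hlK he => hw.inj l j hl hlK hj (by omega) he.symm⟩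
      · refine ⟨(hLS h').1, fun l hl hlK he => ?_⟩
        exact absurd (he ▸ im_mem hl (by omega)) (hLS h').2
  obtain ⟨j, hj, hjK, k, r, hr, hr0, hrk, hrm⟩ := key
  have hY : ∀ l, 0 ≤ l → l ≤ K → w l ∈ Y := hwm
  have hyT1 : ∀ y ∈ Y, y ∉ T1 := fun y hy h => Set.disjoint_left.1 d1 hy h
  have hyT2 : ∀ y ∈ Y, y ∉ T2 := fun y hy h => Set.disjoint_left.1 d2 hy h
  refine ⟨k, r, T1 ∪ im w 0 j, T2 ∪ im w (j + 1) (K + 1), hr, hr0, ?_, Set.subset_union_left, ?_, Set.subset_union_left, ?_, ?_, ?_, ?_, ?_, ?_⟩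
  · intro i hi hik
    obtain ⟨hiY, hil⟩ := hrm i hi hik
    refine ⟨hiY, ?_, ?_⟩
    · rintro (h' | h')
      · exact hyT1 _ hiY h'
      · obtain ⟨l, hl, hlj, he⟩ := mem_im.1 h'
        have := hil l hl (by omega) he.symm
        omega
    · rintro (h' | h')
      · exact hyT2 _ hiY h'
      · obtain ⟨l, hl, hlj, he⟩ := mem_im.1 h'
        have := hil l (by omega) (by omega) he.symm
        omega
  · rintro x (hx | hx)
    · exact Or.inl hx
    · obtain ⟨l, hl, hlj, rfl⟩ := mem_im.1 hx
      exact Or.inr (hY l hl (by omega))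
  · rintro x (hx | hx)
    · exact Or.inl hx
    · obtain ⟨l, hl, hlj, rfl⟩ := mem_im.1 hx
      exact Or.inr (hY l (by omega) (by omega))
  · rcases eq_or_lt_of_le hj with rfl | hj0
    · have : im w 0 0 = ∅ := by simp [im]
      simpa [this] using c1
    · refine c1.union (conn_im hj0 fun i hi hij => hw.adj i hi (by omega)) ⟨z1, hz1, w 0, im_mem le_rfl hj0, ?_⟩
      rw [hw0]; exact a1.symm
  · rcases eq_or_lt_of_le hjK with rfl | hj0
    · have : im w (j + 1) (j + 1) = ∅ := by simp [im]
      simpa [this] using c2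
    · refine c2.union (conn_im (by omega) fun i hi hij => hw.adj i (by omega) (by omega)) ⟨z2, hz2, w K, im_mem (by omega) (by omega), ?_⟩
      rw [hwK]; exact a2.symm
  · rw [Set.disjoint_left]
    rintro x (hx | hx) (hx' | hx')
    · exact Set.disjoint_left.1 d12 hx hx'
    · obtain ⟨l, hl, hlj, rfl⟩ := mem_im.1 hx'
      exact hyT1 _ (hY l (by omega) (by omega)) hx
    · obtain ⟨l, hl, hlj, rfl⟩ := mem_im.1 hx
      exact hyT2 _ (hY l (by omega) (by omega)) hx'
    · obtain ⟨l, hl, hlj, rfl⟩ := mem_im.1 hx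
      obtain ⟨l', hl', hlj', he⟩ := mem_im.1 hx'
      have := hw.inj _ _ (by omega) (by omega) (by omega) (by omega) he
      omega
  · rw [hrk]
    rcases eq_or_lt_of_le hj with rfl | hj0
    · exact ⟨_, rfl, z1, Or.inl hz1, hw0 ▸ a1⟩
    · have := hw.adj (j - 1) (by omega) (by omega)
      rw [show j - 1 + 1 = j by omega] at this
      exact ⟨_, rfl, w (j - 1), Or.inr (im_mem (by omega) (by omega)), this.symm⟩
  · rw [hrk]
    rcases eq_or_lt_of_le hjK with rfl | hj0
    · exact ⟨_, rfl, z2, Or.inl hz2, hwK ▸ a2⟩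
    · have := hw.adj j (by omega) (by omega)
      exact ⟨_, rfl, w (j + 1), Or.inr (im_mem (by omega) (by omega)), this⟩

/-- closing up a path to a cycle -/
theorem close_path {c : ℤ → V} {K : ℤ} (hc : PathOn G c K) (hK : 0 < K) (h : G.Adj (c K) (c 0)) :
    (∀ i, c ((i + (K + 1)) % (K + 1)) = c (i % (K + 1))) ∧ (∀ i, G.Adj (c (i % (K + 1))) (c ((i + 1) % (K + 1)))) ∧
    (∀ i j, c (i % (K + 1)) = c (j % (K + 1)) → K + 1 ∣ i - j) := by
  refine ⟨fun i => by simp, fun i => ?_, fun i j hij => ?_⟩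
  · have h1 := Int.emod_nonneg i (show K + 1 ≠ 0 by omega)
    have h2 := Int.emod_lt_of_pos i (show 0 < K + 1 by omega)
    have e : (i + 1) % (K + 1) = (i % (K + 1) + 1) % (K + 1) := by simp
    rw [e]
    rcases eq_or_lt_of_le (show i % (K + 1) ≤ K by omega) with h3 | h3
    · rw [h3, Int.emod_self]; exact h
    · rw [Int.emod_eq_of_lt (a := i % (K + 1) + 1) (by omega) (by omega)]
      exact hc.adj _ h1 h3
  · have h1 := Int.emod_nonneg i (show K + 1 ≠ 0 by omega)
    have h2 := Int.emod_lt_of_pos i (show 0 < K + 1 by omega)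
    have h3 := Int.emod_nonneg j (show K + 1 ≠ 0 by omega)
    have h4 := Int.emod_lt_of_pos j (show 0 < K + 1 by omega)
    have := hc.inj _ _ h1 (by omega) h3 (by omega) hij
    exact (Int.ModEq.symm (show i % (K + 1) = j % (K + 1) from this)).dvd

end Paths

open SimpleGraph
set_option linter.unusedVariables false

section FTwo

variable {V : Type*} {G : SimpleGraph V}

structure Cfg (G : SimpleGraph V) (u v : V) (m k : ℤ) (q p : ℤ → V) (α β α' β' : ℤ) (L1 L2 L3 L4 : Set V) : Prop where
  per : ∀ i, q (i + m) = q i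
  qadj : ∀ i, G.Adj (q i) (q (i + 1))
  qinj : ∀ i j, q i = q j → m ∣ i - j
  o1 : α < β
  o2 : β < α'
  o3 : α' < β'
  o4 : β' < α + m
  k2 : 2 ≤ k
  path : PathOn G p k
  e : ∃ i, 0 ≤ i ∧ i < k ∧ s(p i, p (i + 1)) = s(u, v)
  pq : ∀ i j, 0 ≤ i → i ≤ k → p i ≠ q j
  l1 : Leg G (p 0) L1 (q β)
  l2 : Leg G (p 0) L2 (q β')
  l3 : Leg G (p k) L3 (q α)
  l4 : Leg G (p k) L4 (q α')
  d12 : Disjoint L1 L2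
  d13 : Disjoint L1 L3
  d14 : Disjoint L1 L4
  d23 : Disjoint L2 L3
  d24 : Disjoint L2 L4
  d34 : Disjoint L3 L4
  lp : ∀ i, 0 ≤ i → i ≤ k → p i ∉ L1 ∪ L2 ∪ L3 ∪ L4
  lq : ∀ i, q i ∉ L1 ∪ L2 ∪ L3 ∪ L4

theorem im_sub {r : ℤ → V} {k : ℤ} {S : Set V} (h : im r 0 (k + 1) ⊆ S) : ∀ i, 0 ≤ i → i ≤ k → r i ∈ S :=
  fun i h1 h2 => h (im_mem h1 (by omega))

theorem cfg_of_sets {u v : V} {k : ℤ} {p : ℤ → V} (hp : PathOn G p k) (hk : 2 ≤ k)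
    (he : ∃ i, 0 ≤ i ∧ i < k ∧ s(p i, p (i + 1)) = s(u, v)) {A B A' B' : Set V}
    (cA : Conn G A) (cB : Conn G B) (cA' : Conn G A') (cB' : Conn G B')
    (dAB : Disjoint A B) (dAA : Disjoint A A') (dAB' : Disjoint A B') (dBA' : Disjoint B A') (dBB : Disjoint B B')
    (dA'B' : Disjoint A' B') (tAB : Tch G A B) (tBA : Tch G B A') (tAB' : Tch G A' B') (tBA' : Tch G B' A)
    (t1 : Tch G {p 0} B) (t2 : Tch G {p 0} B') (t3 : Tch G {p k} A) (t4 : Tch G {p k} A')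
    (hd : ∀ i, 0 ≤ i → i ≤ k → p i ∉ A ∪ B ∪ A' ∪ B') :
    ∃ m q α β α' β' L1 L2 L3 L4, Cfg G u v m k q p α β α' β' L1 L2 L3 L4 := by
  obtain ⟨x1, hx1, y1, hy1, a1⟩ := tAB
  obtain ⟨x2, hx2, y2, hy2, a2⟩ := tBA
  obtain ⟨x3, hx3, y3, hy3, a3⟩ := tAB'
  obtain ⟨x4, hx4, y4, hy4, a4⟩ := tBA'
  obtain ⟨k1, r1, i1, L3, hr1, s1, e1, n1, m1, leg3, sub1, lub3, dd3⟩ := cA.tri hy4 hx1 t3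
  obtain ⟨k2, r2, i2, L1, hr2, s2, e2, n2, m2, leg1, sub2, lub1, dd1⟩ := cB.tri hy1 hx2 t1
  obtain ⟨k3, r3, i3, L4, hr3, s3, e3, n3, m3, leg4, sub3, lub4, dd4⟩ := cA'.tri hy2 hx3 t4
  obtain ⟨k4, r4, i4, L2, hr4, s4, e4, n4, m4, leg2, sub4, lub2, dd2⟩ := cB'.tri hy3 hx4 t2
  have sR1 := im_sub sub1
  have sR2 := im_sub sub2
  have sR3 := im_sub sub3
  have sR4 := im_sub sub4
  have P1 : PathOn G (cat r1 k1 r2) (k1 + k2 + 1) := by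
    refine hr1.concat hr2 (by rw [e1, s2]; exact a1) ?_
    intro i j h1 h2 h3 h4 h
    exact Set.disjoint_left.1 dAB (sR1 i h1 h2) (h ▸ sR2 j h3 h4)
  have M1 := cat_mem (p := r1) (p' := r2) (a := k1) (b := k2) (im_sub le_rfl) (im_sub le_rfl)
  have P2 : PathOn G (cat (cat r1 k1 r2) (k1 + k2 + 1) r3) (k1 + k2 + 1 + k3 + 1) := by
    refine P1.concat hr3 ?_ ?_
    · rw [cat_add hr2.nn, e2, s3]; exact a2
    · intro i j h1 h2 h3 h4 h
      rcases M1 i h1 h2 with h' | h'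
      · exact Set.disjoint_left.1 dAA (sub1 h') (h ▸ sR3 j h3 h4)
      · exact Set.disjoint_left.1 dBA' (sub2 h') (h ▸ sR3 j h3 h4)
  have M2 := cat_mem (p := cat r1 k1 r2) (p' := r3) (a := k1 + k2 + 1) (b := k3) M1 (im_sub le_rfl)
  have P3 : PathOn G (cat (cat (cat r1 k1 r2) (k1 + k2 + 1) r3) (k1 + k2 + 1 + k3 + 1) r4) (k1 + k2 + 1 + k3 + 1 + k4 + 1) := by
    refine P2.concat hr4 ?_ ?_
    · rw [cat_add hr3.nn, e3, s4]; exact a3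
    · intro i j h1 h2 h3 h4 h
      rcases M2 i h1 h2 with (h' | h') | h'
      · exact Set.disjoint_left.1 dAB' (sub1 h') (h ▸ sR4 j h3 h4)
      · exact Set.disjoint_left.1 dBB (sub2 h') (h ▸ sR4 j h3 h4)
      · exact Set.disjoint_left.1 dA'B' (sub3 h') (h ▸ sR4 j h3 h4)
  have M3 := cat_mem (p := cat (cat r1 k1 r2) (k1 + k2 + 1) r3) (p' := r4) (a := k1 + k2 + 1 + k3 + 1) (b := k4) M2 (im_sub le_rfl)
  have g1 := hr1.nn
  have g2 := hr2.nn
  have g3 := hr3.nn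
  have g4 := hr4.nn
  set c := cat (cat (cat r1 k1 r2) (k1 + k2 + 1) r3) (k1 + k2 + 1 + k3 + 1) r4 with hc
  set K := k1 + k2 + 1 + k3 + 1 + k4 + 1 with hK
  have v1 : c i1 = r1 i1 := by rw [hc, cat_le (by omega), cat_le (by omega), cat_le (by omega)]
  have v0 : c 0 = y4 := by rw [hc, cat_le (by omega), cat_le (by omega), cat_le (by omega), s1]
  have v2 : c (k1 + i2 + 1) = r2 i2 := by rw [hc, cat_le (by omega), cat_le (by omega), cat_add n2]
  have v3 : c (k1 + k2 + 1 + i3 + 1) = r3 i3 := by rw [hc, cat_le (by omega), cat_add n3]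
  have v4 : c (k1 + k2 + 1 + k3 + 1 + i4 + 1) = r4 i4 := by rw [hc, cat_add n4]
  have vK : c K = x4 := by rw [hc, hK, cat_add g4, e4]
  obtain ⟨f1, f2, f3⟩ := close_path P3 (by omega) (by rw [vK, v0]; exact a4)
  have MM : ∀ i, c (i % (K + 1)) ∈ im r1 0 (k1 + 1) ∪ im r2 0 (k2 + 1) ∪ im r3 0 (k3 + 1) ∪ im r4 0 (k4 + 1) := fun i =>
    M3 _ (Int.emod_nonneg i (show K + 1 ≠ 0 by omega)) (by have := Int.emod_lt_of_pos i (show 0 < K + 1 by omega); omega)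
  have dj : ∀ {S T : Set V}, Disjoint S T → ∀ {x}, x ∈ S → x ∈ T → False := fun h x h1 h2 => Set.disjoint_left.1 h h1 h2
  refine ⟨K + 1, fun i => c (i % (K + 1)), i1, k1 + i2 + 1, k1 + k2 + 1 + i3 + 1, k1 + k2 + 1 + k3 + 1 + i4 + 1, L1, L2, L3, L4,
    f1, f2, f3, by omega, by omega, by omega, by omega, hk, hp, he, ?_, ?_, ?_, ?_, ?_,
    dBB.mono lub1 lub2, dAB.symm.mono lub1 lub3, dBA'.mono lub1 lub4, dAB'.symm.mono lub2 lub3, dA'B'.symm.mono lub2 lub4, dAA.mono lub3 lub4, ?_, ?_⟩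
  · intro i j h0 h1 h2
    refine hd i h0 h1 ?_
    rw [h2]
    rcases MM j with ((h | h) | h) | h
    · exact Or.inl (Or.inl (Or.inl (sub1 h)))
    · exact Or.inl (Or.inl (Or.inr (sub2 h)))
    · exact Or.inl (Or.inr (sub3 h))
    · exact Or.inr (sub4 h)
  · show Leg G (p 0) L1 (c _)
    rw [Int.emod_eq_of_lt (by omega) (by omega), v2]; exact leg1
  · show Leg G (p 0) L2 (c _)
    rw [Int.emod_eq_of_lt (by omega) (by omega), v4]; exact leg2
  · show Leg G (p k) L3 (c _)
    rw [Int.emod_eq_of_lt (by omega) (by omega), v1]; exact leg3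
  · show Leg G (p k) L4 (c _)
    rw [Int.emod_eq_of_lt (by omega) (by omega), v3]; exact leg4
  · intro i h0 h1 h
    refine hd i h0 h1 ?_
    rcases h with ((h | h) | h) | h
    · exact Or.inl (Or.inl (Or.inr (lub1 h)))
    · exact Or.inr (lub2 h)
    · exact Or.inl (Or.inl (Or.inl (lub3 h)))
    · exact Or.inl (Or.inr (lub4 h))
  · intro i h
    have h' := MM i
    rcases h' with ((h' | h') | h') | h' <;> rcases h with ((h | h) | h) | h
    · exact dj dAB (sub1 h') (lub1 h)
    · exact dj dAB' (sub1 h') (lub2 h)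
    · exact dj dd3 h h'
    · exact dj dAA (sub1 h') (lub4 h)
    · exact dj dd1 h h'
    · exact dj dBB (sub2 h') (lub2 h)
    · exact dj dAB.symm (sub2 h') (lub3 h)
    · exact dj dBA' (sub2 h') (lub4 h)
    · exact dj dBA'.symm (sub3 h') (lub1 h)
    · exact dj dA'B' (sub3 h') (lub2 h)
    · exact dj dAA.symm (sub3 h') (lub3 h)
    · exact dj dd4 h h'
    · exact dj dBB.symm (sub4 h') (lub1 h)
    · exact dj dd2 h h'
    · exact dj dAB'.symm (sub4 h') (lub3 h)
    · exact dj dA'B'.symm (sub4 h') (lub4 h)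

theorem Tch.of_union {X1 X2 T : Set V} (h : Tch G (X1 ∪ X2) T) : Tch G X1 T ∨ Tch G X2 T := by
  obtain ⟨a, ha, b, hb, hab⟩ := h
  exact ha.imp (fun h => ⟨a, h, b, hb, hab⟩) (fun h => ⟨a, h, b, hb, hab⟩)

theorem f2_aux {u v : V} (huv : G.Adj u v) {Du Dv A2 A3 B1 B2 B3 : Set V} (hu : u ∈ Du) (hv : v ∈ Dv)
    (hc : Conn G Du ∧ Conn G Dv ∧ Conn G A2 ∧ Conn G A3 ∧ Conn G B1 ∧ Conn G B2 ∧ Conn G B3)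
    (hd : [Du, Dv, A2, A3, B1, B2, B3].Pairwise Disjoint)
    (h1 : Tch G Dv B1) (h2 : Tch G Du B2) (h3 : Tch G Du B3)
    (hA : Tch G A2 B1 ∧ Tch G A2 B2 ∧ Tch G A2 B3 ∧ Tch G A3 B1 ∧ Tch G A3 B2 ∧ Tch G A3 B3) :
    ∃ m k q p α β α' β' L1 L2 L3 L4, Cfg G u v m k q p α β α' β' L1 L2 L3 L4 := by
  obtain ⟨cu, cv, cA2, cA3, cB1, cB2, cB3⟩ := hc
  simp only [List.pairwise_cons, List.mem_cons, List.not_mem_nil, or_false, forall_eq_or_imp, forall_eq] at hd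
  obtain ⟨⟨d1, d2, d3, d4, d5, d6⟩, ⟨d7, d8, d9, d10, d11⟩, ⟨d12, d13, d14, d15⟩, ⟨d16, d17, d18⟩, ⟨d19, d20⟩, d21, -⟩ := hd
  obtain ⟨t1, t2, t3, t4, t5, t6⟩ := hA
  obtain ⟨ku, ru, B2', B3', hru, ru0, rum, b1, b2, b3, b4, cB2', cB3', dB, tu2, tu3⟩ := cu.center hu cB2 cB3 d5 d6 d21 h2 h3
  obtain ⟨d, hd, b, hb, hdb⟩ := h1
  obtain ⟨kv, rv, hrv, rv0, rvk, rvm⟩ := cv.exists_path hv hd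
  obtain ⟨kb, rb, A2', A3', hrb, rb0, rbm, a1, a2, a3, a4, cA2', cA3', dA, tb2, tb3⟩ := cB1.center hb cA2 cA3 d13.symm d16.symm d12 t1.symm t4.symm
  have g1 := hru.nn
  have g2 := hrv.nn
  have g3 := hrb.nn
  have dj : ∀ {S T : Set V}, Disjoint S T → ∀ {x}, x ∈ S → x ∈ T → False := fun h x h1 h2 => Set.disjoint_left.1 h h1 h2
  have P1 : PathOn G (cat (fun i => ru (ku - i)) ku rv) (ku + kv + 1) := by
    refine hru.rev.concat hrv (by simpa [ru0, rv0] using huv) ?_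
    intro i j h1 h2 h3 h4 h
    exact dj d1 (rum (ku - i) (by omega) (by omega)).1 (h ▸ rvm j h3 h4)
  have M1 := cat_mem (p := fun i => ru (ku - i)) (p' := rv) (a := ku) (b := kv) (S := {x | x ∈ Du ∧ x ∉ B2' ∧ x ∉ B3'}) 
    (fun i h1 h2 => rum (ku - i) (by omega) (by omega)) rvm
  have P2 : PathOn G (cat (cat (fun i => ru (ku - i)) ku rv) (ku + kv + 1) rb) (ku + kv + 1 + kb + 1) := by
    refine P1.concat hrb ?_ ?_
    · rw [cat_add g2, rvk, rb0]; exact hdb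
    · intro i j h1 h2 h3 h4 h
      rcases M1 i h1 h2 with h' | h'
      · exact dj d4 h'.1 (h ▸ (rbm j h3 h4).1)
      · exact dj d9 h' (h ▸ (rbm j h3 h4).1)
  have M2 := cat_mem (p := cat (fun i => ru (ku - i)) ku rv) (p' := rb) (a := ku + kv + 1) (b := kb) M1
    (T := {x | x ∈ B1 ∧ x ∉ A2' ∧ x ∉ A3'}) rbm
  set p := cat (cat (fun i => ru (ku - i)) ku rv) (ku + kv + 1) rb with hp
  have v0 : p 0 = ru ku := by rw [hp, cat_le (by omega), cat_le (by omega)]; simp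
  have vk : p (ku + kv + 1 + kb + 1) = rb kb := by rw [hp, cat_add g3]
  have vu : p ku = u := by rw [hp, cat_le (by omega), cat_le (by omega)]; simp [ru0]
  have vv : p (ku + 1) = v := by rw [hp, cat_le (by omega), show ku + 1 = ku + 0 + 1 by ring, cat_add le_rfl, rv0]
  have D : ∀ {A B : Set V}, A ⊆ A2 ∪ B1 ∨ A ⊆ A3 ∪ B1 → B ⊆ B2 ∪ Du ∨ B ⊆ B3 ∪ Du → Disjoint A B := by
    intro A B hA hB
    rw [Set.disjoint_left]
    intro x hxA hxB
    have h1 : x ∈ A2 ∨ x ∈ A3 ∨ x ∈ B1 := by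
      rcases hA with h | h <;> rcases h hxA with h | h <;> simp [h]
    have h2 : x ∈ B2 ∨ x ∈ B3 ∨ x ∈ Du := by
      rcases hB with h | h <;> rcases h hxB with h | h <;> simp [h]
    rcases h1 with h1 | h1 | h1 <;> rcases h2 with h2 | h2 | h2
    · exact dj d14 h1 h2
    · exact dj d15 h1 h2
    · exact dj d2 h2 h1
    · exact dj d17 h1 h2
    · exact dj d18 h1 h2
    · exact dj d3 h2 h1
    · exact dj d19 h1 h2
    · exact dj d20 h1 h2
    · exact dj d4 h2 h1
  have hh := cfg_of_sets (G := G) (u := u) (v := v) (k := ku + kv + 1 + kb + 1) (p := p) P2 (by omega)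
    ⟨ku, by omega, by omega, by rw [vu, vv]⟩ (A := A3') (B := B2') (A' := A2') (B' := B3') cA3' cB2' cA2' cB3'
    (D (Or.inr a4) (Or.inl b2)) dA.symm (D (Or.inr a4) (Or.inr b4)) (D (Or.inl a2) (Or.inl b2)).symm dB
    (D (Or.inl a2) (Or.inr b4)) (t5.mono a3 b1) (t2.symm.mono b1 a1) (t3.mono a1 b3) (t6.symm.mono b3 a3)
    (v0 ▸ tu2) (v0 ▸ tu3) (vk ▸ tb3) (vk ▸ tb2) ?_
  · obtain ⟨m, q, α, β, α', β', L1, L2, L3, L4, h⟩ := hh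
    exact ⟨_, _, _, _, _, _, _, _, _, _, _, _, h⟩
  · intro i h0 h1 h
    rcases M2 i h0 h1 with (h' | h') | h'
    · rcases h with ((h | h) | h) | h
      · rcases a4 h with h | h
        · exact dj d3 h'.1 h
        · exact dj d4 h'.1 h
      · exact h'.2.1 h
      · rcases a2 h with h | h
        · exact dj d2 h'.1 h
        · exact dj d4 h'.1 h
      · exact h'.2.2 h
    · rcases h with ((h | h) | h) | h
      · rcases a4 h with h | h
        · exact dj d8 h' h
        · exact dj d9 h' h
      · rcases b2 h with h | h
        · exact dj d10 h' h
        · exact dj d1 h h'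
      · rcases a2 h with h | h
        · exact dj d7 h' h
        · exact dj d9 h' h
      · rcases b4 h with h | h
        · exact dj d11 h' h
        · exact dj d1 h h'
    · rcases h with ((h | h) | h) | h
      · exact h'.2.2 h
      · rcases b2 h with h | h
        · exact dj d19 h'.1 h
        · exact dj d4 h h'.1
      · exact h'.2.1 h
      · rcases b4 h with h | h
        · exact dj d20 h'.1 h
        · exact dj d4 h h'.1

theorem k33_core {B : Fin 3 ⊕ Fin 3 → Set V} (hB : Model K33 G B) {i} {z : V} (hz : z ∈ B i) : z ∈ core G := by
  by_contra h
  have h' : ∀ y, ¬ G.Adj z y := fun y hy => h ⟨y, hy⟩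
  rcases i with i | i
  · exact hB.not_mem_of_isolated h' (j := .inr 0) (by simp [K33]) hz
  · exact hB.not_mem_of_isolated h' (j := .inl 0) (by simp [K33]) hz

theorem f2 [Finite V] (hG : SixFree G) {u v : V} (huv : G.Adj u v) (h : Contr33 G u v) :
    ∃ m k q p α β α' β' L1 L2 L3 L4, Cfg G u v m k q p α β α' β' L1 L2 L3 L4 := by
  obtain ⟨f, g, hB, hu, hv⟩ := h
  have cf : ∀ i, Conn G (f i) := fun i => hB.conn (.inl i)
  have cg : ∀ i, Conn G (g i) := fun i => hB.conn (.inr i)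
  have df : ∀ {i j}, i ≠ j → Disjoint (f i) (f j) := fun h => hB.disj (w := .inl _) (w' := .inl _) (by simpa using h)
  have dg : ∀ {i j}, i ≠ j → Disjoint (g i) (g j) := fun h => hB.disj (w := .inr _) (w' := .inr _) (by simpa using h)
  have dfg : ∀ i j, Disjoint (f i) (g j) := fun i j => hB.disj (w := .inl _) (w' := .inr _) (by simp)
  have tfg : ∀ i j, Tch G (f i) (g j) := fun i j => hB.adj (w := .inl _) (w' := .inr _) (by simp [K33])
  obtain ⟨Du, Dv, cu, cv, su, sv, hun, hdj⟩ := (cf 0).exists_partition (conn_singleton u) (conn_singleton v)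
    (by simpa using hu) (by simpa using hv) (by simpa using huv.ne)
  simp only [Set.singleton_subset_iff] at su sv
  have eu : Du ⊆ f 0 := hun ▸ Set.subset_union_left
  have ev : Dv ⊆ f 0 := hun ▸ Set.subset_union_right
  have hnall : ∀ X : Set V, Conn G X → X ⊆ f 0 → ∀ z ∈ f 0, z ∉ X → Tch G X (g 0) → Tch G X (g 1) → Tch G X (g 2) → False := by
    intro X cX eX z hz hzX t0 t1 t2
    refine hG.k33 (x := z) (A0 := X) (A1 := f 1) (A2 := f 2) (B0 := g 0) (B1 := g 1) (B2 := g 2) (k33_core hB (i := .inl 0) hz)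
      ⟨cX, cf _, cf _, cg _, cg _, cg _⟩ ?_ ⟨t0, t1, t2, tfg _ _, tfg _ _, tfg _ _, tfg _ _, tfg _ _, tfg _ _⟩
      ⟨hzX, ?_, ?_, ?_, ?_, ?_⟩
    · simp only [List.pairwise_cons, List.mem_cons, List.not_mem_nil, or_false, forall_eq_or_imp, forall_eq]
      refine ⟨⟨(df (by decide)).mono_left eX, (df (by decide)).mono_left eX, (dfg _ _).mono_left eX, (dfg _ _).mono_left eX, (dfg _ _).mono_left eX⟩,
        ⟨df (by decide), dfg _ _, dfg _ _, dfg _ _⟩, ⟨dfg _ _, dfg _ _, dfg _ _⟩, ⟨dg (by decide), dg (by decide)⟩, dg (by decide), by simp⟩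
    · exact Set.disjoint_left.1 (df (by decide)) hz
    · exact Set.disjoint_left.1 (df (by decide)) hz
    · exact Set.disjoint_left.1 (dfg _ _) hz
    · exact Set.disjoint_left.1 (dfg _ _) hz
    · exact Set.disjoint_left.1 (dfg _ _) hz
  have n1 := hnall Du cu eu v hv (fun h => Set.disjoint_left.1 hdj h sv)
  have n2 := hnall Dv cv ev u hu (fun h => Set.disjoint_left.1 hdj su h)
  have hor : ∀ j, Tch G Du (g j) ∨ Tch G Dv (g j) := fun j => Tch.of_union (hun ▸ tfg 0 j)
  have fin : ∀ (a b c : Fin 3), a ≠ b → a ≠ c → b ≠ c → ∀ {u v : V} {Du Dv : Set V}, G.Adj u v → u ∈ Du → v ∈ Dv → Conn G Du → Conn G Dv →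
      Du ⊆ f 0 → Dv ⊆ f 0 → Disjoint Du Dv → Tch G Dv (g a) → Tch G Du (g b) → Tch G Du (g c) →
      ∃ m k q p α β α' β' L1 L2 L3 L4, Cfg G u v m k q p α β α' β' L1 L2 L3 L4 := by
    intro a b c hab hac hbc u v Du Dv huv su sv cu cv eu ev hdj h1 h2 h3
    refine f2_aux (A2 := f 1) (A3 := f 2) huv su sv ⟨cu, cv, cf _, cf _, cg a, cg b, cg c⟩ ?_ h1 h2 h3 ⟨tfg _ _, tfg _ _, tfg _ _, tfg _ _, tfg _ _, tfg _ _⟩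
    simp only [List.pairwise_cons, List.mem_cons, List.not_mem_nil, or_false, forall_eq_or_imp, forall_eq]
    refine ⟨⟨hdj, (df (by decide)).mono_left eu, (df (by decide)).mono_left eu, (dfg _ _).mono_left eu, (dfg _ _).mono_left eu, (dfg _ _).mono_left eu⟩,
      ⟨(df (by decide)).mono_left ev, (df (by decide)).mono_left ev, (dfg _ _).mono_left ev, (dfg _ _).mono_left ev, (dfg _ _).mono_left ev⟩,
        ⟨df (by decide), dfg _ _, dfg _ _, dfg _ _⟩, ⟨dfg _ _, dfg _ _, dfg _ _⟩, ⟨dg hab, dg hac⟩, dg hbc, by simp⟩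
  have finU := fun (a b c : Fin 3) (hab : a ≠ b) (hac : a ≠ c) (hbc : b ≠ c) => fin a b c hab hac hbc huv su sv cu cv eu ev hdj
  have finV : ∀ (a b c : Fin 3) (hab : a ≠ b) (hac : a ≠ c) (hbc : b ≠ c), Tch G Du (g a) → Tch G Dv (g b) → Tch G Dv (g c) →
      ∃ m k q p α β α' β' L1 L2 L3 L4, Cfg G u v m k q p α β α' β' L1 L2 L3 L4 := by
    intro a b c hab hac hbc h1 h2 h3
    obtain ⟨m, k, q, p, α, β, α', β', L1, L2, L3, L4, h⟩ := fin a b c hab hac hbc huv.symm sv su cv cu ev eu hdj.symm h1 h2 h3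
    refine ⟨m, k, q, p, α, β, α', β', L1, L2, L3, L4, { h with e := ?_ }⟩
    obtain ⟨i, h0, h1, h2⟩ := h.e
    exact ⟨i, h0, h1, h2.trans Sym2.eq_swap⟩
  rcases hor 0 with r0 | r0 <;> rcases hor 1 with r1 | r1 <;> rcases hor 2 with r2 | r2
  · exact absurd (n1 r0 r1 r2) id
  · exact finU 2 0 1 (by decide) (by decide) (by decide) r2 r0 r1
  · exact finU 1 0 2 (by decide) (by decide) (by decide) r1 r0 r2
  · exact finV 0 1 2 (by decide) (by decide) (by decide) r0 r1 r2
  · exact finU 0 1 2 (by decide) (by decide) (by decide) r0 r1 r2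
  · exact finV 1 0 2 (by decide) (by decide) (by decide) r1 r0 r2
  · exact finV 2 0 1 (by decide) (by decide) (by decide) r2 r0 r1
  · exact absurd (n2 r0 r1 r2) id

end FTwo

open SimpleGraph
set_option linter.unusedVariables false

section FThree

variable {V : Type*} {G : SimpleGraph V}

theorem Leg.conn_add {S L : Set V} {p b : V} (hS : Conn G S) (hp : p ∈ S) (h : Leg G p L b) : Conn G (S ∪ L) := by
  rcases h with ⟨rfl, -⟩ | ⟨hc, ⟨x, hx, hpx⟩, -⟩
  · simpa using hS
  · exact hS.union hc ⟨p, hp, x, hx, hpx⟩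

theorem Leg.tch_add {S L T : Set V} {p b : V} (h : Leg G p L b) (hp : p ∈ S) (hb : b ∈ T) : Tch G (S ∪ L) T := by
  rcases h with ⟨rfl, h⟩ | ⟨hc, -, y, hy, hyb⟩
  · exact ⟨p, Or.inl hp, b, hb, h⟩
  · exact ⟨y, Or.inr hy, b, hb, hyb⟩

variable {u v : V} {m k : ℤ} {q p : ℤ → V} {α β α' β' : ℤ} {L1 L2 L3 L4 : Set V}

theorem Cfg.mpos (h : Cfg G u v m k q p α β α' β' L1 L2 L3 L4) : 4 ≤ m := by
  have := h.o1; have := h.o2; have := h.o3; have := h.o4; omega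

theorem Cfg.per' (h : Cfg G u v m k q p α β α' β' L1 L2 L3 L4) (i : ℤ) : q (i - m) = q i := by
  rw [← h.per (i - m)]; congr 1; omega

theorem Cfg.perm (h : Cfg G u v m k q p α β α' β' L1 L2 L3 L4) (i t : ℤ) : q (i + m * t) = q i := by
  induction t using Int.induction_on with
  | zero => simp
  | succ n ih => rw [← ih, ← h.per (i + m * n)]; congr 1; ring
  | pred n ih => rw [← ih, ← h.per (i + m * (-n - 1))]; congr 1; ring

theorem Cfg.window (h : Cfg G u v m k q p α β α' β' L1 L2 L3 L4) (a i : ℤ) : ∃ j, a ≤ j ∧ j < a + m ∧ q j = q i := by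
  have hm := h.mpos
  refine ⟨a + (i - a) % m, ?_, ?_, ?_⟩
  · have := Int.emod_nonneg (i - a) (show m ≠ 0 by omega); omega
  · have := Int.emod_lt_of_pos (i - a) (show 0 < m by omega); omega
  · have := Int.emod_add_mul_ediv (i - a) m
    rw [← h.perm (a + (i - a) % m) ((i - a) / m)]
    congr 1; omega

theorem Cfg.inj (h : Cfg G u v m k q p α β α' β' L1 L2 L3 L4) {i j : ℤ} (hij : q i = q j) (h1 : i - j < m) (h2 : j - i < m) : i = j := by
  obtain ⟨c, hc⟩ := h.qinj i j hij
  have hm := h.mpos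
  have : c = 0 := by
    rcases lt_trichotomy c 0 with h | h | h
    · nlinarith
    · exact h
    · nlinarith
  subst this; omega

theorem Cfg.qq (h : Cfg G u v m k q p α β α' β' L1 L2 L3 L4) (a b c d : ℤ)
    (hc : (b ≤ c ∧ d ≤ a + m) ∨ (d ≤ a ∧ b ≤ c + m)) : Disjoint (im q a b) (im q c d) := by
  rw [Set.disjoint_left]
  intro x hx hx'
  obtain ⟨i, h1, h2, rfl⟩ := mem_im.1 hx
  obtain ⟨j, h3, h4, h5⟩ := mem_im.1 hx'
  have := h.inj h5 (by omega) (by omega)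
  omega

theorem Cfg.pp (h : Cfg G u v m k q p α β α' β' L1 L2 L3 L4) (a b c d : ℤ)
    (hc : 0 ≤ a ∧ b ≤ k + 1 ∧ 0 ≤ c ∧ d ≤ k + 1 ∧ (b ≤ c ∨ d ≤ a)) : Disjoint (im p a b) (im p c d) := by
  rw [Set.disjoint_left]
  intro x hx hx'
  obtain ⟨i, h1, h2, rfl⟩ := mem_im.1 hx
  obtain ⟨j, h3, h4, h5⟩ := mem_im.1 hx'
  have := h.path.inj j i (by omega) (by omega) (by omega) (by omega) h5
  omega

theorem Cfg.pqd (h : Cfg G u v m k q p α β α' β' L1 L2 L3 L4) (a b c d : ℤ)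
    (hc : 0 ≤ a ∧ b ≤ k + 1) : Disjoint (im p a b) (im q c d) := by
  rw [Set.disjoint_left]
  intro x hx hx'
  obtain ⟨i, h1, h2, rfl⟩ := mem_im.1 hx
  obtain ⟨j, h3, h4, h5⟩ := mem_im.1 hx'
  exact h.pq i j (by omega) (by omega) h5.symm

theorem Cfg.pL (h : Cfg G u v m k q p α β α' β' L1 L2 L3 L4) (a b : ℤ) (hc : 0 ≤ a ∧ b ≤ k + 1) :
    Disjoint (im p a b) (L1 ∪ L2 ∪ L3 ∪ L4) := by
  rw [Set.disjoint_left]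
  intro x hx hx'
  obtain ⟨i, h1, h2, rfl⟩ := mem_im.1 hx
  exact h.lp i (by omega) (by omega) hx'

theorem Cfg.qL (h : Cfg G u v m k q p α β α' β' L1 L2 L3 L4) (a b : ℤ) :
    Disjoint (im q a b) (L1 ∪ L2 ∪ L3 ∪ L4) := by
  rw [Set.disjoint_left]
  intro x hx hx'
  obtain ⟨i, h1, h2, rfl⟩ := mem_im.1 hx
  exact h.lq i hx'

theorem Cfg.disj (h : Cfg G u v m k q p α β α' β' L1 L2 L3 L4) :
    ((∀ a b c d : ℤ, (b ≤ c ∧ d ≤ a + m) ∨ (d ≤ a ∧ b ≤ c + m) → Disjoint (im q a b) (im q c d)) ∧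
    (∀ a b c d : ℤ, 0 ≤ a ∧ b ≤ k + 1 ∧ 0 ≤ c ∧ d ≤ k + 1 ∧ (b ≤ c ∨ d ≤ a) → Disjoint (im p a b) (im p c d)) ∧
    (∀ a b c d : ℤ, 0 ≤ a ∧ b ≤ k + 1 → Disjoint (im p a b) (im q c d)) ∧
    (∀ a b c d : ℤ, 0 ≤ a ∧ b ≤ k + 1 → Disjoint (im q c d) (im p a b))) ∧
    ((∀ a b : ℤ, 0 ≤ a ∧ b ≤ k + 1 → Disjoint (im p a b) L1) ∧ (∀ a b : ℤ, 0 ≤ a ∧ b ≤ k + 1 → Disjoint (im p a b) L2) ∧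
    (∀ a b : ℤ, 0 ≤ a ∧ b ≤ k + 1 → Disjoint (im p a b) L3) ∧ (∀ a b : ℤ, 0 ≤ a ∧ b ≤ k + 1 → Disjoint (im p a b) L4)) ∧
    ((∀ a b : ℤ, 0 ≤ a ∧ b ≤ k + 1 → Disjoint L1 (im p a b)) ∧ (∀ a b : ℤ, 0 ≤ a ∧ b ≤ k + 1 → Disjoint L2 (im p a b)) ∧
    (∀ a b : ℤ, 0 ≤ a ∧ b ≤ k + 1 → Disjoint L3 (im p a b)) ∧ (∀ a b : ℤ, 0 ≤ a ∧ b ≤ k + 1 → Disjoint L4 (im p a b))) ∧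
    ((∀ a b : ℤ, Disjoint (im q a b) L1) ∧ (∀ a b : ℤ, Disjoint (im q a b) L2) ∧
    (∀ a b : ℤ, Disjoint (im q a b) L3) ∧ (∀ a b : ℤ, Disjoint (im q a b) L4)) ∧
    ((∀ a b : ℤ, Disjoint L1 (im q a b)) ∧ (∀ a b : ℤ, Disjoint L2 (im q a b)) ∧
    (∀ a b : ℤ, Disjoint L3 (im q a b)) ∧ (∀ a b : ℤ, Disjoint L4 (im q a b))) ∧
    (Disjoint L1 L2 ∧ Disjoint L1 L3 ∧ Disjoint L1 L4 ∧ Disjoint L2 L3 ∧ Disjoint L2 L4 ∧ Disjoint L3 L4) ∧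
    (Disjoint L2 L1 ∧ Disjoint L3 L1 ∧ Disjoint L4 L1 ∧ Disjoint L3 L2 ∧ Disjoint L4 L2 ∧ Disjoint L4 L3) := by
  have e1 : L1 ⊆ L1 ∪ L2 ∪ L3 ∪ L4 := fun x hx => Or.inl (Or.inl (Or.inl hx))
  have e2 : L2 ⊆ L1 ∪ L2 ∪ L3 ∪ L4 := fun x hx => Or.inl (Or.inl (Or.inr hx))
  have e3 : L3 ⊆ L1 ∪ L2 ∪ L3 ∪ L4 := fun x hx => Or.inl (Or.inr hx)
  have e4 : L4 ⊆ L1 ∪ L2 ∪ L3 ∪ L4 := fun x hx => Or.inr hx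
  refine ⟨⟨h.qq, h.pp, h.pqd, fun a b c d hc => (h.pqd a b c d hc).symm⟩,
    ⟨fun a b hc => (h.pL a b hc).mono_right e1, fun a b hc => (h.pL a b hc).mono_right e2,
      fun a b hc => (h.pL a b hc).mono_right e3, fun a b hc => (h.pL a b hc).mono_right e4⟩,
    ⟨fun a b hc => ((h.pL a b hc).mono_right e1).symm, fun a b hc => ((h.pL a b hc).mono_right e2).symm,
      fun a b hc => ((h.pL a b hc).mono_right e3).symm, fun a b hc => ((h.pL a b hc).mono_right e4).symm⟩,
    ⟨fun a b => (h.qL a b).mono_right e1, fun a b => (h.qL a b).mono_right e2,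
      fun a b => (h.qL a b).mono_right e3, fun a b => (h.qL a b).mono_right e4⟩,
    ⟨fun a b => ((h.qL a b).mono_right e1).symm, fun a b => ((h.qL a b).mono_right e2).symm,
      fun a b => ((h.qL a b).mono_right e3).symm, fun a b => ((h.qL a b).mono_right e4).symm⟩,
    ⟨h.d12, h.d13, h.d14, h.d23, h.d24, h.d34⟩, ⟨h.d12.symm, h.d13.symm, h.d14.symm, h.d23.symm, h.d24.symm, h.d34.symm⟩⟩

theorem Cfg.qc (h : Cfg G u v m k q p α β α' β' L1 L2 L3 L4) {a b : ℤ} (hab : a < b) : Conn G (im q a b) :=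
  conn_im hab fun i _ _ => h.qadj i

theorem Cfg.pc (h : Cfg G u v m k q p α β α' β' L1 L2 L3 L4) {a b : ℤ} (hab : 0 ≤ a ∧ a < b ∧ b ≤ k + 1) : Conn G (im p a b) :=
  conn_im hab.2.1 fun i _ _ => h.path.adj i (by omega) (by omega)

theorem Cfg.qt (h : Cfg G u v m k q p α β α' β' L1 L2 L3 L4) {a b c d : ℤ}
    (hc : a < b ∧ c < d ∧ (b = c ∨ b = c + m ∨ d = a ∨ d = a + m)) : Tch G (im q a b) (im q c d) := by
  have key : ∀ {a b c d : ℤ}, a < b → c < d → (b = c ∨ b = c + m) → Tch G (im q a b) (im q c d) := by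
    intro a b c d h1 h2 h3
    refine ⟨q (b - 1), im_mem (by omega) (by omega), q c, im_mem le_rfl h2, ?_⟩
    have := h.qadj (b - 1)
    rw [show b - 1 + 1 = b by omega] at this
    rcases h3 with rfl | rfl
    · exact this
    · rwa [h.per] at this
  obtain ⟨h1, h2, h3⟩ := hc
  rcases h3 with h3 | h3 | h3 | h3
  · exact key h1 h2 (Or.inl h3)
  · exact key h1 h2 (Or.inr h3)
  · exact (key h2 h1 (Or.inl h3)).symm
  · exact (key h2 h1 (Or.inr h3)).symm

theorem Cfg.pt (h : Cfg G u v m k q p α β α' β' L1 L2 L3 L4) {a b c d : ℤ}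
    (hc : 0 ≤ a ∧ b ≤ k + 1 ∧ 0 ≤ c ∧ d ≤ k + 1 ∧ a < b ∧ c < d ∧ (b = c ∨ d = a)) : Tch G (im p a b) (im p c d) := by
  have key : ∀ {a b c d : ℤ}, 0 ≤ a → d ≤ k + 1 → a < b → c < d → b = c → Tch G (im p a b) (im p c d) := by
    intro a b c d h0 h4 h1 h2 h3
    refine ⟨p (b - 1), im_mem (by omega) (by omega), p c, im_mem le_rfl h2, ?_⟩
    have := h.path.adj (b - 1) (by omega) (by omega)
    rwa [show b - 1 + 1 = c by omega] at this
  obtain ⟨h1, h2, h3, h4, h5, h6, h7 | h7⟩ := hc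
  · exact key h1 h4 h5 h6 h7
  · exact (key h3 h2 h6 h5 h7).symm

theorem Cfg.reflect (h : Cfg G u v m k q p α β α' β' L1 L2 L3 L4) :
    Cfg G u v m k (fun i => q (-i)) p (-α') (-β) (-α) (-β' + m) L1 L2 L4 L3 := by
  have := h.o1; have := h.o2; have := h.o3; have := h.o4
  refine ⟨?_, ?_, ?_, by omega, by omega, by omega, by omega, h.k2, h.path, h.e, fun i j => h.pq i (-j), ?_, ?_, ?_, ?_,
    h.d12, h.d14, h.d13, h.d24, h.d23, h.d34.symm, ?_, ?_⟩
  · intro i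
    show q (-(i + m)) = q (-i)
    rw [← h.per (-(i + m))]; congr 1; omega
  · intro i
    have := (h.qadj (-(i + 1))).symm
    rwa [show -(i + 1) + 1 = -i by omega] at this
  · intro i j hij
    have := h.qinj _ _ hij
    rw [show -i - -j = -(i - j) by omega] at this
    exact (dvd_neg).1 this
  · show Leg G (p 0) L1 (q (- -β))
    rw [neg_neg]; exact h.l1
  · show Leg G (p 0) L2 (q (-(-β' + m)))
    rw [show -(-β' + m) = β' - m by omega, h.per']; exact h.l2
  · show Leg G (p k) L4 (q (- -α'))
    rw [neg_neg]; exact h.l4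
  · show Leg G (p k) L3 (q (- -α))
    rw [neg_neg]; exact h.l3
  · intro i h0 h1 h2
    exact h.lp i h0 h1 (by simp only [Set.mem_union] at h2 ⊢; tauto)
  · intro i h2
    exact h.lq (-i) (by simp only [Set.mem_union] at h2 ⊢; tauto)

theorem Cfg.rot (h : Cfg G u v m k q p α β α' β' L1 L2 L3 L4) :
    Cfg G u v m k q p α' β' (α + m) (β + m) L2 L1 L4 L3 := by
  have := h.o1; have := h.o2; have := h.o3; have := h.o4
  refine ⟨h.per, h.qadj, h.qinj, by omega, by omega, by omega, by omega, h.k2, h.path, h.e, h.pq, h.l2, ?_, h.l4, ?_,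
    h.d12.symm, h.d24, h.d23, h.d14, h.d13, h.d34.symm, ?_, ?_⟩
  · rw [h.per]; exact h.l1
  · rw [h.per]; exact h.l3
  · intro i h0 h1 h2
    exact h.lp i h0 h1 (by simp only [Set.mem_union] at h2 ⊢; tauto)
  · intro i h2
    exact h.lq i (by simp only [Set.mem_union] at h2 ⊢; tauto)

theorem Cfg.rev (h : Cfg G u v m k q p α β α' β' L1 L2 L3 L4) :
    Cfg G u v m k q (fun i => p (k - i)) β α' β' (α + m) L4 L3 L1 L2 := by
  have := h.o1; have := h.o2; have := h.o3; have := h.o4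
  refine ⟨h.per, h.qadj, h.qinj, by omega, by omega, by omega, by omega, h.k2, h.path.rev, ?_, ?_, ?_, ?_, ?_, ?_,
    h.d34.symm, h.d14.symm, h.d24.symm, h.d13.symm, h.d23.symm, h.d12, ?_, ?_⟩
  · obtain ⟨i, h0, h1, h2⟩ := h.e
    refine ⟨k - 1 - i, by omega, by omega, ?_⟩
    show s(p (k - (k - 1 - i)), p (k - (k - 1 - i + 1))) = _
    rw [show k - (k - 1 - i) = i + 1 by omega, show k - (k - 1 - i + 1) = i by omega, Sym2.eq_swap]
    exact h2
  · intro i j h0 h1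
    exact h.pq _ j (by omega) (by omega)
  · simpa using h.l4
  · simpa [h.per] using h.l3
  · simpa using h.l1
  · simpa using h.l2
  · intro i h0 h1 h2
    exact h.lp (k - i) (by omega) (by omega) (by simp only [Set.mem_union] at h2 ⊢; tauto)
  · intro i h2
    exact h.lq i (by simp only [Set.mem_union] at h2 ⊢; tauto)

theorem Cfg.core_p (h : Cfg G u v m k q p α β α' β' L1 L2 L3 L4) {i : ℤ} (h0 : 0 ≤ i) (h1 : i < k) : p i ∈ core G :=
  ⟨_, h.path.adj i h0 h1⟩

theorem not_mem_im_p (h : Cfg G u v m k q p α β α' β' L1 L2 L3 L4) {i a b : ℤ} (hi : 0 ≤ i ∧ i ≤ k ∧ 0 ≤ a ∧ b ≤ k + 1 ∧ (i < a ∨ b ≤ i)) :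
    p i ∉ im p a b := by
  intro h'
  obtain ⟨j, h1, h2, h3⟩ := mem_im.1 h'
  have := h.path.inj j i (by omega) (by omega) (by omega) (by omega) h3
  omega

theorem not_mem_im_q (h : Cfg G u v m k q p α β α' β' L1 L2 L3 L4) {i a b : ℤ} (hi : 0 ≤ i ∧ i ≤ k) :
    p i ∉ im q a b := by
  intro h'
  obtain ⟨j, h1, h2, h3⟩ := mem_im.1 h'
  exact h.pq i j hi.1 hi.2 h3.symm

/-- the vertices not used are isolated -/
theorem Cfg.span (hG : SixFree G) (h : Cfg G u v m k q p α β α' β' L1 L2 L3 L4) {x : V} (hx : x ∈ core G) :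
    (∃ i, 0 ≤ i ∧ i ≤ k ∧ p i = x) ∨ (∃ i, q i = x) ∨ x ∈ L1 ∪ L2 ∪ L3 ∪ L4 := by
  by_contra hcon
  push Not at hcon
  obtain ⟨n1, n2, n3⟩ := hcon
  have := h.o1; have := h.o2; have := h.o3; have := h.o4; have := h.k2
  have hD := h.disj
  have np : ∀ a b, 0 ≤ a → b ≤ k + 1 → x ∉ im p a b := fun a b h0 h1 h' => by
    obtain ⟨i, h2, h3, h4⟩ := mem_im.1 h'
    exact n1 i (by omega) (by omega) h4
  have nq : ∀ a b, x ∉ im q a b := fun a b h' => by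
    obtain ⟨i, h2, h3, h4⟩ := mem_im.1 h'
    exact n2 i h4
  simp only [Set.mem_union, not_or] at n3
  have p0 : p 0 ∈ im p 0 k := im_mem le_rfl (by omega)
  have pk : p k ∈ im p k (k + 1) := im_mem le_rfl (by omega)
  have cC := h.l2.conn_add (h.l1.conn_add (h.pc (a := 0) (b := k) (by omega)) p0) (Or.inl p0)
  have cD := h.l4.conn_add (h.l3.conn_add (h.pc (a := k) (b := k + 1) (by omega)) pk) (Or.inl pk)
  refine hG.k33 (x := x) (A0 := im p 0 k ∪ L1 ∪ L2) (A1 := im q α β) (A2 := im q α' β')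
    (B0 := im p k (k + 1) ∪ L3 ∪ L4) (B1 := im q β α') (B2 := im q β' (α + m)) hx
    ⟨cC, h.qc (by omega), h.qc (by omega), cD, h.qc (by omega), h.qc (by omega)⟩ ?_
    ⟨(h.pt (by omega)).ul.ul.symm.ul.ul.symm, (h.l1.tch_add p0 (im_mem le_rfl (by omega))).ul,
      h.l2.tch_add (Or.inl p0) (im_mem le_rfl (by omega)), (h.l3.tch_add pk (im_mem le_rfl (by omega))).ul.symm, h.qt (by omega), h.qt (by omega),
      (h.l4.tch_add (Or.inl pk) (im_mem le_rfl (by omega))).symm, h.qt (by omega), h.qt (by omega)⟩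
    ⟨?_, nq _ _, nq _ _, ?_, nq _ _, nq _ _⟩
  · simp only [List.pairwise_cons, List.mem_cons, List.not_mem_nil, or_false, forall_eq_or_imp, forall_eq,
      Set.disjoint_union_left, Set.disjoint_union_right]
    simp (disch := omega) [hD]
  · simp [np 0 k le_rfl (by omega), n3]
  · simp [np k (k + 1) (by omega) le_rfl, n3]

end FThree

open SimpleGraph
set_option linter.unusedVariables false

section FThreeStep

variable {V : Type*} {G : SimpleGraph V}
variable {u v : V} {m k : ℤ} {q p : ℤ → V} {α β α' β' : ℤ} {L1 L2 L3 L4 : Set V}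

theorem Leg.tch_right {L T : Set V} {p b : V} (h : Leg G p L b) (hL : L.Nonempty) (hb : b ∈ T) : Tch G L T := by
  rcases h with ⟨rfl, h⟩ | ⟨hc, -, y, hy, hyb⟩
  · simp at hL
  · exact ⟨y, hy, b, hb, hyb⟩

theorem Leg.tch_left {L T : Set V} {p b : V} (h : Leg G p L b) (hL : L.Nonempty) (hb : p ∈ T) : Tch G L T :=
  h.symm.tch_right hL hb

theorem Leg.conn {L : Set V} {p b : V} (h : Leg G p L b) (hL : L.Nonempty) : Conn G L := by
  rcases h with ⟨rfl, h⟩ | ⟨hc, -⟩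
  · simp at hL
  · exact hc

theorem Cfg.l1_far (hG : SixFree G) (h : Cfg G u v m k q p α β α' β' L1 L2 L3 L4) {z t : V} (hz : z ∈ L1) (hzt : G.Adj z t)
    (ht : t ∈ im p k (k + 1) ∪ L3 ∪ L4) : False := by
  have := h.o1; have := h.o2; have := h.o3; have := h.o4; have := h.k2
  have hD := h.disj
  have p0 : p 0 ∈ im p 0 1 := im_mem le_rfl (by omega)
  have pk : p k ∈ im p k (k + 1) := im_mem le_rfl (by omega)
  have cC := h.l2.conn_add (h.l1.conn_add (h.pc (a := 0) (b := 1) (by omega)) p0) (Or.inl p0)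
  have cD := h.l4.conn_add (h.l3.conn_add (h.pc (a := k) (b := k + 1) (by omega)) pk) (Or.inl pk)
  have hlp := h.lp 1 (by omega) (by omega)
  simp only [Set.mem_union, not_or] at hlp
  refine hG.k33 (x := p 1) (A0 := im p 0 1 ∪ L1 ∪ L2) (A1 := im q α β) (A2 := im q α' β')
    (B0 := im p k (k + 1) ∪ L3 ∪ L4) (B1 := im q β α') (B2 := im q β' (α + m)) (h.core_p (by omega) (by omega))
    ⟨cC, h.qc (by omega), h.qc (by omega), cD, h.qc (by omega), h.qc (by omega)⟩ ?_
    ⟨⟨z, Or.inl (Or.inr hz), t, ht, hzt⟩, (h.l1.tch_add p0 (im_mem le_rfl (by omega))).ul,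
      h.l2.tch_add (Or.inl p0) (im_mem le_rfl (by omega)), (h.l3.tch_add pk (im_mem le_rfl (by omega))).ul.symm, h.qt (by omega), h.qt (by omega),
      (h.l4.tch_add (Or.inl pk) (im_mem le_rfl (by omega))).symm, h.qt (by omega), h.qt (by omega)⟩
    ⟨?_, not_mem_im_q h (by omega), not_mem_im_q h (by omega), ?_, not_mem_im_q h (by omega), not_mem_im_q h (by omega)⟩
  · simp only [List.pairwise_cons, List.mem_cons, List.not_mem_nil, or_false, forall_eq_or_imp, forall_eq,
      Set.disjoint_union_left, Set.disjoint_union_right]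
    simp (disch := omega) [hD]
  · simp [hlp, not_mem_im_p h (i := 1) (a := 0) (b := 1) (by omega)]
  · simp [hlp, not_mem_im_p h (i := 1) (a := k) (b := k + 1) (by omega)]

theorem Cfg.l1_p (hG : SixFree G) (h : Cfg G u v m k q p α β α' β' L1 L2 L3 L4) {z : V} {j : ℤ} (hz : z ∈ L1) (hzt : G.Adj z (p j))
    (h1 : 1 ≤ j) (hj : j < k) : False := by
  have := h.o1; have := h.o2; have := h.o3; have := h.o4; have := h.k2
  have hD := h.disj
  have p0 : p 0 ∈ im p 0 1 := im_mem le_rfl (by omega)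
  have pk : p k ∈ im p (j + 1) (k + 1) := im_mem (by omega) (by omega)
  have cC := h.l2.conn_add (h.pc (a := 0) (b := 1) (by omega)) p0
  have cD := h.l4.conn_add (h.l3.conn_add (h.pc (a := j + 1) (b := k + 1) (by omega)) pk) (Or.inl pk)
  have hL : L1.Nonempty := ⟨z, hz⟩
  refine hG.k33h (A0 := im p 0 1 ∪ L2) (A1 := im q α β) (A2 := im q α' β')
    (B0 := im q β α') (B1 := im p (j + 1) (k + 1) ∪ L3 ∪ L4) (B2 := im q β' (α + m)) (s0 := L1) (s1 := im p 1 (j + 1))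
    ⟨cC, h.qc (by omega), h.qc (by omega), h.qc (by omega), cD, h.qc (by omega), h.l1.conn hL, h.pc (by omega)⟩ ?_
    ⟨h.l2.tch_add p0 (im_mem le_rfl (by omega)), h.qt (by omega), (h.l3.tch_add pk (im_mem le_rfl (by omega))).ul.symm, h.qt (by omega),
      h.qt (by omega), (h.l4.tch_add (Or.inl pk) (im_mem le_rfl (by omega))).symm, h.qt (by omega)⟩
    ⟨h.l1.tch_left hL (Or.inl p0), h.l1.tch_right hL (im_mem le_rfl (by omega)), (h.pt (by omega)).symm.ul.symm,
      (h.pt (by omega)).symm.ul.ul.symm, ⟨z, hz, p j, im_mem (by omega) (by omega), hzt⟩⟩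
  simp only [List.pairwise_cons, List.mem_cons, List.not_mem_nil, or_false, forall_eq_or_imp, forall_eq,
      Set.disjoint_union_left, Set.disjoint_union_right]
  simp (disch := omega) [hD]

theorem Cfg.l1_l2 (hG : SixFree G) (h : Cfg G u v m k q p α β α' β' L1 L2 L3 L4) {z t : V} (hz : z ∈ L1) (hzt : G.Adj z t)
    (ht : t ∈ L2) : False := by
  have := h.o1; have := h.o2; have := h.o3; have := h.o4; have := h.k2
  have hD := h.disj
  have p0 : p 0 ∈ im p 0 1 := im_mem le_rfl (by omega)
  have pk : p k ∈ im p 1 (k + 1) := im_mem (by omega) (by omega)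
  have cD := h.l4.conn_add (h.l3.conn_add (h.pc (a := 1) (b := k + 1) (by omega)) pk) (Or.inl pk)
  have hL : L1.Nonempty := ⟨z, hz⟩
  have hL2 : L2.Nonempty := ⟨t, ht⟩
  refine hG.k33h (A0 := im p 0 1) (A1 := im q α β) (A2 := im q α' β')
    (B0 := im q β α') (B1 := im q β' (α + m)) (B2 := im p 1 (k + 1) ∪ L3 ∪ L4) (s0 := L1) (s1 := L2)
    ⟨h.pc (by omega), h.qc (by omega), h.qc (by omega), h.qc (by omega), h.qc (by omega), cD, h.l1.conn hL, h.l2.conn hL2⟩ ?_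
    ⟨(h.pt (by omega)).symm.ul.ul.symm, h.qt (by omega), h.qt (by omega), (h.l3.tch_add pk (im_mem le_rfl (by omega))).ul.symm,
      h.qt (by omega), h.qt (by omega), (h.l4.tch_add (Or.inl pk) (im_mem le_rfl (by omega))).symm⟩
    ⟨h.l1.tch_left hL p0, h.l1.tch_right hL (im_mem le_rfl (by omega)), h.l2.tch_left hL2 p0,
      h.l2.tch_right hL2 (im_mem le_rfl (by omega)), ⟨z, hz, t, ht, hzt⟩⟩
  simp only [List.pairwise_cons, List.mem_cons, List.not_mem_nil, or_false, forall_eq_or_imp, forall_eq,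
      Set.disjoint_union_left, Set.disjoint_union_right]
  simp (disch := omega) [hD]

theorem Cfg.l1_q (hG : SixFree G) (h : Cfg G u v m k q p α β α' β' L1 L2 L3 L4) {z : V} {j : ℤ} (hz : z ∈ L1) (hzt : G.Adj z (q j))
    (h1 : α < j) (hj : j < β) : False := by
  have := h.o1; have := h.o2; have := h.o3; have := h.o4; have := h.k2
  have hD := h.disj
  have p0 : p 0 ∈ im p 0 k := im_mem le_rfl (by omega)
  have pk : p k ∈ im p k (k + 1) := im_mem (by omega) (by omega)
  have cC := h.l2.conn_add (h.pc (a := 0) (b := k) (by omega)) p0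
  have cD := h.l4.conn_add (h.l3.conn_add (h.pc (a := k) (b := k + 1) (by omega)) pk) (Or.inl pk)
  have hL : L1.Nonempty := ⟨z, hz⟩
  refine hG.k33h (A0 := im q β α') (A1 := im q β' (α + m)) (A2 := im p k (k + 1) ∪ L3 ∪ L4)
    (B0 := im p 0 k ∪ L2) (B1 := im q α (α + 1)) (B2 := im q α' β') (s0 := L1) (s1 := im q (α + 1) β)
    ⟨h.qc (by omega), h.qc (by omega), cD, cC, h.qc (by omega), h.qc (by omega), h.l1.conn hL, h.qc (by omega)⟩ ?_
    ⟨h.qt (by omega), (h.l2.tch_add p0 (im_mem le_rfl (by omega))).symm, h.qt (by omega), h.qt (by omega),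
      (h.pt (by omega)).ul.ul.symm.ul.symm, (h.l3.tch_add pk (im_mem le_rfl (by omega))).ul,
      h.l4.tch_add (Or.inl pk) (im_mem le_rfl (by omega))⟩
    ⟨h.l1.tch_right hL (im_mem le_rfl (by omega)), h.l1.tch_left hL (Or.inl p0), h.qt (by omega),
      h.qt (by omega), ⟨z, hz, q j, im_mem (by omega) (by omega), hzt⟩⟩
  simp only [List.pairwise_cons, List.mem_cons, List.not_mem_nil, or_false, forall_eq_or_imp, forall_eq,
      Set.disjoint_union_left, Set.disjoint_union_right]
  simp (disch := omega) [hD]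

theorem Cfg.l1_nbr (hG : SixFree G) (h : Cfg G u v m k q p α β α' β' L1 L2 L3 L4) {z t : V} (hz : z ∈ L1) (hzt : G.Adj z t) :
    t ∈ L1 ∨ t = p 0 ∨ t = q β ∨ ∃ j, α' ≤ j ∧ j ≤ α + m ∧ t = q j := by
  have := h.o1; have := h.o2; have := h.o3; have := h.o4; have := h.k2
  rcases h.span hG (x := t) ⟨z, hzt.symm⟩ with ⟨i, h0, h1, rfl⟩ | ⟨i, rfl⟩ | ht
  · rcases eq_or_lt_of_le h0 with h0 | h0
    · right; left; rw [← h0]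
    · rcases eq_or_lt_of_le h1 with h1 | h1
      · exact (h.l1_far hG hz hzt (Or.inl (Or.inl (h1 ▸ im_mem le_rfl (by omega))))).elim
      · exact (h.l1_p hG hz hzt (by omega) h1).elim
  · obtain ⟨j, h0, h1, h2⟩ := h.window (α + 1) i
    rw [← h2] at hzt ⊢
    rcases lt_trichotomy j β with h3 | h3 | h3
    · exact (h.l1_q hG hz hzt (by omega) h3).elim
    · right; right; left; rw [h3]
    · rcases lt_or_ge j α' with h4 | h4
      · exact (h.reflect.l1_q hG (j := -j) hz (by simpa using hzt) (by omega) (by omega)).elim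
      · right; right; right; exact ⟨j, h4, by omega, rfl⟩
  · rcases ht with ((ht | ht) | ht) | ht
    · exact Or.inl ht
    · exact (h.l1_l2 hG hz hzt ht).elim
    · exact (h.l1_far hG hz hzt (Or.inl (Or.inr ht))).elim
    · exact (h.l1_far hG hz hzt (Or.inr ht)).elim


theorem ssub_legs {L1 L2 L3 L4 M1 M2 M3 M4 : Set V} {x : V} (h : M1 ∪ M2 ∪ M3 ∪ M4 ⊆ L1 ∪ L2 ∪ L3 ∪ L4)
    (hx : x ∈ L1) (hx' : x ∉ M1 ∪ M2 ∪ M3 ∪ M4) : M1 ∪ M2 ∪ M3 ∪ M4 ⊂ L1 ∪ L2 ∪ L3 ∪ L4 :=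
  ⟨h, fun h' => hx' (h' (Or.inl (Or.inl (Or.inl hx))))⟩

theorem Cfg.l1_open (h : Cfg G u v m k q p α β α' β' L1 L2 L3 L4) {z : V} {j : ℤ} (hz : z ∈ L1) (hzt : G.Adj z (q j))
    (h1 : α' < j) (h2 : j < α + m) :
    ∃ k p M1 M2, Cfg G u v m k q p α β α' j M1 M2 L3 L4 ∧ M1 ∪ M2 ∪ L3 ∪ L4 ⊂ L1 ∪ L2 ∪ L3 ∪ L4 := by
  have := h.o1; have := h.o2; have := h.o3; have := h.o4; have := h.k2
  have hL : L1.Nonempty := ⟨z, hz⟩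
  have hlq : ∀ i, q i ∉ L1 := fun i hi => h.lq i (Or.inl (Or.inl (Or.inl hi)))
  have hlp : ∀ i, 0 ≤ i → i ≤ k → p i ∉ L1 := fun i h0 h1 hi => h.lp i h0 h1 (Or.inl (Or.inl (Or.inl hi)))
  obtain ⟨y0, hy0, t0, ht0, hyp⟩ := h.l1.tch_left hL (Set.mem_singleton _)
  rw [Set.mem_singleton_iff.1 ht0] at hyp
  obtain ⟨K, r, T1, T2, hr, hr0, hrY, s1, s1', s2, s2', c1, c2, d12, t1, t2⟩ := (h.l1.conn hL).center hy0 (conn_singleton (q β)) (conn_singleton (q j))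
    (by simpa using hlq β) (by simpa using hlq j) (by
      rw [Set.disjoint_singleton]; intro hh; have := h.inj hh (by omega) (by omega); omega)
    (h.l1.tch_right hL (Set.mem_singleton _)) ⟨z, hz, _, rfl, hzt⟩
  have hK := hr.nn
  have hit : ∀ {T : Set V} {x : V}, Conn G T → x ∈ T → T ⊆ {x} ∪ L1 → Tch G {r K} T → ∃ L, L ⊆ T \ {x} ∧ L ⊆ L1 ∧ Leg G (r K) L x := by
    intro T x cT hx hT ht
    obtain ⟨a, ha, y, hy, hay⟩ := ht
    rw [Set.mem_singleton_iff.1 ha] at hay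
    obtain ⟨b, hb, hbT, L, hLT, hleg⟩ := cT.hit hy hay hx (Set.mem_singleton x)
    rw [Set.mem_singleton_iff.1 hb] at hleg
    refine ⟨L, hLT, fun w hw => ?_, hleg⟩
    rcases hT (hLT hw).1 with h' | h'
    · exact absurd h' (hLT hw).2
    · exact h'
  obtain ⟨M1, m1, m1', leg1⟩ := hit c1 (s1 rfl) s1' t1
  obtain ⟨M2, m2, m2', leg2⟩ := hit c2 (s2 rfl) s2' t2
  have e1 : ∀ x ∈ M1, x ∈ T1 := fun x hx => (m1 hx).1
  have e2 : ∀ x ∈ M2, x ∈ T2 := fun x hx => (m2 hx).1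
  have rL : ∀ i, 0 ≤ i → i ≤ K → r i ∉ M1 ∪ M2 ∪ L3 ∪ L4 := by
    intro i h0 h1
    obtain ⟨a, b, c⟩ := hrY i h0 h1
    rintro (((hx | hx) | hx) | hx)
    · exact b (e1 _ hx)
    · exact c (e2 _ hx)
    · exact Set.disjoint_left.1 h.d13 a hx
    · exact Set.disjoint_left.1 h.d14 a hx
  have sub : M1 ∪ M2 ∪ L3 ∪ L4 ⊆ L1 ∪ L2 ∪ L3 ∪ L4 := by
    rintro x (((hx | hx) | hx) | hx)
    · exact Or.inl (Or.inl (Or.inl (m1' hx)))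
    · exact Or.inl (Or.inl (Or.inl (m2' hx)))
    · exact Or.inl (Or.inr hx)
    · exact Or.inr hx
  refine ⟨K + k + 1, cat (fun i => r (K - i)) K p, M1, M2, ⟨h.per, h.qadj, h.qinj, h.o1, h.o2, h1, h2, by omega, ?_, ?_, ?_, ?_, ?_, ?_, ?_,
    ?_, h.d13.mono_left m1', h.d14.mono_left m1', h.d13.mono_left m2', h.d14.mono_left m2', h.d34, ?_, fun i hi => h.lq i (sub hi)⟩,
    ssub_legs sub hy0 (hr0 ▸ rL 0 le_rfl hK)⟩
  · refine hr.rev.concat h.path (by simpa [hr0] using hyp) ?_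
    intro i j' h3 h4 h5 h6 h7
    exact hlp j' h5 h6 (h7 ▸ (hrY (K - i) (by omega) (by omega)).1)
  · obtain ⟨i, h3, h4, h5⟩ := h.e
    refine ⟨K + i + 1, by omega, by omega, ?_⟩
    rw [cat_add h3, show K + i + 1 + 1 = K + (i + 1) + 1 by omega, cat_add (by omega)]
    exact h5
  · intro i j' h3 h4
    rcases le_or_gt i K with h5 | h5
    · rw [cat_le h5]
      intro h7
      exact hlq j' (h7 ▸ (hrY (K - i) (by omega) (by omega)).1)
    · rw [cat_gt h5]; exact h.pq _ _ (by omega) (by omega)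
  · rw [cat_le hK]; simpa using leg1
  · rw [cat_le hK]; simpa using leg2
  · rw [cat_add (by omega)]; exact h.l3
  · rw [cat_add (by omega)]; exact h.l4
  · rw [Set.disjoint_left]
    intro x hx hx'
    exact Set.disjoint_left.1 d12 (e1 x hx) (e2 x hx')
  · intro i h3 h4
    rcases le_or_gt i K with h5 | h5
    · rw [cat_le h5]; exact rL _ (by omega) (by omega)
    · rw [cat_gt h5]; exact fun hh => h.lp _ (by omega) (by omega) (sub hh)

theorem Cfg.l1_end (h : Cfg G u v m k q p α β α' β' L1 L2 L3 L4) {z : V} (hz : z ∈ L1) (hzt : G.Adj z (q α')) :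
    ∃ m q α β α' β' M2, Cfg G u v m k q p α β α' β' L2 M2 L4 L3 ∧ L2 ∪ M2 ∪ L4 ∪ L3 ⊂ L1 ∪ L2 ∪ L3 ∪ L4 := by
  have := h.o1; have := h.o2; have := h.o3; have := h.o4; have := h.k2
  have hL : L1.Nonempty := ⟨z, hz⟩
  have hlq : ∀ i, q i ∉ L1 := fun i hi => h.lq i (Or.inl (Or.inl (Or.inl hi)))
  have hlp : ∀ i, 0 ≤ i → i ≤ k → p i ∉ L1 := fun i h0 h1 hi => h.lp i h0 h1 (Or.inl (Or.inl (Or.inl hi)))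
  obtain ⟨y0, hy0, t0, ht0, hyp⟩ := h.l1.tch_right hL (Set.mem_singleton _)
  rw [Set.mem_singleton_iff.1 ht0] at hyp
  obtain ⟨K, r, i, M, hr, hr0, hrK, hi0, hiK, leg, sR, sM, dd⟩ := (h.l1.conn hL).tri hy0 hz (h.l1.tch_left hL (Set.mem_singleton (p 0))).symm
  have hK := hr.nn
  have rM := im_sub sR
  have rnM : ∀ i, 0 ≤ i → i ≤ K → r i ∉ M := fun i h0 h1 h' => Set.disjoint_left.1 dd h' (im_mem h0 (by omega))
  obtain ⟨n, hn⟩ : ∃ n, n = β + m - α' := ⟨_, rfl⟩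
  have pa : PathOn G (fun i => q (α' + i)) n := by
    refine ⟨by omega, fun i _ _ => ?_, fun i j h1 h2 h3 h4 h5 => ?_⟩
    · have := h.qadj (α' + i)
      rwa [show α' + i + 1 = α' + (i + 1) by omega] at this
    · have := h.inj h5 (by omega) (by omega); omega
  have pc := pa.concat hr (by
      show G.Adj (q (α' + n)) (r 0)
      rw [show α' + n = β + m by omega, h.per, hr0]; exact hyp.symm) (by
      intro i j h1 h2 h3 h4 h5
      exact hlq (α' + i) (h5 ▸ rM j h3 h4))
  obtain ⟨hper, hadj, hinj⟩ := close_path pc (by omega) (by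
    rw [cat_add hK, cat_le (by omega), hrK]
    simpa using hzt)
  set c := cat (fun i => q (α' + i)) n r with hc
  have cm : ∀ x, 0 ≤ x → x ≤ n + K + 1 → c (x % (n + K + 1 + 1)) = c x := fun x h0 h1 => by
    rw [Int.emod_eq_of_lt h0 (by omega)]
  have cmem : ∀ x, (∃ y, c (x % (n + K + 1 + 1)) = q y) ∨ ∃ y, 0 ≤ y ∧ y ≤ K ∧ c (x % (n + K + 1 + 1)) = r y := by
    intro x
    have h1 := Int.emod_nonneg x (show n + K + 1 + 1 ≠ 0 by omega)
    have h2 := Int.emod_lt_of_pos x (show 0 < n + K + 1 + 1 by omega)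
    rcases le_or_gt (x % (n + K + 1 + 1)) n with h5 | h5
    · left; exact ⟨_, cat_le h5⟩
    · right; exact ⟨_, by omega, by omega, cat_gt h5⟩
  have sub : L2 ∪ M ∪ L4 ∪ L3 ⊆ L1 ∪ L2 ∪ L3 ∪ L4 := by
    rintro x (((hx | hx) | hx) | hx)
    · exact Or.inl (Or.inl (Or.inr hx))
    · exact Or.inl (Or.inl (Or.inl (sM hx)))
    · exact Or.inr hx
    · exact Or.inl (Or.inr hx)
  have rL : ∀ i, 0 ≤ i → i ≤ K → r i ∉ L2 ∪ M ∪ L4 ∪ L3 := by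
    intro i h0 h1
    have a := rM i h0 h1
    rintro (((hx | hx) | hx) | hx)
    · exact Set.disjoint_left.1 h.d12 a hx
    · exact rnM i h0 h1 hx
    · exact Set.disjoint_left.1 h.d14 a hx
    · exact Set.disjoint_left.1 h.d13 a hx
  refine ⟨n + K + 1 + 1, fun x => c (x % (n + K + 1 + 1)), 0, β' - α', α + m - α', n + i + 1, M,
    ⟨hper, hadj, hinj, by omega, by omega, by omega, by omega, h.k2, h.path, h.e, ?_, ?_, ?_, ?_, ?_,
      h.d12.symm.mono_right sM, h.d24, h.d23, h.d14.mono_left sM, h.d13.mono_left sM, h.d34.symm, fun i h0 h1 hh => h.lp i h0 h1 (sub hh), ?_⟩,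
      ssub_legs sub hz (hrK ▸ rL K hK le_rfl)⟩
  · intro a b h0 h1 hh
    rcases cmem b with ⟨y, hy⟩ | ⟨y, h2, h3, hy⟩
    · exact h.pq a y h0 h1 (hh.trans hy)
    · exact hlp a h0 h1 ((hh.trans hy) ▸ rM y h2 h3)
  · show Leg G (p 0) L2 (c ((β' - α') % (n + K + 1 + 1)))
    rw [cm _ (by omega) (by omega), hc, cat_le (by omega), show α' + (β' - α') = β' by omega]; exact h.l2
  · show Leg G (p 0) M (c ((n + i + 1) % (n + K + 1 + 1)))
    rw [cm _ (by omega) (by omega), hc, cat_add hi0]; exact leg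
  · show Leg G (p k) L4 (c (0 % (n + K + 1 + 1)))
    rw [cm _ (by omega) (by omega), hc, cat_le (by omega), show α' + 0 = α' by omega]; exact h.l4
  · show Leg G (p k) L3 (c ((α + m - α') % (n + K + 1 + 1)))
    rw [cm _ (by omega) (by omega), hc, cat_le (by omega), show α' + (α + m - α') = α + m by omega, h.per]; exact h.l3
  · intro a
    show c (a % (n + K + 1 + 1)) ∉ _
    rcases cmem a with ⟨y, hy⟩ | ⟨y, h2, h3, hy⟩
    · rw [hy]; exact fun hh => h.lq y (sub hh)
    · rw [hy]; exact rL y h2 h3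

theorem Cfg.replace1 (h : Cfg G u v m k q p α β α' β' L1 L2 L3 L4) {M : Set V} (hM : M ⊆ L1) (hl : Leg G (p 0) M (q β)) :
    Cfg G u v m k q p α β α' β' M L2 L3 L4 := by
  have sub : M ∪ L2 ∪ L3 ∪ L4 ⊆ L1 ∪ L2 ∪ L3 ∪ L4 := by
    intro x hx; simp only [Set.mem_union] at hx ⊢
    rcases hx with ((hx | hx) | hx) | hx
    · have := hM hx; tauto
    all_goals tauto
  exact ⟨h.per, h.qadj, h.qinj, h.o1, h.o2, h.o3, h.o4, h.k2, h.path, h.e, h.pq, hl, h.l2, h.l3, h.l4, h.d12.mono_left hM,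
    h.d13.mono_left hM, h.d14.mono_left hM, h.d23, h.d24, h.d34, fun i h0 h1 hh => h.lp i h0 h1 (sub hh), fun i hh => h.lq i (sub hh)⟩

def HasCfg (G : SimpleGraph V) (u v : V) (S : Set V) : Prop :=
  ∃ m k q p α β α' β' L1 L2 L3 L4, Cfg G u v m k q p α β α' β' L1 L2 L3 L4 ∧ L1 ∪ L2 ∪ L3 ∪ L4 = S

theorem Cfg.l1_step [Finite V] (hG : SixFree G) (hdeg : ∀ x ∈ core G, ∀ y w, ∃ t, G.Adj x t ∧ t ≠ y ∧ t ≠ w)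
    (h : Cfg G u v m k q p α β α' β' L1 L2 L3 L4) (hL : L1.Nonempty) :
    ∃ S, S ⊂ L1 ∪ L2 ∪ L3 ∪ L4 ∧ HasCfg G u v S := by
  by_cases hcl : ∀ z ∈ L1, ∀ t, G.Adj z t → t ∈ L1 ∨ t = p 0 ∨ t = q β
  · obtain ⟨M, hM, hleg⟩ := Leg.shorten _ rfl h.l1 hL hcl (fun z hz => hdeg z (by
      obtain ⟨y, hy, t, -, hyq⟩ := h.l1.tch_right hL (Set.mem_singleton _)
      by_cases hzy : z = y
      · exact hzy ▸ ⟨_, hyq⟩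
      · obtain ⟨a, ha, hab, b, hb, hbb, hadj⟩ := (h.l1.conn hL).cut {z} hz rfl hy (by simpa using Ne.symm hzy)
        rw [Set.mem_singleton_iff.1 hab] at hadj
        exact ⟨_, hadj⟩))
    obtain ⟨x, hx, hxM⟩ := Set.exists_of_ssubset hM
    refine ⟨M ∪ L2 ∪ L3 ∪ L4, ssub_legs ?_ hx ?_, _, _, _, _, _, _, _, _, _, _, _, _, h.replace1 hM.1 hleg, rfl⟩
    · exact Set.union_subset_union_left _ (Set.union_subset_union_left _ (Set.union_subset_union_left _ hM.1))
    · rintro (((hx' | hx') | hx') | hx')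
      · exact hxM hx'
      · exact Set.disjoint_left.1 h.d12 hx hx'
      · exact Set.disjoint_left.1 h.d13 hx hx'
      · exact Set.disjoint_left.1 h.d14 hx hx'
  · push Not at hcl
    obtain ⟨z, hz, t, hzt, n1, n2, n3⟩ := hcl
    rcases h.l1_nbr hG hz hzt with h' | h' | h' | ⟨j, h1, h2, rfl⟩
    · exact absurd h' n1
    · exact absurd h' n2
    · exact absurd h' n3
    rcases eq_or_lt_of_le h1 with h1 | h1
    · rw [← h1] at hzt
      obtain ⟨_, _, _, _, _, _, _, hc, hs⟩ := h.l1_end hz hzt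
      exact ⟨_, hs, _, _, _, _, _, _, _, _, _, _, _, _, hc, rfl⟩
    rcases eq_or_lt_of_le h2 with h2 | h2
    · rw [h2, h.per] at hzt
      obtain ⟨_, _, _, _, _, _, _, hc, hs⟩ := h.reflect.l1_end hz (by simpa using hzt)
      rw [Set.union_assoc (L1 ∪ L2), Set.union_comm L4 L3, ← Set.union_assoc] at hs
      exact ⟨_, hs, _, _, _, _, _, _, _, _, _, _, _, _, hc, rfl⟩
    · obtain ⟨_, _, _, _, hc, hs⟩ := h.l1_open hz hzt h1 h2
      exact ⟨_, hs, _, _, _, _, _, _, _, _, _, _, _, _, hc, rfl⟩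

theorem f3 [Finite V] (hG : SixFree G) (hdeg : ∀ x ∈ core G, ∀ y w, ∃ t, G.Adj x t ∧ t ≠ y ∧ t ≠ w)
    (h : Cfg G u v m k q p α β α' β' L1 L2 L3 L4) :
    ∃ m k q p α β α' β', Cfg G u v m k q p α β α' β' ∅ ∅ ∅ ∅ := by
  suffices H : ∀ (n : ℕ) (S : Set V), S.ncard = n → HasCfg G u v S → HasCfg G u v ∅ by
    obtain ⟨m, k, q, p, α, β, α', β', L1, L2, L3, L4, hc, he⟩ := H _ _ rfl ⟨_, _, _, _, _, _, _, _, _, _, _, _, h, rfl⟩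
    simp only [Set.union_empty_iff] at he
    obtain ⟨⟨⟨rfl, rfl⟩, rfl⟩, rfl⟩ := he
    exact ⟨_, _, _, _, _, _, _, _, hc⟩
  intro n
  induction n using Nat.strong_induction_on with
  | _ n ih =>
    rintro S hn ⟨m, k, q, p, α, β, α', β', L1, L2, L3, L4, hc, rfl⟩
    have next : ∀ {T : Set V}, T = L1 ∪ L2 ∪ L3 ∪ L4 → (∃ S, S ⊂ T ∧ HasCfg G u v S) → HasCfg G u v ∅ := by
      rintro T rfl ⟨S, hS, hS'⟩
      exact ih _ (hn ▸ Set.ncard_lt_ncard hS) S rfl hS'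
    rcases L1.eq_empty_or_nonempty with e1 | e1
    · rcases L2.eq_empty_or_nonempty with e2 | e2
      · rcases L3.eq_empty_or_nonempty with e3 | e3
        · rcases L4.eq_empty_or_nonempty with e4 | e4
          · exact ⟨m, k, q, p, α, β, α', β', L1, L2, L3, L4, hc, by simp [e1, e2, e3, e4]⟩
          · exact next (by ext; simp only [Set.mem_union]; tauto) (hc.rev.l1_step hG hdeg e4)
        · exact next (by ext; simp only [Set.mem_union]; tauto) (hc.rev.rot.l1_step hG hdeg e3)
      · exact next (by ext; simp only [Set.mem_union]; tauto) (hc.rot.l1_step hG hdeg e2)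
    · exact next rfl (hc.l1_step hG hdeg e1)

end FThreeStep

open SimpleGraph
set_option linter.unusedVariables false

section FFour

variable {V : Type*} {G : SimpleGraph V}
variable {u v : V} {m k : ℤ} {q p : ℤ → V} {α β α' β' : ℤ} {L1 L2 L3 L4 : Set V}

/-- some vertex of the segment `p a .. p (b-1)` is adjacent to `q s` -/
def Nb (G : SimpleGraph V) (p : ℤ → V) (a b : ℤ) (x : V) : Prop := ∃ j, a ≤ j ∧ j < b ∧ G.Adj (p j) x

theorem Nb.tch {a b : ℤ} {x : V} {T : Set V} (h : Nb G p a b x) (hx : x ∈ T) : Tch G (im p a b) T := by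
  obtain ⟨j, h1, h2, h3⟩ := h
  exact ⟨p j, im_mem h1 h2, x, hx, h3⟩

theorem nb_self {j : ℤ} {a b : ℤ} {x : V} (h : G.Adj (p j) x) (hj : a ≤ j ∧ j < b) : Nb G p a b x := ⟨j, hj.1, hj.2, h⟩

theorem Leg.adj {x y : V} (h : Leg G x ∅ y) : G.Adj x y := by
  rcases h with ⟨-, h⟩ | ⟨h, -⟩
  · exact h
  · exact absurd h.nonempty (by simp)

theorem Cfg.H (hG : SixFree G) (h : Cfg G u v m k q p α β α' β' L1 L2 L3 L4) {a b c d x s1 s2 s3 s4 : ℤ}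
    (hab : 0 ≤ a ∧ a < b ∧ b ≤ k + 1 ∧ 0 ≤ c ∧ c < d ∧ d ≤ k + 1 ∧ (b ≤ c ∨ d ≤ a)) (hCD : Tch G (im p a b) (im p c d))
    (hs : s1 < s2 ∧ s2 < s3 ∧ s3 < s4 ∧ s4 < s1 + m)
    (h1 : Nb G p a b (q s1)) (h2 : Nb G p c d (q s2)) (h3 : Nb G p a b (q s3)) (h4 : Nb G p c d (q s4))
    (hx : 0 ≤ x ∧ x < k ∧ (x < a ∨ b ≤ x) ∧ (x < c ∨ d ≤ x)) : False := by
  have hD := h.disj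
  refine hG.k33 (x := p x) (A0 := im p a b) (A1 := im q s2 s3) (A2 := im q s4 (s1 + m)) (B0 := im p c d) (B1 := im q s1 s2) (B2 := im q s3 s4)
    (h.core_p (by omega) (by omega))
    ⟨h.pc (by omega), h.qc (by omega), h.qc (by omega), h.pc (by omega), h.qc (by omega), h.qc (by omega)⟩ ?_
    ⟨hCD, h1.tch (im_mem le_rfl (by omega)), h3.tch (im_mem le_rfl (by omega)),
      (h2.tch (im_mem le_rfl (by omega))).symm, h.qt (by omega), h.qt (by omega),
      (h4.tch (im_mem le_rfl (by omega))).symm, h.qt (by omega), h.qt (by omega)⟩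
    ⟨not_mem_im_p h (by omega), not_mem_im_q h (by omega), not_mem_im_q h (by omega), not_mem_im_p h (by omega), not_mem_im_q h (by omega), not_mem_im_q h (by omega)⟩
  simp only [List.pairwise_cons, List.mem_cons, List.not_mem_nil, or_false, forall_eq_or_imp, forall_eq,
      Set.disjoint_union_left, Set.disjoint_union_right]
  simp (disch := omega) [hD]

theorem Cfg.core_q (h : Cfg G u v m k q p α β α' β' L1 L2 L3 L4) (i : ℤ) : q i ∈ core G := ⟨_, h.qadj i⟩

theorem Cfg.nq (h : Cfg G u v m k q p α β α' β' L1 L2 L3 L4) {i a b : ℤ} (hi : (i < a ∧ b ≤ i + m) ∨ (b ≤ i ∧ i < a + m)) :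
    q i ∉ im q a b := by
  intro h'
  obtain ⟨j, h1, h2, h3⟩ := mem_im.1 h'
  have := h.inj h3 (by omega) (by omega)
  omega

theorem Cfg.nqp (h : Cfg G u v m k q p α β α' β' L1 L2 L3 L4) {i a b : ℤ} (hi : 0 ≤ a ∧ b ≤ k + 1) :
    q i ∉ im p a b := by
  intro h'
  obtain ⟨j, h1, h2, h3⟩ := mem_im.1 h'
  exact h.pq j i (by omega) (by omega) h3

/-- shortcuts -/
theorem Cfg.shortcut (hG : SixFree G) (h : Cfg G u v m k q p α β α' β' L1 L2 L3 L4) {a b c d s1 s2 s3 s4 s t : ℤ}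
    (hab : 0 ≤ a ∧ a < b ∧ b ≤ k + 1 ∧ 0 ≤ c ∧ c < d ∧ d ≤ k + 1 ∧ (b ≤ c ∨ d ≤ a)) (hCD : Tch G (im p a b) (im p c d))
    (hs : s ≤ s1 ∧ s1 < s2 ∧ s2 < s3 ∧ s3 < s4 ∧ s4 ≤ t ∧ t + 1 < s + m) (hst : G.Adj (q s) (q t))
    (h1 : Nb G p a b (q s1)) (h2 : Nb G p c d (q s2)) (h3 : Nb G p a b (q s3)) (h4 : Nb G p c d (q s4)) : False := by
  have hD := h.disj
  refine hG.k33 (x := q (t + 1)) (A0 := im p a b) (A1 := im q s2 s3) (A2 := im q s4 (t + 1)) (B0 := im p c d) (B1 := im q s s2) (B2 := im q s3 s4)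
    (h.core_q _)
    ⟨h.pc (by omega), h.qc (by omega), h.qc (by omega), h.pc (by omega), h.qc (by omega), h.qc (by omega)⟩ ?_
    ⟨hCD, h1.tch (im_mem (by omega) (by omega)), h3.tch (im_mem le_rfl (by omega)),
      (h2.tch (im_mem le_rfl (by omega))).symm, h.qt (by omega), h.qt (by omega),
      (h4.tch (im_mem le_rfl (by omega))).symm, tch_of_adj (im_mem (by omega) (by omega)) (im_mem le_rfl (by omega)) hst.symm, h.qt (by omega)⟩
    ⟨h.nqp (by omega), h.nq (by omega), h.nq (by omega), h.nqp (by omega), h.nq (by omega), h.nq (by omega)⟩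
  simp only [List.pairwise_cons, List.mem_cons, List.not_mem_nil, or_false, forall_eq_or_imp, forall_eq,
      Set.disjoint_union_left, Set.disjoint_union_right]
  simp (disch := omega) [hD]

theorem Cfg.hex (hG : SixFree G) (h : Cfg G u v m k q p α β α' β' L1 L2 L3 L4) {s1 s2 s3 s4 s5 s6 : ℤ} {C1 C2 C3 : Set V} {x : V}
    (hs : s1 < s2 ∧ s2 < s3 ∧ s3 < s4 ∧ s4 < s5 ∧ s5 < s6 ∧ s6 < s1 + m)
    (l1 : Leg G (q s1) C1 (q s4)) (l2 : Leg G (q s2) C2 (q s5)) (l3 : Leg G (q s3) C3 (q s6))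
    (d12 : Disjoint C1 C2) (d13 : Disjoint C1 C3) (d23 : Disjoint C2 C3)
    (dq : ∀ i, q i ∉ C1 ∧ q i ∉ C2 ∧ q i ∉ C3) (hx : x ∈ core G) (hxq : ∀ i, q i ≠ x) (hxC : x ∉ C1 ∧ x ∉ C2 ∧ x ∉ C3) : False := by
  have hD := h.disj
  have e1 : ∀ a b, Disjoint (im q a b) C1 := fun a b => Set.disjoint_left.2 fun y hy hy' => by
    obtain ⟨j, -, -, rfl⟩ := mem_im.1 hy; exact (dq j).1 hy'
  have e2 : ∀ a b, Disjoint (im q a b) C2 := fun a b => Set.disjoint_left.2 fun y hy hy' => by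
    obtain ⟨j, -, -, rfl⟩ := mem_im.1 hy; exact (dq j).2.1 hy'
  have e3 : ∀ a b, Disjoint (im q a b) C3 := fun a b => Set.disjoint_left.2 fun y hy hy' => by
    obtain ⟨j, -, -, rfl⟩ := mem_im.1 hy; exact (dq j).2.2 hy'
  have nx : ∀ a b, x ∉ im q a b := fun a b hy => by
    obtain ⟨j, -, -, h'⟩ := mem_im.1 hy; exact hxq j h'
  have m1 : q s1 ∈ im q s1 s2 := im_mem le_rfl (by omega)
  have m2 : q s2 ∈ im q s2 s3 := im_mem le_rfl (by omega)
  have m3 : q s3 ∈ im q s3 s4 := im_mem le_rfl (by omega)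
  have m4 : q s4 ∈ im q s4 s5 := im_mem le_rfl (by omega)
  have m5 : q s5 ∈ im q s5 s6 := im_mem le_rfl (by omega)
  have m6 : q s6 ∈ im q s6 (s1 + m) := im_mem le_rfl (by omega)
  refine hG.k33 (x := x) (A0 := im q s1 s2 ∪ C1) (A1 := im q s3 s4 ∪ C3) (A2 := im q s5 s6)
    (B0 := im q s4 s5) (B1 := im q s6 (s1 + m)) (B2 := im q s2 s3 ∪ C2) hx
    ⟨l1.conn_add (h.qc (by omega)) m1, l3.conn_add (h.qc (by omega)) m3, h.qc (by omega), h.qc (by omega), h.qc (by omega),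
      l2.conn_add (h.qc (by omega)) m2⟩ ?_
    ⟨l1.tch_add m1 m4, (h.qt (by omega)).ul, (h.qt (by omega)).ul.symm.ul.symm, (h.qt (by omega)).ul, l3.tch_add m3 m6,
      (h.qt (by omega)).ul.symm.ul.symm, h.qt (by omega), h.qt (by omega), (l2.tch_add m2 m5).symm⟩
    ⟨by simp [nx, hxC], by simp [nx, hxC], nx _ _, nx _ _, nx _ _, by simp [nx, hxC]⟩
  simp only [List.pairwise_cons, List.mem_cons, List.not_mem_nil, or_false, forall_eq_or_imp, forall_eq,
      Set.disjoint_union_left, Set.disjoint_union_right]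
  simp (disch := omega) [hD, e1, e2, e3, (e1 _ _).symm, (e2 _ _).symm, (e3 _ _).symm, d12, d13, d23, d12.symm, d13.symm, d23.symm]

theorem Cfg.ab (h : Cfg G u v m k q p α β α' β' ∅ ∅ ∅ ∅) :
    G.Adj (p 0) (q β) ∧ G.Adj (p 0) (q β') ∧ G.Adj (p k) (q α) ∧ G.Adj (p k) (q α') :=
  ⟨h.l1.adj, h.l2.adj, h.l3.adj, h.l4.adj⟩

theorem Cfg.ppChord (hG : SixFree G) (h : Cfg G u v m k q p α β α' β' ∅ ∅ ∅ ∅) {a b : ℤ} (ha : 0 ≤ a) (hab : a < b) (hb : b ≤ k)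
    (hadj : G.Adj (p a) (p b)) : b = a + 1 := by
  by_contra hne
  have := h.o1; have := h.o2; have := h.o3; have := h.o4; have := h.k2
  obtain ⟨b1, b2, a1, a2⟩ := h.ab
  exact h.H hG (a := b) (b := k + 1) (c := 0) (d := a + 1) (x := a + 1) (s1 := α) (s2 := β) (s3 := α') (s4 := β') (by omega)
    (tch_of_adj (im_mem le_rfl (by omega)) (im_mem (by omega) (by omega)) hadj.symm) (by omega)
    (nb_self a1 (by omega)) (nb_self b1 (by omega)) (nb_self a2 (by omega)) (nb_self b2 (by omega)) (by omega)

/-- the pair `b, b'` of vertices of `Q` is strictly separated by `q s`, `q t` -/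
def Separ (q : ℤ → V) (m : ℤ) (b b' : V) (s t : ℤ) : Prop :=
  ∃ i j, s < i ∧ i < t ∧ t < j ∧ j < s + m ∧ ((q i = b ∧ q j = b') ∨ (q i = b' ∧ q j = b))

theorem Separ.swap {b b' : V} {s t : ℤ} (h : Separ q m b b' s t) : Separ q m b' b s t := by
  obtain ⟨i, j, h1, h2, h3, h4, h5⟩ := h
  exact ⟨i, j, h1, h2, h3, h4, h5.symm⟩

theorem Cfg.shift (h : Cfg G u v m k q p α β α' β' L1 L2 L3 L4) (t : ℤ) :
    Cfg G u v m k q p (α + m * t) (β + m * t) (α' + m * t) (β' + m * t) L1 L2 L3 L4 := by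
  have := h.o1; have := h.o2; have := h.o3; have := h.o4
  exact ⟨h.per, h.qadj, h.qinj, by omega, by omega, by omega, by omega, h.k2, h.path, h.e, h.pq, by rw [h.perm]; exact h.l1,
    by rw [h.perm]; exact h.l2, by rw [h.perm]; exact h.l3, by rw [h.perm]; exact h.l4, h.d12, h.d13, h.d14, h.d23, h.d24, h.d34, h.lp, h.lq⟩

theorem Cfg.norm_sep (h : Cfg G u v m k q p α β α' β' ∅ ∅ ∅ ∅) {s t : ℤ} (hs : Separ q m (q β) (q β') s t) :
    ∃ α β α' β', Cfg G u v m k q p α β α' β' ∅ ∅ ∅ ∅ ∧ s < β ∧ β < t ∧ t < β' ∧ β' < s + m := by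
  have key : ∀ {α β α' β'} (h : Cfg G u v m k q p α β α' β' ∅ ∅ ∅ ∅), ∀ i j, s < i → i < t → t < j → j < s + m → q i = q β → q j = q β' →
      ∃ α β α' β', Cfg G u v m k q p α β α' β' ∅ ∅ ∅ ∅ ∧ s < β ∧ β < t ∧ t < β' ∧ β' < s + m := by
    intro α β α' β' h i j h1 h2 h3 h4 h5 h6
    obtain ⟨c, hc⟩ := h.qinj _ _ h5
    have hc' : i = β + m * c := by omega
    have h' := h.shift c
    have := h'.o1; have := h'.o2; have := h'.o3; have := h'.o4
    rw [← h.perm β' c] at h6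
    have := h.inj h6 (by omega) (by omega)
    exact ⟨_, _, _, _, h', by omega, by omega, by omega, by omega⟩
  obtain ⟨i, j, h1, h2, h3, h4, ⟨h5, h6⟩ | ⟨h5, h6⟩⟩ := hs
  · exact key h i j h1 h2 h3 h4 h5 h6
  · exact key h.rot i j h1 h2 h3 h4 h5 (by rw [h.per]; exact h6)

/-- every chord separates one of the pairs -/
theorem Cfg.sep_or (hG : SixFree G) (h : Cfg G u v m k q p α β α' β' ∅ ∅ ∅ ∅) {s t : ℤ} (hst : s + 1 < t) (hts : t + 1 < s + m)
    (hadj : G.Adj (q s) (q t)) : Separ q m (q α) (q α') s t ∨ Separ q m (q β) (q β') s t := by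
  by_contra hcon
  rw [not_or] at hcon
  have key : ∀ {p α β α' β'} (h : Cfg G u v m k q p α β α' β' ∅ ∅ ∅ ∅), s ≤ α → β' < s + m →
      ¬ Separ q m (q α) (q α') s t → ¬ Separ q m (q β) (q β') s t → False := by
    intro p α β α' β' h h1 h2 na nb
    have := h.o1; have := h.o2; have := h.o3; have := h.o4; have := h.k2
    obtain ⟨b1, b2, a1, a2⟩ := h.ab
    have tt : Tch G (im p 0 k) (im p k (k + 1)) := h.pt (by omega)
    by_cases hb : t ≤ β
    · by_cases ha : s = α
      · refine h.shortcut hG (a := 0) (b := k) (c := k) (d := k + 1) (s1 := β) (s2 := α') (s3 := β') (s4 := s + m) (s := t) (t := s + m) (by omega)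
          tt (by omega) (by rw [h.per]; exact hadj.symm) (nb_self b1 (by omega)) (nb_self a2 (by omega)) (nb_self b2 (by omega)) ?_
        rw [h.per, ha]; exact nb_self a1 (by omega)
      · have : t ≤ α := by
          by_contra hta
          exact na ⟨α, α', by omega, by omega, by omega, by omega, Or.inl ⟨rfl, rfl⟩⟩
        exact h.shortcut hG (a := k) (b := k + 1) (c := 0) (d := k) (s1 := α) (s2 := β) (s3 := α') (s4 := β') (s := t) (t := s + m) (by omega)
          tt.symm (by omega) (by rw [h.per]; exact hadj.symm) (nb_self a1 (by omega)) (nb_self b1 (by omega)) (nb_self a2 (by omega)) (nb_self b2 (by omega))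
    · have : β' ≤ t := by
        by_contra hta
        exact nb ⟨β, β', by omega, by omega, by omega, by omega, Or.inl ⟨rfl, rfl⟩⟩
      exact h.shortcut hG (a := k) (b := k + 1) (c := 0) (d := k) (s1 := α) (s2 := β) (s3 := α') (s4 := β') (s := s) (t := t) (by omega)
          tt.symm (by omega) hadj (nb_self a1 (by omega)) (nb_self b1 (by omega)) (nb_self a2 (by omega)) (nb_self b2 (by omega))
  have key2 : ∀ {α β α' β'} (h : Cfg G u v m k q p α β α' β' ∅ ∅ ∅ ∅), s ≤ α → α < s + m →
      ¬ Separ q m (q α) (q α') s t → ¬ Separ q m (q β) (q β') s t → False := by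
    intro α β α' β' h h1 h2 na nb
    have := h.o1; have := h.o2; have := h.o3; have := h.o4
    have na' : ¬ Separ q m (q α') (q α) s t := fun h => na h.swap
    have nb' : ¬ Separ q m (q β') (q β) s t := fun h => nb h.swap
    by_cases c1 : β' < s + m
    · exact key h h1 c1 na nb
    by_cases c2 : α' < s + m
    · have h' := h.rev.rot.shift (-1)
      refine key h' (by omega) (by omega) ?_ ?_ <;> simp only [h.perm, h.per] <;> assumption
    by_cases c3 : β < s + m
    · have h' := h.rot.shift (-1)
      refine key h' (by omega) (by omega) ?_ ?_ <;> simp only [h.perm, h.per] <;> assumption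
    · have h' := h.rev.shift (-1)
      refine key h' (by omega) (by omega) ?_ ?_ <;> simp only [h.perm, h.per] <;> assumption
  obtain ⟨j, h1, h2, h3⟩ := h.window s α
  obtain ⟨c, hc⟩ := h.qinj _ _ h3
  have hc' : α + m * c = j := by omega
  refine key2 (h.shift c) (by omega) (by omega) ?_ ?_ <;> simp only [h.perm]
  · exact hcon.1
  · exact hcon.2

theorem Cfg.leg_p (h : Cfg G u v m k q p α β α' β' ∅ ∅ ∅ ∅) {j : ℤ} {x y : V} (h1 : G.Adj (p j) x) (h2 : G.Adj (p j) y) :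
    Leg G x {p j} y := Or.inr ⟨conn_singleton _, ⟨_, rfl, h1.symm⟩, _, rfl, h2⟩

theorem Cfg.leg_e {x y : V} (h1 : G.Adj x y) : Leg G x ∅ y := Or.inl ⟨rfl, h1⟩

theorem Cfg.p_ne (h : Cfg G u v m k q p α β α' β' L1 L2 L3 L4) {i j : ℤ} (hi : 0 ≤ i ∧ i ≤ k ∧ 0 ≤ j ∧ j ≤ k ∧ i ≠ j) : p i ≠ p j :=
  fun hh => hi.2.2.2.2 (h.path.inj i j (by omega) (by omega) (by omega) (by omega) hh)

theorem Cfg.q_ne (h : Cfg G u v m k q p α β α' β' L1 L2 L3 L4) {i j : ℤ} (hi : 0 ≤ i ∧ i ≤ k) : q j ≠ p i :=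
  fun hh => h.pq i j hi.1 hi.2 hh.symm

/-- a chord does not separate both pairs -/
theorem Cfg.not_both (hG : SixFree G) (h : Cfg G u v m k q p α β α' β' ∅ ∅ ∅ ∅) {s t : ℤ} (hadj : G.Adj (q s) (q t))
    (h1 : s < β) (h2 : β < t) (h3 : t < β') (h4 : β' < s + m) : (α ≤ s ∧ t ≤ α') ∨ (s ≤ α ∧ α' ≤ t) := by
  by_contra hcon
  have := h.o1; have := h.o2; have := h.o3; have := h.o4; have := h.k2
  obtain ⟨b1, b2, a1, a2⟩ := h.ab
  have n0 := h.p_ne (i := 0) (j := k) (by omega)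
  have n1 := h.p_ne (i := 1) (j := k) (by omega)
  have n2 := h.p_ne (i := 1) (j := 0) (by omega)
  have nq0 : ∀ i, q i ≠ p 0 := fun i => h.q_ne (by omega)
  have nqk : ∀ i, q i ≠ p k := fun i => h.q_ne (by omega)
  by_cases hc : α' < t
  · refine h.hex hG (s1 := s) (s2 := β) (s3 := α') (s4 := t) (s5 := β') (s6 := α + m) (x := p 1) (by omega) (Cfg.leg_e hadj) (h.leg_p b1 b2)
      (h.leg_p a2 (by rw [h.per]; exact a1)) ?_ ?_ ?_ ?_ (h.core_p (by omega) (by omega)) (fun i => h.q_ne (by omega)) ?_ <;> simp [n0, n1, n2, nq0, nqk, n0.symm]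
  · refine h.hex hG (s1 := s) (s2 := α) (s3 := β) (s4 := t) (s5 := α') (s6 := β') (x := p 1) (by omega) (Cfg.leg_e hadj) (h.leg_p a1 a2)
      (h.leg_p b1 b2) ?_ ?_ ?_ ?_ (h.core_p (by omega) (by omega)) (fun i => h.q_ne (by omega)) ?_ <;> simp [n0, n1, n2, nq0, nqk, n0.symm]

/-- chords separating the `β`-pair do not cross -/
theorem Cfg.n4 (hG : SixFree G) (h : Cfg G u v m k q p α β α' β' ∅ ∅ ∅ ∅) {s t s' t' : ℤ} (hst : G.Adj (q s) (q t)) (hst' : G.Adj (q s') (q t'))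
    (ho : s < s' ∧ s' < t ∧ t < t' ∧ t' < s + m) (h1 : Separ q m (q β) (q β') s t) (h2 : Separ q m (q β) (q β') s' t') : False := by
  have hk := h.k2
  obtain ⟨b1, b2, a1, a2⟩ := h.ab
  obtain ⟨i, j, o1, o2, o3, o4, ho'⟩ := h1
  obtain ⟨i', j', o1', o2', o3', o4', ho''⟩ := h2
  have n2 := h.p_ne (i := 1) (j := 0) (by omega)
  have nq0 : ∀ i, q i ≠ p 0 := fun i => h.q_ne (by omega)
  have c0 : G.Adj (p 0) (q i) ∧ G.Adj (p 0) (q j) := by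
    rcases ho' with ⟨e1, e2⟩ | ⟨e1, e2⟩ <;> rw [e1, e2] <;> constructor <;> assumption
  have : (i' = i ∧ j' = j) ∨ (i' = j ∧ j' = i + m) := by
    have key : (q i' = q i ∧ q j' = q j) ∨ (q i' = q j ∧ q j' = q i) := by
      rcases ho' with ⟨e1, e2⟩ | ⟨e1, e2⟩ <;> rcases ho'' with ⟨e3, e4⟩ | ⟨e3, e4⟩ <;> simp [e1, e2, e3, e4]
    rcases key with ⟨e1, e2⟩ | ⟨e1, e2⟩
    · exact Or.inl ⟨h.inj e1 (by omega) (by omega), h.inj e2 (by omega) (by omega)⟩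
    · rw [← h.per i] at e2
      exact Or.inr ⟨h.inj e1 (by omega) (by omega), h.inj e2 (by omega) (by omega)⟩
  rcases this with ⟨e1, e2⟩ | ⟨e1, e2⟩
  · refine h.hex hG (s1 := s) (s2 := s') (s3 := i) (s4 := t) (s5 := t') (s6 := j) (x := p 1) (by omega) (Cfg.leg_e hst) (Cfg.leg_e hst') (h.leg_p c0.1 c0.2)
      ?_ ?_ ?_ ?_ (h.core_p (by omega) (by omega)) (fun i => h.q_ne (by omega)) ?_ <;> simp [n2, nq0]
  · refine h.hex hG (s1 := s) (s2 := i) (s3 := s') (s4 := t) (s5 := j) (s6 := t') (x := p 1) (by omega) (Cfg.leg_e hst) (h.leg_p c0.1 c0.2) (Cfg.leg_e hst')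
      ?_ ?_ ?_ ?_ (h.core_p (by omega) (by omega)) (fun i => h.q_ne (by omega)) ?_ <;> simp [n2, nq0]

end FFour

open SimpleGraph
set_option linter.unusedVariables false
set_option linter.unusedSimpArgs false

section FFive

variable {V : Type*} {G : SimpleGraph V}
variable {u v : V} {m k : ℤ} {q p : ℤ → V} {α β α' β' : ℤ} {L1 L2 L3 L4 : Set V}

theorem Cfg.n3a (hG : SixFree G) (h : Cfg G u v m k q p α β α' β' ∅ ∅ ∅ ∅) {s t j z : ℤ} (hst : G.Adj (q s) (q t))
    (ho : s < β ∧ β < t ∧ t < β' ∧ β' < s + m) (hj : 1 ≤ j ∧ j ≤ k) (hz : G.Adj (p j) (q z)) (hz1 : s < z ∧ z < t)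
    (hα : α < s ∧ t ≤ α') : False := by
  have hD := h.disj
  have := h.o1; have := h.o2; have := h.o3; have := h.o4; have := h.k2
  obtain ⟨b1, b2, a1, a2⟩ := h.ab
  have a1' : G.Adj (p k) (q (α + m)) := by rw [h.per]; exact a1
  by_cases hjk : j < k
  · refine hG.k33h (A0 := im q (s + 1) t) (A1 := im q (α + m) (s + m)) (A2 := im q t β') (B0 := im q β' (α + m)) (B1 := im p (j + 1) (k + 1))
      (B2 := im q s (s + 1)) (s0 := im p 0 1) (s1 := im p 1 (j + 1))
      ⟨h.qc (by omega), h.qc (by omega), h.qc (by omega), h.qc (by omega), h.pc (by omega), h.qc (by omega), h.pc (by omega), h.pc (by omega)⟩ ?_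
      ⟨h.qt (by omega), h.qt (by omega), (tch_of_adj (im_mem (by omega) (by omega)) (im_mem (by omega) (by omega)) a1').symm, h.qt (by omega),
        h.qt (by omega), (tch_of_adj (im_mem (by omega) (by omega)) (im_mem (by omega) (by omega)) a2).symm,
        (tch_of_adj (im_mem (by omega) (by omega)) (im_mem (by omega) (by omega)) hst).symm⟩
      ⟨tch_of_adj (im_mem (by omega) (by omega)) (im_mem (by omega) (by omega)) b1,
       tch_of_adj (im_mem (by omega) (by omega)) (im_mem (by omega) (by omega)) b2,
       tch_of_adj (im_mem (by omega) (by omega)) (im_mem (by omega) (by omega)) hz, h.pt (by omega), h.pt (by omega)⟩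
    simp only [List.pairwise_cons, List.mem_cons, List.not_mem_nil, or_false, forall_eq_or_imp, forall_eq,
      Set.disjoint_union_left, Set.disjoint_union_right]
    simp (disch := omega) [hD]
  · have hjk' : j = k := by omega
    rw [hjk'] at hz
    refine hG.k33 (x := p 1) (A0 := im q (s + 1) t ∪ im p 0 1) (A1 := im q (α + m) (s + m)) (A2 := im q t β') (B0 := im q β' (α + m)) (B1 := im p k (k + 1))
      (B2 := im q s (s + 1)) (h.core_p (by omega) (by omega))
      ⟨(h.qc (by omega)).union (h.pc (by omega)) (tch_of_adj (im_mem (by omega) (by omega)) (im_mem (by omega) (by omega)) b1).symm,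
       h.qc (by omega), h.qc (by omega), h.qc (by omega), h.pc (by omega), h.qc (by omega)⟩ ?_
      ⟨(tch_of_adj (Or.inr (im_mem (by omega) (by omega))) (im_mem (by omega) (by omega)) b2),
       (tch_of_adj (im_mem (by omega) (by omega)) (im_mem (by omega) (by omega)) hz).symm.ul, (h.qt (by omega)).ul,
       h.qt (by omega), (tch_of_adj (im_mem (by omega) (by omega)) (im_mem (by omega) (by omega)) a1').symm, h.qt (by omega),
        h.qt (by omega), (tch_of_adj (im_mem (by omega) (by omega)) (im_mem (by omega) (by omega)) a2).symm,
        (tch_of_adj (im_mem (by omega) (by omega)) (im_mem (by omega) (by omega)) hst).symm⟩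
      ⟨fun hh => hh.elim (not_mem_im_q h (by omega)) (not_mem_im_p h (by omega)), not_mem_im_q h (by omega), not_mem_im_q h (by omega),
        not_mem_im_q h (by omega), not_mem_im_p h (by omega), not_mem_im_q h (by omega)⟩
    simp only [List.pairwise_cons, List.mem_cons, List.not_mem_nil, or_false, forall_eq_or_imp, forall_eq,
      Set.disjoint_union_left, Set.disjoint_union_right]
    simp (disch := omega) [hD]

theorem Cfg.n3b (hG : SixFree G) (h : Cfg G u v m k q p α β α' β' ∅ ∅ ∅ ∅) {j z j' z' : ℤ} (hst : G.Adj (q α) (q α'))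
    (hj : 1 ≤ j ∧ j ≤ k) (hz : G.Adj (p j) (q z)) (hz1 : α < z ∧ z < α')
    (hj' : 1 ≤ j' ∧ j' ≤ k) (hz' : G.Adj (p j') (q z')) (hz1' : α' < z' ∧ z' < α + m) (hjj : j' = k → j = k) : False := by
  have hD := h.disj
  have := h.o1; have := h.o2; have := h.o3; have := h.o4; have := h.k2
  obtain ⟨b1, b2, a1, a2⟩ := h.ab
  by_cases hjk : j < k
  · exact h.H hG (a := k) (b := k + 1) (c := 1) (d := k) (x := 0) (s1 := α) (s2 := z) (s3 := α') (s4 := z') (by omega) (h.pt (by omega)) (by omega)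
      (nb_self a1 (by omega)) (nb_self hz (by omega)) (nb_self a2 (by omega)) (nb_self hz' (by omega)) (by omega)
  have hjk' : j = k := by omega
  rw [hjk'] at hz
  by_cases hjk2 : j' < k
  · refine hG.k5h (A0 := im q (α' + 1) (α + m)) (A1 := im q (α + 1) α') (A2 := im p k (k + 1)) (A3 := im q α (α + 1)) (A4 := im q α' (α' + 1))
      (s0 := im p 0 1) (s1 := im p 1 k)
      ⟨h.qc (by omega), h.qc (by omega), h.pc (by omega), h.qc (by omega), h.qc (by omega), h.pc (by omega), h.pc (by omega)⟩ ?_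
      ⟨h.qt (by omega), h.qt (by omega), (tch_of_adj (im_mem (by omega) (by omega)) (im_mem (by omega) (by omega)) hz).symm,
        h.qt (by omega), h.qt (by omega), tch_of_adj (im_mem (by omega) (by omega)) (im_mem (by omega) (by omega)) a1,
        tch_of_adj (im_mem (by omega) (by omega)) (im_mem (by omega) (by omega)) a2,
        tch_of_adj (im_mem (by omega) (by omega)) (im_mem (by omega) (by omega)) hst⟩
      ⟨tch_of_adj (im_mem (by omega) (by omega)) (im_mem (by omega) (by omega)) b2,
       tch_of_adj (im_mem (by omega) (by omega)) (im_mem (by omega) (by omega)) b1,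
       tch_of_adj (im_mem (by omega) (by omega)) (im_mem (by omega) (by omega)) hz', h.pt (by omega), h.pt (by omega)⟩
    simp only [List.pairwise_cons, List.mem_cons, List.not_mem_nil, or_false, forall_eq_or_imp, forall_eq,
      Set.disjoint_union_left, Set.disjoint_union_right]
    simp (disch := omega) [hD]
  · have hjk2' : j' = k := by omega
    rw [hjk2'] at hz'
    refine hG.k5 (x := p 1) (A0 := im q (α' + 1) (α + m) ∪ im p 0 1) (A1 := im q (α + 1) α') (A2 := im p k (k + 1)) (A3 := im q α (α + 1)) (A4 := im q α' (α' + 1))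
      (h.core_p (by omega) (by omega))
      ⟨(h.qc (by omega)).union (h.pc (by omega)) (tch_of_adj (im_mem (by omega) (by omega)) (im_mem (by omega) (by omega)) b2).symm,
       h.qc (by omega), h.pc (by omega), h.qc (by omega), h.qc (by omega)⟩ ?_
      ⟨tch_of_adj (Or.inr (im_mem (by omega) (by omega))) (im_mem (by omega) (by omega)) b1,
       (tch_of_adj (im_mem (by omega) (by omega)) (im_mem (by omega) (by omega)) hz').symm.ul,
       (h.qt (by omega)).ul, (h.qt (by omega)).ul, (tch_of_adj (im_mem (by omega) (by omega)) (im_mem (by omega) (by omega)) hz).symm,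
        h.qt (by omega), h.qt (by omega), tch_of_adj (im_mem (by omega) (by omega)) (im_mem (by omega) (by omega)) a1,
        tch_of_adj (im_mem (by omega) (by omega)) (im_mem (by omega) (by omega)) a2,
        tch_of_adj (im_mem (by omega) (by omega)) (im_mem (by omega) (by omega)) hst⟩
      ⟨fun hh => hh.elim (not_mem_im_q h (by omega)) (not_mem_im_p h (by omega)), not_mem_im_q h (by omega), not_mem_im_p h (by omega),
        not_mem_im_q h (by omega), not_mem_im_q h (by omega)⟩
    simp only [List.pairwise_cons, List.mem_cons, List.not_mem_nil, or_false, forall_eq_or_imp, forall_eq,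
      Set.disjoint_union_left, Set.disjoint_union_right]
    simp (disch := omega) [hD]

theorem Cfg.n3c (hG : SixFree G) (h : Cfg G u v m k q p α β α' β' ∅ ∅ ∅ ∅) {s t j z j' z' : ℤ} (hst : G.Adj (q s) (q t))
    (ho : s < β ∧ β < t ∧ t < β' ∧ β' < s + m)
    (hj : 1 ≤ j ∧ j ≤ k) (hz : G.Adj (p j) (q z)) (hz1 : s < z ∧ z < t)
    (hj' : 1 ≤ j' ∧ j' ≤ k) (hz' : G.Adj (p j') (q z')) (hz1' : t < z' ∧ z' < s + m) (hα : α ≤ s ∧ t ≤ α') : False := by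
  by_cases c1 : α < s
  · exact h.n3a hG hst ho hj hz hz1 (by omega)
  by_cases c2 : t < α'
  · refine h.reflect.n3a hG (s := -t) (t := -s) (j := j) (z := -z) ?_ (by omega) hj ?_ (by omega) (by omega)
    · simpa using hst.symm
    · simpa using hz
  have e1 : s = α := by omega
  have e2 : t = α' := by omega
  rw [e1, e2] at hst
  by_cases c3 : j' = k → j = k
  · exact h.n3b hG hst hj hz (by omega) hj' hz' (by omega) c3
  · refine h.rot.n3b hG (j := j') (z := z') (j' := j) (z' := z + m) ?_ hj' hz' (by omega) hj ?_ (by omega) (by tauto)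
    · rw [h.per]; exact hst.symm
    · rw [h.per]; exact hz

theorem Cfg.n3 (hG : SixFree G) (h : Cfg G u v m k q p α β α' β' ∅ ∅ ∅ ∅) {s t j z j' z' : ℤ} (hst : G.Adj (q s) (q t))
    (hs : Separ q m (q β) (q β') s t)
    (hj : 1 ≤ j ∧ j ≤ k) (hz : G.Adj (p j) (q z)) (hz1 : s < z ∧ z < t)
    (hj' : 1 ≤ j' ∧ j' ≤ k) (hz' : G.Adj (p j') (q z')) (hz1' : t < z' ∧ z' < s + m) : False := by
  obtain ⟨α, β, α', β', h, o1, o2, o3, o4⟩ := h.norm_sep hs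
  rcases h.not_both hG hst o1 o2 o3 o4 with hc | hc
  · exact h.n3c hG hst (by omega) hj hz hz1 hj' hz' hz1' hc
  · refine h.rot.n3c hG (s := t) (t := s + m) ?_ (by omega) hj' hz' (by omega) hj (z' := z + m) ?_ (by omega) (by omega)
    · rw [h.per]; exact hst.symm
    · rw [h.per]; exact hz

end FFive

open SimpleGraph
set_option linter.unusedVariables false
set_option linter.unusedSimpArgs false

section FSix

variable {V : Type*} {G : SimpleGraph V}
variable {u v : V} {m k : ℤ} {q p : ℤ → V} {α β α' β' : ℤ} {L1 L2 L3 L4 : Set V}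

/-- the indicator of `y < x` in `ZMod 2` -/
def lt2 (y x : ℤ) : ZMod 2 := if y < x then 1 else 0

/-- no crossing pairs -/
def NoX (M A : Set ℤ) : Prop := ∀ x1 ∈ M, ∀ x2 ∈ M, ∀ y1 ∈ A, ∀ y2 ∈ A, x1 < x2 → y1 ≠ x1 → y1 ≠ x2 → y2 ≠ x1 → y2 ≠ x2 →
  lt2 y1 x1 + lt2 y1 x2 = lt2 y2 x1 + lt2 y2 x2

theorem NoX.ne {M A : Set ℤ} (h : NoX M A) {x1 x2 y1 y2 : ℤ} (h1 : x1 ∈ M) (h2 : x2 ∈ M) (h3 : y1 ∈ A) (h4 : y2 ∈ A)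
    (n1 : y1 ≠ x1) (n2 : y1 ≠ x2) (n3 : y2 ≠ x1) (n4 : y2 ≠ x2) : lt2 y1 x1 + lt2 y1 x2 = lt2 y2 x1 + lt2 y2 x2 := by
  rcases lt_trichotomy x1 x2 with hh | hh | hh
  · exact h x1 h1 x2 h2 y1 h3 y2 h4 hh n1 n2 n3 n4
  · rw [hh, CharTwo.add_self_eq_zero, CharTwo.add_self_eq_zero]
  · rw [add_comm, add_comm (lt2 y2 x1)]
    exact h x2 h2 x1 h1 y1 h3 y2 h4 hh n2 n1 n4 n3

theorem noX_of {M A : Set ℤ} (h1 : ∀ x1 ∈ M, ∀ x2 ∈ M, ∀ y1 ∈ A, ∀ y2 ∈ A, x1 < y1 → y1 < x2 → x2 < y2 → False)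
    (h2 : ∀ x1 ∈ M, ∀ x2 ∈ M, ∀ y1 ∈ A, ∀ y2 ∈ A, y1 < x1 → x1 < y2 → y2 < x2 → False) : NoX M A := by
  intro x1 hx1 x2 hx2 y1 hy1 y2 hy2 hl n1 n2 n3 n4
  have e1 := h1 x1 hx1 x2 hx2 y1 hy1 y2 hy2
  have e2 := h2 x1 hx1 x2 hx2 y1 hy1 y2 hy2
  have e3 := h1 x1 hx1 x2 hx2 y2 hy2 y1 hy1
  have e4 := h2 x1 hx1 x2 hx2 y2 hy2 y1 hy1
  simp only [imp_false, not_lt] at e1 e2 e3 e4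
  unfold lt2
  split_ifs <;> first | rfl | (exfalso; omega)

theorem const_on {S : Set ℤ} {f : ℤ → ZMod 2} (h : ∀ x ∈ S, ∀ y ∈ S, f x = f y) : ∃ c, ∀ x ∈ S, f x = c := by
  by_cases hS : S.Nonempty
  · obtain ⟨y, hy⟩ := hS
    exact ⟨f y, fun x hx => h x hx y hy⟩
  · exact ⟨0, fun x hx => absurd ⟨x, hx⟩ hS⟩

theorem comb {M A : Set ℤ} (h : NoX M A) (h3 : ∀ x y z, x ∈ M → x ∈ A → y ∈ M → y ∈ A → z ∈ M → z ∈ A → x < y → y < z → False) :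
    ∃ φ ψ : ℤ → ZMod 2, ∀ x ∈ M, ∀ y ∈ A, x ≠ y → φ x + ψ y = lt2 y x := by
  have e4 : ∀ a b c d : ZMod 2, a + b = c + d → a + c = b + d := by decide
  have e5 : ∀ a b c : ZMod 2, a + b = c → b + c = a := by decide
  by_cases hA : ∃ a0 ∈ A, a0 ∉ M
  · obtain ⟨a0, ha0, ha0'⟩ := hA
    have : ∀ y, ∃ c, ∀ x ∈ {x | x ∈ M ∧ x ≠ y ∧ y ∈ A}, lt2 y x + lt2 a0 x = c := by
      intro y
      refine const_on ?_
      rintro x ⟨hx, hxy, hy⟩ x' ⟨hx', hxy', -⟩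
      exact e4 _ _ _ _ (h.ne hx hx' hy ha0 hxy.symm hxy'.symm (fun e => ha0' (e ▸ hx)) (fun e => ha0' (e ▸ hx')))
    choose ψ hψ using this
    refine ⟨fun x => lt2 a0 x, ψ, fun x hx y hy hxy => ?_⟩
    exact e5 _ _ _ (hψ y x ⟨hx, hxy, hy⟩)
  by_cases hM : ∃ m0 ∈ M, m0 ∉ A
  · obtain ⟨a0, ha0, ha0'⟩ := hM
    have : ∀ x, ∃ c, ∀ y ∈ {y | y ∈ A ∧ x ≠ y ∧ x ∈ M}, lt2 y x + lt2 y a0 = c := by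
      intro x
      refine const_on ?_
      rintro y ⟨hy, hxy, hx⟩ y' ⟨hy', hxy', -⟩
      exact (h.ne hx ha0 hy hy' hxy.symm (fun e => ha0' (e ▸ hy)) hxy'.symm (fun e => ha0' (e ▸ hy')))
    choose φ hφ using this
    refine ⟨φ, fun y => lt2 y a0, fun x hx y hy hxy => ?_⟩
    rw [add_comm]
    exact e5 _ _ _ (hφ x y ⟨hy, hxy, hx⟩)
  push Not at hA hM
  classical
  refine ⟨fun x => if ∃ y ∈ A, y < x then 1 else 0, fun _ => 0, fun x hx y hy hxy => ?_⟩
  show (if ∃ y ∈ A, y < x then 1 else 0) + (0 : ZMod 2) = if y < x then 1 else 0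
  by_cases hc : y < x
  · rw [if_pos hc, if_pos ⟨y, hy, hc⟩]; simp
  · rw [if_neg hc, if_neg]
    · simp
    · rintro ⟨z, hz, hzx⟩
      exact h3 z x y (hA z hz) hz hx (hM x hx) (hA y hy) hy hzx (by omega)

theorem Cfg.tri (hG : SixFree G) (h : Cfg G u v m k q p α β α' β' ∅ ∅ ∅ ∅) {i j s1 s2 s3 : ℤ} (hi : 0 ≤ i) (hij : i + 1 < j) (hj : j ≤ k)
    (hs : s1 < s2 ∧ s2 < s3 ∧ s3 < s1 + m)
    (h1 : Nb G p (i + 1) j (q s1)) (h2 : Nb G p (i + 1) j (q s2)) (h3 : Nb G p (i + 1) j (q s3))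
    (g1 : Nb G p j (k + 1) (q s1)) (g2 : Nb G p j (k + 1) (q s2)) (g3 : Nb G p j (k + 1) (q s3)) : False := by
  have hD := h.disj
  refine hG.k5 (x := p 0) (A0 := im p (i + 1) j) (A1 := im p j (k + 1)) (A2 := im q s1 s2) (A3 := im q s2 s3) (A4 := im q s3 (s1 + m))
    (h.core_p (by omega) (by omega)) ⟨h.pc (by omega), h.pc (by omega), h.qc (by omega), h.qc (by omega), h.qc (by omega)⟩ ?_
    ⟨h.pt (by omega), h1.tch (im_mem le_rfl (by omega)), h2.tch (im_mem le_rfl (by omega)), h3.tch (im_mem le_rfl (by omega)),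
      g1.tch (im_mem le_rfl (by omega)), g2.tch (im_mem le_rfl (by omega)), g3.tch (im_mem le_rfl (by omega)),
      h.qt (by omega), h.qt (by omega), h.qt (by omega)⟩
    ⟨not_mem_im_p h (by omega), not_mem_im_p h (by omega), not_mem_im_q h (by omega), not_mem_im_q h (by omega), not_mem_im_q h (by omega)⟩
  simp only [List.pairwise_cons, List.mem_cons, List.not_mem_nil, or_false, forall_eq_or_imp, forall_eq,
      Set.disjoint_union_left, Set.disjoint_union_right]
  simp (disch := omega) [hD]

theorem Cfg.twoA (hG : SixFree G) (h : Cfg G u v m k q p α β α' β' ∅ ∅ ∅ ∅) {i j s t z : ℤ} (hi : 0 ≤ i) (hij : i + 1 < j) (hj : j < k)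
    (hs : s < z ∧ z < t ∧ t < s + m)
    (h1 : Nb G p (i + 1) j (q s)) (h2 : Nb G p (i + 1) j (q t)) (g1 : G.Adj (p k) (q s)) (g2 : G.Adj (p k) (q t))
    (hz : Nb G p j k (q z)) : False := by
  have hD := h.disj
  have g1' : Nb G p k (k + 1) (q s) := nb_self g1 (by omega)
  have g2' : Nb G p k (k + 1) (q t) := nb_self g2 (by omega)
  refine hG.k33 (x := p 0) (A0 := im q s (s + 1)) (A1 := im q t (t + 1)) (A2 := im p j k) (B0 := im p (i + 1) j) (B1 := im p k (k + 1)) (B2 := im q (s + 1) t)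
    (h.core_p (by omega) (by omega)) ⟨h.qc (by omega), h.qc (by omega), h.pc (by omega), h.pc (by omega), h.pc (by omega), h.qc (by omega)⟩ ?_
    ⟨(h1.tch (im_mem le_rfl (by omega))).symm, (g1'.tch (im_mem le_rfl (by omega))).symm, h.qt (by omega),
     (h2.tch (im_mem le_rfl (by omega))).symm, (g2'.tch (im_mem le_rfl (by omega))).symm, h.qt (by omega),
     h.pt (by omega), h.pt (by omega), hz.tch (im_mem (by omega) (by omega))⟩
    ⟨not_mem_im_q h (by omega), not_mem_im_q h (by omega), not_mem_im_p h (by omega), not_mem_im_p h (by omega), not_mem_im_p h (by omega), not_mem_im_q h (by omega)⟩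
  simp only [List.pairwise_cons, List.mem_cons, List.not_mem_nil, or_false, forall_eq_or_imp, forall_eq,
      Set.disjoint_union_left, Set.disjoint_union_right]
  simp (disch := omega) [hD]

theorem Cfg.n1 (hG : SixFree G) (h : Cfg G u v m k q p α β α' β' ∅ ∅ ∅ ∅) {i : ℤ} (hi : 0 ≤ i) (hik : i < k) :
    ∃ (φ : ℤ → ZMod 2) (ψ : ℤ → ℤ → ZMod 2), ∀ l j x y, i < l → l < j → j ≤ k → 0 ≤ x → x < m → 0 ≤ y → y < m →
      G.Adj (p l) (q x) → G.Adj (p j) (q y) → x ≠ y → φ x + ψ j y = lt2 y x := by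
  let M : ℤ → Set ℤ := fun j => {x | 0 ≤ x ∧ x < m ∧ Nb G p (i + 1) j (q x)}
  let U : ℤ → Set ℤ := fun j => {x | 0 ≤ x ∧ x < m ∧ Nb G p j (k + 1) (q x)}
  have hlt : ∀ {j x}, x ∈ M j → i + 1 < j := by
    rintro j x ⟨-, -, l, h1, h2, -⟩; omega
  have hX : ∀ j, j ≤ k → NoX (M j) (U j) := by
    intro j hj
    refine noX_of ?_ ?_
    · intro x1 hx1 x2 hx2 y1 hy1 y2 hy2 h1 h2 h3
      have := hlt hx1
      obtain ⟨a1, a2, a3⟩ := hx1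
      obtain ⟨b1, b2, b3⟩ := hx2
      obtain ⟨c1, c2, c3⟩ := hy1
      obtain ⟨d1, d2, d3⟩ := hy2
      exact h.H hG (x := 0) (a := i + 1) (b := j) (c := j) (d := k + 1) (by omega) (h.pt (by omega)) (s1 := x1) (s2 := y1) (s3 := x2) (s4 := y2)
        (by omega) a3 c3 b3 d3 (by omega)
    · intro x1 hx1 x2 hx2 y1 hy1 y2 hy2 h1 h2 h3
      have := hlt hx1
      obtain ⟨a1, a2, a3⟩ := hx1
      obtain ⟨b1, b2, b3⟩ := hx2
      obtain ⟨c1, c2, c3⟩ := hy1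
      obtain ⟨d1, d2, d3⟩ := hy2
      exact h.H hG (x := 0) (c := i + 1) (d := j) (a := j) (b := k + 1) (by omega) (h.pt (by omega)) (s1 := y1) (s2 := x1) (s3 := y2) (s4 := x2)
        (by omega) c3 a3 d3 b3 (by omega)
  obtain ⟨φ, ψk, hφ⟩ := comb (hX k le_rfl) (by
    intro x y z hx hx' hy hy' hz hz' h1 h2
    have := hlt hx
    obtain ⟨a1, a2, a3⟩ := hx
    obtain ⟨b1, b2, b3⟩ := hy
    obtain ⟨c1, c2, c3⟩ := hz
    exact h.tri hG hi this le_rfl (s1 := x) (s2 := y) (s3 := z) (by omega) a3 b3 c3 hx'.2.2 hy'.2.2 hz'.2.2)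
  have e4 : ∀ a b c d e : ZMod 2, a + e = b → c + e = d → a + c = b + d := by decide
  have e5 : ∀ a b c : ZMod 2, a + b = c → b + c = a := by decide
  have e6 : ∀ a b c d : ZMod 2, a + b = c + d → a + c = b + d := by decide
  have main : ∀ j y, ∃ c, ∀ x ∈ {x | x ∈ M j ∧ x ≠ y ∧ 0 ≤ y ∧ y < m ∧ G.Adj (p j) (q y) ∧ j ≤ k}, lt2 y x + φ x = c := by
    intro j y
    by_cases hjk : j = k
    · refine ⟨ψk y, ?_⟩
      rintro x ⟨hx, hxy, h0, h1, h2, h3⟩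
      rw [hjk] at hx h2
      have := hφ x hx y ⟨h0, h1, nb_self h2 (by omega)⟩ hxy
      rw [add_comm]
      have e7 : ∀ a b c : ZMod 2, a + b = c → a + c = b := by decide
      exact e7 _ _ _ this
    refine const_on ?_
    have key : ∀ x1 x2, x1 < x2 → x1 ∈ M j → x2 ∈ M j → x1 ≠ y → x2 ≠ y → 0 ≤ y → y < m → G.Adj (p j) (q y) → j ≤ k →
        lt2 y x1 + φ x1 = lt2 y x2 + φ x2 := by
      intro x1 x2 hl hx1 hx2 n1 n2 h0 h1 h2 h3
      have hij := hlt hx1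
      have hMk : ∀ x, x ∈ M j → x ∈ M k := by
        rintro x ⟨a1, a2, l, a3, a4, a5⟩
        exact ⟨a1, a2, l, a3, by omega, a5⟩
      have hUk : ∀ x, x ∈ U k → x ∈ U j := by
        rintro x ⟨a1, a2, l, a3, a4, a5⟩
        exact ⟨a1, a2, l, by omega, by omega, a5⟩
      have hyU : y ∈ U j := ⟨h0, h1, nb_self h2 (by omega)⟩
      by_cases ha : ∃ a ∈ U k, a ≠ x1 ∧ a ≠ x2
      · obtain ⟨a, ha, m1, m2⟩ := ha
        have f1 := e4 _ _ _ _ _ (hφ x1 (hMk _ hx1) a ha m1.symm) (hφ x2 (hMk _ hx2) a ha m2.symm)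
        rw [(hX j h3).ne hx1 hx2 (hUk _ ha) hyU m1 m2 n1.symm n2.symm] at f1
        have e8 : ∀ a b c d : ZMod 2, a + b = c + d → c + a = d + b := by decide
        exact e8 _ _ _ _ f1
      · exfalso
        push Not at ha
        obtain ⟨b1, b2, a1, a2⟩ := h.ab
        obtain ⟨a, w1, w2, w3⟩ := h.window 0 α
        obtain ⟨a', w1', w2', w3'⟩ := h.window 0 α'
        have hne : a ≠ a' := by
          intro e
          rw [e, w3'] at w3
          have := h.o1; have := h.o2; have := h.o3; have := h.o4
          have := h.inj w3 (by omega) (by omega)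
          omega
        have g : G.Adj (p k) (q a) := by rw [w3]; exact a1
        have g' : G.Adj (p k) (q a') := by rw [w3']; exact a2
        have u1 := ha a ⟨w1, by omega, nb_self g (by omega)⟩
        have u2 := ha a' ⟨w1', by omega, nb_self g' (by omega)⟩
        have g1 : G.Adj (p k) (q x1) := by
          by_cases c : a = x1
          · rw [← c]; exact g
          · have : a' = x1 := by
              by_contra c'
              exact hne ((u1 c).trans (u2 c').symm)
            rw [← this]; exact g'
        have g2 : G.Adj (p k) (q x2) := by
          by_cases c : a = x1
          · rw [← u2 (fun e => hne (c.trans e.symm))]; exact g'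
          · rw [← u1 c]; exact g
        obtain ⟨-, -, m1⟩ := id hx1
        obtain ⟨-, -, m2⟩ := id hx2
        have v1 := hx1.1; have v2 := hx1.2.1; have v3 := hx2.1; have v4 := hx2.2.1
        by_cases c1 : x1 < y ∧ y < x2
        · exact h.twoA hG hi hij (by omega) (s := x1) (t := x2) (z := y) (by omega) m1 m2 g1 g2 (nb_self h2 (by omega))
        · have e : ∃ z, x2 < z ∧ z < x1 + m ∧ q z = q y := by
            by_cases c2 : x2 < y
            · exact ⟨y, c2, by omega, rfl⟩
            · exact ⟨y + m, by omega, by omega, h.per y⟩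
          obtain ⟨z, z1, z2, z3⟩ := e
          exact h.twoA hG hi hij (by omega) (s := x2) (t := x1 + m) (z := z) (by omega) m2 (by rw [h.per]; exact m1) g2 (by rw [h.per]; exact g1)
            (by rw [z3]; exact nb_self h2 (by omega))
    rintro x1 ⟨hx1, n1, h0, h1, h2, h3⟩ x2 ⟨hx2, n2, -⟩
    rcases lt_trichotomy x1 x2 with hh | hh | hh
    · exact key x1 x2 hh hx1 hx2 n1 n2 h0 h1 h2 h3
    · rw [hh]
    · exact (key x2 x1 hh hx2 hx1 n2 n1 h0 h1 h2 h3).symm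
  choose ψ hψ using main
  refine ⟨φ, ψ, ?_⟩
  intro l j x y h1 h2 h3 h4 h5 h6 h7 h8 h9 h10
  exact e5 _ _ _ (hψ j y x ⟨⟨h4, h5, nb_self h8 (by omega)⟩, h10, h6, h7, h9, h3⟩)

end FSix

open SimpleGraph
set_option linter.unusedVariables false
set_option linter.unusedSimpArgs false
set_option maxHeartbeats 1000000

section FSeven

/-- certificate values for oriented edges `x < y` -/
noncomputable def Yc (m i : ℤ) (Out : ℤ → ℤ → Prop) (κ1 κ2 : ℤ → ℤ → ZMod 2) (φ1 φ2 : ℤ → ZMod 2) (ψ1 ψ2 : ℤ → ℤ → ZMod 2)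
    (x y z : ℤ) : ZMod 2 := by
  classical exact
  if m ≤ x then 0
  else if y < m then
    (if Out x y then (if z < m then (if x < z ∧ z < y then 1 else 0) else if z ≤ m + i then 0 else κ2 x y)
     else (if z < m then 0 else if z ≤ m + i then κ1 x y else 0))
  else if y ≤ m + i then (if z < m then 0 else if z ≤ m + i then (if z < y then φ1 x else ψ1 y x) else 0)
  else (if z < m then lt2 z x else if z ≤ m + i then 0 else (if y < z then φ2 x else ψ2 y x))

theorem abs_cert {m k i : ℤ} {C S Out : ℤ → ℤ → Prop} {κ1 κ2 : ℤ → ℤ → ZMod 2} {φ1 φ2 : ℤ → ZMod 2} {ψ1 ψ2 : ℤ → ℤ → ZMod 2}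
    (A1 : ∀ a b c d, a < c → c < b → b < d → C a b → C c d → Out a b → Out c d → False)
    (A2 : ∀ a b c d, a < c → c < b → b < d → C a b → C c d → ¬ Out a b → ¬ Out c d → False)
    (A3 : ∀ a b z j, C a b → Out a b → a < b → S z j → m + i < j → z ≠ a → z ≠ b → κ2 a b = if a < z ∧ z < b then 1 else 0)
    (A4 : ∀ a b z j, C a b → ¬ Out a b → a < b → S z j → j ≤ m + i → z ≠ a → z ≠ b → κ1 a b = if a < z ∧ z < b then 1 else 0)
    (A5 : ∀ l j x y, m + i < l → l < j → S x l → S y j → x ≠ y → φ2 x + ψ2 j y = lt2 y x)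
    (A6 : ∀ l j x y, j < l → l ≤ m + i → S x l → S y j → x ≠ y → φ1 x + ψ1 j y = lt2 y x)
    {a b c d : ℤ} (hab : a < b) (hcd : c < d) (hac : a < c) (had : a ≠ d) (hbc : b ≠ c) (hbd : b ≠ d) (hi : 0 ≤ i)
    (E1 : (b < m ∧ C a b) ∨ (a < m ∧ m ≤ b ∧ S a b) ∨ (m ≤ a ∧ b = a + 1 ∧ a ≠ m + i))
    (E2 : (d < m ∧ C c d) ∨ (c < m ∧ m ≤ d ∧ S c d) ∨ (m ≤ c ∧ d = c + 1 ∧ c ≠ m + i)) :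
    lt2 b c + lt2 b d + Yc m i Out κ1 κ2 φ1 φ2 ψ1 ψ2 a b c + Yc m i Out κ1 κ2 φ1 φ2 ψ1 ψ2 a b d +
      Yc m i Out κ1 κ2 φ1 φ2 ψ1 ψ2 c d a + Yc m i Out κ1 κ2 φ1 φ2 ψ1 ψ2 c d b = 0 := by
  have t1 : (1 : ZMod 2) + 1 = 0 := by decide
  rcases E1 with ⟨b1, e1⟩ | ⟨b1, b2, e1⟩ | ⟨b1, b2, b3⟩
  · -- chord first
    have na : ¬ m ≤ a := by omega
    rcases E2 with ⟨d1, e2⟩ | ⟨d1, d2, e2⟩ | ⟨d1, d2, d3⟩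
    · have nc : ¬ m ≤ c := by omega
      have am : a < m := by omega
      have cm : c < m := by omega
      have nca : ¬ c < a := by omega
      rcases lt_or_gt_of_ne hbc with hl | hl
      · have f1 : b < d := by omega
        have f2 : ¬ c < b := by omega
        have f3 : ¬ d < b := by omega
        by_cases o1 : Out a b <;> by_cases o2 : Out c d <;> simp only [Yc, lt2, na, nc, b1, d1, o1, o2, am, cm, nca, hl, f1, f2, f3, hac, had, if_true, if_false,
          and_true, true_and, and_false, false_and, add_zero, zero_add, t1]
      · have f2 : ¬ b < c := by omega
        have f4 : a < d := by omega
        rcases lt_or_gt_of_ne hbd with hl' | hl'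
        · have g1 := A1 a b c d hac hl hl' e1 e2
          have g2 := A2 a b c d hac hl hl' e1 e2
          have f3 : ¬ d < b := by omega
          by_cases o1 : Out a b <;> by_cases o2 : Out c d <;>
            simp only [Yc, lt2, na, nc, b1, d1, o1, o2, am, cm, nca, hl, hl', f2, f3, f4, hac, if_true, if_false,
              and_true, true_and, and_false, false_and, add_zero, zero_add, t1]
          · exact (g1 o1 o2).elim
          · exact (g2 o1 o2).elim
        · have f3 : ¬ b < d := by omega
          by_cases o1 : Out a b <;> by_cases o2 : Out c d <;>
            simp only [Yc, lt2, na, nc, b1, d1, o1, o2, am, cm, nca, hl, hl', f2, f3, f4, hac, if_true, if_false,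
              and_true, true_and, and_false, false_and, add_zero, zero_add, t1]
    · have nc : ¬ m ≤ c := by omega
      have nd : ¬ d < m := by omega
      have am : a < m := by omega
      have bd : b < d := by omega
      have nca : ¬ c < a := by omega
      have g3 := fun o1 h => A3 a b c d e1 o1 hab e2 h (by omega) (by omega)
      have g4 := fun o1 h => A4 a b c d e1 o1 hab e2 h (by omega) (by omega)
      rcases lt_or_gt_of_ne hbc with hl | hl
      · have f2 : ¬ c < b := by omega
        by_cases o1 : Out a b <;> by_cases o2 : d ≤ m + i
        · simp only [Yc, lt2, na, nc, b1, d1, o1, o2, nd, am, bd, hl, f2, nca, hac, if_true, if_false,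
              and_true, true_and, and_false, false_and, add_zero, zero_add, t1]
        · have := g3 o1 (by omega)
          simp only [Yc, lt2, na, nc, b1, d1, o1, o2, nd, am, bd, hl, f2, nca, hac, if_true, if_false, this,
              and_true, true_and, and_false, false_and, add_zero, zero_add, t1]
        · have := g4 o1 o2
          simp only [Yc, lt2, na, nc, b1, d1, o1, o2, nd, am, bd, hl, f2, nca, hac, if_true, if_false, this,
              and_true, true_and, and_false, false_and, add_zero, zero_add, t1]
        · simp only [Yc, lt2, na, nc, b1, d1, o1, o2, nd, am, bd, hl, f2, nca, hac, if_true, if_false,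
              and_true, true_and, and_false, false_and, add_zero, zero_add, t1]
      · have f2 : ¬ b < c := by omega
        by_cases o1 : Out a b <;> by_cases o2 : d ≤ m + i
        · simp only [Yc, lt2, na, nc, b1, d1, o1, o2, nd, am, bd, hl, f2, nca, hac, if_true, if_false,
              and_true, true_and, and_false, false_and, add_zero, zero_add, t1]
        · have := g3 o1 (by omega)
          simp only [Yc, lt2, na, nc, b1, d1, o1, o2, nd, am, bd, hl, f2, nca, hac, if_true, if_false, this,
              and_true, true_and, and_false, false_and, add_zero, zero_add, t1]
        · have := g4 o1 o2
          simp only [Yc, lt2, na, nc, b1, d1, o1, o2, nd, am, bd, hl, f2, nca, hac, if_true, if_false, this,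
              and_true, true_and, and_false, false_and, add_zero, zero_add, t1]
        · simp only [Yc, lt2, na, nc, b1, d1, o1, o2, nd, am, bd, hl, f2, nca, hac, if_true, if_false,
              and_true, true_and, and_false, false_and, add_zero, zero_add, t1]
    · have nc : ¬ c < m := by omega
      have nd : ¬ d < m := by omega
      have key : c ≤ m + i ↔ d ≤ m + i := by omega
      by_cases o1 : Out a b <;> unfold Yc lt2 <;>
        simp only [na, b1, d1, o1, nc, nd, key, if_true, if_false] <;> split_ifs <;> first | (exfalso; omega) | decide | (generalize κ2 a b = w; revert w; decide) | (generalize κ1 a b = w; revert w; decide)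
  · have na : ¬ m ≤ a := by omega
    have nb : ¬ b < m := by omega
    rcases E2 with ⟨d1, e2⟩ | ⟨d1, d2, e2⟩ | ⟨d1, d2, d3⟩
    · have nc : ¬ m ≤ c := by omega
      have g3 := fun o1 h => A3 c d a b e2 o1 hcd e1 h (by omega) (by omega)
      have g4 := fun o1 h => A4 c d a b e2 o1 hcd e1 h (by omega) (by omega)
      by_cases o1 : Out c d <;> by_cases o2 : b ≤ m + i <;> unfold Yc lt2 <;>
        simp only [na, nc, nb, b1, d1, o1, o2, if_true, if_false]
      · split_ifs <;> first | (exfalso; omega) | decide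
      · rw [g3 o1 (by omega)]; split_ifs <;> first | (exfalso; omega) | decide
      · rw [g4 o1 o2]; split_ifs <;> first | (exfalso; omega) | decide
      · split_ifs <;> first | (exfalso; omega) | decide
    · have nc : ¬ m ≤ c := by omega
      have nd : ¬ d < m := by omega
      have l1 : lt2 a c = 1 := if_pos hac
      have l2 : lt2 c a = 0 := if_neg (by omega)
      have l3 : lt2 b c = 0 := if_neg (by omega)
      rw [l3]
      rcases lt_or_gt_of_ne hbd with hl | hl
      · have l4 : lt2 b d = 1 := if_pos hl
        have nl : ¬ d < b := by omega
        have g5 := fun h => A5 b d a c h hl e1 e2 (by omega)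
        have g6 := fun h => A6 d b c a hl h e2 e1 (by omega)
        by_cases o1 : b ≤ m + i <;> by_cases o2 : d ≤ m + i <;> unfold Yc <;>
          simp only [na, nc, nb, nd, b1, d1, o1, o2, l1, l2, l4, hl, nl, if_true, if_false]
        · rw [← l1, ← g6 o2]; generalize φ1 c = w; generalize ψ1 b a = w'; revert w w'; decide
        · decide
        · omega
        · have := g5 (by omega)
          rw [l2] at this; revert this; generalize φ2 a = w; generalize ψ2 d c = w'; revert w w'; decide
      · have l4 : lt2 b d = 0 := if_neg (by omega)
        have nl : ¬ b < d := by omega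
        have g5 := fun h => A5 d b c a h hl e2 e1 (by omega)
        have g6 := fun h => A6 b d a c hl h e1 e2 (by omega)
        by_cases o1 : b ≤ m + i <;> by_cases o2 : d ≤ m + i <;> unfold Yc <;>
          simp only [na, nc, nb, nd, b1, d1, o1, o2, l1, l2, l4, hl, nl, if_true, if_false]
        · have := g6 o1
          rw [l2] at this; revert this; generalize φ1 a = w; generalize ψ1 d c = w'; revert w w'; decide
        · omega
        · decide
        · have := g5 (by omega)
          rw [l1] at this; revert this; generalize φ2 c = w; generalize ψ2 b a = w'; revert w w'; decide
    · have nc : ¬ c < m := by omega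
      have nd : ¬ d < m := by omega
      have key : c ≤ m + i ↔ d ≤ m + i := by omega
      have key2 : c < b ↔ d < b := by omega
      have key3 : b < c ↔ b < d := by omega
      unfold Yc lt2
      simp only [na, nb, b1, d1, nc, nd, key, key2, key3, if_true, if_false, add_zero, CharTwo.add_self_eq_zero, zero_add]
  · have nc : m ≤ c := by omega
    have k1 : b < c := by omega
    have k2 : b < d := by omega
    unfold Yc lt2
    simp only [b1, nc, k1, k2, if_true]
    decide

theorem planar_of_line {V : Type*} [Finite V] {G : SimpleGraph V} {r : ℤ → V} {N : ℤ} {Y : ℤ → ℤ → ℤ → ZMod 2}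
    (hr : ∀ x y, 0 ≤ x → x < N → 0 ≤ y → y < N → r x = r y → x = y) (hc : ∀ x ∈ core G, ∃ a, 0 ≤ a ∧ a < N ∧ r a = x)
    (h : ∀ a b c d, 0 ≤ a → b < N → d < N → a < b → c < d → a < c → a ≠ d → b ≠ c → b ≠ d → G.Adj (r a) (r b) → G.Adj (r c) (r d) →
      lt2 b c + lt2 b d + Y a b c + Y a b d + Y c d a + Y c d b = 0) : Planar G := by
  classical
  obtain ⟨n, ⟨f⟩⟩ := Finite.exists_equiv_fin V
  let pos : V → ℤ := fun x => if hx : ∃ a, 0 ≤ a ∧ a < N ∧ r a = x then hx.choose else -(1 + ((f x : ℕ) : ℤ))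
  have pos1 : ∀ x, x ∈ core G → 0 ≤ pos x ∧ pos x < N ∧ r (pos x) = x := by
    intro x hx
    have hx' := hc x hx
    have : pos x = hx'.choose := dif_pos hx'
    rw [this]
    exact hx'.choose_spec
  have posinj : ∀ x y, pos x = pos y → x = y := by
    intro x y hxy
    by_cases hx : ∃ a, 0 ≤ a ∧ a < N ∧ r a = x <;> by_cases hy : ∃ a, 0 ≤ a ∧ a < N ∧ r a = y
    · have e1 : pos x = hx.choose := dif_pos hx
      have e2 : pos y = hy.choose := dif_pos hy
      rw [← hx.choose_spec.2.2, ← hy.choose_spec.2.2, ← e1, ← e2, hxy]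
    · have e1 : pos x = hx.choose := dif_pos hx
      have e2 : pos y = _ := dif_neg hy
      have := hx.choose_spec.1
      omega
    · have e1 : pos y = hy.choose := dif_pos hy
      have e2 : pos x = _ := dif_neg hx
      have := hy.choose_spec.1
      omega
    · have e1 : pos x = _ := dif_neg hx
      have e2 : pos y = _ := dif_neg hy
      apply f.injective
      apply Fin.ext
      omega
  let Z : V → V → V → ZMod 2 := fun a b c => if pos a < pos b then Y (pos a) (pos b) (pos c) else Y (pos b) (pos a) (pos c)
  have Zs : ∀ a b c, a ≠ b → Z a b c = Z b a c := by
    intro a b c hab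
    have : pos a ≠ pos b := fun e => hab (posinj _ _ e)
    show (if _ then _ else _) = if _ then _ else _
    split_ifs <;> first | rfl | omega
  let L : V → V → ZMod 2 := fun a b => lt2 (pos a) (pos b)
  have hL : ∀ a b, a ≠ b → L a b + L b a = 1 := by
    intro a b hab
    have : pos a ≠ pos b := fun e => hab (posinj _ _ e)
    show lt2 _ _ + lt2 _ _ = 1
    unfold lt2
    split_ifs <;> first | rfl | omega
  have k1 : ∀ a b c d, G.Adj a b → G.Adj c d → a ≠ c → a ≠ d → b ≠ c → b ≠ d → pos a < pos b → pos c < pos d → pos a < pos c →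
      L a c + L b c + L a d + L b d + Z a b c + Z a b d + Z c d a + Z c d b = 0 := by
    intro a b c d hab hcd n1 n2 n3 n4 p1 p2 p3
    obtain ⟨a1, a2, a3⟩ := pos1 a ⟨_, hab⟩
    obtain ⟨b1, b2, b3⟩ := pos1 b ⟨_, hab.symm⟩
    obtain ⟨c1, c2, c3⟩ := pos1 c ⟨_, hcd⟩
    obtain ⟨d1, d2, d3⟩ := pos1 d ⟨_, hcd.symm⟩
    have e1 : ∀ z, Z a b z = Y (pos a) (pos b) (pos z) := fun z => if_pos p1
    have e2 : ∀ z, Z c d z = Y (pos c) (pos d) (pos z) := fun z => if_pos p2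
    have := h (pos a) (pos b) (pos c) (pos d) a1 b2 d2 p1 p2 p3 (fun e => n2 (posinj _ _ e)) (fun e => n3 (posinj _ _ e))
      (fun e => n4 (posinj _ _ e)) (by rw [a3, b3]; exact hab) (by rw [c3, d3]; exact hcd)
    rw [e1, e1, e2, e2]
    show lt2 _ _ + lt2 _ _ + lt2 _ _ + lt2 _ _ + _ + _ + _ + _ = 0
    have l1 : lt2 (pos a) (pos c) = 1 := if_pos p3
    have l2 : lt2 (pos a) (pos d) = 1 := if_pos (by omega)
    rw [l1, l2]
    have e : ∀ x y a b c d : ZMod 2, 1 + x + 1 + y + a + b + c + d = x + y + a + b + c + d := by decide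
    rw [e]; exact this
  have k2 : ∀ a b c d, G.Adj a b → G.Adj c d → a ≠ c → a ≠ d → b ≠ c → b ≠ d → pos a < pos b → pos c < pos d →
      L a c + L b c + L a d + L b d + Z a b c + Z a b d + Z c d a + Z c d b = 0 := by
    intro a b c d hab hcd n1 n2 n3 n4 p1 p2
    have : pos a ≠ pos c := fun e => n1 (posinj _ _ e)
    rcases lt_or_gt_of_ne this with p3 | p3
    · exact k1 a b c d hab hcd n1 n2 n3 n4 p1 p2 p3
    · have := k1 c d a b hcd hab n1.symm n3.symm n2.symm n4.symm p2 p1 p3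
      rw [← this]
      have e1 := hL a c n1
      have e2 := hL a d n2
      have e3 := hL b c n3
      have e4 := hL b d n4
      have e : ∀ x y : ZMod 2, x + y = 1 → x = y + 1 := by decide
      rw [e _ _ e1, e _ _ e2, e _ _ e3, e _ _ e4]
      have e0 : (4 : ZMod 2) = 0 := by decide
      linear_combination e0
  have k3 : ∀ a b c d, G.Adj a b → G.Adj c d → a ≠ c → a ≠ d → b ≠ c → b ≠ d → pos a < pos b →
      L a c + L b c + L a d + L b d + Z a b c + Z a b d + Z c d a + Z c d b = 0 := by
    intro a b c d hab hcd n1 n2 n3 n4 p1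
    have : pos c ≠ pos d := fun e => hcd.ne (posinj _ _ e)
    rcases lt_or_gt_of_ne this with p3 | p3
    · exact k2 a b c d hab hcd n1 n2 n3 n4 p1 p3
    · have := k2 a b d c hab hcd.symm n2 n1 n4 n3 p1 p3
      rw [Zs c d a hcd.ne, Zs c d b hcd.ne]
      rw [← this]; ring
  refine planar_of_cert (L := L) (Y := Z) ?_ hL
  intro a b c d hab hcd n1 n2 n3 n4
  have : pos a ≠ pos b := fun e => hab.ne (posinj _ _ e)
  rcases lt_or_gt_of_ne this with p3 | p3
  · exact k3 a b c d hab hcd n1 n2 n3 n4 p3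
  · have := k3 b a c d hab.symm hcd n3 n4 n1 n2 p3
    rw [Zs a b c hab.ne, Zs a b d hab.ne]
    rw [← this]; ring

end FSeven

open SimpleGraph
set_option linter.unusedVariables false
set_option linter.unusedSimpArgs false

section FEight

variable {V : Type*} {G : SimpleGraph V}
variable {u v : V} {m k : ℤ} {q p : ℤ → V} {α β α' β' : ℤ} {L1 L2 L3 L4 : Set V}

theorem Cfg.kappa (hG : SixFree G) (h : Cfg G u v m k q p α β α' β' ∅ ∅ ∅ ∅) {a b : ℤ} (i : ℤ) (hi : 0 ≤ i) (hab : a < b)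
    (hC : G.Adj (q a) (q b)) (ha : 0 ≤ a) (hb : b < m)
    (hO : ∀ z z', a < z → z < b → b < z' → z' < a + m → Separ q m (q β) (q β') a b) :
    ∃ c : ZMod 2, ∀ z ∈ {z : ℤ | 0 ≤ z ∧ z < m ∧ z ≠ a ∧ z ≠ b ∧ ∃ j, i < j ∧ j ≤ k ∧ G.Adj (p j) (q z)}, (if a < z ∧ z < b then 1 else 0) = c := by
  refine const_on ?_
  have key : ∀ z z', a < z ∧ z < b → ¬ (a < z' ∧ z' < b) → 0 ≤ z' → z' < m → z' ≠ a → z' ≠ b → (∃ j, i < j ∧ j ≤ k ∧ G.Adj (p j) (q z)) →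
      (∃ j, i < j ∧ j ≤ k ∧ G.Adj (p j) (q z')) → False := by
    rintro z z' hz hz' h0 h1 h2 h3 ⟨j, j1, j2, j3⟩ ⟨j', j1', j2', j3'⟩
    have e : ∃ z, b < z ∧ z < a + m ∧ q z = q z' := by
      by_cases c2 : b < z'
      · exact ⟨z', c2, by omega, rfl⟩
      · exact ⟨z' + m, by omega, by omega, h.per _⟩
    obtain ⟨w, w1, w2, w3⟩ := e
    exact h.n3 hG hC (hO z w hz.1 hz.2 w1 w2) (j := j) (z := z) (j' := j') (z' := w) (by omega) j3 hz (by omega) (by rw [w3]; exact j3') ⟨w1, w2⟩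
  rintro z ⟨z1, z2, z3, z4, z5⟩ z' ⟨z1', z2', z3', z4', z5'⟩
  by_cases c1 : a < z ∧ z < b <;> by_cases c2 : a < z' ∧ z' < b
  · rw [if_pos c1, if_pos c2]
  · exact (key z z' c1 c2 z1' z2' z3' z4' z5 z5').elim
  · exact (key z' z c2 c1 z1 z2 z3 z4 z5' z5).elim
  · rw [if_neg c1, if_neg c2]

theorem f4 [Finite V] (hG : SixFree G) (h : Cfg G u v m k q p α β α' β' ∅ ∅ ∅ ∅) : Planar (G.deleteEdges {s(u, v)}) := by
  classical
  obtain ⟨i, hi0, hik, hie⟩ := h.e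
  have hk := h.k2
  have hm := h.mpos
  let Out : ℤ → ℤ → Prop := fun a b => Separ q m (q β) (q β') a b
  let C : ℤ → ℤ → Prop := fun a b => 0 ≤ a ∧ b < m ∧ G.Adj (q a) (q b)
  let S : ℤ → ℤ → Prop := fun x j => 0 ≤ x ∧ x < m ∧ m ≤ j ∧ j ≤ m + k ∧ G.Adj (p (j - m)) (q x)
  have hr := h.rev
  have inn : ∀ {a b}, ¬ Out a b → a + 1 < b → b + 1 < a + m → G.Adj (q a) (q b) → Separ q m (q α') (q (α + m)) a b := by
    intro a b ho h1 h2 h3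
    rw [h.per]
    rcases h.sep_or hG h1 h2 h3 with hh | hh
    · exact hh.swap
    · exact absurd hh ho
  have K2 : ∀ a b, ∃ c : ZMod 2, C a b → Out a b → a < b →
      ∀ z ∈ {z : ℤ | 0 ≤ z ∧ z < m ∧ z ≠ a ∧ z ≠ b ∧ ∃ j, i < j ∧ j ≤ k ∧ G.Adj (p j) (q z)}, (if a < z ∧ z < b then 1 else 0) = c := by
    intro a b
    by_cases hh : C a b ∧ Out a b ∧ a < b
    · obtain ⟨c, hc⟩ := h.kappa hG i hi0 hh.2.2 hh.1.2.2 hh.1.1 hh.1.2.1 (fun _ _ _ _ _ _ => hh.2.1)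
      exact ⟨c, fun _ _ _ => hc⟩
    · exact ⟨0, fun h1 h2 h3 => absurd ⟨h1, h2, h3⟩ hh⟩
  have K1 : ∀ a b, ∃ c : ZMod 2, C a b → ¬ Out a b → a < b →
      ∀ z ∈ {z : ℤ | 0 ≤ z ∧ z < m ∧ z ≠ a ∧ z ≠ b ∧ ∃ j, k - 1 - i < j ∧ j ≤ k ∧ G.Adj (p (k - j)) (q z)}, (if a < z ∧ z < b then 1 else 0) = c := by
    intro a b
    by_cases hh : C a b ∧ ¬ Out a b ∧ a < b
    · obtain ⟨c, hc⟩ := hr.kappa hG (k - 1 - i) (by omega) hh.2.2 hh.1.2.2 hh.1.1 hh.1.2.1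
        (fun z z' h1 h2 h3 h4 => inn hh.2.1 (by omega) (by omega) hh.1.2.2)
      exact ⟨c, fun _ _ _ => hc⟩
    · exact ⟨0, fun h1 h2 h3 => absurd ⟨h1, h2, h3⟩ hh⟩
  choose κ2 hκ2 using K2
  choose κ1 hκ1 using K1
  obtain ⟨φ2, ψ2, h2⟩ := h.n1 hG hi0 hik
  obtain ⟨φ1, ψ1, h1⟩ := hr.n1 hG (i := k - 1 - i) (by omega) (by omega)
  let r : ℤ → V := fun x => if x < m then q x else p (x - m)
  have rq : ∀ x, x < m → r x = q x := fun x hx => if_pos hx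
  have rp : ∀ x, m ≤ x → r x = p (x - m) := fun x hx => if_neg (by omega)
  refine planar_of_line (r := r) (N := m + k + 1)
    (Y := Yc m i Out κ1 κ2 φ1 φ2 (fun j => ψ1 (k + m - j)) (fun j => ψ2 (j - m))) ?_ ?_ ?_
  · intro x y x0 x1 y0 y1 hxy
    by_cases hx : x < m <;> by_cases hy : y < m
    · rw [rq x hx, rq y hy] at hxy
      exact h.inj hxy (by omega) (by omega)
    · rw [rq x hx, rp y (by omega)] at hxy
      exact (h.q_ne (by omega) hxy).elim
    · rw [rp x (by omega), rq y hy] at hxy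
      exact (h.q_ne (by omega) hxy.symm).elim
    · rw [rp x (by omega), rp y (by omega)] at hxy
      by_contra hne
      exact h.p_ne (by omega) hxy
  · intro x hx
    obtain ⟨y, hy⟩ := hx
    have hx' : x ∈ core G := ⟨y, (del_adj.1 hy).1⟩
    rcases h.span hG hx' with ⟨j, j1, j2, j3⟩ | ⟨j, j1⟩ | hh
    · exact ⟨m + j, by omega, by omega, by rw [rp _ (by omega), ← j3]; congr 1; ring⟩
    · obtain ⟨w, w1, w2, w3⟩ := h.window 0 j
      exact ⟨w, w1, by omega, by rw [rq _ (by omega), w3, j1]⟩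
    · simp at hh
  · intro a b c d a0 bN dN hab hcd hac had hbc hbd E1 E2
    have ty : ∀ x y, 0 ≤ x → y < m + k + 1 → x < y → (G.deleteEdges {s(u, v)}).Adj (r x) (r y) →
        (y < m ∧ C x y) ∨ (x < m ∧ m ≤ y ∧ S x y) ∨ (m ≤ x ∧ y = x + 1 ∧ x ≠ m + i) := by
      intro x y x0 yN hxy E
      rw [del_adj] at E
      by_cases hy : y < m
      · rw [rq x (by omega), rq y hy] at E
        exact Or.inl ⟨hy, x0, hy, E.1⟩
      by_cases hx : x < m
      · rw [rq x hx, rp y (by omega)] at E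
        exact Or.inr (Or.inl ⟨hx, by omega, x0, hx, by omega, by omega, E.1.symm⟩)
      · rw [rp x (by omega), rp y (by omega)] at E
        have := h.ppChord hG (a := x - m) (b := y - m) (by omega) (by omega) (by omega) E.1
        refine Or.inr (Or.inr ⟨by omega, by omega, fun e => E.2 ?_⟩)
        rw [← hie, this]
        have : x - m = i := by omega
        rw [this]
    refine abs_cert (k := k) (C := C) (S := S) (Out := Out) ?_ ?_ ?_ ?_ ?_ ?_ hab hcd hac had hbc hbd hi0 (ty a b a0 bN hab E1) (ty c d (by omega) dN hcd E2)
    · intro a b c d o1 o2 o3 c1 c2 t1 t2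
      have := c1.1; have := c2.2.1
      exact h.n4 hG c1.2.2 c2.2.2 (by omega) t1 t2
    · intro a b c d o1 o2 o3 c1 c2 t1 t2
      have := c1.1; have := c2.2.1
      exact hr.n4 hG c1.2.2 c2.2.2 (by omega) (inn t1 (by omega) (by omega) c1.2.2) (inn t2 (by omega) (by omega) c2.2.2)
    · rintro a b z j c1 o1 hab ⟨z0, z1, j0, j1, hz⟩ hj n1 n2
      exact (hκ2 a b c1 o1 hab z ⟨z0, z1, n1, n2, j - m, by omega, by omega, hz⟩).symm
    · rintro a b z j c1 o1 hab ⟨z0, z1, j0, j1, hz⟩ hj n1 n2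
      refine (hκ1 a b c1 o1 hab z ⟨z0, z1, n1, n2, k - (j - m), by omega, by omega, ?_⟩).symm
      have : k - (k - (j - m)) = j - m := by ring
      rw [this]; exact hz
    · rintro l j x y hl hlj ⟨x0, x1, l0, l1, hx⟩ ⟨y0, y1, j0, j1, hy⟩ hxy
      exact h2 (l - m) (j - m) x y (by omega) (by omega) (by omega) x0 x1 y0 y1 hx hy hxy
    · rintro l j x y hlj hl ⟨x0, x1, l0, l1, hx⟩ ⟨y0, y1, j0, j1, hy⟩ hxy
      have e1 : k - (k + m - l) = l - m := by ring
      have e2 : k - (k + m - j) = j - m := by ring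
      exact h1 (k + m - l) (k + m - j) x y (by omega) (by omega) (by omega) x0 x1 y0 y1 (by rw [e1]; exact hx) (by rw [e2]; exact hy) hxy

end FEight

open SimpleGraph
set_option linter.unusedVariables false
set_option linter.unusedSimpArgs false

theorem f0 : ∀ (n : ℕ) (V : Type) [Finite V] (G : SimpleGraph V) (u v : V), (core G).ncard = n → SixFree G → G.Adj u v →
    ¬ Planar (G.deleteEdges {s(u, v)}) →
    ((∃ B i, Model K5 G B ∧ u ∈ B i ∧ v ∈ B i) ∨ (∃ B i, Model K33 G B ∧ u ∈ B i ∧ v ∈ B i)) → False := by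
  intro n
  induction n using Nat.strong_induction_on with
  | _ n ih =>
    intro V _ G u v hn hG huv hnd hM
    by_cases hdeg : ∀ x ∈ core G, ∀ y z, ∃ t, G.Adj x t ∧ t ≠ y ∧ t ≠ z
    · have hC : Contr33 G u v := by
        rcases hM with ⟨B, i, hB, hu, hv⟩ | ⟨B, i, hB, hu, hv⟩
        · exact f1 hG hdeg hB huv hu hv hnd
        · exact contr33_of_model hB hu hv
      obtain ⟨m, k, q, p, α, β, α', β', L1, L2, L3, L4, h⟩ := f2 hG huv hC
      obtain ⟨m, k, q, p, α, β, α', β', h⟩ := f3 hG hdeg h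
      exact hnd (f4 hG h)
    · push Not at hdeg
      have hnp : ¬ Planar G := not_planar_mono (G.deleteEdges_le _) hnd
      obtain ⟨x, hx, y0, z0, hN0⟩ := hdeg
      have hN0' : ∀ t, G.Adj x t → t = y0 ∨ t = z0 := by
        intro t ht
        by_cases h : t = y0
        · exact Or.inl h
        · exact Or.inr (hN0 t ht h)
      have hy0 : G.Adj x y0 := by
        by_contra h
        exact hnp (hG.planar_of_deg1 le_rfl hx (y := z0) fun s hs => (hN0' s hs).resolve_left fun e => h (e ▸ hs))
      have hz0 : G.Adj x z0 := by
        by_contra h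
        exact hnp (hG.planar_of_deg1 le_rfl hx (y := y0) fun s hs => (hN0' s hs).resolve_right fun e => h (e ▸ hs))
      have hyz : y0 ≠ z0 := by
        rintro rfl
        exact hnp (hG.planar_of_deg1 le_rfl hx (y := y0) fun s hs => (hN0' s hs).elim id id)
      have hnp' := not_planar_suppress hnp hN0' hy0
      have hnyz : ¬ G.Adj y0 z0 := by
        intro h
        refine hnp' (hG.planar_of_isolated (x := x) ?_ hx fun s hs => (contract_adj.1 hs).2.1 rfl)
        intro a b hab
        obtain ⟨hne', ha, hb, h' | ⟨e, h'⟩ | ⟨e, h'⟩⟩ := contract_adj.1 hab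
        · exact h'
        · rcases hN0' _ h' with e' | e'
          · exact absurd (e.trans e'.symm) hne'
          · rw [e, e']; exact h
        · rcases hN0' _ h' with e' | e'
          · exact absurd (e'.trans e.symm) hne'
          · rw [e, e']; exact h.symm
      have hne : ∀ w, s(x, w) ≠ s(u, v) := by
        intro w hw
        have hxw : G.Adj x w := by
          have : s(x, w) ∈ G.edgeSet := by rw [hw]; exact huv
          exact this
        rcases hN0' w hxw with rfl | rfl
        · refine hnd (hG.planar_of_deg1 (G.deleteEdges_le _) hx (y := z0) fun s hs => ?_)
          obtain ⟨h1, h2⟩ := del_adj.1 hs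
          exact (hN0' s h1).resolve_left fun e => h2 (e ▸ hw)
        · refine hnd (hG.planar_of_deg1 (G.deleteEdges_le _) hx (y := y0) fun s hs => ?_)
          obtain ⟨h1, h2⟩ := del_adj.1 hs
          exact (hN0' s h1).resolve_right fun e => h2 (e ▸ hw)
      have hux : u ≠ x := fun e => hne v (by rw [e])
      have hvx : v ≠ x := fun e => hne u (by rw [e]; exact Sym2.eq_swap)
      have hnd' : ¬ Planar (contractEdge (G.deleteEdges {s(u, v)}) y0 x) :=
        not_planar_suppress hnd (fun t ht => hN0' t (del_adj.1 ht).1) (del_adj.2 ⟨hy0, hne y0⟩)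
      have hle : contractEdge (G.deleteEdges {s(u, v)}) y0 x ≤ (contractEdge G y0 x).deleteEdges {s(u, v)} := by
        intro a b hab
        obtain ⟨hne', ha, hb, h'⟩ := contract_adj.1 hab
        have key : ∀ c, c ≠ y0 → G.Adj x c → s(y0, c) ≠ s(u, v) := by
          intro c hc hxc he
          have hcz := (hN0' c hxc).resolve_left hc
          rw [hcz] at he
          have : s(y0, z0) ∈ G.edgeSet := by rw [he]; exact huv
          exact hnyz this
        rcases h' with h' | ⟨e, h'⟩ | ⟨e, h'⟩
        · obtain ⟨h1, h2⟩ := del_adj.1 h'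
          exact del_adj.2 ⟨contract_adj.2 ⟨hne', ha, hb, Or.inl h1⟩, h2⟩
        · obtain ⟨h1, h2⟩ := del_adj.1 h'
          refine del_adj.2 ⟨contract_adj.2 ⟨hne', ha, hb, Or.inr (Or.inl ⟨e, h1⟩)⟩, ?_⟩
          rw [e]
          exact key b (fun h => hne' (e.trans h.symm)) h1
        · obtain ⟨h1, h2⟩ := del_adj.1 h'
          refine del_adj.2 ⟨contract_adj.2 ⟨hne', ha, hb, Or.inr (Or.inr ⟨e, h1⟩)⟩, ?_⟩
          rw [e, Sym2.eq_swap]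
          exact key a (fun h => hne' (h.trans e.symm)) h1
      refine ih _ ?_ V (contractEdge G y0 x) u v rfl (hG.contract hy0.symm)
        (contract_adj.2 ⟨huv.ne, hux, hvx, Or.inl huv⟩) (not_planar_mono hle hnd') ?_
      · rw [← hn]
        exact Set.ncard_lt_ncard ⟨core_contract hy0, fun h => not_mem_core_contract (h hx)⟩ (Set.toFinite _)
      · rcases hM with ⟨B, i, hB, hu, hv⟩ | ⟨B, i, hB, hu, hv⟩
        · exact Or.inl ⟨_, i, hB.suppress hy0.ne hN0' hy0 K5_deg, ⟨hu, hux⟩, ⟨hv, hvx⟩⟩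
        · exact Or.inr ⟨_, i, hB.suppress hy0.ne hN0' hy0 K33_deg, ⟨hu, hux⟩, ⟨hv, hvx⟩⟩

theorem almostPlanar_of_sixFree (V : Type) [Finite V] (G : SimpleGraph V) (hG : SixFree G) (hnp : ¬ Planar G) :
    AlmostPlanar G := by
  refine ⟨hnp, fun u v huv => ?_⟩
  by_contra hc
  push Not at hc
  obtain ⟨hnd, hnc⟩ := hc
  have hiso : ∀ y, ¬ (contractEdge G u v).Adj v y := fun y h => (contract_adj.1 h).2.1 rfl
  have hucore : u ∈ core G := ⟨v, huv⟩
  refine f0 _ V G u v rfl hG huv hnd ?_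
  rcases not_planar_iff.1 hnc with h | h
  · left
    obtain ⟨B, hB⟩ := isMinor_iff.1 h
    have hv : ∀ i, v ∉ B i := fun i => by
      obtain ⟨j, _, _, hj, _⟩ := K5_deg i
      exact hB.not_mem_of_isolated hiso hj
    have hL := hB.of_contract huv hv
    by_contra hcon
    refine hG.crit5 hL hucore fun i hi => ?_
    rcases hi with hi | ⟨h1, h2⟩
    · exact hcon ⟨_, i, hL, Or.inl hi, Or.inr ⟨rfl, hi⟩⟩
    · exact huv.ne h1
  · right
    obtain ⟨B, hB⟩ := isMinor_iff.1 h
    have hv : ∀ i, v ∉ B i := fun i => by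
      obtain ⟨j, _, _, hj, _⟩ := K33_deg i
      exact hB.not_mem_of_isolated hiso hj
    have hL := hB.of_contract huv hv
    by_contra hcon
    refine hG.crit33 hL hucore fun i hi => ?_
    rcases hi with hi | ⟨h1, h2⟩
    · exact hcon ⟨_, i, hL, Or.inl hi, Or.inr ⟨rfl, hi⟩⟩
    · exact huv.ne h1

/-- Characterization of all (not necessarily 3-connected) almost-planar graphs:
(i) almost-planar ↔ (ii) `G*` is obtained from a 3-connected almost-planar `H` by
subdividing only edges of `D(H)` ↔ (iii) {K5+, K33+, K5h, K33h, K5⊕e, K33⊕e}-free. -/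
theorem stmt11 {V : Type} [Fintype V] (G : SimpleGraph V) (hnp : ¬ Planar G) :
    (AlmostPlanar G ↔
      (∃ (U : Type) (H : SimpleGraph U), KConnected H 3 ∧ AlmostPlanar H ∧
        IsSubdivisionWithin (G.induce (core G)) H (Dset H))) ∧
    ((∃ (U : Type) (H : SimpleGraph U), KConnected H 3 ∧ AlmostPlanar H ∧
        IsSubdivisionWithin (G.induce (core G)) H (Dset H)) ↔
      (¬ IsMinor K5plus G ∧ ¬ IsMinor K33plus G ∧ ¬ IsMinor K5h G ∧ ¬ IsMinor K33h G ∧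
       ¬ IsMinor K5oplus G ∧ ¬ IsMinor K33oplus G)) := by
  have h32 : SixFree G → (∃ (U : Type) (H : SimpleGraph U), KConnected H 3 ∧ AlmostPlanar H ∧
        IsSubdivisionWithin (G.induce (core G)) H (Dset H)) := fun hG =>
    Carried.sub hG (carried_of_sixFree almostPlanar_of_sixFree _ V G rfl hG hnp)
  have h21 : (∃ (U : Type) (H : SimpleGraph U), KConnected H 3 ∧ AlmostPlanar H ∧
        IsSubdivisionWithin (G.induce (core G)) H (Dset H)) → AlmostPlanar G := by
    rintro ⟨U, H, -, hH, hs⟩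
    exact almostPlanar_of_sub hnp hH hs
  exact ⟨⟨fun h => h32 (sixFree_of_almostPlanar h), h21⟩, fun h => sixFree_of_almostPlanar (h21 h), h32⟩
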